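/- Let F = (P,Q) be a Keller map, i.e. P, Q ∈ ℂ[x,y] and the Jacobian determinant J(P,Q) := P_x Q_y − P_y Q_x is a nonzero constant. If both P and Q are rational polynomials, then F is invertible: there exists a polynomial map G : ℂ² → ℂ² with G ∘ F = id and F ∘ G = id. -/

import Mathlib

open MvPolynomial Filter

/-- Evaluation of a bivariate polynomial at a point of `ℂ × ℂ`. -/
noncomputable def evalPoly (P : MvPolynomial (Fin 2) ℂ) (p : ℂ × ℂ) : ℂ :=
  MvPolynomial.eval ![p.1, p.2] P

/-- The polynomial map `ℂ² → ℂ²` given by a pair of polynomials. -/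
noncomputable def polyMap (P Q : MvPolynomial (Fin 2) ℂ) (p : ℂ × ℂ) : ℂ × ℂ :=
  (evalPoly P p, evalPoly Q p)

/-- `(P, Q)` is a Keller map: the Jacobian determinant is a nonzero constant. -/
def IsKeller (P Q : MvPolynomial (Fin 2) ℂ) : Prop :=
  ∃ c : ℂ, c ≠ 0 ∧
    pderiv 0 P * pderiv 1 Q - pderiv 1 P * pderiv 0 Q = MvPolynomial.C c

/-- `P` is a rational polynomial: away from finitely many values `c`, the fiber
`P = c` is homeomorphic to `ℂ` minus a finite set of points. -/
def IsRationalPoly (P : MvPolynomial (Fin 2) ℂ) : Prop :=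
  ∃ S : Finset ℂ, ∀ c ∉ S, ∃ T : Finset ℂ,
    Nonempty ({p : ℂ × ℂ // evalPoly P p = c} ≃ₜ {z : ℂ // z ∉ T})

/-- The polynomial map `(P, Q)` has a polynomial inverse. -/
def IsInvertible (P Q : MvPolynomial (Fin 2) ℂ) : Prop :=
  ∃ A B : MvPolynomial (Fin 2) ℂ,
    polyMap A B ∘ polyMap P Q = id ∧ polyMap P Q ∘ polyMap A B = id

/-- The non-proper value set of a map `F : ℂ² → ℂ²`. -/
def nonProperSet (F : ℂ × ℂ → ℂ × ℂ) : Set (ℂ × ℂ) :=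
  {a | ∃ b : ℕ → ℂ × ℂ,
    Tendsto (fun i => ‖b i‖) atTop atTop ∧ Tendsto (fun i => F (b i)) atTop (nhds a)}

namespace KellerRational

open scoped Polynomial

/-! ### Hahn series with rational exponents -/

/-- Hahn series in `u = 1/x` with rational exponents. -/
abbrev Hahn (S : Type*) [Zero S] := HahnSeries ℚ S

section Order

variable {S : Type*} [CommRing S]

/-- All coefficients of `a` in exponents `< p` vanish. -/
def Lge (p : ℚ) (a : Hahn S) : Prop := ∀ i < p, a.coeff i = 0

theorem Lge.mono {p q : ℚ} {a : Hahn S} (h : Lge q a) (hpq : p ≤ q) : Lge p a :=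
  fun i hi => h i (hi.trans_le hpq)

theorem Lge.coeff {p i : ℚ} {a : Hahn S} (h : Lge p a) (hi : i < p) : a.coeff i = 0 := h i hi

theorem lge_zero (p : ℚ) : Lge p (0 : Hahn S) := fun _ _ => rfl

theorem Lge.add {p : ℚ} {a b : Hahn S} (ha : Lge p a) (hb : Lge p b) : Lge p (a + b) :=
  fun i hi => by simp [ha i hi, hb i hi]

theorem Lge.sub {p : ℚ} {a b : Hahn S} (ha : Lge p a) (hb : Lge p b) : Lge p (a - b) :=
  fun i hi => by simp [ha i hi, hb i hi]

theorem Lge.neg {p : ℚ} {a : Hahn S} (ha : Lge p a) : Lge p (-a) :=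
  fun i hi => by simp [ha i hi]

theorem Lge.sum {ι : Type*} {s : Finset ι} {p : ℚ} {f : ι → Hahn S} (h : ∀ i ∈ s, Lge p (f i)) :
    Lge p (∑ i ∈ s, f i) := fun q hq => by
  rw [HahnSeries.coeff_sum]
  exact Finset.sum_eq_zero fun i hi => h i hi q hq

theorem lge_single {p q : ℚ} (h : p ≤ q) (s : S) : Lge p (HahnSeries.single q s) :=
  fun _ hi => HahnSeries.coeff_single_of_ne (hi.trans_le h).ne

theorem lge_C (s : S) : Lge 0 (HahnSeries.C s : Hahn S) := lge_single le_rfl s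

theorem lge_one : Lge 0 (1 : Hahn S) := lge_single le_rfl 1

theorem Lge.mul {p q : ℚ} {a b : Hahn S} (ha : Lge p a) (hb : Lge q b) : Lge (p + q) (a * b) := by
  intro i hi
  rw [HahnSeries.coeff_mul]
  refine Finset.sum_eq_zero fun ij hij => ?_
  simp only [Finset.mem_antidiagonal] at hij
  by_cases h1 : ij.1 < p
  · simp [ha _ h1]
  · rw [hb ij.2 (by linarith [hij.2.2]), mul_zero]

theorem Lge.coeff_mul {p q : ℚ} {a b : Hahn S} (ha : Lge p a) (hb : Lge q b) :
    (a * b).coeff (p + q) = a.coeff p * b.coeff q := by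
  rw [HahnSeries.coeff_mul, Finset.sum_eq_single (p, q)]
  · rintro ⟨i, j⟩ hij hne
    simp only [Finset.mem_antidiagonal] at hij
    rcases lt_trichotomy i p with h | h | h
    · simp [ha _ h]
    · exact absurd (Prod.ext h (by simp only; linarith [hij.2.2])) hne
    · simp [hb j (by linarith [hij.2.2])]
  · intro h
    simp only [Finset.mem_antidiagonal, HahnSeries.mem_support, and_true, not_and, not_not] at h
    by_cases h1 : a.coeff p = 0
    · simp [h1]
    · simp [h h1]

theorem Lge.pow {p : ℚ} {a : Hahn S} (ha : Lge p a) (n : ℕ) : Lge (n * p) (a ^ n) := by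
  induction n with
  | zero => simpa using lge_one
  | succ n ih => rw [pow_succ]; exact (ih.mul ha).mono (by push_cast; linarith)

theorem Lge.coeff_pow {p : ℚ} {a : Hahn S} (ha : Lge p a) (n : ℕ) :
    (a ^ n).coeff (n * p) = a.coeff p ^ n := by
  induction n with
  | zero => simp
  | succ n ih =>
    rw [pow_succ, pow_succ, ← ih, ← (ha.pow n).coeff_mul ha]
    congr 1; push_cast; ring

theorem Lge.pow₀ {a : Hahn S} (ha : Lge 0 a) (n : ℕ) : Lge 0 (a ^ n) :=
  (ha.pow n).mono (by simp)

theorem Lge.mul₀ {a b : Hahn S} (ha : Lge 0 a) (hb : Lge 0 b) : Lge 0 (a * b) :=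
  (ha.mul hb).mono (by simp)

/-- The order of `a` is exactly `p`. -/
def Ord (p : ℚ) (a : Hahn S) : Prop := Lge p a ∧ a.coeff p ≠ 0

theorem Ord.lge {p : ℚ} {a : Hahn S} (h : Ord p a) : Lge p a := h.1

theorem Ord.ne_zero {p : ℚ} {a : Hahn S} (h : Ord p a) : a ≠ 0 := by
  rintro rfl; exact h.2 rfl

theorem exists_ord {a : Hahn S} (ha : a ≠ 0) : ∃ p, Ord p a :=
  ⟨a.order, fun _ hi => HahnSeries.coeff_eq_zero_of_lt_order hi,
    fun h => ha (HahnSeries.coeff_order_eq_zero.1 h)⟩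

theorem Ord.le {p q : ℚ} {a : Hahn S} (h : Ord p a) (hq : Lge q a) : q ≤ p := by
  by_contra! hlt
  exact h.2 (hq p hlt)

theorem Ord.unique {p q : ℚ} {a : Hahn S} (h : Ord p a) (h' : Ord q a) : p = q :=
  le_antisymm (h'.le h.1) (h.le h'.1)

theorem Ord.neg {p : ℚ} {a : Hahn S} (h : Ord p a) : Ord p (-a) :=
  ⟨h.1.neg, by simpa using h.2⟩

theorem ord_C {s : S} (hs : s ≠ 0) : Ord 0 (HahnSeries.C s : Hahn S) :=
  ⟨lge_C s, by simpa [HahnSeries.C_apply] using hs⟩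

theorem ord_single {q : ℚ} {s : S} (hs : s ≠ 0) : Ord q (HahnSeries.single q s) :=
  ⟨lge_single le_rfl s, by simpa using hs⟩

theorem Ord.add_of_lt {p q : ℚ} {a b : Hahn S} (h : Ord p a) (hb : Lge q b) (hpq : p < q) :
    Ord p (a + b) :=
  ⟨h.1.add (hb.mono hpq.le), by simpa [hb p hpq] using h.2⟩

theorem lge_of_forall_ord {q : ℚ} {a : Hahn S} (h : ∀ p, Ord p a → q ≤ p) : Lge q a := by
  by_cases ha : a = 0
  · rw [ha]; exact lge_zero q
  · obtain ⟨p, hp⟩ := exists_ord ha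
    exact hp.1.mono (h p hp)

variable [IsDomain S]

theorem Ord.mul {p q : ℚ} {a b : Hahn S} (ha : Ord p a) (hb : Ord q b) : Ord (p + q) (a * b) :=
  ⟨ha.1.mul hb.1, by rw [ha.1.coeff_mul hb.1]; exact mul_ne_zero ha.2 hb.2⟩

theorem ord_one : Ord 0 (1 : Hahn S) := ord_single one_ne_zero

theorem Ord.pow {p : ℚ} {a : Hahn S} (ha : Ord p a) (n : ℕ) : Ord (n * p) (a ^ n) :=
  ⟨ha.1.pow n, by rw [ha.1.coeff_pow]; exact pow_ne_zero n ha.2⟩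

end Order

section Map

variable {S S' : Type*} [CommRing S'] [CommRing S]

/-- Coefficientwise application of a ring homomorphism. -/
noncomputable def hmap (f : S →+* S') : Hahn S →+* Hahn S' where
  toFun a := a.map f
  map_zero' := by ext; simp
  map_one' := by ext q; by_cases h : q = 0 <;> simp [HahnSeries.coeff_one, h]
  map_add' a b := by ext; simp
  map_mul' a b := HahnSeries.map_mul (f : S →ₙ+* S')

@[simp] theorem hmap_coeff (f : S →+* S') (a : Hahn S) (q : ℚ) :
    (hmap f a).coeff q = f (a.coeff q) := rfl

@[simp] theorem hmap_single (f : S →+* S') (q : ℚ) (s : S) :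
    hmap f (HahnSeries.single q s) = HahnSeries.single q (f s) := by
  ext i; by_cases h : i = q <;> simp [h]

@[simp] theorem hmap_C (f : S →+* S') (s : S) :
    hmap f (HahnSeries.C s) = HahnSeries.C (f s) := hmap_single f 0 s

theorem hmap_injective {f : S →+* S'} (hf : Function.Injective f) :
    Function.Injective (hmap f) := fun a b h => by
  ext q; exact hf (by simpa using congrArg (fun z => z.coeff q) h)

theorem Lge.hmap (f : S →+* S') {p : ℚ} {a : Hahn S} (h : Lge p a) : Lge p (hmap f a) :=
  fun i hi => by simp [h i hi]

theorem lge_hmap_iff {f : S →+* S'} (hf : Function.Injective f) {p : ℚ} {a : Hahn S} :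
    Lge p (hmap f a) ↔ Lge p a :=
  ⟨fun h i hi => hf (by simpa using h i hi), fun h => h.hmap f⟩

theorem ord_hmap_iff {f : S →+* S'} (hf : Function.Injective f) {p : ℚ} {a : Hahn S} :
    Ord p (hmap f a) ↔ Ord p a := by
  rw [Ord, Ord, lge_hmap_iff hf, hmap_coeff, map_ne_zero_iff f hf]

theorem hmap_hmap {S'' : Type*} [CommRing S''] (g : S' →+* S'') (f : S →+* S') (a : Hahn S) :
    hmap g (hmap f a) = hmap (g.comp f) a := rfl

end Map

theorem coeff_mul_of_subset {S : Type*} [CommRing S] {a b : Hahn S} {s t : Set ℚ} (hs : s.IsPWO)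
    (ht : t.IsPWO) (has : a.support ⊆ s) (hbt : b.support ⊆ t) (q : ℚ) :
    (a * b).coeff q = ∑ ij ∈ Finset.antidiagonal hs ht q, a.coeff ij.1 * b.coeff ij.2 := by
  rw [HahnSeries.coeff_mul]
  refine Finset.sum_subset (fun ij h => ?_) (fun ij h h' => ?_)
  · simp only [Finset.mem_antidiagonal] at h ⊢
    exact ⟨has h.1, hbt h.2.1, h.2.2⟩
  · simp only [Finset.mem_antidiagonal, HahnSeries.mem_support, not_and] at h h'
    by_cases h1 : a.coeff ij.1 = 0
    · simp [h1]
    · by_cases h2 : b.coeff ij.2 = 0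
      · simp [h2]
      · exact absurd h.2.2 (h' h1 h2)

section Derivations

variable {S : Type*} [CommRing S] [Algebra ℂ S]

/-- Coefficientwise multiplication by a function of the exponent. -/
noncomputable def cmul (χ : ℚ → ℂ) (a : Hahn S) : Hahn S where
  coeff q := χ q • a.coeff q
  isPWO_support' := a.isPWO_support.mono fun q hq => by
    simp only [Function.mem_support] at hq
    exact fun h => hq (by simp [h])

@[simp] theorem cmul_coeff (χ : ℚ → ℂ) (a : Hahn S) (q : ℚ) :
    (cmul χ a).coeff q = χ q • a.coeff q := rfl

theorem support_cmul (χ : ℚ → ℂ) (a : Hahn S) : (cmul χ a).support ⊆ a.support := fun q hq => by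
  simp only [HahnSeries.mem_support, cmul_coeff] at hq ⊢
  exact fun h => hq (by simp [h])

/-- The derivation `x ∂/∂x`. -/
noncomputable def theta : Hahn S →+ Hahn S where
  toFun := cmul fun q => -(q : ℂ)
  map_zero' := by ext; simp
  map_add' a b := by ext; simp

@[simp] theorem theta_coeff (a : Hahn S) (q : ℚ) : (theta a).coeff q = -(q : ℂ) • a.coeff q := rfl

theorem theta_mul (a b : Hahn S) : theta (a * b) = a * theta b + b * theta a := by
  ext q
  have hs (a : Hahn S) : (theta a).support ⊆ a.support := support_cmul _ a
  rw [theta_coeff, HahnSeries.coeff_add, mul_comm b,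
    coeff_mul_of_subset a.isPWO_support b.isPWO_support subset_rfl (hs b),
    coeff_mul_of_subset a.isPWO_support b.isPWO_support (hs a) subset_rfl, HahnSeries.coeff_mul,
    Finset.smul_sum, ← Finset.sum_add_distrib]
  refine Finset.sum_congr rfl fun ij hij => ?_
  simp only [Finset.mem_antidiagonal] at hij
  rw [← hij.2.2, theta_coeff, theta_coeff, mul_smul_comm, smul_mul_assoc, ← add_smul]
  congr 1; push_cast; ring

theorem theta_C (s : S) : theta (HahnSeries.C s : Hahn S) = 0 := by
  ext q; by_cases h : q = 0 <;> simp [HahnSeries.C_apply, h]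

theorem theta_single (p : ℚ) (s : S) :
    theta (HahnSeries.single p s) = HahnSeries.single p (-(p : ℂ) • s) := by
  ext q; by_cases h : q = p <;> simp [h]

theorem Lge.theta {p : ℚ} {a : Hahn S} (h : Lge p a) : Lge p (theta a) :=
  fun i hi => by simp [h i hi]

/-- Coefficientwise application of a derivation. -/
noncomputable def dmap (d : Derivation ℂ S S) : Hahn S →+ Hahn S where
  toFun a := a.map d
  map_zero' := by ext; simp
  map_add' a b := by ext; simp

@[simp] theorem dmap_coeff (d : Derivation ℂ S S) (a : Hahn S) (q : ℚ) :
    (dmap d a).coeff q = d (a.coeff q) := rfl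

theorem dmap_mul (d : Derivation ℂ S S) (a b : Hahn S) :
    dmap d (a * b) = a * dmap d b + b * dmap d a := by
  have hs (a : Hahn S) : (dmap d a).support ⊆ a.support := fun q hq => by
    simp only [HahnSeries.mem_support, dmap_coeff] at hq ⊢
    exact fun h => hq (by simp [h])
  ext q
  rw [dmap_coeff, HahnSeries.coeff_add, mul_comm b,
    coeff_mul_of_subset a.isPWO_support b.isPWO_support subset_rfl (hs b),
    coeff_mul_of_subset a.isPWO_support b.isPWO_support (hs a) subset_rfl,
    HahnSeries.coeff_mul, map_sum, ← Finset.sum_add_distrib]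
  refine Finset.sum_congr rfl fun ij _ => ?_
  simp [mul_comm]

theorem dmap_single (d : Derivation ℂ S S) (p : ℚ) (s : S) :
    dmap d (HahnSeries.single p s) = HahnSeries.single p (d s) := by
  ext q; by_cases h : q = p <;> simp [h]

theorem Lge.dmap (d : Derivation ℂ S S) {p : ℚ} {a : Hahn S} (h : Lge p a) : Lge p (dmap d a) :=
  fun i hi => by simp [h i hi]

/-- Twisting the coefficients by a character of the exponents. -/
noncomputable def twist (χ : ℚ → ℂ) (h0 : χ 0 = 1) (hadd : ∀ p q, χ (p + q) = χ p * χ q) :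
    Hahn S →+* Hahn S where
  toFun := cmul χ
  map_zero' := by ext; simp
  map_one' := by ext q; by_cases h : q = 0 <;> simp [HahnSeries.coeff_one, h, h0]
  map_add' a b := by ext; simp
  map_mul' a b := by
    ext q
    rw [cmul_coeff, coeff_mul_of_subset a.isPWO_support b.isPWO_support (support_cmul χ a)
      (support_cmul χ b), HahnSeries.coeff_mul, Finset.smul_sum]
    refine Finset.sum_congr rfl fun ij hij => ?_
    simp only [Finset.mem_antidiagonal] at hij
    rw [← hij.2.2, hadd]
    simp only [cmul_coeff, mul_smul, smul_mul_assoc, mul_smul_comm]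
    rw [smul_comm]

end Derivations

section Contraction

/-- Hahn series with support in a submonoid. -/
def suppIn (S : Type*) [CommRing S] (Γ : AddSubmonoid ℚ) : Subring (Hahn S) where
  carrier := {a | ∀ q ∉ Γ, a.coeff q = 0}
  mul_mem' {a b} ha hb q hq := by
    rw [HahnSeries.coeff_mul]
    refine Finset.sum_eq_zero fun ij hij => ?_
    have h := (Finset.mem_antidiagonal.1 hij)
    by_cases h1 : ij.1 ∈ Γ
    · by_cases h2 : ij.2 ∈ Γ
      · exact absurd (h.2.2 ▸ Γ.add_mem h1 h2) hq
      · rw [hb _ h2, mul_zero]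
    · rw [ha _ h1, zero_mul]
  one_mem' q hq := by
    rw [HahnSeries.coeff_one, if_neg]
    rintro rfl; exact hq Γ.zero_mem
  add_mem' {a b} ha hb q hq := by simp [ha q hq, hb q hq]
  zero_mem' _ _ := rfl
  neg_mem' {a} ha q hq := by simp [ha q hq]

theorem C_mem_suppIn {S : Type*} [CommRing S] (Γ : AddSubmonoid ℚ) (s : S) :
    (HahnSeries.C s : Hahn S) ∈ suppIn S Γ := fun q hq => by
  rw [HahnSeries.C_apply, HahnSeries.coeff_single_of_ne]
  rintro rfl; exact hq Γ.zero_mem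

theorem exists_fixedPoint {V : Type*} [Zero V] (K : ℚ → Set V) {Γ : Set ℚ} (hΓ : Γ.IsPWO)
    (hK0 : ∀ q, 0 ∈ K q) (hKΓ : ∀ q ∉ Γ, ∀ v ∈ K q, v = 0) (Φ : Hahn V → Hahn V)
    (hΦ : ∀ a : Hahn V, (∀ q, a.coeff q ∈ K q) → ∀ q, (Φ a).coeff q ∈ K q)
    (hc : ∀ a b : Hahn V, (∀ q, a.coeff q ∈ K q) → (∀ q, b.coeff q ∈ K q) → ∀ q,
      (∀ p < q, a.coeff p = b.coeff p) → (Φ a).coeff q = (Φ b).coeff q) :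
    ∃ a : Hahn V, (∀ q, a.coeff q ∈ K q) ∧ Φ a = a := by
  classical
  have hwf : WellFounded ((· < ·) : Γ → Γ → Prop) := by
    exact hΓ.isWF
  let tr (q : Γ) (r : ∀ p : Γ, p < q → V) : Hahn V :=
    { coeff := fun p => if h : ∃ hp : p ∈ Γ, (⟨p, hp⟩ : Γ) < q then r ⟨p, h.1⟩ h.2 else 0
      isPWO_support' := hΓ.mono fun p hp => by
        by_contra hn
        exact hp (dif_neg fun h => hn h.1) }
  let f : Γ → V := hwf.fix fun q r => (Φ (tr q r)).coeff q
  have hf (q : Γ) : f q = (Φ (tr q fun p _ => f p)).coeff q := hwf.fix_eq _ q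
  have hfK (q : Γ) : f q ∈ K q := by
    induction q using hwf.induction with
    | _ q ih =>
      rw [hf]
      refine hΦ _ (fun p => ?_) _
      by_cases h : ∃ hp : p ∈ Γ, (⟨p, hp⟩ : Γ) < q
      · simpa only [tr, dif_pos h] using ih _ h.2
      · simpa only [tr, dif_neg h] using hK0 p
  let a : Hahn V :=
    { coeff := fun p => if h : p ∈ Γ then f ⟨p, h⟩ else 0
      isPWO_support' := hΓ.mono fun p hp => by
        by_contra hn
        exact hp (dif_neg hn) }
  have ha (q : ℚ) : a.coeff q ∈ K q := by
    by_cases h : q ∈ Γ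
    · simpa only [a, dif_pos h] using hfK ⟨q, h⟩
    · simpa only [a, dif_neg h] using hK0 q
  refine ⟨a, ha, ?_⟩
  ext q
  by_cases h : q ∈ Γ
  · have : a.coeff q = f ⟨q, h⟩ := dif_pos h
    rw [this, hf]
    refine hc _ _ ha (fun p => ?_) q fun p hp => ?_
    · by_cases h' : ∃ hp : p ∈ Γ, (⟨p, hp⟩ : Γ) < ⟨q, h⟩
      · rw [show (tr ⟨q, h⟩ fun p _ => f p).coeff p = f ⟨p, h'.1⟩ from dif_pos h']
        exact hfK ⟨p, h'.1⟩
      · simpa only [tr, dif_neg h'] using hK0 p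
    · by_cases h' : p ∈ Γ
      · have h'' : ∃ hp : p ∈ Γ, (⟨p, hp⟩ : Γ) < ⟨q, h⟩ := ⟨h', hp⟩
        simp only [tr, a, dif_pos h', dif_pos h'']
      · have h'' : ¬ ∃ hp : p ∈ Γ, (⟨p, hp⟩ : Γ) < ⟨q, h⟩ := fun h => h' h.1
        simp only [tr, a, dif_neg h', dif_neg h'']
  · rw [hKΓ q h _ (hΦ a ha q), hKΓ q h _ (ha q)]

theorem isPWO_closure_supports {S : Type*} [CommRing S] (T : Set (Hahn S)) (hT : T.Finite)
    (h0 : ∀ a ∈ T, Lge 0 a) :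
    ∃ Γ : AddSubmonoid ℚ, (Γ : Set ℚ).IsPWO ∧ (∀ q ∈ Γ, 0 ≤ q) ∧ ∀ a ∈ T, a ∈ suppIn S Γ := by
  have hnn : ∀ q ∈ ⋃ a ∈ T, a.support, (0 : ℚ) ≤ q := fun q hq => by
    simp only [Set.mem_iUnion, HahnSeries.mem_support] at hq
    obtain ⟨a, ha, hq⟩ := hq
    by_contra! h
    exact hq (h0 a ha q h)
  refine ⟨AddSubmonoid.closure (⋃ a ∈ T, a.support), ?_, ?_, ?_⟩
  · refine Set.IsPWO.addSubmonoid_closure hnn ?_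
    simpa using (Finset.isPWO_bUnion hT.toFinset (f := fun a : Hahn S => a.support)).2
      fun a _ => a.isPWO_support
  · intro q hq
    induction hq using AddSubmonoid.closure_induction with
    | mem x hx => exact hnn x hx
    | zero => exact le_rfl
    | add x y _ _ hx hy => exact add_nonneg hx hy
  · intro a ha q hq
    by_contra h
    exact hq (AddSubmonoid.subset_closure (Set.mem_biUnion ha h))

theorem eval_mem_subring {R : Type*} [CommRing R] (A : Subring R) {p : R[X]}
    (hp : ∀ i, p.coeff i ∈ A) {h : R} (hh : h ∈ A) : p.eval h ∈ A := by
  rw [Polynomial.eval_eq_sum_range]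
  exact A.sum_mem fun i _ => A.mul_mem (hp i) (A.pow_mem hh i)

/-- The divided difference of a polynomial at two points. -/
theorem exists_divided_difference {S : Type*} [CommRing S] {p : (Hahn S)[X]}
    (hp : ∀ i, Lge 0 (p.coeff i)) (hp2 : ∀ i, 2 ≤ i → (p.coeff i).coeff 0 = 0)
    {h h' : Hahn S} (hh : Lge 0 h) (hh' : Lge 0 h') :
    ∃ e : Hahn S, Lge 0 e ∧ e.coeff 0 = (p.coeff 1).coeff 0 ∧
      p.eval h - p.eval h' = (h - h') * e := by
  refine ⟨∑ i ∈ Finset.range (p.natDegree + 1),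
    p.coeff i * ∑ j ∈ Finset.range i, h ^ j * h' ^ (i - 1 - j), ?_, ?_, ?_⟩
  · exact Lge.sum fun i _ => (hp i).mul₀ (Lge.sum fun j _ => (hh.pow₀ _).mul₀ (hh'.pow₀ _))
  · rw [HahnSeries.coeff_sum]
    have hl (i : ℕ) : Lge 0 (∑ j ∈ Finset.range i, h ^ j * h' ^ (i - 1 - j)) :=
      Lge.sum fun j _ => (hh.pow₀ _).mul₀ (hh'.pow₀ _)
    have key (i : ℕ) := Lge.coeff_mul (hp i) (hl i)
    simp only [add_zero] at key
    rw [Finset.sum_eq_single 1]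
    · rw [key]; simp
    · intro i _ hi
      rw [key]
      rcases i with _ | i
      · simp
      · rw [hp2 _ (by omega), zero_mul]
    · intro h1
      rw [Polynomial.coeff_eq_zero_of_natDegree_lt (by simpa using h1)]
      simp
  · rw [Polynomial.eval_eq_sum_range, Polynomial.eval_eq_sum_range, ← Finset.sum_sub_distrib,
      Finset.mul_sum]
    refine Finset.sum_congr rfl fun i _ => ?_
    rw [← mul_sub, ← (Commute.all h h').mul_geom_sum₂ i]
    ring

theorem exists_simple_root {S : Type*} [CommRing S] {p : (Hahn S)[X]}
    (hp : ∀ i, Lge 0 (p.coeff i)) (hp2 : ∀ i, 2 ≤ i → (p.coeff i).coeff 0 = 0)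
    {a : S} (ha : a * (p.coeff 1).coeff 0 = 1) :
    ∃ h : Hahn S, Lge 0 h ∧ p.eval h = 0 ∧ h.coeff 0 = - a * (p.coeff 0).coeff 0 := by
  obtain ⟨Γ, hΓ, hΓ0, hT⟩ := isPWO_closure_supports
    ((fun i => p.coeff i) '' (Finset.range (p.natDegree + 1) : Set ℕ))
    (Set.Finite.image _ (Finset.finite_toSet _)) (by rintro _ ⟨i, _, rfl⟩; exact hp i)
  have hpΓ (i : ℕ) : p.coeff i ∈ suppIn S Γ := by
    by_cases hi : i < p.natDegree + 1
    · exact hT _ ⟨i, by simpa using hi, rfl⟩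
    · rw [Polynomial.coeff_eq_zero_of_natDegree_lt (by omega)]; exact zero_mem _
  have hpos {h : Hahn S} (hh : h ∈ suppIn S Γ) : Lge 0 h := fun q hq =>
    hh q fun hq' => (hΓ0 q hq').not_gt hq
  have hgood {h : Hahn S} :
      (∀ q, h.coeff q ∈ {v : S | q ∉ Γ → v = 0}) ↔ h ∈ suppIn S Γ := Iff.rfl
  have hunit : ∀ h h' : Hahn S, h ∈ suppIn S Γ → h' ∈ suppIn S Γ → ∀ q,
      (∀ p < q, h.coeff p = h'.coeff p) →
      (h - HahnSeries.C a * p.eval h).coeff q = (h' - HahnSeries.C a * p.eval h').coeff q := by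
    intro h h' hh hh' q hq
    obtain ⟨e, he0, he1, he⟩ := exists_divided_difference hp hp2 (hpos hh) (hpos hh')
    have h1 : (h - HahnSeries.C a * p.eval h) - (h' - HahnSeries.C a * p.eval h')
        = (h - h') * (1 - HahnSeries.C a * e) := by linear_combination -HahnSeries.C a * he
    have h2 : Lge q (h - h') := fun i hi => by simp [hq i hi]
    have h3 : Lge 0 (1 - HahnSeries.C a * e) := lge_one.sub ((lge_C a).mul₀ he0)
    have h4 := h2.coeff_mul h3
    have h5 : (1 - HahnSeries.C a * e).coeff 0 = 0 := by
      rw [HahnSeries.coeff_sub, HahnSeries.C_mul_eq_smul, HahnSeries.coeff_smul, he1]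
      simp [ha]
    rw [h5, mul_zero, add_zero, ← h1, HahnSeries.coeff_sub, sub_eq_zero] at h4
    exact h4
  have hmem : ∀ h ∈ suppIn S Γ, h - HahnSeries.C a * p.eval h ∈ suppIn S Γ := fun h hh =>
    sub_mem hh (mul_mem (C_mem_suppIn Γ a) (eval_mem_subring _ hpΓ hh))
  obtain ⟨h, hh, hfix⟩ := exists_fixedPoint (fun q => {v : S | q ∉ Γ → v = 0}) hΓ
    (fun q _ => rfl) (fun q hq v hv => hv hq) (fun h => h - HahnSeries.C a * p.eval h)
    (fun h hh => hmem h hh) hunit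
  rw [hgood] at hh
  have hz : HahnSeries.C a * p.eval h = 0 := by
    linear_combination -hfix
  have hau : IsUnit a := IsUnit.of_mul_eq_one _ ha
  have hroot : p.eval h = 0 := by
    have := hau.map (HahnSeries.C : S →+* Hahn S)
    exact (this.mul_right_eq_zero).1 hz
  refine ⟨h, hpos hh, hroot, ?_⟩
  obtain ⟨e, he0, he1, he⟩ := exists_divided_difference hp hp2 (hpos hh) (lge_zero 0)
  have h4 := ((hpos hh).sub (lge_zero 0)).coeff_mul he0
  rw [← he, hroot, ← Polynomial.coeff_zero_eq_eval_zero, he1] at h4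
  simp only [zero_sub, add_zero, sub_zero, HahnSeries.coeff_neg] at h4
  linear_combination a * h4 * (-1) - h.coeff 0 * ha

end Contraction

section AlgClosed

/-- A polynomial with Hahn series coefficients as a Hahn series with polynomial coefficients. -/
noncomputable def polySwap (S : Type*) [CommRing S] : (Hahn S)[X] →+* Hahn S[X] :=
  Polynomial.eval₂RingHom (hmap Polynomial.C) (HahnSeries.C Polynomial.X)

theorem polySwap_coeff {S : Type*} [CommRing S] (p : (Hahn S)[X]) (q : ℚ) (j : ℕ) :
    ((polySwap S p).coeff q).coeff j = (p.coeff j).coeff q := by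
  induction p using Polynomial.induction_on' with
  | add p p' hp hp' => simp [hp, hp']
  | monomial n a =>
    rw [polySwap, Polynomial.coe_eval₂RingHom, Polynomial.eval₂_monomial, ← map_pow, mul_comm,
      HahnSeries.C_mul_eq_smul, HahnSeries.coeff_smul, hmap_coeff, smul_eq_mul,
      mul_comm, Polynomial.coeff_C_mul, Polynomial.coeff_X_pow, Polynomial.coeff_monomial]
    by_cases h : j = n
    · simp [h]
    · simp [h, Ne.symm h]

theorem polySwap_injective {S : Type*} [CommRing S] : Function.Injective (polySwap S) :=
  fun p p' h => by
  ext j q; rw [← polySwap_coeff, h, polySwap_coeff]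

theorem exists_polySwap_eq {S : Type*} [CommRing S] {A : Hahn S[X]} {N : ℕ}
    (hA : ∀ q, (A.coeff q).natDegree ≤ N) :
    ∃ a : (Hahn S)[X], polySwap S a = A ∧ a.natDegree ≤ N := by
  refine ⟨∑ j ∈ Finset.range (N + 1), Polynomial.monomial j
    (A.map (Polynomial.lcoeff S j)), ?_, ?_⟩
  · ext q j
    rw [polySwap_coeff, Polynomial.finsetSum_coeff]
    by_cases h : j < N + 1
    · rw [Finset.sum_eq_single j]
      · simp
      · intro b _ hb; rw [Polynomial.coeff_monomial, if_neg hb]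
      · intro h'; exact absurd (Finset.mem_range.2 h) h'
    · rw [Polynomial.coeff_eq_zero_of_natDegree_lt ((hA q).trans_lt (by omega)),
        Finset.sum_eq_zero, HahnSeries.coeff_zero]
      intro b hb
      rw [Polynomial.coeff_monomial, if_neg]
      rintro rfl; exact h (Finset.mem_range.1 hb)
  · refine Polynomial.natDegree_sum_le_of_forall_le _ _ fun j hj => ?_
    exact (Polynomial.natDegree_monomial_le _).trans (by
      have := Finset.mem_range.1 hj; omega)

variable {F : Type*} [Field F]

theorem natDegree_X_sub_C_pow' {R : Type*} [CommRing R] [Nontrivial R] (a : R) (n : ℕ) :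
    ((Polynomial.X - Polynomial.C a) ^ n).natDegree = n := by
  rw [(Polynomial.monic_X_sub_C a).natDegree_pow, Polynomial.natDegree_X_sub_C, mul_one]

theorem exists_coprime_splitting {g h : F[X]} (hg : g.Monic) (hh : h.Monic)
    (hco : IsCoprime g h) :
    ∃ α β : ZeroHom F[X] F[X], (∀ e, e = h * α e + g * β e) ∧
      ∀ e, e.degree < ((g.natDegree + h.natDegree : ℕ) : WithBot ℕ) →
        (α e).degree < g.natDegree ∧ (β e).degree < h.natDegree := by
  obtain ⟨u, v, huv⟩ := hco
  have hid (e : F[X]) : e = h * ((e * v) %ₘ g) + g * (e * u + h * ((e * v) /ₘ g)) := by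
    have := Polynomial.modByMonic_add_div (e * v) g
    linear_combination (-h) * this - e * huv
  refine ⟨⟨fun e => (e * v) %ₘ g, by simp⟩,
    ⟨fun e => e * u + h * ((e * v) /ₘ g), by simp⟩, hid, fun e he => ?_⟩
  have hα : ((e * v) %ₘ g).degree < g.natDegree := by
    rw [← Polynomial.degree_eq_natDegree hg.ne_zero]
    exact Polynomial.degree_modByMonic_lt _ hg
  refine ⟨hα, ?_⟩
  have h1 : (g * (e * u + h * ((e * v) /ₘ g))).degree < ((g.natDegree + h.natDegree : ℕ) : WithBot ℕ) := by
    have : g * (e * u + h * ((e * v) /ₘ g)) = e - h * ((e * v) %ₘ g) := by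
      linear_combination -hid e
    rw [this]
    refine (Polynomial.degree_sub_le _ _).trans_lt (max_lt he ?_)
    rw [Polynomial.degree_mul, Polynomial.degree_eq_natDegree hh.ne_zero, add_comm, Nat.cast_add]
    exact WithBot.add_lt_add_right (by simp) hα
  change (e * u + h * ((e * v) /ₘ g)).degree < _
  rw [Polynomial.degree_mul, Polynomial.degree_eq_natDegree hg.ne_zero, Nat.cast_add] at h1
  exact lt_of_add_lt_add_left h1

theorem exists_hensel_factors {p : (Hahn F)[X]} (hp : p.Monic) (hp0 : ∀ i, Lge 0 (p.coeff i))
    {g h : F[X]} (hg : g.Monic) (hh : h.Monic) (hco : IsCoprime g h)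
    (hgh : ∀ i, (g * h).coeff i = (p.coeff i).coeff 0) :
    ∃ a b : (Hahn F)[X], p = a * b ∧ a.natDegree = g.natDegree ∧ b.natDegree = h.natDegree := by
  obtain ⟨α, β, hid, hdeg⟩ := exists_coprime_splitting hg hh hco
  have hn : p.natDegree = g.natDegree + h.natDegree := by
    rw [← hg.natDegree_mul hh]
    refine le_antisymm (Polynomial.le_natDegree_of_ne_zero ?_)
      (Polynomial.natDegree_le_iff_coeff_eq_zero.2 fun i hi => ?_)
    · rw [hgh, hp.coeff_natDegree]; simp
    · rw [hgh, Polynomial.coeff_eq_zero_of_natDegree_lt hi]; rfl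
  obtain ⟨Γ, hΓ, hΓ0, hT⟩ := isPWO_closure_supports
    ((fun i => p.coeff i) '' (Finset.range (p.natDegree + 1) : Set ℕ))
    (Set.Finite.image _ (Finset.finite_toSet _)) (by rintro _ ⟨i, _, rfl⟩; exact hp0 i)
  have hpΓ (i : ℕ) : p.coeff i ∈ suppIn F Γ := by
    by_cases hi : i < p.natDegree + 1
    · exact hT _ ⟨i, by simpa using hi, rfl⟩
    · rw [Polynomial.coeff_eq_zero_of_natDegree_lt (by omega)]; exact zero_mem _
  set n := g.natDegree + h.natDegree with hn'
  set P := polySwap F p - HahnSeries.C (g * h) with hP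
  let K : ℚ → Set F[X] := fun q => {v | (q ∉ Γ → v = 0) ∧ (q ≤ 0 → v = 0) ∧ v.degree < n}
  have hdegmem {a b : F[X]} (ha : a.degree < g.natDegree) (hb : b.degree < h.natDegree) :
      (a * b).degree < n := by
    by_cases hb0 : b = 0
    · simp [hb0]
    rw [Polynomial.degree_mul, hn', Nat.cast_add]
    by_cases ha0 : a = 0
    · rw [ha0, Polynomial.degree_zero, WithBot.bot_add]
      exact_mod_cast WithBot.bot_lt_coe _
    · rw [Polynomial.degree_eq_natDegree ha0] at ha ⊢
      rw [Polynomial.degree_eq_natDegree hb0] at hb ⊢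
      norm_cast at *
      omega
  have hPK (q : ℚ) : P.coeff q ∈ K q := by
    have hc (j : ℕ) : (P.coeff q).coeff j
        = (p.coeff j).coeff q - ((HahnSeries.C (g * h) : Hahn F[X]).coeff q).coeff j := by
      rw [hP, HahnSeries.coeff_sub, Polynomial.coeff_sub, polySwap_coeff]
    have h0 : q ≤ 0 → P.coeff q = 0 := by
      intro hq
      ext j
      rw [hc]
      rcases hq.lt_or_eq with h | rfl
      · rw [hp0 j q h, HahnSeries.C_apply, HahnSeries.coeff_single_of_ne h.ne]; simp
      · rw [HahnSeries.C_apply, HahnSeries.coeff_single_same, hgh]; simp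
    refine ⟨fun hq => ?_, h0, ?_⟩
    · ext j
      rw [hc, hpΓ j q hq, C_mem_suppIn Γ (g * h) q hq]; simp
    · by_cases hq : q = 0
      · rw [h0 hq.le, Polynomial.degree_zero]
        exact_mod_cast WithBot.bot_lt_coe _
      · rw [Polynomial.degree_lt_iff_coeff_zero]
        intro j hj
        rw [hc, HahnSeries.C_apply, HahnSeries.coeff_single_of_ne hq, Polynomial.coeff_zero,
          sub_zero]
        rcases hj.lt_or_eq with h | rfl
        · rw [Polynomial.coeff_eq_zero_of_natDegree_lt (by omega)]; rfl
        · rw [← hn, hp.coeff_natDegree, HahnSeries.coeff_one, if_neg hq]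
  have hmapΓ (γ : ZeroHom F[X] F[X]) {a : Hahn F[X]} (ha : ∀ q, a.coeff q ∈ K q) :
      a.map γ ∈ suppIn F[X] Γ ∧ Lge 0 (a.map γ) ∧ (a.map γ).coeff 0 = 0 := by
    refine ⟨fun q hq => ?_, fun q hq => ?_, ?_⟩ <;> rw [HahnSeries.map_coeff]
    · rw [(ha q).1 hq, map_zero]
    · rw [(ha q).2.1 hq.le, map_zero]
    · rw [(ha 0).2.1 le_rfl, map_zero]
  obtain ⟨E, hE, hfix⟩ := exists_fixedPoint K hΓ (fun q => ⟨fun _ => rfl, fun _ => rfl, by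
      rw [Polynomial.degree_zero]; exact_mod_cast WithBot.bot_lt_coe _⟩) (fun q hq v hv => hv.1 hq)
    (fun e => P - e.map α * e.map β) (by
      intro a ha q
      obtain ⟨h1, h2, h3⟩ := hmapΓ α ha
      obtain ⟨h1', h2', h3'⟩ := hmapΓ β ha
      refine ⟨fun hq => ?_, fun hq => ?_, ?_⟩
      · rw [HahnSeries.coeff_sub, (hPK q).1 hq, mul_mem h1 h1' q hq, sub_zero]
      · rw [HahnSeries.coeff_sub, (hPK q).2.1 hq]
        rcases hq.lt_or_eq with h | rfl
        · rw [h2.mul₀ h2' q h, sub_zero]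
        · have := h2.coeff_mul h2'
          rw [h3, zero_mul, add_zero] at this
          rw [this, sub_zero]
      · rw [HahnSeries.coeff_sub]
        refine (Polynomial.degree_sub_le _ _).trans_lt (max_lt (hPK q).2.2 ?_)
        rw [HahnSeries.coeff_mul, ← Polynomial.mem_degreeLT]
        refine Submodule.sum_mem _ fun ij _ => ?_
        rw [Polynomial.mem_degreeLT, HahnSeries.map_coeff, HahnSeries.map_coeff]
        exact hdegmem (hdeg _ (ha _).2.2).1 (hdeg _ (ha _).2.2).2)
    (by
      intro a b ha hb q hq
      obtain ⟨_, h2, h3⟩ := hmapΓ β ha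
      obtain ⟨_, h2', h3'⟩ := hmapΓ α hb
      have hl (γ : ZeroHom F[X] F[X]) : Lge q (a.map γ - b.map γ) := fun i hi => by
        rw [HahnSeries.coeff_sub, HahnSeries.map_coeff, HahnSeries.map_coeff, hq i hi, sub_self]
      have e1 := (hl α).coeff_mul h2
      have e2 := h2'.coeff_mul (hl β)
      have e3 : (a.map α * a.map β) - (b.map α * b.map β) =
        (a.map α - b.map α) * a.map β + b.map α * (a.map β - b.map β) := by ring
      rw [h3, mul_zero, add_zero] at e1
      rw [h3', zero_mul, zero_add] at e2
      have e4 := congrArg (fun z => z.coeff q) e3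
      simp only [HahnSeries.coeff_sub, HahnSeries.coeff_add, e1, e2, add_zero] at e4
      simp only [HahnSeries.coeff_sub]
      rw [sub_eq_zero.1 e4])
  have hsplit : E = HahnSeries.C h * E.map α + HahnSeries.C g * E.map β := by
    ext1; funext q
    rw [HahnSeries.coeff_add, HahnSeries.C_mul_eq_smul, HahnSeries.C_mul_eq_smul,
      HahnSeries.coeff_smul, HahnSeries.coeff_smul]
    exact hid _
  have hprod : polySwap F p = (HahnSeries.C g + E.map α) * (HahnSeries.C h + E.map β) := by
    have h1 : polySwap F p = P + HahnSeries.C g * HahnSeries.C h := by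
      rw [hP, map_mul]; ring
    rw [h1]
    linear_combination hfix + hsplit
  have hbound (γ : ZeroHom F[X] F[X]) (g : F[X]) (hγ : ∀ e, e.degree < (n : WithBot ℕ) →
      (γ e).degree < g.natDegree) (q : ℚ) :
      ((HahnSeries.C g + E.map γ).coeff q).natDegree ≤ g.natDegree := by
    rw [HahnSeries.coeff_add]
    refine (Polynomial.natDegree_add_le _ _).trans (max_le ?_ ?_)
    · by_cases hq : q = 0
      · rw [hq, HahnSeries.C_apply, HahnSeries.coeff_single_same]
      · rw [HahnSeries.C_apply, HahnSeries.coeff_single_of_ne hq]; simp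
    · rw [HahnSeries.map_coeff]
      exact Polynomial.natDegree_le_of_degree_le (hγ _ (hE q).2.2).le
  obtain ⟨a, ha, hda⟩ := exists_polySwap_eq (hbound α g fun e he => (hdeg e he).1)
  obtain ⟨b, hb, hdb⟩ := exists_polySwap_eq (hbound β h fun e he => (hdeg e he).2)
  have hpab : p = a * b := polySwap_injective (by rw [map_mul, ha, hb, hprod])
  have hab : a.natDegree + b.natDegree = n := by
    rw [← hn, hpab, Polynomial.natDegree_mul]
    · rintro rfl; exact hp.ne_zero (by simp [hpab])
    · rintro rfl; exact hp.ne_zero (by simp [hpab])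
  exact ⟨a, b, hpab, by omega, by omega⟩

theorem exists_coprime_factors [IsAlgClosed F] [CharZero F] {p : F[X]} (hp : p.Monic)
    (hn : 1 ≤ p.natDegree) (h1 : p.coeff (p.natDegree - 1) = 0)
    (h2 : p ≠ Polynomial.X ^ p.natDegree) :
    ∃ g h : F[X], g.Monic ∧ h.Monic ∧ IsCoprime g h ∧ p = g * h ∧ 1 ≤ g.natDegree ∧
      1 ≤ h.natDegree := by
  obtain ⟨ρ, hρ⟩ := IsAlgClosed.exists_root p (by
    rw [Polynomial.degree_eq_natDegree hp.ne_zero]; exact_mod_cast (by omega))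
  obtain ⟨h, hh, hnd⟩ := Polynomial.exists_eq_pow_rootMultiplicity_mul_and_not_dvd p hp.ne_zero ρ
  set e := p.rootMultiplicity ρ
  have he : 0 < e := (Polynomial.rootMultiplicity_pos hp.ne_zero).2 hρ
  have hgm : ((Polynomial.X - Polynomial.C ρ) ^ e).Monic := (Polynomial.monic_X_sub_C ρ).pow e
  have hhm : h.Monic := hgm.of_mul_monic_left (hh ▸ hp)
  refine ⟨_, h, hgm, hhm, ?_, hh, ?_, ?_⟩
  · exact IsCoprime.pow_left ((Polynomial.irreducible_X_sub_C ρ).coprime_iff_not_dvd.2 hnd)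
  · rw [natDegree_X_sub_C_pow']; exact he
  · by_contra! hlt
    have h1' : h = 1 := hhm.natDegree_eq_zero.1 (by omega)
    rw [h1', mul_one] at hh
    have hen : p.natDegree = e := by rw [hh, natDegree_X_sub_C_pow']
    have hc : p.nextCoeff = 0 := by
      rw [Polynomial.nextCoeff_of_natDegree_pos (by omega), h1]
    rw [hh, Polynomial.Monic.nextCoeff_pow (Polynomial.monic_X_sub_C ρ),
      Polynomial.nextCoeff_X_sub_C] at hc
    have : ρ = 0 := by
      simpa [he.ne'] using hc
    rw [this, Polynomial.C_0, sub_zero] at hh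
    exact h2 (by rw [hen]; exact hh)

theorem exists_root_of_monic [IsAlgClosed F] [CharZero F] (n : ℕ) :
    ∀ p : (Hahn F)[X], p.Monic → p.natDegree = n + 1 → ∃ z, p.eval z = 0 := by
  classical
  induction n using Nat.strong_induction_on with
  | _ n ih =>
  intro p0 hp0 hn0
  set c : Hahn F := p0.coeff n * HahnSeries.C ((n + 1 : F)⁻¹) with hc
  have hcn : ((n : Hahn F) + 1) * c = p0.coeff n := by
    have h1 : ((n : Hahn F) + 1) = HahnSeries.C ((n : F) + 1) := by rw [map_add, map_natCast, map_one]
    have h2 : ((n : F) + 1) ≠ 0 := by exact_mod_cast n.succ_ne_zero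
    rw [h1, hc, mul_left_comm, ← map_mul, mul_inv_cancel₀ h2, map_one, mul_one]
  set p := p0.comp (Polynomial.X - Polynomial.C c) with hp
  have hpn : p.natDegree = n + 1 := by rw [hp, Polynomial.natDegree_comp]; simp [hn0]
  have hpm : p.Monic := hp0.comp (Polynomial.monic_X_sub_C c) (by simp)
  have hpc : p.coeff n = 0 := by
    have hlow : (p0 - Polynomial.X ^ (n + 1)).natDegree ≤ n := by
      refine Polynomial.natDegree_le_iff_coeff_eq_zero.2 fun i hi => ?_
      rw [Polynomial.coeff_sub, Polynomial.coeff_X_pow]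
      rcases (Nat.succ_le_of_lt hi).lt_or_eq with h | h
      · rw [Polynomial.coeff_eq_zero_of_natDegree_lt (by omega), if_neg (by omega), sub_zero]
      · rw [if_pos h.symm, ← h, Nat.succ_eq_add_one, ← hn0, hp0.coeff_natDegree, sub_self]
    have h1 : p = (Polynomial.X - Polynomial.C c) ^ (n + 1) +
        (p0 - Polynomial.X ^ (n + 1)).comp (Polynomial.X - Polynomial.C c) := by
      rw [Polynomial.sub_comp, Polynomial.X_pow_comp]; ring
    have h3 : ((Polynomial.X - Polynomial.C c) ^ (n + 1)).coeff n = -(((n : Hahn F) + 1) * c) := by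
      have := Polynomial.Monic.nextCoeff_pow (Polynomial.monic_X_sub_C c) (n + 1)
      rw [Polynomial.nextCoeff_X_sub_C, Polynomial.nextCoeff_of_natDegree_pos
        (by rw [natDegree_X_sub_C_pow']; omega), natDegree_X_sub_C_pow'] at this
      simpa using this
    have h4 : ((p0 - Polynomial.X ^ (n + 1)).comp (Polynomial.X - Polynomial.C c)).coeff n
        = p0.coeff n := by
      have h5 := Polynomial.coeff_comp_degree_mul_degree
        (p := p0 - Polynomial.X ^ (n + 1)) (q := Polynomial.X - Polynomial.C c) (by simp)
      rcases hlow.lt_or_eq with h | h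
      · rw [Polynomial.coeff_eq_zero_of_natDegree_lt]
        · have := Polynomial.coeff_eq_zero_of_natDegree_lt h
          rw [Polynomial.coeff_sub, Polynomial.coeff_X_pow, if_neg (by omega), sub_zero] at this
          exact this.symm
        · rw [Polynomial.natDegree_comp]; simpa using h
      · rw [h, Polynomial.natDegree_X_sub_C, mul_one, Polynomial.leadingCoeff_X_sub_C, one_pow,
          mul_one, Polynomial.leadingCoeff, h, Polynomial.coeff_sub, Polynomial.coeff_X_pow,
          if_neg (by omega), sub_zero] at h5
        exact h5
    rw [h1, Polynomial.coeff_add, h3, h4, ← hcn]; ring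
  suffices h : ∃ z, p.eval z = 0 by
    obtain ⟨z, hz⟩ := h
    exact ⟨z - c, by simpa [hp, Polynomial.eval_comp] using hz⟩
  by_cases hX : p = Polynomial.X ^ (n + 1)
  · exact ⟨0, by simp [hX]⟩
  have hex : ∃ i ∈ Finset.range (n + 1), p.coeff i ≠ 0 := by
    by_contra! hall
    refine hX ?_
    ext1 i
    rw [Polynomial.coeff_X_pow]
    rcases lt_trichotomy i (n + 1) with h | h | h
    · rw [hall i (Finset.mem_range.2 h), if_neg h.ne]
    · rw [if_pos h, h, ← hpn, hpm.coeff_natDegree]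
    · rw [if_neg h.ne', Polynomial.coeff_eq_zero_of_natDegree_lt (by omega)]
  have hT : ((Finset.range (n + 1)).filter fun i => p.coeff i ≠ 0).Nonempty := by
    obtain ⟨i, hi, h⟩ := hex; exact ⟨i, Finset.mem_filter.2 ⟨hi, h⟩⟩
  obtain ⟨i, hi, hmin⟩ := Finset.exists_min_image _
    (fun i => (p.coeff i).order / ((n + 1 : ℚ) - i)) hT
  rw [Finset.mem_filter, Finset.mem_range] at hi
  set γ := (p.coeff i).order / ((n + 1 : ℚ) - i) with hγ
  set s : Hahn F := HahnSeries.single (-γ) 1 with hs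
  have hs0 : s ≠ 0 := (ord_single one_ne_zero).ne_zero
  set q := p.scaleRoots s with hq
  have hqn : q.natDegree = n + 1 := by rw [hq, Polynomial.natDegree_scaleRoots, hpn]
  have hqm : q.Monic := (Polynomial.monic_scaleRoots_iff s).2 hpm
  have hsc (i : ℕ) : q.coeff i = p.coeff i * s ^ (n + 1 - i) := by
    rw [hq, Polynomial.coeff_scaleRoots, hpn]
  have hso (k : ℕ) : Ord (k * -γ) (s ^ k) := (ord_single one_ne_zero).pow k
  have hq0 (j : ℕ) : Lge 0 (q.coeff j) := by
    rcases lt_or_ge j (n + 1) with h | h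
    · by_cases hz : p.coeff j = 0
      · rw [hsc, hz, zero_mul]; exact lge_zero 0
      · have h1 := hmin j (Finset.mem_filter.2 ⟨Finset.mem_range.2 h, hz⟩)
        have hpos : (0 : ℚ) < (n + 1 : ℚ) - j := by
          have : (j : ℚ) < n + 1 := by exact_mod_cast h
          linarith
        rw [le_div_iff₀ hpos] at h1
        rw [hsc]
        refine Lge.mono (Lge.mul (p := (p.coeff j).order) (fun _ hi =>
          HahnSeries.coeff_eq_zero_of_lt_order hi) (hso _).1) ?_
        rw [Nat.cast_sub h.le]
        push_cast
        linarith
    · rcases h.lt_or_eq with h | h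
      · rw [Polynomial.coeff_eq_zero_of_natDegree_lt (by omega)]; exact lge_zero 0
      · rw [← h, ← hqn, hqm.coeff_natDegree]; exact lge_one
  have hqi : (q.coeff i).coeff 0 ≠ 0 := by
    rw [hsc]
    have h1 : Ord (p.coeff i).order (p.coeff i) := ⟨fun _ hi =>
          HahnSeries.coeff_eq_zero_of_lt_order hi, fun h => hi.2 (HahnSeries.coeff_order_eq_zero.1 h)⟩
    have h2 := (h1.mul (hso (n + 1 - i))).2
    have hpos : (0 : ℚ) < (n + 1 : ℚ) - i := by
      have : (i : ℚ) < n + 1 := by exact_mod_cast hi.1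
      linarith
    have h3 : (p.coeff i).order + ((n + 1 - i : ℕ) : ℚ) * -γ = 0 := by
      rw [Nat.cast_sub hi.1.le, hγ]; push_cast; field_simp; ring
    rwa [h3] at h2
  suffices h : ∃ z, q.eval z = 0 by
    obtain ⟨z, hz⟩ := h
    refine ⟨s⁻¹ * z, ?_⟩
    have := Polynomial.scaleRoots_eval₂_mul (p := p) (RingHom.id (Hahn F)) (s⁻¹ * z) s
    rw [RingHom.id_apply, mul_inv_cancel_left₀ hs0, ← hq] at this
    simp only [Polynomial.eval₂_id, hz] at this
    exact (mul_eq_zero.1 this.symm).resolve_left (pow_ne_zero _ hs0)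
  let q0 : F[X] := (polySwap F q).coeff 0
  have hq0c (j : ℕ) : q0.coeff j = (q.coeff j).coeff 0 := polySwap_coeff q 0 j
  have hq0n : q0.natDegree = n + 1 := by
    refine le_antisymm (Polynomial.natDegree_le_iff_coeff_eq_zero.2 fun j hj => ?_)
      (Polynomial.le_natDegree_of_ne_zero ?_)
    · rw [hq0c, Polynomial.coeff_eq_zero_of_natDegree_lt (by omega)]; rfl
    · rw [hq0c, ← hqn, hqm.coeff_natDegree]; simp
  have hq0m : q0.Monic := by
    rw [Polynomial.Monic, Polynomial.leadingCoeff, hq0n, hq0c, ← hqn, hqm.coeff_natDegree]; simp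
  obtain ⟨g, h, hg, hh, hco, hgh, hg1, hh1⟩ := exists_coprime_factors hq0m (by omega)
    (by rw [hq0n, hq0c, Nat.add_sub_cancel, hsc, hpc]; simp)
    (by
      intro hX
      rw [hq0n] at hX
      apply hqi
      rw [← hq0c, hX, Polynomial.coeff_X_pow, if_neg hi.1.ne])
  obtain ⟨a, b, hab, hda, hdb⟩ := exists_hensel_factors hqm hq0 hg hh hco
    (fun i => by rw [← hgh, hq0c])
  have hsum : g.natDegree + h.natDegree = n + 1 := by
    rw [← hq0n, hgh, hg.natDegree_mul hh]
  have ha0 : a ≠ 0 := by rintro rfl; exact hqm.ne_zero (by simp [hab])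
  obtain ⟨z, hz⟩ := ih (g.natDegree - 1) (by omega) (a * Polynomial.C a.leadingCoeff⁻¹)
    (Polynomial.monic_mul_leadingCoeff_inv ha0)
    (by rw [Polynomial.natDegree_mul_leadingCoeff_inv a ha0, hda]; omega)
  refine ⟨z, ?_⟩
  rw [Polynomial.eval_mul, Polynomial.eval_C] at hz
  have := (mul_eq_zero.1 hz).resolve_right (by simpa using ha0)
  rw [hab, Polynomial.eval_mul, this, zero_mul]

instance [IsAlgClosed F] [CharZero F] : IsAlgClosed (Hahn F) :=
  IsAlgClosed.of_exists_root _ fun p hp hirr => by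
    obtain ⟨z, hz⟩ := exists_root_of_monic (p.natDegree - 1) p hp
      (by have := hirr.natDegree_pos; omega)
    exact ⟨z, hz⟩

end AlgClosed

section Partial

variable (A : Type*) [CommRing A]

/-- The derivative with respect to the outer variable. -/
noncomputable def dY : Derivation A A[X][X] A[X][X] :=
  Derivation.mk' ((Polynomial.derivative : A[X][X] →ₗ[A[X]] A[X][X]).restrictScalars A)
    fun a b => by
      simp only [LinearMap.coe_restrictScalars, Polynomial.derivative_mul, smul_eq_mul]; ring

/-- The derivative with respect to the inner variable. -/
noncomputable def dX : Derivation A A[X][X] A[X][X] :=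
  Derivation.mk' ((Polynomial.Bivariate.swap (R := A)).symm.toLinearMap ∘ₗ
    (dY A : A[X][X] →ₗ[A] A[X][X]) ∘ₗ (Polynomial.Bivariate.swap (R := A)).toLinearMap)
    fun a b => by
      change Polynomial.Bivariate.swap.symm (dY A (Polynomial.Bivariate.swap (a * b))) =
        a • Polynomial.Bivariate.swap.symm (dY A (Polynomial.Bivariate.swap b)) +
          b • Polynomial.Bivariate.swap.symm (dY A (Polynomial.Bivariate.swap a))
      simp only [map_mul, Derivation.leibniz, map_add, smul_eq_mul, AlgEquiv.symm_apply_apply]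

variable {A}

theorem dY_apply (p : A[X][X]) : dY A p = Polynomial.derivative p := rfl

theorem dX_apply (p : A[X][X]) : dX A p = Polynomial.Bivariate.swap.symm
    (Polynomial.derivative (Polynomial.Bivariate.swap p)) := rfl

@[simp] theorem dY_C (p : A[X]) : dY A (Polynomial.C p) = 0 := by simp [dY_apply]

@[simp] theorem dY_X : dY A (Polynomial.X) = 1 := by simp [dY_apply]

@[simp] theorem dX_C (p : A[X]) : dX A (Polynomial.C p) = Polynomial.C (Polynomial.derivative p) := by
  rw [dX_apply, Polynomial.Bivariate.swap_C, Polynomial.derivative_map,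
    AlgEquiv.symm_apply_eq, Polynomial.Bivariate.swap_C]

@[simp] theorem dX_X : dX A (Polynomial.X) = 0 := by
  rw [dX_apply, Polynomial.Bivariate.swap_Y]; simp

/-- The Jacobian determinant. -/
noncomputable def jac (a b : A[X][X]) : A[X][X] := dX A a * dY A b - dY A a * dX A b

theorem jac_mul (a b c : A[X][X]) : jac a (b * c) = b * jac a c + c * jac a b := by
  simp only [jac, Derivation.leibniz, smul_eq_mul]; ring

theorem jac_add (a b c : A[X][X]) : jac a (b + c) = jac a b + jac a c := by
  simp only [jac, map_add]; ring

theorem jac_sub (a b c : A[X][X]) : jac a (b - c) = jac a b - jac a c := by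
  simp only [jac, map_sub]; ring

theorem jac_self (a : A[X][X]) : jac a a = 0 := by simp only [jac]; ring

theorem jac_swap (a b : A[X][X]) : jac a b = - jac b a := by simp only [jac]; ring

theorem jac_aeval (a b : A[X][X]) (p : A[X]) :
    jac a (Polynomial.aeval b p) = Polynomial.aeval b (Polynomial.derivative p) * jac a b := by
  have h (D : Derivation A A[X][X] A[X][X]) : D (Polynomial.aeval b p) =
      Polynomial.aeval b (Polynomial.derivative p) * D b := by
    rw [Derivation.map_aeval, smul_eq_mul]
  simp only [jac, h]; ring

theorem jac_C_C (a : A[X][X]) (c : A) : jac a (Polynomial.C (Polynomial.C c)) = 0 := by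
  simp [jac]

end Partial

section Evaluation

variable {A S : Type*} [CommRing A] [CommRing S] [Algebra A S]

/-- The element `x` of the field of Hahn series in `x⁻¹`. -/
noncomputable def hx (S : Type*) [CommRing S] : Hahn S := HahnSeries.single (-1) 1

/-- Evaluation of polynomials in `x`. -/
noncomputable def xmap (A S : Type*) [CommRing A] [CommRing S] [Algebra A S] :
    A[X] →+* Hahn S :=
  Polynomial.eval₂RingHom (HahnSeries.C.comp (algebraMap A S)) (hx S)

@[simp] theorem xmap_C (a : A) : xmap A S (Polynomial.C a) = HahnSeries.C (algebraMap A S a) := by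
  simp [xmap]

@[simp] theorem xmap_X : xmap A S Polynomial.X = hx S := by simp [xmap]

/-- Substitution of a Hahn series in `x⁻¹` for the outer variable. -/
noncomputable def ev (η : Hahn S) : A[X][X] →+* Hahn S :=
  Polynomial.eval₂RingHom (xmap A S) η

theorem ev_C (η : Hahn S) (p : A[X]) : ev η (Polynomial.C p) = xmap A S p := by simp [ev]

@[simp] theorem ev_C_C (η : Hahn S) (a : A) :
    ev η (Polynomial.C (Polynomial.C a)) = HahnSeries.C (algebraMap A S a) := by simp [ev]

@[simp] theorem ev_C_X (η : Hahn S) : ev η (Polynomial.C (Polynomial.X : A[X])) = hx S := by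
  simp [ev]

@[simp] theorem ev_X (η : Hahn S) : ev η (Polynomial.X : A[X][X]) = η := by simp [ev]

theorem ev_eq_eval (η : Hahn S) (p : A[X][X]) : ev η p = (p.map (xmap A S)).eval η := by
  rw [Polynomial.eval_map]; rfl

/-- Ring homomorphisms out of `A[X][X]` agree if they agree on the generators. -/
theorem ringHom_ext₂ {B : Type*} [CommRing B] {f g : A[X][X] →+* B}
    (hC : ∀ a, f (Polynomial.C (Polynomial.C a)) = g (Polynomial.C (Polynomial.C a)))
    (hX : f (Polynomial.C Polynomial.X) = g (Polynomial.C Polynomial.X))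
    (hY : f Polynomial.X = g Polynomial.X) : f = g := by
  refine Polynomial.ringHom_ext (fun p => ?_) hY
  have : f.comp Polynomial.C = g.comp Polynomial.C :=
    Polynomial.ringHom_ext hC hX
  exact RingHom.congr_fun this p

@[simp] theorem hmap_hx {S' : Type*} [CommRing S'] (f : S →+* S') : hmap f (hx S) = hx S' := by
  simp [hx, hmap_single]

theorem hmap_ev {S' : Type*} [CommRing S'] [Algebra A S'] (f : S →ₐ[A] S') (η : Hahn S)
    (p : A[X][X]) : hmap (f : S →+* S') (ev η p) = ev (hmap (f : S →+* S') η) p := by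
  have : (hmap (f : S →+* S')).comp (ev (A := A) η) = ev (hmap (f : S →+* S') η) :=
    ringHom_ext₂ (fun a => by simp) (by simp) (by simp)
  exact RingHom.congr_fun this p

theorem ev_map {A' : Type*} [CommRing A'] [Algebra A' S] (f : A →+* A')
    (hf : ∀ a, algebraMap A' S (f a) = algebraMap A S a) (η : Hahn S) (p : A[X][X]) :
    ev η (p.map (Polynomial.mapRingHom f)) = ev η p := by
  have : (ev η).comp (Polynomial.mapRingHom (Polynomial.mapRingHom f)) = ev (A := A) η :=
    ringHom_ext₂ (fun a => by simp [hf]) (by simp) (by simp)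
  exact RingHom.congr_fun this p

theorem hx_ord [Nontrivial S] : Ord (-1) (hx S) := ord_single one_ne_zero

theorem hx_pow (n : ℕ) : hx S ^ n = HahnSeries.single (-(n : ℚ)) 1 := by
  induction n with
  | zero => simp
  | succ n ih =>
    rw [pow_succ, ih, hx, HahnSeries.single_mul_single, one_mul]; congr 1; push_cast; ring_nf

theorem xmap_coeff (p : A[X]) (n : ℕ) : (xmap A S p).coeff (-(n : ℚ)) = algebraMap A S (p.coeff n) := by
  induction p using Polynomial.induction_on' with
  | add p q hp hq => simp [hp, hq]
  | monomial k a =>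
    rw [← Polynomial.C_mul_X_pow_eq_monomial, map_mul, map_pow, xmap_C, xmap_X, hx_pow,
      HahnSeries.C_mul_eq_smul, HahnSeries.coeff_smul, smul_eq_mul, Polynomial.coeff_C_mul_X_pow]
    by_cases h : n = k
    · simp [h]
    · rw [HahnSeries.coeff_single_of_ne (by simpa using h), if_neg h]; simp

theorem xmap_coeff_of_ne (p : A[X]) (q : ℚ) (hq : ∀ n : ℕ, q ≠ -n) : (xmap A S p).coeff q = 0 := by
  induction p using Polynomial.induction_on' with
  | add p q hp hq => simp [hp, hq]
  | monomial k a =>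
    rw [← Polynomial.C_mul_X_pow_eq_monomial, map_mul, map_pow, xmap_C, xmap_X, hx_pow,
      HahnSeries.C_mul_eq_smul, HahnSeries.coeff_smul, HahnSeries.coeff_single_of_ne (hq k),
      smul_zero]

theorem xmap_lge (p : A[X]) : Lge (-(p.natDegree : ℚ)) (xmap A S p) := fun q hq => by
  by_cases h : ∃ n : ℕ, q = -n
  · obtain ⟨n, rfl⟩ := h
    rw [xmap_coeff, Polynomial.coeff_eq_zero_of_natDegree_lt, map_zero]
    have : (p.natDegree : ℚ) < n := by linarith
    exact_mod_cast this
  · push Not at h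
    exact xmap_coeff_of_ne p q h

theorem xmap_injective (h : Function.Injective (algebraMap A S)) :
    Function.Injective (xmap A S) := fun p q hpq => by
  ext n
  apply h
  rw [← xmap_coeff, ← xmap_coeff, hpq]

/-- The chain rule. -/
theorem chain_rule (η : Hahn S) (δ : Hahn S →+ Hahn S)
    (hδ : ∀ a b, δ (a * b) = a * δ b + b * δ a)
    (hA : ∀ a : A, δ (HahnSeries.C (algebraMap A S a)) = 0) (p : A[X][X]) :
    δ (ev η p) = ev η (dX A p) * δ (hx S) + ev η (dY A p) * δ η := by
  induction p using Polynomial.induction_on with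
  | add p q hp hq => simp only [map_add, hp, hq]; ring
  | C a =>
    induction a using Polynomial.induction_on with
    | add p q hp hq => simp only [map_add, hp, hq]; ring
    | C a =>
      rw [ev_C_C, hA, dX_C, dY_C, Polynomial.derivative_C, Polynomial.C_0, map_zero]; ring
    | monomial n a ih =>
      rw [pow_succ, ← mul_assoc, Polynomial.C_mul, map_mul, hδ, ih]
      simp only [Derivation.leibniz, dX_C, dY_C, Polynomial.derivative_X, smul_eq_mul, map_mul,
        map_add, map_zero, mul_zero, ev_C_X, map_one]
      ring
  | monomial n a ih =>
    rw [pow_succ, ← mul_assoc, map_mul, hδ, ih]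
    simp only [Derivation.leibniz, dX_X, dY_X, smul_eq_mul, map_mul, map_add, mul_zero, ev_X,
      mul_one, zero_add]
    ring

theorem chain_jac (η : Hahn S) {δ₁ δ₂ : Hahn S →+ Hahn S}
    (h₁ : ∀ a b, δ₁ (a * b) = a * δ₁ b + b * δ₁ a) (hA₁ : ∀ a : A, δ₁ (HahnSeries.C (algebraMap A S a)) = 0)
    (h₂ : ∀ a b, δ₂ (a * b) = a * δ₂ b + b * δ₂ a) (hA₂ : ∀ a : A, δ₂ (HahnSeries.C (algebraMap A S a)) = 0)
    (a b : A[X][X]) :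
    δ₁ (ev η a) * δ₂ (ev η b) - δ₂ (ev η a) * δ₁ (ev η b) =
      ev η (jac a b) * (δ₁ (hx S) * δ₂ η - δ₂ (hx S) * δ₁ η) := by
  rw [chain_rule η δ₁ h₁ hA₁, chain_rule η δ₁ h₁ hA₁, chain_rule η δ₂ h₂ hA₂,
    chain_rule η δ₂ h₂ hA₂, jac, map_sub, map_mul, map_mul]
  ring

end Evaluation

section Theta

variable {S : Type*} [CommRing S] [Algebra ℂ S]

@[simp] theorem theta_hx : theta (hx S) = hx S := by
  rw [hx, theta_single]; simp

theorem dmap_hx (d : Derivation ℂ S S) : dmap d (hx S) = 0 := by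
  rw [hx, dmap_single]; simp

theorem dmap_C (d : Derivation ℂ S S) (s : S) :
    dmap d (HahnSeries.C s) = HahnSeries.C (d s) := dmap_single d 0 s

theorem theta_chain (η : Hahn S) (p : ℂ[X][X]) :
    theta (ev η p) = ev η (dX ℂ p) * hx S + ev η (dY ℂ p) * theta η := by
  rw [chain_rule (A := ℂ) η theta theta_mul fun a => theta_C _, theta_hx]

/-- On a branch of a level curve of `P`, the derivative of `b` along the branch is the Jacobian. -/
theorem level_theta {η : Hahn S} {P : ℂ[X][X]} (hP : theta (ev η P) = 0) (b : ℂ[X][X]) :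
    ev η (dY ℂ P) * theta (ev η b) = - hx S * ev η (jac P b) := by
  have h1 := theta_chain η P
  have h2 := theta_chain η b
  rw [hP] at h1
  rw [h2, jac, map_sub, map_mul, map_mul]
  linear_combination - ev η (dY ℂ b) * h1

theorem level_jac [IsDomain S] {η : Hahn S} {P Q : ℂ[X][X]} {c₀ : ℂ} (hc₀ : c₀ ≠ 0)
    (hJ : jac P Q = Polynomial.C (Polynomial.C c₀)) (hP : theta (ev η P) = 0) (b : ℂ[X][X]) :
    ev η (jac P b) * theta (ev η Q) = HahnSeries.C (algebraMap ℂ S c₀) * theta (ev η b) := by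
  have h1 := level_theta hP Q
  have h2 := level_theta hP b
  rw [hJ, ev_C_C] at h1
  have hne : ev η (dY ℂ P) ≠ 0 := by
    intro h
    rw [h, zero_mul, eq_comm, neg_mul, neg_eq_zero] at h1
    refine (mul_ne_zero hx_ord.ne_zero ?_) h1
    exact (ord_C ((map_ne_zero_iff _ (algebraMap ℂ S).injective).2 hc₀)).ne_zero
  apply mul_left_cancel₀ hne
  linear_combination ev η (jac P b) * h1 - HahnSeries.C (algebraMap ℂ S c₀) * h2

theorem level_dY_ne_zero [IsDomain S] {η : Hahn S} {P Q : ℂ[X][X]} {c₀ : ℂ} (hc₀ : c₀ ≠ 0)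
    (hJ : jac P Q = Polynomial.C (Polynomial.C c₀)) (hP : theta (ev η P) = 0) :
    ev η (dY ℂ P) ≠ 0 := by
  have h1 := level_theta hP Q
  rw [hJ, ev_C_C] at h1
  intro h
  rw [h, zero_mul, eq_comm, neg_mul, neg_eq_zero] at h1
  refine (mul_ne_zero hx_ord.ne_zero ?_) h1
  exact (ord_C ((map_ne_zero_iff _ (algebraMap ℂ S).injective).2 hc₀)).ne_zero

/-- The Jacobian with respect to a coefficientwise derivation and `theta`. -/
theorem dmap_theta_jac (d : Derivation ℂ S S) (η : Hahn S) (a b : ℂ[X][X]) :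
    dmap d (ev η a) * theta (ev η b) - theta (ev η a) * dmap d (ev η b) =
      - ev η (jac a b) * hx S * dmap d η := by
  rw [chain_jac (A := ℂ) η (dmap_mul d) (fun a => by
      rw [dmap_C, d.map_algebraMap, map_zero]) theta_mul fun a => theta_C _]
  rw [dmap_hx, theta_hx]; ring

/-- Leading coefficients in the Jacobian identity. -/
theorem leading_jac (d : Derivation ℂ S S) {η : Hahn S} {a b : ℂ[X][X]} {p q : ℚ}
    (ha : Lge p (ev η a)) (hb : Lge q (ev η b)) :
    (- ev η (jac a b) * hx S * dmap d η).coeff (p + q) =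
      -(q : ℂ) • (d ((ev η a).coeff p) * (ev η b).coeff q) +
        (p : ℂ) • ((ev η a).coeff p * d ((ev η b).coeff q)) := by
  rw [← dmap_theta_jac, HahnSeries.coeff_sub, (ha.dmap d).coeff_mul hb.theta,
    ha.theta.coeff_mul (hb.dmap d), theta_coeff, theta_coeff, dmap_coeff, dmap_coeff,
    smul_mul_assoc, mul_smul_comm, neg_smul, neg_smul]
  abel

end Theta

section Disc

variable {S : Type*} [CommRing S]

theorem lge_polySwap_iff {r : ℚ} {p : (Hahn S)[X]} :
    Lge r (polySwap S p) ↔ ∀ i, Lge r (p.coeff i) := by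
  refine ⟨fun h i q hq => by rw [← polySwap_coeff, h q hq]; rfl, fun h q hq => ?_⟩
  ext i
  rw [polySwap_coeff, h i q hq]; rfl

theorem Lge.eval {r : ℚ} {p : (Hahn S)[X]} (hp : Lge r (polySwap S p))
    {h : Hahn S} (hh : Lge 0 h) :
    Lge r (p.eval h) ∧
      (p.eval h).coeff r = ((polySwap S p).coeff r).eval (h.coeff 0) := by
  have hp' := lge_polySwap_iff.1 hp
  have hterm (i : ℕ) : Lge r (p.coeff i * h ^ i) :=
    ((hp' i).mul (hh.pow₀ i)).mono (by simp)
  refine ⟨by rw [Polynomial.eval_eq_sum_range]; exact Lge.sum fun i _ => hterm i, ?_⟩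
  have hd : ((polySwap S p).coeff r).natDegree ≤ p.natDegree :=
    Polynomial.natDegree_le_iff_coeff_eq_zero.2 fun i hi => by
      rw [polySwap_coeff, Polynomial.coeff_eq_zero_of_natDegree_lt hi]; rfl
  rw [Polynomial.eval_eq_sum_range, Polynomial.eval_eq_sum_range' (Nat.lt_succ_of_le hd),
    HahnSeries.coeff_sum]
  refine Finset.sum_congr rfl fun i _ => ?_
  have h1 := Lge.coeff_mul (hp' i) (hh.pow₀ i)
  have h2 := hh.coeff_pow i
  simp only [add_zero, mul_zero] at h1 h2
  rw [h1, h2, polySwap_coeff]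

/-- The disc of radius `r` around `η`, as a series with a free parameter. -/
noncomputable def disc (η : Hahn S) (r : ℚ) : Hahn S[X] :=
  hmap Polynomial.C η + HahnSeries.single (-r) Polynomial.X

theorem disc_shift (η h : Hahn S) (r : ℚ) :
    disc (η + HahnSeries.single (-r) 1 * h) r =
      hmap Polynomial.C η + HahnSeries.single (-r) 1 *
        (hmap Polynomial.C h + HahnSeries.C Polynomial.X) := by
  rw [disc, map_add, map_mul, hmap_single, map_one, mul_add, add_assoc]
  rw [HahnSeries.C_apply, HahnSeries.single_mul_single, one_mul, add_zero]

variable [Algebra ℂ S]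

/-- The Taylor polynomial of `b` on a disc. -/
noncomputable def tay (η : Hahn S) (r : ℚ) (b : ℂ[X][X]) : (Hahn S)[X] :=
  (b.map (xmap ℂ S)).comp
    (Polynomial.C η + Polynomial.C (HahnSeries.single (-r) 1) * Polynomial.X)

theorem tay_eval (η : Hahn S) (r : ℚ) (b : ℂ[X][X]) (h : Hahn S) :
    (tay η r b).eval h = ev (η + HahnSeries.single (-r) 1 * h) b := by
  simp [tay, Polynomial.eval_comp, ev_eq_eval]

theorem polySwap_tay (η : Hahn S) (r : ℚ) (b : ℂ[X][X]) :
    polySwap S (tay η r b) = ev (disc η r) b := by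
  have hC (a : Hahn S) : polySwap S (Polynomial.C a) = hmap Polynomial.C a := by
    simp [polySwap]
  have : ((polySwap S).comp ((Polynomial.compRingHom (Polynomial.C η +
      Polynomial.C (HahnSeries.single (-r) 1) * Polynomial.X)).comp
      (Polynomial.mapRingHom (xmap ℂ S)))) = ev (disc η r) := by
    refine ringHom_ext₂ (fun a => ?_) ?_ ?_
    · simp [hC, hmap_C, -HahnSeries.C_apply]
    · simp [hC]
    · simp only [RingHom.comp_apply, Polynomial.coe_mapRingHom, Polynomial.map_X,
        Polynomial.coe_compRingHom, Polynomial.X_comp, map_add, map_mul, hC, ev_X, disc,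
        hmap_single, map_one]
      rw [polySwap, Polynomial.coe_eval₂RingHom, Polynomial.eval₂_X, HahnSeries.C_apply,
        HahnSeries.single_mul_single, one_mul, add_zero]
  exact RingHom.congr_fun this b

theorem disc_subst {η : Hahn S} {r p : ℚ} {b : ℂ[X][X]} (hb : Lge p (ev (disc η r) b))
    {h : Hahn S} (hh : Lge 0 h) :
    Lge p (ev (η + HahnSeries.single (-r) 1 * h) b) ∧
      (ev (η + HahnSeries.single (-r) 1 * h) b).coeff p =
        ((ev (disc η r) b).coeff p).eval (h.coeff 0) := by
  rw [← tay_eval, ← polySwap_tay]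
  rw [← polySwap_tay] at hb
  exact hb.eval hh

theorem disc_subst_zero {η : Hahn S} {r p : ℚ} {b : ℂ[X][X]} (hb : Lge p (ev (disc η r) b)) :
    Lge p (ev η b) ∧ (ev η b).coeff p = ((ev (disc η r) b).coeff p).coeff 0 := by
  have := disc_subst hb (lge_zero 0)
  rwa [mul_zero, add_zero, HahnSeries.coeff_zero, ← Polynomial.coeff_zero_eq_eval_zero] at this

theorem hmap_disc {S' : Type*} [CommRing S'] [Algebra ℂ S'] (f : S →ₐ[ℂ] S') (η : Hahn S) (r : ℚ) :
    hmap ((Polynomial.mapAlgHom f : S[X] →ₐ[ℂ] S'[X]) : S[X] →+* S'[X]) (disc η r) =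
      disc (hmap (f : S →+* S') η) r := by
  rw [disc, map_add, hmap_single, disc, hmap_hmap, hmap_hmap]
  congr 2
  · congr 1
    ext a; simp
  · simp

theorem ev_disc_shift {η h : Hahn S} {r p : ℚ} {b : ℂ[X][X]} (hb : Lge p (ev (disc η r) b))
    (hh : Lge 0 h) :
    Lge p (ev (disc (η + HahnSeries.single (-r) 1 * h) r) b) ∧
      (ev (disc (η + HahnSeries.single (-r) 1 * h) r) b).coeff p =
        ((ev (disc η r) b).coeff p).comp (Polynomial.X + Polynomial.C (h.coeff 0)) := by
  let φ : S →ₐ[ℂ] S[X] := Polynomial.CAlgHom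
  have h1 : disc (hmap (φ : S →+* S[X]) η) r =
      hmap ((Polynomial.mapAlgHom φ : S[X] →ₐ[ℂ] S[X][X]) : S[X] →+* S[X][X]) (disc η r) :=
    (hmap_disc φ η r).symm
  have h2 : Lge p (ev (disc (hmap (φ : S →+* S[X]) η) r) b) := by
    rw [h1, ← hmap_ev]; exact hb.hmap _
  have h3 := disc_subst h2 (h := hmap Polynomial.C h + HahnSeries.C Polynomial.X)
    ((hh.hmap _).add (lge_C _))
  rw [disc_shift]
  refine ⟨h3.1, h3.2.trans ?_⟩
  rw [h1, ← hmap_ev, hmap_coeff, HahnSeries.coeff_add, hmap_coeff, HahnSeries.C_apply,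
    HahnSeries.coeff_single_same]
  change Polynomial.eval _ (Polynomial.map _ _) = _
  rw [Polynomial.eval_map, add_comm]
  rfl

end Disc

/-- A Keller pair, with the first polynomial monic in the second variable. -/
structure Keller (P Q : ℂ[X][X]) (c₀ : ℂ) : Prop where
  jac_eq : jac P Q = Polynomial.C (Polynomial.C c₀)
  ne_zero : c₀ ≠ 0
  monic : P.Monic

/-- The behaviour of a Keller pair on the disc around a branch along which `Q` is unbounded. -/
structure TypeI (P Q : ℂ[X][X]) {S : Type*} [CommRing S] [Algebra ℂ S] (η : Hahn S) (c : S)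
    (β : ℚ) (f g : S) : Prop where
  pos : 0 < β
  unit_f : IsUnit f
  unit_g : IsUnit g
  lge_P : Lge 0 (ev (disc η (β - 1)) P)
  coeff_P : (ev (disc η (β - 1)) P).coeff 0 = Polynomial.C c + Polynomial.C f * Polynomial.X
  lge_Q : Lge (-β) (ev (disc η (β - 1)) Q)
  coeff_Q : (ev (disc η (β - 1)) Q).coeff (-β) = Polynomial.C g

namespace TypeI

variable {P Q : ℂ[X][X]} {S : Type*} [CommRing S] [Algebra ℂ S] {η : Hahn S} {c : S}
    {β : ℚ} {f g : S}

theorem map (h : TypeI P Q η c β f g) {S' : Type*} [CommRing S'] [Algebra ℂ S']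
    (φ : S →ₐ[ℂ] S') : TypeI P Q (hmap (φ : S →+* S') η) (φ c) β (φ f) (φ g) where
  pos := h.pos
  unit_f := h.unit_f.map φ
  unit_g := h.unit_g.map φ
  lge_P := by rw [← hmap_disc, ← hmap_ev]; exact h.lge_P.hmap _
  coeff_P := by
    rw [← hmap_disc, ← hmap_ev, hmap_coeff, h.coeff_P]; simp
  lge_Q := by rw [← hmap_disc, ← hmap_ev]; exact h.lge_Q.hmap _
  coeff_Q := by
    rw [← hmap_disc, ← hmap_ev, hmap_coeff, h.coeff_Q]; simp

theorem Q_at (h : TypeI P Q η c β f g) {z : Hahn S} (hz : Lge 0 z) :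
    Lge (-β) (ev (η + HahnSeries.single (1 - β) 1 * z) Q) ∧
      (ev (η + HahnSeries.single (1 - β) 1 * z) Q).coeff (-β) = g := by
  have := disc_subst h.lge_Q hz
  rw [neg_sub, h.coeff_Q, Polynomial.eval_C] at this
  exact this

theorem P_at (h : TypeI P Q η c β f g) {z : Hahn S} (hz : Lge 0 z) :
    (ev (η + HahnSeries.single (1 - β) 1 * z) P).coeff 0 = c + f * z.coeff 0 := by
  have := disc_subst h.lge_P hz
  rw [neg_sub, h.coeff_P] at this
  simpa using this.2

theorem Q_self (h : TypeI P Q η c β f g) :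
    Lge (-β) (ev η Q) ∧ (ev η Q).coeff (-β) = g := by
  simpa using h.Q_at (lge_zero 0)

theorem tay_props (h : TypeI P Q η c β f g) (s : S) :
    let p := tay η (β - 1) P - Polynomial.C (HahnSeries.C s)
    (∀ i, Lge 0 (p.coeff i)) ∧ (∀ i, 2 ≤ i → (p.coeff i).coeff 0 = 0) ∧
      (p.coeff 1).coeff 0 = f ∧ (p.coeff 0).coeff 0 = c - s := by
  have hc (i : ℕ) : (polySwap S (tay η (β - 1) P)).coeff 0 =
    Polynomial.C c + Polynomial.C f * Polynomial.X := by rw [polySwap_tay, h.coeff_P]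
  refine ⟨?_, fun i hi => ?_, ?_, ?_⟩
  · rw [← lge_polySwap_iff, map_sub, polySwap_tay]
    refine h.lge_P.sub ?_
    rw [lge_polySwap_iff]
    intro i
    rw [Polynomial.coeff_C]
    split_ifs
    exacts [lge_C s, lge_zero 0]
  · rw [← polySwap_coeff, map_sub, HahnSeries.coeff_sub, hc i, Polynomial.coeff_sub,
      polySwap_coeff, Polynomial.coeff_C_of_ne_zero (by omega : i ≠ 0), Polynomial.coeff_add,
      Polynomial.coeff_C_of_ne_zero (by omega : i ≠ 0), Polynomial.coeff_C_mul,
      Polynomial.coeff_X_of_ne_one (by omega)]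
    simp
  · rw [← polySwap_coeff, map_sub, HahnSeries.coeff_sub, hc 1, Polynomial.coeff_sub,
      polySwap_coeff]
    simp [Polynomial.coeff_C]
  · rw [← polySwap_coeff, map_sub, HahnSeries.coeff_sub, hc 1, Polynomial.coeff_sub,
      polySwap_coeff]
    simp [Polynomial.coeff_C]

theorem exists_root (h : TypeI P Q η c β f g) (s : S) :
    ∃ z : Hahn S, Lge 0 z ∧ ev (η + HahnSeries.single (1 - β) 1 * z) P = HahnSeries.C s := by
  obtain ⟨h1, h2, h3, h4⟩ := h.tay_props s
  obtain ⟨a, ha⟩ := h.unit_f.exists_left_inv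
  obtain ⟨z, hz, hroot, -⟩ := exists_simple_root h1 h2 (a := a) (by rw [h3]; exact ha)
  refine ⟨z, hz, ?_⟩
  rw [Polynomial.eval_sub, tay_eval, Polynomial.eval_C, sub_eq_zero, neg_sub] at hroot
  exact hroot

theorem root_unique (h : TypeI P Q η c β f g) {z z' : Hahn S} (hz : Lge 0 z) (hz' : Lge 0 z')
    (hzz : ev (η + HahnSeries.single (1 - β) 1 * z) P =
      ev (η + HahnSeries.single (1 - β) 1 * z') P) : z = z' := by
  obtain ⟨h1, h2, h3, h4⟩ := h.tay_props 0
  obtain ⟨e, he, he0, heq⟩ := exists_divided_difference h1 h2 hz hz'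
  rw [Polynomial.eval_sub, Polynomial.eval_sub, tay_eval, tay_eval, Polynomial.eval_C, Polynomial.eval_C,
    neg_sub, hzz, sub_self,
    eq_comm] at heq
  by_contra hne
  obtain ⟨p, hp⟩ := exists_ord (sub_ne_zero.2 hne)
  have := hp.1.coeff_mul he
  rw [heq, he0, h3, HahnSeries.coeff_zero, eq_comm, h.unit_f.mul_left_eq_zero] at this
  exact hp.2 this

end TypeI

section DiscJac

variable {S : Type*} [CommRing S] [Algebra ℂ S]

/-- The Jacobian identity for the leading forms on a disc. -/
theorem disc_jac {η : Hahn S} {r p q : ℚ} {a b : ℂ[X][X]} (ha : Lge p (ev (disc η r) a))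
    (hb : Lge q (ev (disc η r) b)) :
    (ev (disc η r) (jac a b)).coeff (p + q + 1 + r) =
      (q : ℂ) • (Polynomial.derivative ((ev (disc η r) a).coeff p) * (ev (disc η r) b).coeff q) -
        (p : ℂ) • ((ev (disc η r) a).coeff p *
          Polynomial.derivative ((ev (disc η r) b).coeff q)) := by
  have h := leading_jac (Derivation.restrictScalars ℂ
    (Polynomial.derivative' : Derivation S S[X] S[X])) ha hb
  have hd : dmap (Derivation.restrictScalars ℂ
      (Polynomial.derivative' : Derivation S S[X] S[X])) (disc η r) =
      HahnSeries.single (-r) 1 := by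
    rw [disc, map_add, dmap_single]
    have : dmap (Derivation.restrictScalars ℂ
      (Polynomial.derivative' : Derivation S S[X] S[X])) (hmap Polynomial.C η) = 0 := by
      ext q : 2
      rw [dmap_coeff, hmap_coeff]
      exact Polynomial.derivative_C
    rw [this, zero_add]
    congr 1
    exact Polynomial.derivative_X
  rw [hd, mul_assoc, hx, HahnSeries.single_mul_single, one_mul,
    show p + q = (p + q + 1 + r) + (-1 + -r) by ring, HahnSeries.coeff_mul_single_add, mul_one,
    HahnSeries.coeff_neg] at h
  rw [neg_eq_iff_eq_neg.1 h, neg_add, ← neg_smul, neg_neg, ← sub_eq_add_neg]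
  rfl

end DiscJac

variable {F : Type*} [Field F] [Algebra ℂ F] {P Q : ℂ[X][X]} {c₀ : ℂ}

theorem natDegree_tay (hP : P.Monic) (η : Hahn F) (r : ℚ) :
    (tay η r P).coeff P.natDegree = HahnSeries.single (-(P.natDegree * r)) 1 := by
  have h1 : (Polynomial.C η + Polynomial.C (HahnSeries.single (-r) (1 : F)) *
      Polynomial.X : (Hahn F)[X]).natDegree = 1 := by
    rw [add_comm]
    exact Polynomial.natDegree_linear (ord_single one_ne_zero).ne_zero
  have h2 : (P.map (xmap ℂ F)).natDegree = P.natDegree := hP.natDegree_map _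
  have h3 := Polynomial.coeff_comp_degree_mul_degree (p := P.map (xmap ℂ F))
    (q := (Polynomial.C η + Polynomial.C (HahnSeries.single (-r) (1 : F)) *
      Polynomial.X : (Hahn F)[X])) (by rw [h1]; exact one_ne_zero)
  rw [h1, mul_one, h2, (hP.map _).leadingCoeff, one_mul, Polynomial.leadingCoeff, h1] at h3
  rw [tay, h3]
  simp only [Polynomial.coeff_add, Polynomial.coeff_C_succ, Polynomial.coeff_C_mul,
    Polynomial.coeff_X_one, zero_add, mul_one]
  rw [HahnSeries.single_pow, one_pow, smul_neg, nsmul_eq_mul]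

theorem tay_coeff (η : Hahn F) (r : ℚ) (b : ℂ[X][X]) (i : ℕ) :
    (tay η r b).coeff i = (tay η 0 b).coeff i * HahnSeries.single (-(i * r)) 1 := by
  have : tay η r b = (tay η 0 b).comp
      (Polynomial.C (HahnSeries.single (-r) 1) * Polynomial.X) := by
    rw [tay, tay, Polynomial.comp_assoc]
    congr 1
    simp
  rw [this, Polynomial.comp_C_mul_X_coeff, HahnSeries.single_pow, one_pow, smul_neg,
    nsmul_eq_mul]

theorem Keller.natDegree_pos (h : Keller P Q c₀) : 0 < P.natDegree := by
  rw [Nat.pos_iff_ne_zero]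
  intro h0
  have hP : P = 1 := h.monic.natDegree_eq_zero.1 h0
  have := h.jac_eq
  rw [hP, jac, Derivation.map_one_eq_zero, Derivation.map_one_eq_zero, zero_mul, zero_mul, sub_zero, eq_comm,
    Polynomial.C_eq_zero, Polynomial.C_eq_zero] at this
  exact h.ne_zero this

theorem Keller.exists_typeI (hK : Keller P Q c₀) {η : Hahn F} {c : F}
    (hη : ev η P = HahnSeries.C c) (hQ : ¬ Lge 0 (ev η Q)) :
    ∃ β f g, TypeI P Q η c β f g := by
  classical
  have : CharZero F := charZero_of_injective_algebraMap (algebraMap ℂ F).injective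
  have hex (i : ℕ) : ∃ p : ℚ, (tay η 0 P).coeff i ≠ 0 → Ord p ((tay η 0 P).coeff i) := by
    by_cases h : (tay η 0 P).coeff i = 0
    · exact ⟨0, fun h' => (h' h).elim⟩
    · obtain ⟨p, hp⟩ := exists_ord h
      exact ⟨p, fun _ => hp⟩
  choose o ho using hex
  obtain ⟨i₀, hi₀, hmin⟩ := Finset.exists_min_image
    (((tay η 0 P).support).erase 0) (fun i => o i / i) (by
      refine ⟨P.natDegree, Finset.mem_erase.2 ⟨hK.natDegree_pos.ne', ?_⟩⟩
      rw [Polynomial.mem_support_iff, natDegree_tay hK.monic]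
      exact (ord_single one_ne_zero).ne_zero)
  simp only [Finset.mem_erase, Polynomial.mem_support_iff] at hi₀ hmin
  obtain ⟨ρ, hρ⟩ : ∃ ρ, ρ = o i₀ / i₀ := ⟨_, rfl⟩
  have hi₀' : (i₀ : ℚ) ≠ 0 := Nat.cast_ne_zero.2 hi₀.1
  have hc0 : (tay η ρ P).coeff 0 = HahnSeries.C c := by
    rw [Polynomial.coeff_zero_eq_eval_zero, tay_eval, mul_zero, add_zero, hη]
  have hP0 : Lge 0 (ev (disc η ρ) P) := by
    rw [← polySwap_tay, lge_polySwap_iff]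
    intro i
    rcases eq_or_ne i 0 with rfl | hi
    · rw [hc0]; exact lge_C c
    by_cases hz : (tay η 0 P).coeff i = 0
    · rw [tay_coeff, hz, zero_mul]; exact lge_zero 0
    rw [tay_coeff]
    refine ((ho i hz).lge.mul (lge_single le_rfl _)).mono ?_
    have := hmin i ⟨hi, hz⟩
    have hi' : (0 : ℚ) < i := by exact_mod_cast Nat.pos_of_ne_zero hi
    rw [← hρ, le_div_iff₀ hi'] at this
    linarith
  obtain ⟨A, hA⟩ : ∃ A, A = (ev (disc η ρ) P).coeff 0 := ⟨_, rfl⟩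
  have hA' : Polynomial.derivative A ≠ 0 := by
    intro h0
    have hcoef : A.coeff i₀ ≠ 0 := by
      rw [hA, ← polySwap_tay, polySwap_coeff, tay_coeff]
      have h1 : o i₀ + -(i₀ * ρ) = 0 := by rw [hρ]; field_simp; ring
      have h2 := HahnSeries.coeff_mul_single_add (x := (tay η 0 P).coeff i₀) (r := (1 : F))
        (a := o i₀) (b := -(i₀ * ρ))
      rw [h1, mul_one] at h2
      rw [h2]
      exact (ho i₀ hi₀.2).2
    rw [Polynomial.eq_C_of_derivative_eq_zero h0,
      Polynomial.coeff_C_of_ne_zero hi₀.1] at hcoef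
    exact hcoef rfl
  have hb0 : ev (disc η ρ) Q ≠ 0 := fun h => hQ <| (disc_subst_zero (by
    rw [h]; exact lge_zero 0)).1
  obtain ⟨q, hq⟩ := exists_ord hb0
  have hq0 : q < 0 := by
    by_contra hneg
    exact hQ (disc_subst_zero (hq.lge.mono (not_lt.1 hneg))).1
  have hj := disc_jac hP0 hq.lge
  obtain ⟨G, hG⟩ : ∃ G, G = (ev (disc η ρ) Q).coeff q := ⟨_, rfl⟩
  have hG0 : G ≠ 0 := hG ▸ hq.2
  rw [hK.jac_eq, ev_C_C, ← hA, ← hG, Rat.cast_zero, zero_smul, sub_zero, zero_add,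
    HahnSeries.C_apply] at hj
  have hne : (q : ℂ) • (Polynomial.derivative A * G) ≠ 0 :=
    smul_ne_zero (Rat.cast_ne_zero.2 hq0.ne) (mul_ne_zero hA' hG0)
  have hqρ : q + 1 + ρ = 0 := by
    by_contra h
    rw [HahnSeries.coeff_single_of_ne h] at hj
    exact hne hj.symm
  rw [hqρ, HahnSeries.coeff_single_same] at hj
  have hunit : IsUnit ((q : ℂ) • (Polynomial.derivative A * G)) := by
    rw [← hj]
    exact (isUnit_iff_ne_zero.2 hK.ne_zero).map (algebraMap ℂ F[X])
  rw [Algebra.smul_def, IsUnit.mul_iff, IsUnit.mul_iff (y := G)] at hunit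
  obtain ⟨-, hAu, hGu⟩ := hunit
  obtain ⟨f, hf, hfA⟩ := Polynomial.isUnit_iff.1 hAu
  obtain ⟨g, hg, hgG⟩ := Polynomial.isUnit_iff.1 hGu
  have hρ' : ρ = -q - 1 := by linarith
  subst hρ'
  refine ⟨-q, f, g, by linarith, hf, hg, hP0, ?_, by rw [neg_neg]; exact hq.lge, ?_⟩
  · rw [← hA]
    have h0 : Polynomial.derivative (A - Polynomial.C f * Polynomial.X) = 0 := by
      simp [← hfA]
    have h1 := Polynomial.eq_C_of_derivative_eq_zero h0
    have h2 : (A - Polynomial.C f * Polynomial.X).coeff 0 = c := by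
      have := (disc_subst_zero hP0).2
      rw [hη, HahnSeries.C_apply, HahnSeries.coeff_single_same, ← hA] at this
      simp [this]
    rw [h2] at h1
    exact sub_eq_iff_eq_add.1 h1
  · rw [neg_neg, ← hG, hgG]

variable {P Q : ℂ[X][X]} {c₀ : ℂ}

theorem TypeI.relation (hK : Keller P Q c₀) {S : Type*} [CommRing S] [Algebra ℂ S]
    {η : Hahn S} {c : S} {β : ℚ} {f g : S} (h : TypeI P Q η c β f g) :
    algebraMap ℂ S c₀ = -(β : ℂ) • (f * g) := by
  have := disc_jac h.lge_P h.lge_Q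
  rw [hK.jac_eq, ev_C_C, h.coeff_P, h.coeff_Q, show (0 : ℚ) + -β + 1 + (β - 1) = 0 by ring,
    HahnSeries.C_apply, HahnSeries.coeff_single_same, Rat.cast_zero, zero_smul, sub_zero,
    Polynomial.derivative_add, Polynomial.derivative_C, zero_add, Polynomial.derivative_C_mul,
    Polynomial.derivative_X, mul_one, ← Polynomial.C_mul, Rat.cast_neg] at this
  have := congrArg (fun p => p.coeff 0) this
  simpa using this

/-- An algebraic closure of the field of rational functions of the level. -/
abbrev Kb : Type := AlgebraicClosure (FractionRing ℂ[X])

/-- The embedding of polynomials in the level into `Kb`. -/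
noncomputable def toKb : ℂ[X] →ₐ[ℂ] Kb := IsScalarTower.toAlgHom ℂ ℂ[X] Kb

theorem toKb_injective : Function.Injective toKb := by
  change Function.Injective (algebraMap ℂ[X] Kb)
  rw [IsScalarTower.algebraMap_eq ℂ[X] (FractionRing ℂ[X]) Kb]
  exact (algebraMap (FractionRing ℂ[X]) Kb).injective.comp (IsFractionRing.injective _ _)

/-- A branch at infinity of the generic level of `P`, with polynomial coefficients, along which `Q`
is unbounded. -/
structure Lift (P Q : ℂ[X][X]) (y : Hahn ℂ[X]) (β : ℚ) (g : ℂ) : Prop where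
  pos : 0 < β
  ne_zero : g ≠ 0
  root : ev y P = HahnSeries.C Polynomial.X
  lge_Q : Lge (-β) (ev y Q)
  coeff_Q : (ev y Q).coeff (-β) = Polynomial.C g

namespace Lift

variable {y y' : Hahn ℂ[X]} {β β' : ℚ} {g g' : ℂ}

theorem ord_Q (h : Lift P Q y β g) : Ord (-β) (ev y Q) :=
  ⟨h.lge_Q, by rw [h.coeff_Q]; exact Polynomial.C_ne_zero.2 h.ne_zero⟩

theorem typeI (hK : Keller P Q c₀) (h : Lift P Q y β g) :
    ∃ f : ℂ, f ≠ 0 ∧ TypeI P Q y Polynomial.X β (Polynomial.C f) (Polynomial.C g) := by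
  have hroot : ev (hmap (toKb : ℂ[X] →+* Kb) y) P = HahnSeries.C (toKb Polynomial.X) := by
    rw [← hmap_ev, h.root, hmap_C]; rfl
  have hord : Ord (-β) (ev (hmap (toKb : ℂ[X] →+* Kb) y) Q) := by
    rw [← hmap_ev]; exact (ord_hmap_iff toKb_injective).2 h.ord_Q
  obtain ⟨β', f, g', ht⟩ := hK.exists_typeI hroot fun h0 => by
    have := hord.le h0
    linarith [h.pos]
  have hord' : Ord (-β') (ev (hmap (toKb : ℂ[X] →+* Kb) y) Q) :=
    ⟨ht.Q_self.1, by rw [ht.Q_self.2]; exact ht.unit_g.ne_zero⟩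
  obtain rfl : β = β' := neg_injective (hord.unique hord')
  have hg : g' = algebraMap ℂ Kb g := by
    rw [← ht.Q_self.2, ← hmap_ev, hmap_coeff, h.coeff_Q]
    exact toKb.commutes g
  have hβ : (β : ℂ) ≠ 0 := Rat.cast_ne_zero.2 h.pos.ne'
  have hf : f = algebraMap ℂ Kb (-c₀ / (β * g)) := by
    have := ht.relation hK
    rw [hg, Algebra.smul_def] at this
    apply mul_right_cancel₀ (b := algebraMap ℂ Kb (-(β * g)))
    · rw [Ne, map_eq_zero_iff _ (algebraMap ℂ Kb).injective, neg_eq_zero]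
      exact mul_ne_zero hβ h.ne_zero
    · rw [← map_mul, show -c₀ / (β * g) * -(β * g) = c₀ by
        field_simp [h.ne_zero], this]
      simp only [map_neg, map_mul]
      ring
  have hf0 : -c₀ / (β * g) ≠ 0 :=
    div_ne_zero (neg_ne_zero.2 hK.ne_zero) (mul_ne_zero hβ h.ne_zero)
  have hinj : Function.Injective ((Polynomial.mapAlgHom toKb : ℂ[X][X] →ₐ[ℂ] Kb[X]) :
      ℂ[X][X] →+* Kb[X]) := Polynomial.map_injective _ toKb_injective
  refine ⟨-c₀ / (β * g), hf0, h.pos, (isUnit_iff_ne_zero.2 hf0).map Polynomial.C,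
    (isUnit_iff_ne_zero.2 h.ne_zero).map Polynomial.C, ?_, ?_, ?_, ?_⟩
  · rw [← lge_hmap_iff hinj, hmap_ev, hmap_disc]; exact ht.lge_P
  · apply hinj
    rw [← hmap_coeff, hmap_ev, hmap_disc, ht.coeff_P, hf, ← toKb.commutes]
    simp
  · rw [← lge_hmap_iff hinj, hmap_ev, hmap_disc]; exact ht.lge_Q
  · apply hinj
    rw [← hmap_coeff, hmap_ev, hmap_disc, ht.coeff_Q, hg, ← toKb.commutes]
    simp

/-- Specialization of the level. -/
noncomputable def _root_.KellerRational.spec {F : Type*} [CommRing F] [Algebra ℂ F] (c : F)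
    (y : Hahn ℂ[X]) : Hahn F := hmap (Polynomial.aeval c : ℂ[X] →ₐ[ℂ] F) y

end Lift

theorem ev_spec {F : Type*} [CommRing F] [Algebra ℂ F] (c : F) (y : Hahn ℂ[X]) (b : ℂ[X][X]) :
    ev (spec c y) b = spec c (ev y b) := (hmap_ev _ _ _).symm

theorem spec_coeff {F : Type*} [CommRing F] [Algebra ℂ F] (c : F) (y : Hahn ℂ[X]) (q : ℚ) :
    (spec c y).coeff q = Polynomial.aeval c (y.coeff q) := rfl

namespace Lift

variable {y y' : Hahn ℂ[X]} {β β' : ℚ} {g g' : ℂ}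

theorem spec_root (h : Lift P Q y β g) {F : Type*} [CommRing F] [Algebra ℂ F] (c : F) :
    ev (spec c y) P = HahnSeries.C c := by
  rw [ev_spec, h.root, spec, hmap_C]
  simp [-HahnSeries.C_apply]

theorem ord_spec_Q (h : Lift P Q y β g) {F : Type*} [Field F] [Algebra ℂ F] (c : F) :
    Ord (-β) (ev (spec c y) Q) := by
  rw [ev_spec]
  refine ⟨h.lge_Q.hmap _, ?_⟩
  rw [spec_coeff, h.coeff_Q, Polynomial.aeval_C]
  exact (map_ne_zero_iff _ (algebraMap ℂ F).injective).2 h.ne_zero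

theorem ord_dY (hK : Keller P Q c₀) (h : Lift P Q y β g) :
    ∃ u : ℂ, u ≠ 0 ∧ Lge (β - 1) (ev y (dY ℂ P)) ∧
      (ev y (dY ℂ P)).coeff (β - 1) = Polynomial.C u := by
  have h1 := level_theta (η := y) (P := P) (by rw [h.root, theta_C]) Q
  rw [hK.jac_eq, ev_C_C] at h1
  have hβ : (β : ℂ) ≠ 0 := Rat.cast_ne_zero.2 h.pos.ne'
  have hne := level_dY_ne_zero (η := y) hK.ne_zero hK.jac_eq (by rw [h.root, theta_C])
  have hth : (theta (ev y Q)).coeff (-β) = Polynomial.C (β * g) := by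
    rw [theta_coeff, h.coeff_Q, Rat.cast_neg, neg_neg, Polynomial.smul_C, smul_eq_mul]
  have hth' : Ord (-β) (theta (ev y Q)) := ⟨h.lge_Q.theta, by
    rw [hth]; exact Polynomial.C_ne_zero.2 (mul_ne_zero hβ h.ne_zero)⟩
  obtain ⟨p, hp⟩ := exists_ord hne
  have h2 := hp.mul hth'
  have h3 : Ord (-1 : ℚ) (-hx ℂ[X] * HahnSeries.C (algebraMap ℂ ℂ[X] c₀)) := by
    rw [neg_mul, ← add_zero (-1 : ℚ)]
    exact (hx_ord.mul (ord_C (Polynomial.C_ne_zero.2 hK.ne_zero))).neg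
  rw [h1] at h2
  have h4 : p = β - 1 := by linarith [h2.unique h3]
  subst h4
  have h5 := hp.lge.coeff_mul hth'.lge
  rw [h1, hth, show β - 1 + -β = -1 by ring, neg_mul, HahnSeries.coeff_neg, hx,
    HahnSeries.C_apply, HahnSeries.single_mul_single, add_zero, HahnSeries.coeff_single_same,
    one_mul] at h5
  refine ⟨-c₀ / (β * g), div_ne_zero (neg_ne_zero.2 hK.ne_zero) (mul_ne_zero hβ h.ne_zero),
    hp.lge, ?_⟩
  apply mul_right_cancel₀ (Polynomial.C_ne_zero.2 (mul_ne_zero hβ h.ne_zero))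
  rw [← h5, ← Polynomial.C_mul, div_mul_cancel₀ _ (mul_ne_zero hβ h.ne_zero), Polynomial.C_neg]
  rfl

/-- The level derivative of polynomials. -/
noncomputable def _root_.KellerRational.dT : Derivation ℂ ℂ[X] ℂ[X] := Polynomial.derivative'

theorem dY_mul_dT {y : Hahn ℂ[X]} (h : ev y P = HahnSeries.C Polynomial.X) :
    ev y (dY ℂ P) * dmap dT y = 1 := by
  have := chain_rule (A := ℂ) y (dmap dT) (dmap_mul dT) (fun a => by
    rw [dmap_C]; simp) P
  rw [h, dmap_C, dmap_hx, mul_zero, zero_add] at this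
  rw [← this, dT]
  change HahnSeries.C (Polynomial.derivative Polynomial.X) = 1
  rw [Polynomial.derivative_X, map_one]

theorem dT_lge (hK : Keller P Q c₀) (h : Lift P Q y β g) : Lge (1 - β) (dmap dT y) := by
  obtain ⟨u, hu, h1, h2⟩ := h.ord_dY hK
  refine lge_of_forall_ord fun p hp => ?_
  have := Ord.mul ⟨h1, by rw [h2]; exact Polynomial.C_ne_zero.2 hu⟩ hp
  rw [dY_mul_dT h.root] at this
  linarith [this.unique ord_one]

theorem eq_shift (hK : Keller P Q c₀) (h : Lift P Q y β g) (c : ℂ) :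
    ∃ z, Lge 0 z ∧ y = hmap Polynomial.C (spec c y) + HahnSeries.single (1 - β) 1 * z := by
  have hq (q : ℚ) (hq : q < 1 - β) : y.coeff q = Polynomial.C (Polynomial.aeval c (y.coeff q)) := by
    have h1 : Polynomial.derivative (y.coeff q) = 0 := h.dT_lge hK q hq
    have h2 := Polynomial.eq_C_of_derivative_eq_zero h1
    rw [h2]
    simp
  refine ⟨HahnSeries.single (-(1 - β)) 1 * (y - hmap Polynomial.C (spec c y)), ?_, ?_⟩
  · have : Lge (1 - β) (y - hmap Polynomial.C (spec c y)) := fun q hq' => by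
      rw [HahnSeries.coeff_sub, hmap_coeff, spec_coeff, ← hq q hq', sub_self]
    refine ((lge_single le_rfl _).mul this).mono ?_
    linarith
  · rw [← mul_assoc, HahnSeries.single_mul_single, add_neg_cancel, mul_one]
    change y = _ + 1 * _
    ring

theorem data_eq (h : Lift P Q y β g) (h' : Lift P Q y' β' g') {c : ℂ}
    (hc : spec c y = spec c y') : β = β' ∧ g = g' := by
  have h1 := h.ord_spec_Q c
  have h2 := h'.ord_spec_Q c
  rw [hc] at h1
  obtain rfl := neg_injective (h1.unique h2)
  refine ⟨rfl, ?_⟩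
  have h3 : (ev (spec c y) Q).coeff (-β) = g := by
    rw [ev_spec, spec_coeff, h.coeff_Q, Polynomial.aeval_C]; rfl
  rw [← h3, hc, ev_spec, spec_coeff, h'.coeff_Q, Polynomial.aeval_C]; rfl

theorem spec_typeI (hK : Keller P Q c₀) (h : Lift P Q y β g) {F : Type*} [CommRing F]
    [Algebra ℂ F] (c : F) :
    ∃ f : ℂ, f ≠ 0 ∧ TypeI P Q (spec c y) c β (algebraMap ℂ F f) (algebraMap ℂ F g) := by
  obtain ⟨f, hf, ht⟩ := h.typeI hK
  refine ⟨f, hf, ?_⟩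
  have := ht.map (Polynomial.aeval c : ℂ[X] →ₐ[ℂ] F)
  rwa [Polynomial.aeval_C, Polynomial.aeval_C, Polynomial.aeval_X] at this

theorem spec_injective (hK : Keller P Q c₀) (h : Lift P Q y β g) (h' : Lift P Q y' β' g') {c : ℂ}
    (hc : spec c y = spec c y') : y = y' := by
  obtain ⟨rfl, rfl⟩ := h.data_eq h' hc
  obtain ⟨z, hz, hy⟩ := h.eq_shift hK c
  obtain ⟨z', hz', hy'⟩ := h'.eq_shift hK c
  obtain ⟨f, hf, ht⟩ := h.spec_typeI hK c
  have ht' := ht.map (Polynomial.CAlgHom : ℂ →ₐ[ℂ] ℂ[X])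
  have : z = z' := ht'.root_unique hz hz' (by
    rw [← hc] at hy'
    change ev (hmap Polynomial.C _ + _) P = ev (hmap Polynomial.C _ + _) P
    rw [← hy, ← hy', h.root, h'.root])
  rw [hy, hy', hc, this]

end Lift

theorem TypeI.exists_lift {η : Hahn ℂ} {c : ℂ} {β : ℚ} {f g : ℂ} (h : TypeI P Q η c β f g)
    (hη : ev η P = HahnSeries.C c) :
    ∃ y, Lift P Q y β g ∧ spec c y = η ∧
      ∃ z, Lge 0 z ∧ y = hmap Polynomial.C η + HahnSeries.single (1 - β) 1 * z := by
  have ht := h.map (Polynomial.CAlgHom : ℂ →ₐ[ℂ] ℂ[X])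
  obtain ⟨z, hz, hroot⟩ := ht.exists_root Polynomial.X
  refine ⟨_, ⟨h.pos, h.unit_g.ne_zero, hroot, (ht.Q_at hz).1, (ht.Q_at hz).2⟩, ?_, z, hz, rfl⟩
  have h1 : spec c (hmap ((Polynomial.CAlgHom : ℂ →ₐ[ℂ] ℂ[X]) : ℂ →+* ℂ[X]) η +
      HahnSeries.single (1 - β) 1 * z) = η + HahnSeries.single (1 - β) 1 * spec c z := by
    rw [spec, map_add, map_mul, hmap_single, map_one, spec, hmap_hmap]
    congr 1
    ext q
    simp
  rw [h1]
  have h2 : spec c z = 0 := h.root_unique (hz.hmap _) (lge_zero 0) (by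
    rw [mul_zero, add_zero, hη, ← h1, ev_spec, hroot, spec, hmap_C]
    simp [-HahnSeries.C_apply])
  rw [h2, mul_zero, add_zero]

section Level

variable {P Q : ℂ[X][X]} {c₀ : ℂ} {F : Type*} [Field F] [Algebra ℂ F]

/-- The polynomial whose roots are the branches at infinity of a level of `P`. -/
noncomputable def lev (P : ℂ[X][X]) (c : F) : (Hahn F)[X] :=
  P.map (xmap ℂ F) - Polynomial.C (HahnSeries.C c)

theorem lev_eval (P : ℂ[X][X]) (c : F) (η : Hahn F) :
    (lev P c).eval η = ev η P - HahnSeries.C c := by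
  rw [lev, Polynomial.eval_sub, ← ev_eq_eval, Polynomial.eval_C]

theorem Keller.lev_monic (hK : Keller P Q c₀) (c : F) : (lev P c).Monic := by
  refine (hK.monic.map _).sub_of_left ?_
  rw [hK.monic.degree_map, Polynomial.degree_eq_natDegree hK.monic.ne_zero]
  exact Polynomial.degree_C_le.trans_lt (by exact_mod_cast hK.natDegree_pos)

theorem Keller.lev_natDegree (hK : Keller P Q c₀) (c : F) :
    (lev P c).natDegree = P.natDegree := by
  rw [lev, Polynomial.natDegree_sub_C, hK.monic.natDegree_map]

theorem lev_derivative (c : F) (η : Hahn F) :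
    (Polynomial.derivative (lev P c)).eval η = ev η (dY ℂ P) := by
  rw [lev, Polynomial.derivative_sub, Polynomial.derivative_C, sub_zero,
    Polynomial.derivative_map, ← ev_eq_eval, dY_apply]

open Classical in
/-- The branches at infinity of a level of `P`. -/
noncomputable def rts (P : ℂ[X][X]) (c : F) : Finset (Hahn F) := (lev P c).roots.toFinset

theorem Keller.mem_rts (hK : Keller P Q c₀) {c : F} {η : Hahn F} :
    η ∈ rts P c ↔ ev η P = HahnSeries.C c := by
  classical
  rw [rts, Multiset.mem_toFinset, Polynomial.mem_roots (hK.lev_monic c).ne_zero,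
    Polynomial.IsRoot, lev_eval, sub_eq_zero]

theorem Keller.dY_ne_zero (hK : Keller P Q c₀) {c : F} {η : Hahn F}
    (h : ev η P = HahnSeries.C c) : ev η (dY ℂ P) ≠ 0 :=
  level_dY_ne_zero hK.ne_zero hK.jac_eq (by rw [h, theta_C])

theorem Keller.nodup_roots (hK : Keller P Q c₀) (c : F) : (lev P c).roots.Nodup := by
  classical
  rw [Multiset.nodup_iff_count_le_one]
  intro η
  rw [Polynomial.count_roots]
  by_contra! h
  have h1 := (Polynomial.one_lt_rootMultiplicity_iff_isRoot (hK.lev_monic c).ne_zero).1 h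
  have h2 : ev η P = HahnSeries.C c := by
    have := h1.1
    rwa [Polynomial.IsRoot, lev_eval, sub_eq_zero] at this
  apply hK.dY_ne_zero h2
  rw [← lev_derivative c]
  exact h1.2

theorem Keller.descend (hK : Keller P Q c₀) {c : ℂ} {η : Hahn F}
    (h : ev η P = HahnSeries.C (algebraMap ℂ F c)) :
    ∃ η₀ : Hahn ℂ, ev η₀ P = HahnSeries.C c ∧ hmap (algebraMap ℂ F) η₀ = η := by
  have hmapev (z : Hahn ℂ) : hmap (algebraMap ℂ F) (ev z P) = ev (hmap (algebraMap ℂ F) z) P :=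
    hmap_ev (Algebra.ofId ℂ F) z P
  have h1 : (lev P c).map (hmap (algebraMap ℂ F)) = lev P (algebraMap ℂ F c) := by
    rw [lev, lev, Polynomial.map_sub, Polynomial.map_map, Polynomial.map_C, hmap_C]
    congr 2
    ext a
    · simp
    · simp
  have h2 : η ∈ (lev P (algebraMap ℂ F c)).roots := by
    rw [Polynomial.mem_roots (hK.lev_monic _).ne_zero, Polynomial.IsRoot, lev_eval, h, sub_self]
  rw [← h1, (IsAlgClosed.splits (lev P c)).roots_map_of_injective
    (hmap_injective (algebraMap ℂ F).injective), Multiset.mem_map] at h2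
  obtain ⟨η₀, h3, h4⟩ := h2
  refine ⟨η₀, ?_, h4⟩
  rwa [Polynomial.mem_roots (hK.lev_monic _).ne_zero, Polynomial.IsRoot, lev_eval,
    sub_eq_zero] at h3

theorem Keller.exists_lift (hK : Keller P Q c₀) {c : F} {η : Hahn F}
    (hη : ev η P = HahnSeries.C c) (hQ : ¬ Lge 0 (ev η Q)) :
    ∃ y β g, Lift P Q y β g ∧ spec c y = η := by
  obtain ⟨β, f, g, ht⟩ := hK.exists_typeI hη hQ
  obtain ⟨z, hz, hroot⟩ := ht.exists_root 0
  have hroot' : ev (η + HahnSeries.single (1 - β) 1 * z) P = HahnSeries.C (algebraMap ℂ F 0) := by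
    rw [hroot, map_zero (algebraMap ℂ F)]
  obtain ⟨η₀, hη₀, hm⟩ := hK.descend hroot'
  have hmev : hmap (algebraMap ℂ F) (ev η₀ Q) = ev (η + HahnSeries.single (1 - β) 1 * z) Q := by
    rw [← hm]; exact hmap_ev (Algebra.ofId ℂ F) η₀ Q
  have hord : Ord (-β) (ev η₀ Q) := by
    rw [← ord_hmap_iff (algebraMap ℂ F).injective, hmev]
    exact ⟨(ht.Q_at hz).1, by rw [(ht.Q_at hz).2]; exact ht.unit_g.ne_zero⟩
  obtain ⟨β', f', g', ht'⟩ := hK.exists_typeI hη₀ fun h => by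
    have := hord.le h
    linarith [ht.pos]
  obtain rfl : β = β' := neg_injective (hord.unique
    ⟨ht'.Q_self.1, by rw [ht'.Q_self.2]; exact ht'.unit_g.ne_zero⟩)
  obtain ⟨y, hy, -, z', hz', hyz⟩ := ht'.exists_lift hη₀
  refine ⟨y, β, g', hy, ?_⟩
  have ht'' := ht'.map (Algebra.ofId ℂ F)
  have h1 : spec c y = hmap (algebraMap ℂ F) η₀ + HahnSeries.single (1 - β) 1 * spec c z' := by
    rw [hyz, spec, map_add, map_mul, hmap_single, map_one, spec, hmap_hmap]
    congr 2
    ext a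
    simp
  have h2 : η = hmap (algebraMap ℂ F) η₀ + HahnSeries.single (1 - β) 1 * (-z) := by
    rw [hm]; ring
  have h3 : spec c z' = -z := ht''.root_unique (hz'.hmap _) hz.neg (by
    change ev (hmap (algebraMap ℂ F) _ + _) P = ev (hmap (algebraMap ℂ F) _ + _) P
    rw [← h1, ← h2, hη, hy.spec_root])
  rw [h1, h3, ← h2]

variable [IsAlgClosed F]

theorem charZero_of_algebra (F : Type*) [Field F] [Algebra ℂ F] : CharZero F :=
  charZero_of_injective_algebraMap (algebraMap ℂ F).injective

theorem isAlgClosed_hahn (F : Type*) [Field F] [Algebra ℂ F] [IsAlgClosed F] :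
    IsAlgClosed (Hahn F) :=
  have := charZero_of_algebra F
  inferInstance

theorem Keller.card_rts (hK : Keller P Q c₀) (c : F) : (rts P c).card = P.natDegree := by
  classical
  have := isAlgClosed_hahn F
  rw [rts, Multiset.toFinset_card_of_nodup (hK.nodup_roots c), ← hK.lev_natDegree c]
  exact (IsAlgClosed.splits _).natDegree_eq_card_roots.symm

theorem Keller.lev_eq_prod (hK : Keller P Q c₀) (c : F) :
    lev P c = ∏ η ∈ rts P c, (Polynomial.X - Polynomial.C η) := by
  classical
  have := isAlgClosed_hahn F
  have h1 := (IsAlgClosed.splits (lev P c)).eq_prod_roots_of_monic (hK.lev_monic c)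
  conv_lhs => rw [h1]
  rw [rts, Finset.prod, Multiset.toFinset_val, Multiset.dedup_eq_self.2 (hK.nodup_roots c)]

end Level

section Sigma

variable {S : Type*} [CommRing S] [Algebra ℂ S]

/-- The standard character of the exponents. -/
noncomputable def chi (q : ℚ) : ℂ := Complex.exp (2 * Real.pi * Complex.I * q)

theorem chi_zero : chi 0 = 1 := by simp [chi]

theorem chi_add (p q : ℚ) : chi (p + q) = chi p * chi q := by
  rw [chi, chi, chi, ← Complex.exp_add]
  push_cast
  ring_nf

theorem chi_ne_zero (q : ℚ) : chi q ≠ 0 := Complex.exp_ne_zero _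

theorem chi_eq_one_iff {q : ℚ} : chi q = 1 ↔ ∃ n : ℤ, q = n := by
  rw [chi, Complex.exp_eq_one_iff]
  have : (2 * Real.pi * Complex.I : ℂ) ≠ 0 := by simp [Real.pi_ne_zero]
  refine exists_congr fun n => ⟨fun h => ?_, fun h => ?_⟩
  · rw [mul_comm, mul_left_inj' this] at h
    exact_mod_cast h
  · rw [h]; push_cast; ring

/-- Monodromy around infinity. -/
noncomputable def sigma : Hahn S →+* Hahn S := twist chi chi_zero chi_add

@[simp] theorem sigma_coeff (a : Hahn S) (q : ℚ) : (sigma a).coeff q = chi q • a.coeff q := rfl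

theorem sigma_iter_coeff (n : ℕ) (a : Hahn S) (q : ℚ) :
    (sigma^[n] a).coeff q = chi (n * q) • a.coeff q := by
  induction n with
  | zero => simp [chi_zero]
  | succ n ih =>
    rw [Function.iterate_succ_apply', sigma_coeff, ih, smul_smul, ← chi_add]
    push_cast
    ring_nf

theorem sigma_C (s : S) : sigma (HahnSeries.C s : Hahn S) = HahnSeries.C s := by
  ext q
  rw [sigma_coeff, HahnSeries.C_apply]
  by_cases h : q = 0
  · rw [h, chi_zero, one_smul]
  · rw [HahnSeries.coeff_single_of_ne h, smul_zero]

theorem sigma_single (p : ℚ) (s : S) :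
    sigma (HahnSeries.single p s) = HahnSeries.single p (chi p • s) := by
  ext q
  rw [sigma_coeff]
  by_cases h : q = p
  · rw [h, HahnSeries.coeff_single_same, HahnSeries.coeff_single_same]
  · rw [HahnSeries.coeff_single_of_ne h, HahnSeries.coeff_single_of_ne h, smul_zero]

theorem sigma_hx : sigma (hx S) = hx S := by
  have : chi (-1) = 1 := chi_eq_one_iff.2 ⟨-1, by simp⟩
  rw [hx, sigma_single, this, one_smul]

theorem sigma_injective : Function.Injective (sigma : Hahn S → Hahn S) := fun a b h => by
  ext q
  have := congrArg (fun z => z.coeff q) h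
  simp only [sigma_coeff] at this
  have h2 := congrArg (fun z => (chi q)⁻¹ • z) this
  simpa only [smul_smul, inv_mul_cancel₀ (chi_ne_zero q), one_smul] using h2

theorem lge_sigma_iff {p : ℚ} {a : Hahn S} : Lge p (sigma a) ↔ Lge p a :=
  forall₂_congr fun q _ => by
    rw [sigma_coeff]
    refine ⟨fun h => ?_, fun h => by rw [h, smul_zero]⟩
    have h2 := congrArg (fun z => (chi q)⁻¹ • z) h
    simpa only [smul_smul, inv_mul_cancel₀ (chi_ne_zero q), one_smul, smul_zero] using h2

theorem ev_sigma (η : Hahn S) (b : ℂ[X][X]) : ev (sigma η) b = sigma (ev η b) := by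
  have : ev (A := ℂ) (sigma η) = sigma.comp (ev η) := by
    refine ringHom_ext₂ (fun a => ?_) ?_ ?_
    · rw [RingHom.comp_apply, ev_C_C, ev_C_C, sigma_C]
    · rw [RingHom.comp_apply, ev_C_X, ev_C_X, sigma_hx]
    · rw [RingHom.comp_apply, ev_X, ev_X]
  rw [this]; rfl

end Sigma

section Lifts

variable {P Q : ℂ[X][X]} {c₀ : ℂ}

theorem Lift.sigma {y : Hahn ℂ[X]} {β : ℚ} {g : ℂ} (h : Lift P Q y β g) :
    Lift P Q (sigma y) β (chi (-β) * g) where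
  pos := h.pos
  ne_zero := mul_ne_zero (chi_ne_zero _) h.ne_zero
  root := by rw [ev_sigma, h.root, sigma_C]
  lge_Q := by rw [ev_sigma, lge_sigma_iff]; exact h.lge_Q
  coeff_Q := by rw [ev_sigma, sigma_coeff, h.coeff_Q, Polynomial.smul_C, smul_eq_mul]

theorem Lift.sigma_iter {y : Hahn ℂ[X]} {β : ℚ} {g : ℂ} (h : Lift P Q y β g) (n : ℕ) :
    Lift P Q (KellerRational.sigma^[n] y) β (chi (n * -β) * g) := by
  induction n with
  | zero => simpa [chi_zero] using h
  | succ n ih =>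
    rw [Function.iterate_succ_apply']
    have := ih.sigma
    rw [← mul_assoc, ← chi_add, show -β + (n : ℚ) * -β = ((n + 1 : ℕ) : ℚ) * -β by
      push_cast; ring] at this
    exact this

/-- The branches at infinity of the generic level along which `Q` is unbounded. -/
def lifts (P Q : ℂ[X][X]) : Set (Hahn ℂ[X]) := {y | ∃ β g, Lift P Q y β g}

theorem Keller.finite_lifts (hK : Keller P Q c₀) : (lifts P Q).Finite := by
  refine Set.Finite.of_finite_image (f := spec (0 : ℂ))
    ((rts P (0 : ℂ)).finite_toSet.subset ?_) ?_
  · rintro _ ⟨y, ⟨β, g, h⟩, rfl⟩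
    exact hK.mem_rts.2 (h.spec_root 0)
  · rintro y ⟨β, g, h⟩ y' ⟨β', g', h'⟩ hyy
    exact h.spec_injective hK h' hyy

theorem Lift.exists_period (hK : Keller P Q c₀) {y : Hahn ℂ[X]} {β : ℚ} {g : ℂ}
    (h : Lift P Q y β g) : 0 < Function.minimalPeriod KellerRational.sigma y := by
  apply Function.minimalPeriod_pos_of_mem_periodicPts
  have h1 : Set.MapsTo (fun n : ℕ => KellerRational.sigma^[n] y) Set.univ (lifts P Q) :=
    fun n _ => ⟨_, _, h.sigma_iter n⟩
  obtain ⟨m, -, n, -, hmn, heq⟩ :=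
    Set.infinite_univ.exists_ne_map_eq_of_mapsTo h1 hK.finite_lifts
  wlog hlt : m < n generalizing m n
  · exact this n m hmn.symm heq.symm (lt_of_le_of_ne (not_lt.1 hlt) hmn.symm)
  obtain ⟨k, rfl⟩ := Nat.exists_eq_add_of_lt hlt
  refine ⟨k + 1, by omega, (sigma_injective.iterate m) ?_⟩
  rw [← Function.iterate_add_apply, ← add_assoc]
  exact heq.symm

end Lifts

section Lagrange

variable {F : Type*} [Field F]

/-- Bounds on the coefficients of a polynomial in terms of its values. -/
theorem exists_lagrange_bound (s : Finset (Hahn F)) : ∃ D : ℕ, ∀ (r : (Hahn F)[X]) (ρ : ℚ),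
    r.degree < s.card → (∀ η ∈ s, Lge ρ (r.eval η)) → ∀ i, Lge (ρ - D) (r.coeff i) := by
  classical
  have hb (a : Hahn F) : ∃ D : ℕ, Lge (-(D : ℚ)) a := by
    by_cases h : a = 0
    · exact ⟨0, h ▸ lge_zero _⟩
    obtain ⟨p, hp⟩ := exists_ord h
    obtain ⟨D, hD⟩ := exists_nat_ge (-p)
    exact ⟨D, hp.lge.mono (by linarith)⟩
  choose d hd using hb
  refine ⟨∑ η ∈ s, ∑ i ∈ (Lagrange.basis s id η).support, d ((Lagrange.basis s id η).coeff i),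
    fun r ρ hr hv i => ?_⟩
  rw [Lagrange.eq_interpolate Function.injective_id.injOn hr, Lagrange.interpolate_apply,
    Polynomial.finsetSum_coeff]
  refine Lge.sum fun η hη => ?_
  rw [Polynomial.coeff_C_mul]
  by_cases hi : (Lagrange.basis s id η).coeff i = 0
  · rw [hi, mul_zero]; exact lge_zero _
  refine ((hv η hη).mul (hd _)).mono ?_
  have h1 : d ((Lagrange.basis s id η).coeff i) ≤
      ∑ i ∈ (Lagrange.basis s id η).support, d ((Lagrange.basis s id η).coeff i) :=
    Finset.single_le_sum (f := fun i => d ((Lagrange.basis s id η).coeff i))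
      (fun _ _ => Nat.zero_le _) (Polynomial.mem_support_iff.2 hi)
  have h2 := Finset.single_le_sum (f := fun η => ∑ i ∈ (Lagrange.basis s id η).support,
    d ((Lagrange.basis s id η).coeff i)) (fun _ _ => Nat.zero_le _) hη
  have h3 := h1.trans h2
  rw [sub_eq_add_neg]
  gcongr

theorem exists_uniform_lge {ι : Type*} (s : Finset ι) (f : ι → Hahn F) :
    ∃ ρ : ℚ, ∀ i ∈ s, Lge ρ (f i) := by
  classical
  induction s using Finset.induction_on with
  | empty => exact ⟨0, fun i hi => (Finset.notMem_empty i hi).elim⟩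
  | insert a s ha ih =>
    obtain ⟨ρ, h⟩ := ih
    obtain ⟨ρ', h'⟩ : ∃ ρ', Lge ρ' (f a) := by
      by_cases h0 : f a = 0
      · exact ⟨0, h0 ▸ lge_zero _⟩
      · exact (exists_ord h0).imp fun _ h => h.lge
    refine ⟨min ρ ρ', fun i hi => ?_⟩
    rcases Finset.mem_insert.1 hi with rfl | hi
    · exact h'.mono (min_le_right _ _)
    · exact (h i hi).mono (min_le_left _ _)

theorem eq_C_of_aeval_eq_zero [IsAlgClosed F] {a : Hahn F} {p : F[X]} (hp : p ≠ 0)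
    (h : p.eval₂ (HahnSeries.C : F →+* Hahn F) a = 0) : ∃ κ, a = HahnSeries.C κ := by
  rw [Polynomial.eval₂_eq_eval_map] at h
  have h1 : a ∈ (p.map (HahnSeries.C : F →+* Hahn F)).roots := by
    rw [Polynomial.mem_roots (Polynomial.map_ne_zero hp)]
    exact h
  rw [(IsAlgClosed.splits p).roots_map_of_injective HahnSeries.C_injective, Multiset.mem_map] at h1
  obtain ⟨κ, -, hκ⟩ := h1
  exact ⟨κ, hκ.symm⟩

end Lagrange

section Values

variable {P Q : ℂ[X][X]} {c₀ : ℂ} {F : Type*} [Field F] [Algebra ℂ F] [IsAlgClosed F]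

theorem Keller.eval_const_of_ne (hK : Keller P Q c₀) {c : F} {a b : ℂ[X][X]}
    (hb : ∀ η ∈ rts P c, ev η a ≠ 0 → Lge 0 (ev η b)) {η : Hahn F} (hη : η ∈ rts P c)
    (haη : ev η a ≠ 0) : ∃ κ, ev η b = HahnSeries.C κ := by
  classical
  let ι : ℂ[X][X] →+* F[X][X] := Polynomial.mapRingHom (Polynomial.mapRingHom (algebraMap ℂ F))
  have hι (η : Hahn F) (b : ℂ[X][X]) : ev η (ι b) = ev η b := ev_map _ (fun _ => rfl) η b
  let f : F[X][X] := ι P - Polynomial.C (Polynomial.C c)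
  have hf : f.Monic := by
    refine (hK.monic.map _).sub_of_left ?_
    rw [hK.monic.degree_map, Polynomial.degree_eq_natDegree hK.monic.ne_zero]
    exact Polynomial.degree_C_le.trans_lt (by exact_mod_cast hK.natDegree_pos)
  have hfd : f.natDegree = P.natDegree := by
    rw [Polynomial.natDegree_sub_C]; exact hK.monic.natDegree_map _
  have hf1 : f ≠ 1 := by
    intro h
    rw [h, Polynomial.natDegree_one] at hfd
    exact hK.natDegree_pos.ne hfd
  have hfη (η) (h : η ∈ rts P c) : ev η f = 0 := by
    rw [map_sub, hι, hK.mem_rts.1 h, ev_C_C, sub_eq_zero]; rfl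
  let r (n : ℕ) : F[X][X] := (ι a * ι b ^ n) %ₘ f
  have hr (n : ℕ) (η) (h : η ∈ rts P c) : ev η (r n) = ev η a * ev η b ^ n := by
    have h1 := congrArg (ev η) (Polynomial.modByMonic_add_div (ι a * ι b ^ n) f)
    rw [map_add, map_mul, hfη η h, zero_mul, add_zero, map_mul, map_pow, hι, hι] at h1
    exact h1
  have hrd (n : ℕ) : (r n).natDegree < P.natDegree := by
    rw [← hfd]; exact Polynomial.natDegree_modByMonic_lt _ hf hf1
  obtain ⟨D₀, hD⟩ := exists_lagrange_bound (rts P c)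
  obtain ⟨ρ, hρ⟩ := exists_uniform_lge (rts P c) (fun η => ev η a)
  obtain ⟨D, hDρ⟩ := exists_nat_ge (D₀ - ρ)
  have hrx (n i : ℕ) : ((r n).coeff i).natDegree ≤ D := by
    have h1 := hD ((r n).map (xmap F F)) ρ (by
      rw [hK.card_rts]
      refine Polynomial.degree_map_le.trans_lt ?_
      by_cases h0 : r n = 0
      · rw [h0, Polynomial.degree_zero]; exact WithBot.bot_lt_coe _
      · rw [Polynomial.degree_eq_natDegree h0]; exact_mod_cast hrd n) (fun η hη => by
      rw [← ev_eq_eval, hr n η hη]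
      by_cases h0 : ev η a = 0
      · rw [h0, zero_mul]; exact lge_zero _
      · exact ((hρ η hη).mul ((hb η hη h0).pow₀ n)).mono (add_zero _).ge) i
    rw [Polynomial.coeff_map] at h1
    rw [Polynomial.natDegree_le_iff_coeff_eq_zero]
    intro N hN
    have h2 := h1 (-(N : ℚ)) (by
      have : (D : ℚ) < N := by exact_mod_cast hN
      linarith)
    rw [xmap_coeff] at h2
    exact h2
  let V := Fin P.natDegree → Fin (D + 1) → F
  let v (n : Fin (Module.finrank F V + 1)) : V := fun i j => ((r n).coeff i).coeff j
  have hdep : ¬ LinearIndependent F v := fun h => by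
    have := h.fintype_card_le_finrank
    rw [Fintype.card_fin] at this
    omega
  obtain ⟨κ, hκ, n₀, hn₀⟩ := Fintype.not_linearIndependent_iff.1 hdep
  have hrel : ∑ n : Fin (Module.finrank F V + 1),
      Polynomial.C (Polynomial.C (κ n)) * r n = 0 := by
    ext i j
    rw [Polynomial.finsetSum_coeff, Polynomial.finsetSum_coeff]
    simp only [Polynomial.coeff_C_mul, Polynomial.coeff_zero]
    by_cases hi : i < P.natDegree
    · by_cases hj : j < D + 1
      · have := congrFun (congrFun hκ ⟨i, hi⟩) ⟨j, hj⟩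
        rw [Finset.sum_apply, Finset.sum_apply] at this
        exact this
      · refine Finset.sum_eq_zero fun n _ => ?_
        rw [Polynomial.coeff_eq_zero_of_natDegree_lt (lt_of_le_of_lt (hrx n i) (by omega)),
          mul_zero]
    · refine Finset.sum_eq_zero fun n _ => ?_
      rw [Polynomial.coeff_eq_zero_of_natDegree_lt (lt_of_lt_of_le (hrd n) (by omega)),
        Polynomial.coeff_zero, mul_zero]
  let p : F[X] := ∑ n : Fin (Module.finrank F V + 1), Polynomial.C (κ n) * Polynomial.X ^ (n : ℕ)
  have hp : p ≠ 0 := by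
    intro h
    have h1 := congrArg (fun p => p.coeff n₀) h
    simp only [p, Polynomial.finsetSum_coeff, Polynomial.coeff_C_mul_X_pow,
      Polynomial.coeff_zero] at h1
    rw [Finset.sum_eq_single n₀ (fun n _ hn => if_neg fun h => hn (Fin.ext h.symm))
      (fun h => (h (Finset.mem_univ _)).elim), if_pos rfl] at h1
    exact hn₀ h1
  refine eq_C_of_aeval_eq_zero hp ((mul_eq_zero.1 ?_).resolve_left haη)
  have h1 := congrArg (ev η) hrel
  rw [map_zero, map_sum] at h1
  rw [← h1, Polynomial.eval₂_finsetSum, Finset.mul_sum]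
  refine Finset.sum_congr rfl fun n _ => ?_
  rw [map_mul, ev_C_C, hr n η hη, Polynomial.eval₂_mul, Polynomial.eval₂_C,
    Polynomial.eval₂_X_pow, mul_left_comm]
  rfl

theorem Keller.eval_const (hK : Keller P Q c₀) {c : F} {b : ℂ[X][X]}
    (hb : ∀ η ∈ rts P c, Lge 0 (ev η b)) {η : Hahn F} (hη : η ∈ rts P c) :
    ∃ κ, ev η b = HahnSeries.C κ :=
  hK.eval_const_of_ne (a := 1) (fun η hη _ => hb η hη) hη (by rw [map_one]; exact one_ne_zero)

theorem Keller.exists_not_lge_of_ne (hK : Keller P Q c₀) {c : F} {a : ℂ[X][X]} {η : Hahn F}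
    (hη : η ∈ rts P c) (ha : ev η a ≠ 0) : ∃ η ∈ rts P c, ev η a ≠ 0 ∧ ¬ Lge 0 (ev η Q) := by
  by_contra! h
  obtain ⟨κ, hκ⟩ := hK.eval_const_of_ne h hη ha
  have h1 := level_theta (η := η) (P := P) (by rw [hK.mem_rts.1 hη, theta_C]) Q
  rw [hκ, theta_C, mul_zero, hK.jac_eq, ev_C_C, neg_mul, eq_comm, neg_eq_zero] at h1
  exact mul_ne_zero hx_ord.ne_zero
    (ord_C ((map_ne_zero_iff _ (algebraMap ℂ F).injective).2 hK.ne_zero)).ne_zero h1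

theorem Keller.exists_not_lge (hK : Keller P Q c₀) (c : F) :
    ∃ η ∈ rts P c, ¬ Lge 0 (ev η Q) := by
  obtain ⟨η, hη⟩ := Finset.card_pos.1 (by rw [hK.card_rts c]; exact hK.natDegree_pos)
  obtain ⟨η', h, -, h'⟩ := hK.exists_not_lge_of_ne (a := 1) hη (by rw [map_one]; exact one_ne_zero)
  exact ⟨η', h, h'⟩

end Values

section Lifts

variable {P Q : ℂ[X][X]} {c₀ : ℂ}

/-- The generic level. -/
noncomputable abbrev tt : Kb := toKb Polynomial.X

theorem spec_tt (y : Hahn ℂ[X]) : spec tt y = hmap (toKb : ℂ[X] →+* Kb) y := by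
  have : (Polynomial.aeval tt : ℂ[X] →ₐ[ℂ] Kb) = toKb :=
    Polynomial.algHom_ext (by rw [Polynomial.aeval_X])
  rw [spec, this]

theorem Keller.exists_mem_lifts (hK : Keller P Q c₀) : ∃ y β g, Lift P Q y β g := by
  obtain ⟨η, hη, hQ⟩ := hK.exists_not_lge tt
  obtain ⟨y, β, g, h, -⟩ := hK.exists_lift (hK.mem_rts.1 hη) hQ
  exact ⟨y, β, g, h⟩

theorem ev_injective {y : Hahn ℂ[X]} (h : ev y P = HahnSeries.C Polynomial.X) :
    Function.Injective (ev (A := ℂ) y) := by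
  rw [injective_iff_map_eq_zero]
  intro b
  induction hn : b.natDegree using Nat.strong_induction_on generalizing b with
  | _ n ih =>
    intro hb
    have h1 := chain_rule (A := ℂ) y (dmap dT) (dmap_mul dT) (fun a => by
      rw [dmap_C]; simp) b
    rw [hb, map_zero, dmap_hx, mul_zero, zero_add, eq_comm] at h1
    have h2 : dmap dT y ≠ 0 := fun h0 => by
      have := Lift.dY_mul_dT h
      rw [h0, mul_zero] at this
      exact zero_ne_one this
    have h3 := (mul_eq_zero.1 h1).resolve_right h2
    have h4 : Polynomial.derivative b = 0 := by
      by_cases hn0 : b.natDegree = 0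
      · rw [Polynomial.eq_C_of_natDegree_eq_zero hn0, Polynomial.derivative_C]
      · exact ih _ (hn ▸ Polynomial.natDegree_derivative_lt hn0) _ rfl h3
    have h5 := Polynomial.eq_C_of_derivative_eq_zero h4
    rw [h5, ev_C] at hb
    rw [h5, (injective_iff_map_eq_zero _).1 (xmap_injective Polynomial.C_injective) _ hb, map_zero]

theorem ev_aeval {S : Type*} [CommRing S] [Algebra ℂ S] {η : Hahn S} {c : S}
    (h : ev η P = HahnSeries.C c) (κ : ℂ[X]) :
    ev η (Polynomial.aeval P κ) = HahnSeries.C (Polynomial.aeval c κ) := by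
  have : (ev η).comp (Polynomial.aeval P : ℂ[X] →ₐ[ℂ] ℂ[X][X]).toRingHom =
      (HahnSeries.C).comp (Polynomial.aeval c : ℂ[X] →ₐ[ℂ] S).toRingHom := by
    refine Polynomial.ringHom_ext (fun a => ?_) ?_
    · change ev η (Polynomial.aeval P (Polynomial.C a)) =
        HahnSeries.C (Polynomial.aeval c (Polynomial.C a))
      rw [Polynomial.aeval_C, Polynomial.aeval_C]
      exact ev_C_C η a
    · change ev η (Polynomial.aeval P Polynomial.X) =
        HahnSeries.C (Polynomial.aeval c Polynomial.X)
      rw [Polynomial.aeval_X, Polynomial.aeval_X, h]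
  exact RingHom.congr_fun this κ

theorem Lift.ev_aeval_level {y : Hahn ℂ[X]} {β : ℚ} {g : ℂ} (h : Lift P Q y β g) (κ : ℂ[X]) :
    ev y (Polynomial.aeval P κ) = HahnSeries.C κ := by
  rw [ev_aeval h.root, Polynomial.aeval_X_left_apply]

theorem Keller.eq_aeval (hK : Keller P Q c₀) {b : ℂ[X][X]}
    (hb : ∀ η ∈ rts P tt, Lge 0 (ev η b)) : ∃ κ : ℂ[X], b = Polynomial.aeval P κ := by
  obtain ⟨y, β, g, h⟩ := hK.exists_mem_lifts
  obtain ⟨κ, hκ⟩ := hK.eval_const hb (hK.mem_rts.2 (h.spec_root tt))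
  refine ⟨(ev y b).coeff 0, ev_injective h.root ?_⟩
  rw [h.ev_aeval_level]
  apply hmap_injective (f := (toKb : ℂ[X] →+* Kb)) toKb_injective
  rw [ev_spec, spec_tt] at hκ
  rw [hκ, hmap_C]
  congr 1
  have := congrArg (fun a => a.coeff 0) hκ
  simpa [eq_comm] using this

end Lifts

open Topology

section Glue

/-- A copy of `ℂ` carrying the discrete topology. -/
def DiscreteComplex : Type := ℂ

instance : TopologicalSpace DiscreteComplex := ⊥

instance : DiscreteTopology DiscreteComplex := ⟨rfl⟩

/-- Local functions which agree up to locally constant functions on a simply connected space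
glue to a global one, up to locally constant functions. -/
theorem exists_glue {B : Type*} [TopologicalSpace B] [SimplyConnectedSpace B]
    [LocallyPathConnectedSpace B] (U : B → Set B) (hU : ∀ x, IsOpen (U x)) (hxU : ∀ x, x ∈ U x)
    (f : B → B → ℂ)
    (hf : ∀ i j, ∀ x ∈ U i ∩ U j, ∀ᶠ x' in 𝓝 x, f i x' - f j x' = f i x - f j x) :
    ∃ g : B → ℂ, ∀ i, ∀ x ∈ U i, ∀ᶠ x' in 𝓝 x, g x' - f i x' = g x - f i x := by
  let Z : FiberBundleCore B B DiscreteComplex :=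
    { baseSet := U
      isOpen_baseSet := hU
      indexAt := id
      mem_baseSet_at := hxU
      coordChange := fun i j x v => (id v : ℂ) + (f i x - f j x)
      coordChange_self := fun i x _ v => by
        exact (congrArg (fun a => (id v : ℂ) + a) (sub_self _)).trans (add_zero _)
      continuousOn_coordChange := by
        rintro i j ⟨x, v⟩ ⟨hx, -⟩
        refine ContinuousAt.continuousWithinAt ?_
        refine (continuousAt_const (y := (show DiscreteComplex from (id v : ℂ) + (f i x - f j x)))).congr ?_
        rw [nhds_prod_eq, nhds_discrete DiscreteComplex]
        filter_upwards [(hf i j x hx).prod_mk (show {v} ∈ pure v from rfl)] with y hy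
        rw [show y.2 = v from hy.2]
        exact (congrArg (fun a : ℂ => (id v : ℂ) + a) hy.1).symm
      coordChange_comp := fun i j k x _ v => by
        change (id v : ℂ) + (f i x - f j x) + (f j x - f k x) = (id v : ℂ) + (f i x - f k x)
        ring }
  have hcov : IsCoveringMap (Bundle.TotalSpace.proj : Bundle.TotalSpace DiscreteComplex Z.Fiber → B) :=
    FiberBundle.isCoveringMap
  obtain ⟨x₀⟩ : Nonempty B := inferInstance
  obtain ⟨s, ⟨-, hs⟩, -⟩ := hcov.existsUnique_continuousMap_lifts (ContinuousMap.id B) x₀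
    (⟨x₀, (0 : ℂ)⟩ : Bundle.TotalSpace DiscreteComplex Z.Fiber) rfl
  have hs' (x) : (s x).1 = x := congrFun hs x
  let g₀ (x : B) : ℂ := id (s x).2
  refine ⟨fun x => g₀ x + f x x, fun i x hx => ?_⟩
  have h1 : ContinuousAt (fun x' => (Z.localTriv i (s x')).2) x := by
    refine ContinuousAt.snd ?_
    refine ContinuousAt.comp (g := Z.localTriv i) ?_ s.continuous.continuousAt
    refine (Z.localTriv i).continuousAt ?_
    rw [Z.mem_localTriv_source, ← Z.baseSet_at, hs']
    exact hx
  rw [ContinuousAt, nhds_discrete DiscreteComplex, tendsto_pure] at h1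
  filter_upwards [h1] with x' hx'
  have h2 (x) : (Z.localTriv i (s x)).2 = (g₀ x + (f x x - f i x) : ℂ) := by
    rw [Z.localTriv_apply]
    change g₀ x + (f (s x).1 (s x).1 - f i (s x).1) = _
    rw [hs']
  rw [h2, h2] at hx'
  change g₀ x' + (f x' x' - f i x') = g₀ x + (f x x - f i x) at hx'
  linear_combination hx'

end Glue

section Primitive

variable {X : Type*} [TopologicalSpace X]

/-- `f` has derivative `w` with respect to `Q` at `p`. -/
def Prim (Q w f : X → ℂ) (p : X) : Prop :=
  (fun p' => f p' - f p - (Q p' - Q p) * w p) =o[𝓝 p] fun p' => Q p' - Q p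

/-- `χ` is a local inverse of `Q` near `p`, in which `w` is holomorphic. -/
structure Chart (Q w : X → ℂ) (p : X) (χ : ℂ → X) : Prop where
  base : χ (Q p) = p
  right : ∀ᶠ s in 𝓝 (Q p), Q (χ s) = s
  left : ∀ᶠ p' in 𝓝 p, χ (Q p') = p'
  cont : ∀ᶠ s in 𝓝 (Q p), ContinuousAt χ s
  diff : ∀ᶠ s in 𝓝 (Q p), DifferentiableAt ℂ (w ∘ χ) s

variable {Q w f f₁ f₂ : X → ℂ} {p : X} {χ : ℂ → X}

theorem Prim.sub (h₁ : Prim Q w f₁ p) (h₂ : Prim Q w f₂ p) :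
    Prim Q 0 (fun x => f₁ x - f₂ x) p := by
  refine (Asymptotics.IsLittleO.sub h₁ h₂).congr_left fun p' => ?_
  simp only [Pi.zero_apply]
  ring

theorem Prim.congr (h : Prim Q w f₁ p) (he : ∀ᶠ p' in 𝓝 p, f₂ p' - f₁ p' = f₂ p - f₁ p) :
    Prim Q w f₂ p := by
  refine Asymptotics.IsLittleO.congr' h ?_ EventuallyEq.rfl
  filter_upwards [he] with p' hp
  linear_combination -hp

/-- In a chart, a primitive is an antiderivative. -/
theorem Chart.hasDerivAt (hχ : Chart Q w p χ) (hf : ∀ᶠ p' in 𝓝 p, Prim Q w f p') :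
    ∀ᶠ s in 𝓝 (Q p), HasDerivAt (f ∘ χ) (w (χ s)) s := by
  have hc : Tendsto χ (𝓝 (Q p)) (𝓝 p) := by
    have := hχ.cont.self_of_nhds
    rwa [ContinuousAt, hχ.base] at this
  filter_upwards [hχ.cont, hχ.right.eventually_nhds, hc.eventually hf] with s h1 h2 h3
  rw [hasDerivAt_iff_isLittleO]
  refine (Asymptotics.IsLittleO.comp_tendsto h3 h1).congr' ?_ ?_
  · filter_upwards [h2] with s' hs'
    simp only [Function.comp_apply]
    rw [hs', h2.self_of_nhds, smul_eq_mul]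
  · filter_upwards [h2] with s' hs'
    simp only [Function.comp_apply]
    rw [hs', h2.self_of_nhds]

theorem Chart.zero (hχ : Chart Q w p χ) : Chart Q 0 p χ :=
  ⟨hχ.base, hχ.right, hχ.left, hχ.cont, .of_forall fun _ => differentiableAt_const 0⟩

/-- A function with vanishing derivative is locally constant. -/
theorem Chart.eventually_eq (hχ : Chart Q w p χ) (hQ : ContinuousAt Q p)
    (hf : ∀ᶠ p' in 𝓝 p, Prim Q 0 f p') : ∀ᶠ p' in 𝓝 p, f p' = f p := by
  obtain ⟨ε, hε, h⟩ := Metric.eventually_nhds_iff_ball.1 (hχ.zero.hasDerivAt hf)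
  filter_upwards [hχ.left, hQ.eventually (Metric.ball_mem_nhds _ hε)] with p' h1 h2
  have h3 := (Metric.isOpen_ball (x := Q p) (ε := ε)).is_const_of_deriv_eq_zero
    (convex_ball _ _).isPreconnected (fun s hs => (h s hs).differentiableAt.differentiableWithinAt)
    (fun s hs => (h s hs).deriv) h2 (Metric.mem_ball_self hε)
  rw [Function.comp_apply, Function.comp_apply, h1, hχ.base] at h3
  exact h3

theorem Chart.exists_prim (hχ : Chart Q w p χ) (hQ : ∀ᶠ p' in 𝓝 p, ContinuousAt Q p') :
    ∃ f, ∀ᶠ p' in 𝓝 p, Prim Q w f p' := by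
  obtain ⟨ε, hε, h⟩ := Metric.eventually_nhds_iff_ball.1 hχ.diff
  obtain ⟨W, hW⟩ := (show DifferentiableOn ℂ (w ∘ χ) (Metric.ball (Q p) ε) from
    fun s hs => (h s hs).differentiableWithinAt).isExactOn_ball
  refine ⟨W ∘ Q, ?_⟩
  filter_upwards [hχ.left, hQ, hQ.self_of_nhds.eventually (Metric.ball_mem_nhds _ hε)]
    with p' h1 h2 h3
  have h4 := hasDerivAt_iff_isLittleO.1 (hW _ h3)
  rw [Function.comp_apply, h1] at h4
  exact h4.comp_tendsto h2

end Primitive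

section Planar

theorem isPreconnected_norm_gt {R : ℝ} (hR : 0 < R) : IsPreconnected {z : ℂ | R < ‖z‖} := by
  have h : {z : ℂ | R < ‖z‖} = Complex.exp '' {s : ℂ | Real.log R < s.re} := by
    ext z
    constructor
    · intro hz
      have h0 : z ≠ 0 := norm_pos_iff.1 (hR.trans hz)
      refine ⟨Complex.log z, ?_, Complex.exp_log h0⟩
      rw [Set.mem_ofPred_eq, Complex.log_re]
      exact Real.log_lt_log hR hz
    · rintro ⟨s, hs, rfl⟩
      rw [Set.mem_ofPred_eq, Complex.norm_exp]
      exact (Real.log_lt_iff_lt_exp hR).1 hs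
  rw [h]
  exact (convex_halfSpace_re_gt _).isPreconnected.image _ Complex.continuous_exp.continuousOn

theorem eq_of_eventually_eq {d : ℂ → ℂ} {S : Set ℂ} (hS : IsOpen S) (hc : IsPreconnected S)
    (hd : ∀ x ∈ S, ∀ᶠ x' in 𝓝 x, d x' = d x) {x y : ℂ} (hx : x ∈ S) (hy : y ∈ S) : d x = d y := by
  have h (x) (hx : x ∈ S) : HasDerivAt d 0 x :=
    (hasDerivAt_const x (d x)).congr_of_eventuallyEq (hd x hx)
  exact hS.is_const_of_deriv_eq_zero hc
    (fun x hx => (h x hx).differentiableAt.differentiableWithinAt) (fun x hx => (h x hx).deriv) hx hy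

variable {X : Type*} [TopologicalSpace X] {T : Finset ℂ}

/-- On a planar surface, a holomorphic form having a primitive which vanishes at the ends has a
global primitive whose limit values at the ends form a finite set. -/
theorem exists_global_prim (φ : X ≃ₜ {z : ℂ // z ∉ T}) {Q w : X → ℂ} (hQ : Continuous Q)
    (hχ : ∀ p, ∃ χ, Chart Q w p χ) {ge : X → ℂ} (hge : ∀ᶠ p in cocompact X, Prim Q w ge p) :
    ∃ (g : X → ℂ) (K : Finset ℂ), (∀ p, Prim Q w g p) ∧
      ∀ᶠ p in cocompact X, g p - ge p ∈ K := by
  classical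
  have : T2Space X := φ.isEmbedding.t2Space
  have hT : IsOpen {z : ℂ | z ∉ T} := T.finite_toSet.isClosed.isOpen_compl
  let ψ : X → ℂ := fun p => (φ p).1
  have hψ : IsOpenEmbedding ψ := (hT.isOpenEmbedding_subtypeVal).comp φ.isOpenEmbedding
  have hψr {z : ℂ} (hz : z ∉ T) : ∃ p, ψ p = z := ⟨φ.symm ⟨z, hz⟩, by simp [ψ]⟩
  have hψT (p : X) : ψ p ∉ T := (φ p).2
  obtain ⟨K, hK, hKge⟩ := mem_cocompact.1 hge
  have hK1 : IsClosed (ψ '' K) := (hK.image hψ.continuous).isClosed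
  have hKT {z : ℂ} (hz : z ∈ T) : z ∉ ψ '' K := by
    rintro ⟨p, -, rfl⟩
    exact hψT p hz
  have hgeK {p : X} (hp : ψ p ∉ ψ '' K) : ∀ᶠ p' in 𝓝 p, Prim Q w ge p' := by
    filter_upwards [hK.isClosed.isOpen_compl.mem_nhds
      (show p ∈ Kᶜ from fun h => hp ⟨p, h, rfl⟩)] with p' hp'
    exact hKge hp'
  have hloc (p : X) : ∃ (f : X → ℂ) (U : Set X), IsOpen U ∧ p ∈ U ∧ ∀ p' ∈ U, Prim Q w f p' := by
    obtain ⟨χ, h⟩ := hχ p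
    obtain ⟨f, hf⟩ := h.exists_prim (.of_forall fun _ => hQ.continuousAt)
    obtain ⟨U, hU, hUo, hpU⟩ := eventually_nhds_iff.1 hf
    exact ⟨f, U, hUo, hpU, hU⟩
  choose f U hUo hpU hU using hloc
  have hdiff {f₁ f₂ : X → ℂ} {p : X} (h₁ : ∀ᶠ p' in 𝓝 p, Prim Q w f₁ p')
      (h₂ : ∀ᶠ p' in 𝓝 p, Prim Q w f₂ p') : ∀ᶠ p' in 𝓝 p, f₁ p' - f₂ p' = f₁ p - f₂ p := by
    obtain ⟨χ, h⟩ := hχ p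
    exact h.eventually_eq hQ.continuousAt (h₁.and h₂ |>.mono fun p' h => h.1.sub h.2)
  let q : {z : ℂ // z ∉ T} → X := φ.symm
  have hq (z) : ψ (q z) = z := by simp [ψ, q]
  let U' (z : ℂ) : Set ℂ := if hz : z ∉ T then ψ '' U (q ⟨z, hz⟩) else (ψ '' K)ᶜ
  let h' (z : ℂ) : X → ℂ := if hz : z ∉ T then f (q ⟨z, hz⟩) else ge
  let f' (z : ℂ) : ℂ → ℂ := Function.extend ψ (h' z) 0
  have hf' (z p) : f' z (ψ p) = h' z p := hψ.injective.extend_apply _ _ _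
  have hU'T {z} (hz : z ∉ T) : U' z = ψ '' U (q ⟨z, hz⟩) := dif_pos hz
  have hUT {z} (hz : z ∈ T) : U' z = (ψ '' K)ᶜ := dif_neg (not_not.2 hz)
  have hh' (z) (p : X) (hp : ψ p ∈ U' z) : ∀ᶠ p' in 𝓝 p, Prim Q w (h' z) p' := by
    by_cases hz : z ∈ T
    · rw [hUT hz] at hp
      rw [show h' z = ge from dif_neg (not_not.2 hz)]
      exact hgeK hp
    · rw [hU'T hz] at hp
      rw [show h' z = f (q ⟨z, hz⟩) from dif_pos hz]
      obtain ⟨p₁, hp₁, he⟩ := hp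
      rw [hψ.injective he] at hp₁
      filter_upwards [(hUo _).mem_nhds hp₁] with p' hp'
      exact hU _ p' hp'
  obtain ⟨g, hg⟩ := exists_glue U' (fun z => by
      by_cases hz : z ∈ T
      · rw [hUT hz]; exact hK1.isOpen_compl
      · rw [hU'T hz]; exact hψ.isOpenMap _ (hUo _))
    (fun z => by
      by_cases hz : z ∈ T
      · rw [hUT hz]; exact hKT hz
      · rw [hU'T hz]; exact ⟨_, hpU _, hq _⟩) f' (by
      intro i j x hx
      by_cases hxT : x ∈ T
      · have hi (i) (hx : x ∈ U' i) : i ∈ T := by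
          by_contra hi
          rw [hU'T hi] at hx
          obtain ⟨p, -, rfl⟩ := hx
          exact hψT p hxT
        have : f' i = f' j := by
          simp only [f', h']
          rw [dif_neg (not_not.2 (hi i hx.1)), dif_neg (not_not.2 (hi j hx.2))]
        exact .of_forall fun _ => by rw [this, sub_self, sub_self]
      · obtain ⟨p, rfl⟩ := hψr hxT
        rw [← hψ.map_nhds_eq p, eventually_map]
        simp only [hf']
        exact hdiff (hh' i p hx.1) (hh' j p hx.2))
  have hgprim (p : X) : Prim Q w (g ∘ ψ) p := by
    have h1 : ψ p ∈ U' (ψ p) := by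
      rw [hU'T (hψT p)]; exact ⟨_, hpU _, hq _⟩
    have h2 := hg (ψ p) (ψ p) h1
    rw [← hψ.map_nhds_eq p, eventually_map] at h2
    simp only [hf'] at h2
    exact (hh' _ p h1).self_of_nhds.congr h2
  let d (z : ℂ) : ℂ := g z - Function.extend ψ ge 0 z
  have hdψ (p) : d (ψ p) = g (ψ p) - ge p := by
    simp only [d]
    rw [hψ.injective.extend_apply]
  have hd (x) (hx : x ∉ ψ '' K) : ∀ᶠ x' in 𝓝 x, d x' = d x := by
    by_cases hxT : x ∈ T
    · have h1 := hg x x (by rw [hUT hxT]; exact hx)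
      simp only [f', h'] at h1
      rw [dif_neg (not_not.2 hxT)] at h1
      exact h1
    · obtain ⟨p, rfl⟩ := hψr hxT
      rw [← hψ.map_nhds_eq p, eventually_map]
      simp only [hdψ]
      exact hdiff (.of_forall hgprim) (hgeK hx)
  obtain ⟨R, hR0, hR⟩ : ∃ R, 0 < R ∧ ψ '' K ⊆ Metric.closedBall 0 R := by
    obtain ⟨R, hR⟩ := (hK.image hψ.continuous).isBounded.subset_closedBall 0
    exact ⟨max R 1, by positivity, hR.trans (Metric.closedBall_subset_closedBall (le_max_left _ _))⟩
  have hout : {z : ℂ | R < ‖z‖} ⊆ (ψ '' K)ᶜ := fun z hz hzK => by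
    have := hR hzK
    rw [mem_closedBall_zero_iff] at this
    exact this.not_gt hz
  have hopen : IsOpen {z : ℂ | R < ‖z‖} := isOpen_lt continuous_const continuous_norm
  let z₀ : ℂ := ((R + 1 : ℝ) : ℂ)
  have hz₀ : z₀ ∈ {z : ℂ | R < ‖z‖} := by
    simp only [z₀, Set.mem_ofPred_eq, Complex.norm_real]
    rw [Real.norm_of_nonneg (by linarith)]
    linarith
  have hV (t : ℂ) : ∃ V, IsOpen V ∧ t ∈ V ∧ (t ∈ T → ∀ z ∈ V, d z = d t) := by
    by_cases ht : t ∈ T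
    · obtain ⟨V, hV, hVo, htV⟩ := eventually_nhds_iff.1 (hd t (hKT ht))
      exact ⟨V, hVo, htV, fun _ => hV⟩
    · exact ⟨Set.univ, isOpen_univ, trivial, fun h => (ht h).elim⟩
  choose V hVo htV hV using hV
  have hcpt : IsCompact (ψ ⁻¹' (Metric.closedBall 0 R \ ⋃ t ∈ T, V t)) := by
    refine hψ.isInducing.isCompact_preimage' ?_ ?_
    · exact (isCompact_closedBall (0 : ℂ) R).diff (isOpen_biUnion fun t _ => hVo t)
    · rintro z ⟨-, hz⟩
      refine hψr fun hzT => hz ?_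
      exact Set.mem_biUnion hzT (htV z)
  refine ⟨g ∘ ψ, insert (d z₀) (T.image d), hgprim, mem_cocompact.2 ⟨_, hcpt, fun p hp => ?_⟩⟩
  rw [Set.mem_ofPred_eq, Function.comp_apply, ← hdψ, Finset.mem_insert, Finset.mem_image]
  by_cases hpR : R < ‖ψ p‖
  · exact Or.inl (eq_of_eventually_eq hopen (isPreconnected_norm_gt hR0)
      (fun x hx => hd x (hout hx)) hpR hz₀)
  · have : ψ p ∈ ⋃ t ∈ T, V t := by
      by_contra h
      exact hp ⟨by rw [mem_closedBall_zero_iff]; exact not_lt.1 hpR, h⟩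
    obtain ⟨t, ht, htp⟩ := Set.mem_iUnion₂.1 this
    exact Or.inr ⟨t, ht, (hV t ht _ htp).symm⟩

/-- On a planar surface, a holomorphic form having a primitive which vanishes at the ends is
zero. -/
theorem eq_zero_of_planar (φ : X ≃ₜ {z : ℂ // z ∉ T}) {Q w : X → ℂ} (hQ : Continuous Q)
    (hχ : ∀ p, ∃ χ, Chart Q w p χ) {ge : X → ℂ} (hge : ∀ᶠ p in cocompact X, Prim Q w ge p)
    (hlim : Tendsto ge (cocompact X) (𝓝 0)) (p : X) : w p = 0 := by
  have : T2Space X := φ.isEmbedding.t2Space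
  have hconn : PreconnectedSpace X := by
    have h1 : IsPreconnected ((T : Set ℂ)ᶜ) :=
      (T.countable_toSet.isConnected_compl_of_one_lt_rank
        (by rw [Complex.rank_real_complex]; norm_num)).isPreconnected
    have h2 : PreconnectedSpace {z : ℂ // z ∉ T} := isPreconnected_iff_preconnectedSpace.1 h1
    have h3 := isPreconnected_range φ.symm.continuous
    rw [φ.symm.surjective.range_eq] at h3
    exact ⟨h3⟩
  obtain ⟨g, K, hg, hgK⟩ := exists_global_prim φ hQ hχ hge
  have hgc : Continuous g := by
    refine continuous_iff_continuousAt.2 fun p => ?_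
    obtain ⟨χ, h⟩ := hχ p
    have h1 := (h.hasDerivAt (.of_forall hg)).self_of_nhds.continuousAt.comp_of_eq
      hQ.continuousAt rfl
    refine h1.congr ?_
    filter_upwards [h.left] with p' hp'
    simp only [Function.comp_apply, hp']
  let A : Set X := {p | ∀ᶠ p' in 𝓝 p, w p' = 0}
  have hA : IsClopen A := by
    refine ⟨isClosed_of_closure_subset fun p hp => ?_,
      isOpen_iff_mem_nhds.2 fun p hp => eventually_eventually_nhds.2 hp⟩
    obtain ⟨χ, h⟩ := hχ p
    rcases (Complex.analyticAt_iff_eventually_differentiableAt.2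
      h.diff).eventually_eq_zero_or_eventually_ne_zero with h1 | h1
    · filter_upwards [h.left, hQ.continuousAt.eventually h1] with p' h2 h3
      rwa [Function.comp_apply, h2] at h3
    · by_contra hpA
      have h2 : ∀ᶠ p' in 𝓝 p, p' ≠ p → w p' ≠ 0 := by
        filter_upwards [h.left, hQ.continuousAt.eventually (eventually_nhdsWithin_iff.1 h1)]
          with p' h2 h3 hne
        rw [Function.comp_apply, h2] at h3
        refine h3 fun he => hne ?_
        rw [← h2, ← h.base]
        exact congrArg χ he
      obtain ⟨p', hp', hp'A⟩ := mem_closure_iff_nhds.1 hp _ h2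
      by_cases hne : p' = p
      · exact hpA (hne ▸ hp'A)
      · exact hp' hne (Eventually.self_of_nhds (p := fun x => w x = 0) hp'A)
  by_contra hp
  have hA0 : A = ∅ := by
    by_contra hne
    have := hA.eq_univ (Set.nonempty_iff_ne_empty.2 hne)
    exact hp (Eventually.self_of_nhds (p := fun x => w x = 0) (this ▸ Set.mem_univ p : p ∈ A))
  have hopen : IsOpen (Set.range g) := by
    refine isOpen_iff_mem_nhds.2 ?_
    rintro _ ⟨p, rfl⟩
    obtain ⟨χ, h⟩ := hχ p
    have h1 := h.hasDerivAt (.of_forall hg)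
    rcases (Complex.analyticAt_iff_eventually_differentiableAt.2
      (h1.mono fun s hs => hs.differentiableAt)).eventually_constant_or_nhds_le_map_nhds with h2 | h2
    · have : p ∈ A := by
        have h3 : ∀ᶠ s in 𝓝 (Q p), w (χ s) = 0 := by
          filter_upwards [h1, h2.eventually_nhds] with s h3 h4
          refine h3.unique ((hasDerivAt_const s ((g ∘ χ) (Q p))).congr_of_eventuallyEq h4)
        filter_upwards [h.left, hQ.continuousAt.eventually h3] with p' h4 h5
        rwa [h4] at h5
      rw [hA0] at this
      exact this.elim
    · rw [Function.comp_apply, h.base] at h2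
      refine h2 (mem_map.2 (univ_mem' fun s => ⟨χ s, rfl⟩))
  have hKclosed : IsClosed (K : Set ℂ) := K.finite_toSet.isClosed
  have hclos {v : ℂ} (hv : v ∈ closure (Set.range g)) : v ∈ Set.range g ∪ K := by
    by_cases hvK : v ∈ (K : Set ℂ)
    · exact Or.inr hvK
    left
    obtain ⟨ε, hε, hεK⟩ := Metric.isOpen_iff.1 hKclosed.isOpen_compl v hvK
    obtain ⟨C, hC, hCg⟩ := mem_cocompact.1 (hgK.and (hlim.eventually
      (Metric.ball_mem_nhds 0 (half_pos hε))))
    have h1 : v ∈ closure (g '' C) := by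
      rw [Metric.mem_closure_iff] at hv ⊢
      intro δ hδ
      obtain ⟨_, ⟨p, rfl⟩, hb⟩ := hv (min δ (ε / 2)) (lt_min hδ (half_pos hε))
      refine ⟨g p, ⟨p, ?_, rfl⟩, hb.trans_le (min_le_left _ _)⟩
      by_contra hpC
      obtain ⟨h2, h3⟩ := hCg hpC
      refine hεK ?_ h2
      rw [Metric.mem_ball, dist_comm]
      have h4 : dist (g p) (g p - ge p) = dist (ge p) 0 := by
        rw [dist_eq_norm, dist_eq_norm]; congr 1; ring
      have h5 := dist_triangle v (g p) (g p - ge p)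
      have h6 := hb.trans_le (min_le_right _ _)
      linarith
    rw [(hC.image hgc).isClosed.closure_eq] at h1
    exact Set.image_subset_range _ _ h1
  have hbdd : Bornology.IsBounded (Set.range g) := by
    obtain ⟨C, hC, hCg⟩ := mem_cocompact.1 (hgK.and (hlim.eventually
      (Metric.ball_mem_nhds 0 one_pos)))
    obtain ⟨r, hr⟩ := K.finite_toSet.isBounded.subset_closedBall 0
    refine ((hC.image hgc).isBounded.union (Metric.isBounded_closedBall (x := 0) (r := r + 1))).subset ?_
    rintro _ ⟨p, rfl⟩
    by_cases hpC : p ∈ C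
    · exact Or.inl ⟨p, hpC, rfl⟩
    · right
      obtain ⟨h2, h3⟩ := hCg hpC
      have h4 := hr h2
      rw [mem_closedBall_zero_iff] at h4 ⊢
      rw [dist_zero_right] at h3
      calc ‖g p‖ = ‖(g p - ge p) + ge p‖ := by rw [sub_add_cancel]
        _ ≤ _ := norm_add_le _ _
        _ ≤ _ := by linarith
  have hKc : IsPreconnected ((K : Set ℂ)ᶜ) :=
    (K.countable_toSet.isConnected_compl_of_one_lt_rank
      (by rw [Complex.rank_real_complex]; norm_num)).isPreconnected
  have hv : IsOpen (Set.range g ∪ K)ᶜ := by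
    refine (isClosed_of_closure_subset fun v hv => ?_).isOpen_compl
    rw [closure_union, hKclosed.closure_eq] at hv
    exact hv.elim hclos Or.inr
  obtain ⟨x, -, hx1, hx2⟩ := hKc (Set.range g) (Set.range g ∪ K)ᶜ hopen hv
    (fun x hx => by
      by_cases h : x ∈ Set.range g
      · exact Or.inl h
      · exact Or.inr fun h' => h'.elim h hx)
    (by
      have h1 : (Set.range g).Infinite := infinite_of_mem_nhds (g p) (hopen.mem_nhds ⟨p, rfl⟩)
      obtain ⟨x, hx, hxK⟩ := (h1.sdiff K.finite_toSet).nonempty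
      exact ⟨x, hxK, hx⟩)
    (by
      by_contra hne
      refine NormedSpace.unbounded_univ ℂ ℂ ((hbdd.union K.finite_toSet.isBounded).subset ?_)
      intro x _
      by_contra hx
      exact hne ⟨x, fun h => hx (Or.inr h), hx⟩)
  exact hx2 (Or.inl hx1)

end Planar

section Curve

/-- Evaluation at a point of the plane. -/
noncomputable def at₂ (b : ℂ[X][X]) (p : ℂ × ℂ) : ℂ := Polynomial.evalEval p.1 p.2 b

theorem at₂_def (b : ℂ[X][X]) (p : ℂ × ℂ) :
    at₂ b p = Polynomial.evalEvalRingHom p.1 p.2 b := rfl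

@[simp] theorem at₂_add (a b : ℂ[X][X]) (p : ℂ × ℂ) : at₂ (a + b) p = at₂ a p + at₂ b p := by
  simp [at₂_def]

@[simp] theorem at₂_sub (a b : ℂ[X][X]) (p : ℂ × ℂ) : at₂ (a - b) p = at₂ a p - at₂ b p := by
  simp [at₂_def]

@[simp] theorem at₂_mul (a b : ℂ[X][X]) (p : ℂ × ℂ) : at₂ (a * b) p = at₂ a p * at₂ b p := by
  simp [at₂_def]

@[simp] theorem at₂_C (a : ℂ[X]) (p : ℂ × ℂ) : at₂ (Polynomial.C a) p = a.eval p.1 := by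
  exact Polynomial.evalEval_C ..

@[simp] theorem at₂_X (p : ℂ × ℂ) : at₂ Polynomial.X p = p.2 := by
  simp [at₂]

@[simp] theorem at₂_pow (a : ℂ[X][X]) (n : ℕ) (p : ℂ × ℂ) : at₂ (a ^ n) p = at₂ a p ^ n := by
  simp [at₂_def]

theorem at₂_contDiff (b : ℂ[X][X]) : ContDiff ℂ 1 (at₂ b) := by
  induction b using Polynomial.induction_on' with
  | add a b ha hb =>
    rw [show at₂ (a + b) = fun p => at₂ a p + at₂ b p from funext fun p => at₂_add a b p]
    exact ha.add hb
  | monomial n a =>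
    rw [show at₂ (Polynomial.monomial n a) = fun p => a.eval p.1 * p.2 ^ n from funext fun p => by
      rw [← Polynomial.C_mul_X_pow_eq_monomial]; simp]
    have h : ContDiff ℂ 1 fun z : ℂ => a.eval z := by
      simpa only [Polynomial.coe_aeval_eq_eval] using Polynomial.contDiff_aeval (𝕜 := ℂ) a 1
    exact (h.comp contDiff_fst).mul (contDiff_snd.pow n)

theorem at₂_continuous (b : ℂ[X][X]) : Continuous (at₂ b) := (at₂_contDiff b).continuous

theorem at₂_hasFDerivAt (b : ℂ[X][X]) (p : ℂ × ℂ) :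
    HasFDerivAt (at₂ b) (at₂ (dX ℂ b) p • ContinuousLinearMap.fst ℂ ℂ ℂ +
      at₂ (dY ℂ b) p • ContinuousLinearMap.snd ℂ ℂ ℂ) p := by
  induction b using Polynomial.induction_on' with
  | add a b ha hb =>
    rw [show at₂ (a + b) = fun p => at₂ a p + at₂ b p from funext fun p => at₂_add a b p]
    refine (ha.add hb).congr_fderiv ?_
    simp only [map_add, at₂_add]
    module
  | monomial n a =>
    rw [show at₂ (Polynomial.monomial n a) = fun p => a.eval p.1 * p.2 ^ n from funext fun p => by
      rw [← Polynomial.C_mul_X_pow_eq_monomial]; simp]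
    have h1 : HasFDerivAt (fun p : ℂ × ℂ => a.eval p.1)
        ((Polynomial.derivative a).eval p.1 • ContinuousLinearMap.fst ℂ ℂ ℂ) p :=
      ((a.hasDerivAt p.1).comp_hasFDerivAt p hasFDerivAt_fst)
    have h2 : HasFDerivAt (fun p : ℂ × ℂ => p.2 ^ n)
        ((n * p.2 ^ (n - 1)) • ContinuousLinearMap.snd ℂ ℂ ℂ) p :=
      ((hasDerivAt_pow n p.2).comp_hasFDerivAt p hasFDerivAt_snd)
    refine (h1.mul h2).congr_fderiv ?_
    rw [← Polynomial.C_mul_X_pow_eq_monomial]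
    simp only [Derivation.leibniz, Derivation.leibniz_pow, dX_C, dX_X, dY_C, dY_X, smul_eq_mul,
      nsmul_eq_mul, mul_zero, mul_one, add_zero, zero_add, at₂_mul, at₂_pow, at₂_X, at₂_C]
    have h3 : at₂ ((n : ℂ[X][X])) p = n := by simp [at₂_def]
    rw [h3]
    module

theorem at₂_jac_eq (a b : ℂ[X][X]) (p : ℂ × ℂ) : at₂ (jac a b) p =
    at₂ (dX ℂ a) p * at₂ (dY ℂ b) p - at₂ (dY ℂ a) p * at₂ (dX ℂ b) p := by
  simp [jac]

/-- The invertible linear map with given rows. -/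
noncomputable def rowsEquiv (a b c d : ℂ) (h : a * d - b * c ≠ 0) : (ℂ × ℂ) ≃L[ℂ] (ℂ × ℂ) :=
  ContinuousLinearEquiv.equivOfInverse
    ((a • ContinuousLinearMap.fst ℂ ℂ ℂ + b • ContinuousLinearMap.snd ℂ ℂ ℂ).prod
      (c • ContinuousLinearMap.fst ℂ ℂ ℂ + d • ContinuousLinearMap.snd ℂ ℂ ℂ))
    ((a * d - b * c)⁻¹ • (d • ContinuousLinearMap.fst ℂ ℂ ℂ - b • ContinuousLinearMap.snd ℂ ℂ ℂ).prod
      (a • ContinuousLinearMap.snd ℂ ℂ ℂ - c • ContinuousLinearMap.fst ℂ ℂ ℂ))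
    (fun v => by
      ext
      · simp; field_simp; ring
      · simp; field_simp; ring)
    (fun v => by
      ext
      · simp; field_simp; ring
      · simp; field_simp; rw [div_eq_iff (by convert h using 1; ring)]; ring)

/-- The level curve of a polynomial. -/
abbrev Level (P : ℂ[X][X]) (c : ℂ) : Type := {p : ℂ × ℂ // at₂ P p = c}

variable {P : ℂ[X][X]} {c : ℂ}

/-- Local inverses of polynomials on a level curve. -/
theorem exists_chart (b : ℂ[X][X]) (p : Level P c) (h : at₂ (jac P b) p ≠ 0) :
    ∃ χ : ℂ → Level P c, χ (at₂ b p) = p ∧ (∀ᶠ s in 𝓝 (at₂ b p), at₂ b (χ s) = s) ∧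
      (∀ᶠ p' : Level P c in 𝓝 p, χ (at₂ b p') = p') ∧ (∀ᶠ s in 𝓝 (at₂ b p), ContinuousAt χ s) ∧
      ∀ᶠ s in 𝓝 (at₂ b p), DifferentiableAt ℂ (fun s => (χ s : ℂ × ℂ)) s := by
  classical
  obtain ⟨p, hp⟩ := p
  simp only at h ⊢
  rw [at₂_jac_eq] at h
  let F : ℂ × ℂ → ℂ × ℂ := fun p => (at₂ P p, at₂ b p)
  let e := rowsEquiv _ _ _ _ h
  have hFc : ContDiff ℂ 1 F := (at₂_contDiff P).prodMk (at₂_contDiff b)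
  have hF : HasFDerivAt F (e : (ℂ × ℂ) →L[ℂ] (ℂ × ℂ)) p :=
    (at₂_hasFDerivAt P p).prodMk (at₂_hasFDerivAt b p)
  have hS : HasStrictFDerivAt F (e : (ℂ × ℂ) →L[ℂ] (ℂ × ℂ)) p :=
    hFc.contDiffAt.hasStrictFDerivAt' hF one_ne_zero
  let g := hS.localInverse F e p
  have hgp : g (c, at₂ b p) = p := by rw [← hp]; exact hS.localInverse_apply_image
  have hgr : ∀ᶠ v in 𝓝 (c, at₂ b p), F (g v) = v := by
    rw [← hp]; exact hS.eventually_right_inverse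
  have hgl : ∀ᶠ v in 𝓝 p, g (F v) = v := hS.eventually_left_inverse
  have hgd : ContDiffAt ℂ 1 g (c, at₂ b p) := by
    have := hFc.contDiffAt.to_localInverse (n := 1) hF one_ne_zero
    rw [← hp]; exact this
  have hι : Continuous fun s : ℂ => ((c, s) : ℂ × ℂ) := by fun_prop
  have hgd' : ∀ᶠ v in 𝓝 (c, at₂ b p), ContDiffAt ℂ 1 g v := hgd.eventually (by simp)
  let χ : ℂ → Level P c := fun s => if h : at₂ P (g (c, s)) = c then ⟨g (c, s), h⟩ else ⟨p, hp⟩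
  have hχ : ∀ᶠ s in 𝓝 (at₂ b p), (χ s : ℂ × ℂ) = g (c, s) := by
    filter_upwards [hι.continuousAt.eventually hgr] with s hs
    have h1 : at₂ P (g (c, s)) = c := congrArg Prod.fst hs
    simp only [χ, dif_pos h1]
  refine ⟨χ, Subtype.ext ?_, ?_, ?_, ?_, ?_⟩
  · rw [hχ.self_of_nhds, hgp]
  · filter_upwards [hχ, hι.continuousAt.eventually hgr] with s h1 h2
    rw [h1]
    exact congrArg Prod.snd h2
  · filter_upwards [(continuous_subtype_val.continuousAt (x := (⟨p, hp⟩ : Level P c))).eventually hgl] with p' h2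
    apply Subtype.ext
    have h3 : g (c, at₂ b p') = p' := by
      have : F p' = (c, at₂ b p') := Prod.ext p'.2 rfl
      rw [← this, h2]
    have h4 : at₂ P (g (c, at₂ b p')) = c := by rw [h3]; exact p'.2
    simp only [χ, dif_pos h4, h3]
  · filter_upwards [hχ.eventually_nhds, hι.continuousAt.eventually hgd'] with s h1 h2
    rw [IsInducing.continuousAt_iff (f := χ) (g := (Subtype.val : Level P c → ℂ × ℂ)) ⟨rfl⟩]
    exact ((ContinuousAt.comp (f := fun s : ℂ => ((c, s) : ℂ × ℂ)) h2.continuousAt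
      hι.continuousAt)).congr (h1.mono fun s hs => hs.symm)
  · filter_upwards [hχ.eventually_nhds, hι.continuousAt.eventually hgd'] with s h1 h2
    have h3 : DifferentiableAt ℂ (fun s : ℂ => ((c, s) : ℂ × ℂ)) s := by fun_prop
    exact (DifferentiableAt.comp s (h2.differentiableAt one_ne_zero) h3).congr_of_eventuallyEq h1

end Curve

section Ends

variable {X : Type*} [TopologicalSpace X]

/-- `γ` lifts the exponential function on a half-plane along `f`. -/
def EndLift (f : X → ℂ) (a : ℝ) (γ : ℂ → X) : Prop :=
  ∀ s : ℂ, a < s.re → f (γ s) = Complex.exp s ∧ ContinuousAt γ s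

variable {f : X → ℂ} {a : ℝ} {γ γ' : ℂ → X}

theorem isOpen_halfPlane (a : ℝ) : IsOpen {s : ℂ | a < s.re} :=
  isOpen_lt continuous_const Complex.continuous_re

theorem norm_exp_mem {s : ℂ} (hs : a < s.re) : Complex.exp s ∈ {z : ℂ | Real.exp a < ‖z‖} := by
  rw [Set.mem_ofPred_eq, Complex.norm_exp]
  exact Real.exp_lt_exp.2 hs

theorem EndLift.exists_of_isCoveringMapOn
    (hf : IsCoveringMapOn f {z | Real.exp a < ‖z‖}) {p : X} {s : ℂ} (hs : a < s.re)
    (hp : f p = Complex.exp s) : ∃ γ, EndLift f a γ ∧ γ s = p := by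
  classical
  have h1 := hf.isCoveringMap_restrictPreimage
  have : SimplyConnectedSpace {s : ℂ | a < s.re} := by
    have := (convex_halfSpace_re_gt a).contractibleSpace ⟨s, hs⟩
    infer_instance
  have : LocallyPathConnectedSpace {s : ℂ | a < s.re} :=
    (isOpen_halfPlane a).locallyPathConnectedSpace
  let e : C({s : ℂ | a < s.re}, {z : ℂ | Real.exp a < ‖z‖}) :=
    ⟨fun s => ⟨Complex.exp s, norm_exp_mem s.2⟩, by fun_prop⟩
  have hpm : p ∈ f ⁻¹' {z | Real.exp a < ‖z‖} := by
    rw [Set.mem_preimage, hp]; exact norm_exp_mem hs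
  obtain ⟨F, ⟨hF, hFe⟩, -⟩ := h1.existsUnique_continuousMap_lifts e ⟨s, hs⟩ ⟨p, hpm⟩
    (Subtype.ext hp)
  refine ⟨fun z => if h : a < z.re then (F ⟨z, h⟩ : X) else p, ?_, ?_⟩
  · intro z hz
    constructor
    · simp only [dif_pos hz]
      exact congrArg Subtype.val (congrFun hFe ⟨z, hz⟩)
    · have h2 : ContinuousOn (fun z => if h : a < z.re then (F ⟨z, h⟩ : X) else p)
          {s : ℂ | a < s.re} := by
        rw [continuousOn_iff_continuous_domRestrict]
        refine (continuous_subtype_val.comp F.continuous).congr fun z => ?_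
        have h3 : a < (z : ℂ).re := z.2
        simp only [Set.domRestrict_apply, Function.comp_apply, dif_pos h3]
      exact h2.continuousAt ((isOpen_halfPlane a).mem_nhds hz)
  · simp only [dif_pos hs, hF]

theorem EndLift.eq_of_isCoveringMapOn
    (hf : IsCoveringMapOn f {z | Real.exp a < ‖z‖}) (h : EndLift f a γ) (h' : EndLift f a γ')
    {s : ℂ} (hs : a < s.re) (heq : γ s = γ' s) {z : ℂ} (hz : a < z.re) : γ z = γ' z := by
  have h1 := hf.isCoveringMap_restrictPreimage
  have : PreconnectedSpace {s : ℂ | a < s.re} :=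
    isPreconnected_iff_preconnectedSpace.1 (convex_halfSpace_re_gt a).isPreconnected
  have hm {γ : ℂ → X} (h : EndLift f a γ) (s : {s : ℂ | a < s.re}) :
      γ s ∈ f ⁻¹' {z | Real.exp a < ‖z‖} := by
    rw [Set.mem_preimage, (h s s.2).1]; exact norm_exp_mem s.2
  have hc {γ : ℂ → X} (h : EndLift f a γ) : Continuous fun s : {s : ℂ | a < s.re} =>
      (⟨γ s, hm h s⟩ : f ⁻¹' {z | Real.exp a < ‖z‖}) := by
    refine continuous_iff_continuousAt.2 fun s => ?_
    rw [IsInducing.subtypeVal.continuousAt_iff]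
    exact ContinuousAt.comp (f := Subtype.val) (g := γ) (h s s.2).2 continuousAt_subtype_val
  have h2 := h1.eq_of_comp_eq (hc h) (hc h') (funext fun s => Subtype.ext
    ((h s s.2).1.trans (h' s s.2).1.symm)) ⟨s, hs⟩ (Subtype.ext heq)
  exact congrArg Subtype.val (congrFun h2 ⟨z, hz⟩)

theorem EndLift.shift (h : EndLift f a γ) (k : ℤ) :
    EndLift f a fun s => γ (s + k * (2 * Real.pi * Complex.I)) := by
  intro s hs
  have h1 : a < (s + k * (2 * Real.pi * Complex.I)).re := by simpa using hs
  refine ⟨?_, ?_⟩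
  · rw [(h _ h1).1, Complex.exp_eq_exp_iff_exists_int]
    exact ⟨k, rfl⟩
  · exact ContinuousAt.comp (g := γ) (f := fun s : ℂ => s + k * (2 * Real.pi * Complex.I))
      (h _ h1).2 (by fun_prop)

end Ends

section HalfPlane

/-- `G` is an exponentially decaying antiderivative of `h` on a half-plane. -/
def DecayPrim (h : ℂ → ℂ) (a C ε : ℝ) (G : ℂ → ℂ) : Prop :=
  ∀ s : ℂ, a < s.re → HasDerivAt G (h s) s ∧ ‖G s‖ ≤ C * Real.exp (-(ε * s.re))

variable {h h' G G' : ℂ → ℂ} {a C ε : ℝ}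

theorem DecayPrim.shift (hG : DecayPrim h a C ε G) {w : ℂ} (hw : w.re = 0) :
    DecayPrim (fun s => h (s + w)) a C ε fun s => G (s + w) := by
  intro s hs
  have h1 : (s + w).re = s.re := by simp [hw]
  have h2 := hG (s + w) (by rwa [h1])
  exact ⟨h2.1.comp_add_const s w, by rw [← h1]; exact h2.2⟩

theorem DecayPrim.unique (hε : 0 < ε) (hG : DecayPrim h a C ε G) (hG' : DecayPrim h' a C ε G')
    (hh : ∀ s : ℂ, a < s.re → h s = h' s) {s : ℂ} (hs : a < s.re) : G s = G' s := by
  have hd (z : ℂ) (hz : a < z.re) : HasDerivAt (fun z => G z - G' z) 0 z := by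
    have := (hG z hz).1.sub (hG' z hz).1
    rwa [hh z hz, sub_self] at this
  have hc (n : ℕ) : G (s + n) - G' (s + n) = G s - G' s :=
    (isOpen_halfPlane a).is_const_of_deriv_eq_zero (convex_halfSpace_re_gt a).isPreconnected
      (fun z hz => (hd z hz).differentiableAt.differentiableWithinAt) (fun z hz => (hd z hz).deriv)
      (x := s + n) (y := s) (by
        rw [Set.mem_ofPred_eq, Complex.add_re, Complex.natCast_re]
        have : (0 : ℝ) ≤ n := n.cast_nonneg
        linarith) hs
  have hb (n : ℕ) : ‖G s - G' s‖ ≤ 2 * (C * Real.exp (-(ε * (s.re + n)))) := by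
    have h1 : a < (s + n).re := by
      rw [Complex.add_re, Complex.natCast_re]
      have : (0 : ℝ) ≤ n := n.cast_nonneg
      linarith
    have h2 := (hG _ h1).2
    have h3 := (hG' _ h1).2
    rw [Complex.add_re, Complex.natCast_re] at h2 h3
    rw [← hc n]
    exact (norm_sub_le _ _).trans (by linarith)
  have ht : Tendsto (fun n : ℕ => 2 * (C * Real.exp (-(ε * (s.re + n))))) atTop (𝓝 (2 * (C * 0))) := by
    refine Tendsto.const_mul _ (Tendsto.const_mul _ ?_)
    exact Real.tendsto_exp_neg_atTop_nhds_zero.comp (Tendsto.const_mul_atTop hε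
      (tendsto_atTop_add_const_left _ _ tendsto_natCast_atTop_atTop))
  have h0 := ge_of_tendsto' ht hb
  rw [mul_zero, mul_zero] at h0
  exact sub_eq_zero.1 (norm_le_zero_iff.1 h0)

theorem exists_decayPrim (hε : 0 < ε) (hd : ∀ s : ℂ, a < s.re → DifferentiableAt ℂ h s)
    (hb : ∀ s : ℂ, a < s.re → ‖h s‖ ≤ C * Real.exp (-(ε * s.re))) :
    ∃ G, DecayPrim h a (C / (1 - Real.exp (-ε))) ε G := by
  obtain ⟨G₀, hG₀⟩ := (convex_halfSpace_re_gt a).exists_forall_hasDerivWithinAt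
    (fun s hs => (hd s hs).differentiableWithinAt)
  replace hG₀ (s : ℂ) (hs : a < s.re) : HasDerivAt G₀ (h s) s :=
    (hG₀ s hs).hasDerivAt ((isOpen_halfPlane a).mem_nhds hs)
  have hC {s : ℂ} (hs : a < s.re) : 0 ≤ C := by
    have := (norm_nonneg _).trans (hb s hs)
    exact nonneg_of_mul_nonneg_left this (Real.exp_pos _)
  have hmv {b : ℝ} (hab : a < b) {s z : ℂ} (hs : b ≤ s.re) (hz : b ≤ z.re) :
      ‖G₀ z - G₀ s‖ ≤ C * Real.exp (-(ε * b)) * ‖z - s‖ := by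
    have hC' := hC (hab.trans_le hs)
    refine Convex.norm_image_sub_le_of_norm_hasDerivWithin_le (f' := h)
      (s := {s : ℂ | b ≤ s.re}) (fun x hx => (hG₀ x (hab.trans_le hx)).hasDerivWithinAt)
      (fun x hx => ?_) (convex_halfSpace_re_ge b) hs hz
    refine (hb x (hab.trans_le hx)).trans ?_
    gcongr
    exact hx
  have hre (s : ℂ) (n : ℕ) : (s + n).re = s.re + n := by simp
  have hmem {s : ℂ} (hs : a < s.re) (n : ℕ) : a < (s + n).re := by
    rw [hre]
    have : (0 : ℝ) ≤ n := n.cast_nonneg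
    linarith
  have he1 : Real.exp (-ε) < 1 := by rw [Real.exp_lt_one_iff]; linarith
  have hstep {s : ℂ} (hs : a < s.re) (n : ℕ) :
      dist (G₀ (s + n)) (G₀ (s + (n + 1 : ℕ))) ≤ C * Real.exp (-(ε * s.re)) * Real.exp (-ε) ^ n := by
    rw [dist_comm, dist_eq_norm]
    refine (hmv (hmem hs n) le_rfl (by rw [hre, hre]; push_cast; linarith)).trans ?_
    have h1 : s + ((n + 1 : ℕ) : ℂ) - (s + n) = 1 := by push_cast; ring
    rw [h1, norm_one, mul_one, ← Real.exp_nat_mul, mul_assoc C, ← Real.exp_add, hre]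
    apply le_of_eq
    congr 2; ring
  have hlim {s : ℂ} (hs : a < s.re) : ∃ L, Tendsto (fun n : ℕ => G₀ (s + n)) atTop (𝓝 L) :=
    cauchySeq_tendsto_of_complete (cauchySeq_of_le_geometric _ _ he1 (hstep hs))
  by_cases hne : ∃ s : ℂ, a < s.re
  swap
  · exact ⟨0, fun s hs => absurd ⟨s, hs⟩ hne⟩
  obtain ⟨s₀, hs₀⟩ := hne
  obtain ⟨L, hL⟩ := hlim hs₀
  have hL' {s : ℂ} (hs : a < s.re) : Tendsto (fun n : ℕ => G₀ (s + n)) atTop (𝓝 L) := by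
    have h1 : Tendsto (fun n : ℕ => G₀ (s + n) - G₀ (s₀ + n)) atTop (𝓝 0) := by
      rw [tendsto_zero_iff_norm_tendsto_zero]
      have ht : Tendsto (fun n : ℕ => C * Real.exp (-(ε * (min s.re s₀.re + n))) * ‖s - s₀‖) atTop
          (𝓝 (C * 0 * ‖s - s₀‖)) := by
        refine Tendsto.mul_const _ (Tendsto.const_mul _ ?_)
        exact Real.tendsto_exp_neg_atTop_nhds_zero.comp (Tendsto.const_mul_atTop hε
          (tendsto_atTop_add_const_left _ _ tendsto_natCast_atTop_atTop))
      rw [mul_zero, zero_mul] at ht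
      refine squeeze_zero (fun _ => norm_nonneg _) (fun n => ?_) ht
      have h2 := hmv (b := min s.re s₀.re + n) (s := s₀ + n) (z := s + n) (by
          have := lt_min hs hs₀
          have h3 : (0 : ℝ) ≤ n := n.cast_nonneg
          linarith) (by rw [hre]; gcongr; exact min_le_right _ _)
        (by rw [hre]; gcongr; exact min_le_left _ _)
      rwa [add_sub_add_right_eq_sub] at h2
    have h2 := h1.add hL
    rw [zero_add] at h2
    exact h2.congr fun n => by ring
  refine ⟨fun s => G₀ s - L, fun s hs => ⟨(hG₀ s hs).sub_const L, ?_⟩⟩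
  have h1 := dist_le_of_le_geometric_of_tendsto₀ _ _ he1 (hstep hs) (hL' hs)
  rw [Nat.cast_zero, add_zero, dist_eq_norm] at h1
  exact h1.trans (le_of_eq (by ring))

end HalfPlane

section EndPrimitive

variable {X : Type*} [TopologicalSpace X] {f ψ : X → ℂ} {a C ε : ℝ}

/-- A form decaying faster than `1 / f` at the ends has a primitive vanishing at the ends. -/
theorem exists_end_prim (hε : 0 < ε) (hcov : IsCoveringMapOn f {z | Real.exp a < ‖z‖}) (hfc : Continuous f)
    (hχ : ∀ p, Real.exp a < ‖f p‖ → ∃ χ, Chart f ψ p χ)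
    (hb : ∀ p, Real.exp a < ‖f p‖ → ‖ψ p‖ ≤ C * ‖f p‖ ^ (-(1 + ε))) :
    ∃ (ge : X → ℂ) (C' : ℝ), ∀ p, Real.exp a < ‖f p‖ →
      Prim f ψ ge p ∧ ‖ge p‖ ≤ C' * ‖f p‖ ^ (-ε) := by
  classical
  let h (γ : ℂ → X) : ℂ → ℂ := fun s => ψ (γ s) * Complex.exp s
  set C' := C / (1 - Real.exp (-ε)) with hC'
  have hfp {γ : ℂ → X} (hγ : EndLift f a γ) {s : ℂ} (hs : a < s.re) :
      Real.exp a < ‖f (γ s)‖ := by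
    rw [(hγ s hs).1]; exact norm_exp_mem hs
  have hG {γ : ℂ → X} (hγ : EndLift f a γ) : ∃ G, DecayPrim (h γ) a C' ε G := by
    refine exists_decayPrim hε (fun s hs => ?_) (fun s hs => ?_)
    · obtain ⟨χ, hχ⟩ := hχ (γ s) (hfp hγ hs)
      have h1 := hχ.diff.self_of_nhds
      rw [(hγ s hs).1] at h1
      have h2 : DifferentiableAt ℂ (fun s => (ψ ∘ χ) (Complex.exp s)) s :=
        DifferentiableAt.comp (g := ψ ∘ χ) s h1 Complex.differentiableAt_exp
      refine DifferentiableAt.mul (h2.congr_of_eventuallyEq ?_) Complex.differentiableAt_exp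
      filter_upwards [(hγ s hs).2.eventually hχ.left, (isOpen_halfPlane a).mem_nhds hs] with z h3 h4
      rw [(hγ z h4).1] at h3
      rw [Function.comp_apply, h3]
    · have h1 := hb (γ s) (hfp hγ hs)
      rw [(hγ s hs).1, Complex.norm_exp] at h1
      simp only [h]
      rw [norm_mul, Complex.norm_exp]
      calc _ ≤ C * Real.exp s.re ^ (-(1 + ε)) * Real.exp s.re := by gcongr
        _ = _ := by
          rw [← Real.exp_mul, mul_assoc, ← Real.exp_add]
          congr 2; ring
  have hlog {z : ℂ} (hz : Real.exp a < ‖z‖) : z ≠ 0 ∧ a < (Complex.log z).re := by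
    have h0 := (Real.exp_pos a).trans hz
    exact ⟨norm_pos_iff.1 h0, by rw [Complex.log_re]; exact (Real.lt_log_iff_exp_lt h0).2 hz⟩
  have hex (p : X) : ∃ (γ G : ℂ → _), Real.exp a < ‖f p‖ →
      EndLift f a γ ∧ DecayPrim (h γ) a C' ε G ∧ γ (Complex.log (f p)) = p := by
    by_cases hp : Real.exp a < ‖f p‖
    · obtain ⟨γ, h1, h2⟩ := EndLift.exists_of_isCoveringMapOn hcov (hlog hp).2
        (Complex.exp_log (hlog hp).1).symm
      obtain ⟨G, h3⟩ := hG h1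
      exact ⟨γ, G, fun _ => ⟨h1, h3, h2⟩⟩
    · exact ⟨fun _ => p, 0, fun h => absurd h hp⟩
  choose γ G hγG using hex
  let ge : X → ℂ := fun p => G p (Complex.log (f p))
  have hge {γ' G' : ℂ → _} (hγ' : EndLift f a γ') (hG' : DecayPrim (h γ') a C' ε G') {s : ℂ}
      (hs : a < s.re) : ge (γ' s) = G' s := by
    have hp := hfp hγ' hs
    obtain ⟨h1, h2, h3⟩ := hγG (γ' s) hp
    obtain ⟨k, hk⟩ := Complex.exp_eq_exp_iff_exists_int.1
      ((Complex.exp_log (hlog hp).1).trans (hγ' s hs).1)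
    have h4 := h1.shift k
    have h5 (z : ℂ) (hz : a < z.re) := EndLift.eq_of_isCoveringMapOn hcov h4 hγ' hs
      (by rw [← hk]; exact h3) hz
    have h6 := h2.shift (w := k * (2 * Real.pi * Complex.I)) (by simp)
    have h7 := h6.unique hε hG' (fun z hz => by
      simp only [h]
      rw [h5 z hz, Complex.exp_eq_exp_iff_exists_int.2 ⟨k, rfl⟩]) hs
    rw [← h7, ← hk]
  refine ⟨ge, C', fun p hp => ?_⟩
  obtain ⟨hγ, hG, hγp⟩ := hγG p hp
  set s := Complex.log (f p) with hs
  have hsa : a < s.re := (hlog hp).2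
  have hf0 := (hlog hp).1
  refine ⟨?_, ?_⟩
  · obtain ⟨χ, hχ⟩ := hχ p hp
    let l : ℂ → ℂ := fun z => s + Complex.log (z / f p)
    have hl0 : l (f p) = s := by simp [l, div_self hf0]
    have hld : HasDerivAt l (f p)⁻¹ (f p) := by
      have h1 : HasDerivAt (fun z => z / f p) (1 / f p) (f p) := (hasDerivAt_id (f p)).div_const _
      have h2 := (h1.clog (by rw [div_self hf0]; exact Complex.one_mem_slitPlane)).const_add s
      rwa [div_self hf0, div_one, one_div] at h2
    have hlt : Tendsto l (𝓝 (f p)) (𝓝 s) := by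
      have := hld.continuousAt
      rwa [ContinuousAt, hl0] at this
    have hγl : Tendsto (fun z => γ p (l z)) (𝓝 (f p)) (𝓝 p) := by
      have h1 := (hγ s hsa).2
      rw [ContinuousAt, hγp] at h1
      exact h1.comp hlt
    have hev : ∀ᶠ p' in 𝓝 p, γ p (l (f p')) = p' ∧ a < (l (f p')).re := by
      have h0 : ∀ᶠ z in 𝓝 (f p), z ≠ 0 := isOpen_ne.mem_nhds hf0
      filter_upwards [hfc.continuousAt.eventually (hγl.eventually hχ.left), hχ.left,
        hfc.continuousAt.eventually (hlt.eventually ((isOpen_halfPlane a).mem_nhds hsa)),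
        hfc.continuousAt.eventually h0] with p' h1 h2 h3 h4
      have h5 : f (γ p (l (f p'))) = f p' := by
        rw [(hγ _ h3).1, Complex.exp_add, Complex.exp_log hf0, Complex.exp_log (div_ne_zero h4 hf0),
          mul_div_cancel₀ _ hf0]
      rw [h5, h2] at h1
      exact ⟨h1.symm, h3⟩
    have hd : HasDerivAt (fun z => G p (l z)) (ψ p) (f p) := by
      have h1 := (hG s hsa).1
      rw [← hl0] at h1
      have h2 := h1.comp (f p) hld
      simp only [h, hl0, hγp] at h2
      rwa [hs, Complex.exp_log hf0, mul_inv_cancel_right₀ hf0] at h2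
    refine ((hasDerivAt_iff_isLittleO.1 hd).comp_tendsto hfc.continuousAt).congr' ?_ EventuallyEq.rfl
    have hev' : ∀ᶠ p' in 𝓝 p, ge p' = G p (l (f p')) := by
      filter_upwards [hev] with p' h1
      conv_lhs => rw [← h1.1]
      exact hge hγ hG h1.2
    filter_upwards [hev'] with p' h1
    simp only [Function.comp_apply]
    rw [h1, hev'.self_of_nhds, smul_eq_mul]
  · have h1 := (hG s hsa).2
    rwa [hs, Complex.log_re, mul_comm ε, ← mul_neg, ← Real.rpow_def_of_pos (norm_pos_iff.2 hf0)] at h1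

end EndPrimitive

section Chart

variable {X : Type*} [TopologicalSpace X] {f ψ Q w ge l : X → ℂ} {p : X} {χ : ℂ → X}

theorem Prim.change (h₁ : Prim f ψ ge p) (h₂ : Prim f l Q p) (hl : l p ≠ 0)
    (hψ : ψ p = l p * w p) : Prim Q w ge p := by
  have h3 : (fun p' => f p' - f p) =O[𝓝 p] fun p' => Q p' - Q p := by
    have h6 : (fun p' => Q p' - Q p - (f p' - f p) * l p) =o[𝓝 p]
        fun p' => (f p' - f p) * l p := by
      refine Asymptotics.IsLittleO.trans_isBigO h₂ ?_
      simp_rw [mul_comm _ (l p)]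
      exact Asymptotics.isBigO_self_const_mul hl _ _
    have h7 := h6.right_isBigO_add
    simp only [sub_add_cancel] at h7
    refine Asymptotics.IsBigO.trans ?_ h7
    simp_rw [mul_comm _ (l p)]
    exact Asymptotics.isBigO_self_const_mul hl _ _
  refine Asymptotics.IsLittleO.trans_isBigO ?_ h3
  refine (Asymptotics.IsLittleO.sub h₁ (Asymptotics.IsLittleO.const_mul_left h₂ (w p))).congr_left fun p' => ?_
  rw [hψ]
  ring

theorem exists_openPartialHomeomorph (hf : Continuous f)
    (right : ∀ᶠ s in 𝓝 (f p), f (χ s) = s) (left : ∀ᶠ p' in 𝓝 p, χ (f p') = p')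
    (cont : ∀ᶠ s in 𝓝 (f p), ContinuousAt χ s) :
    ∃ e : OpenPartialHomeomorph X ℂ, p ∈ e.source ∧ Set.EqOn f e e.source := by
  obtain ⟨V, hV, hVo, hpV⟩ := eventually_nhds_iff.1 (right.and cont)
  obtain ⟨U, hU, hUo, hpU⟩ := eventually_nhds_iff.1 left
  have hχ : ContinuousOn χ V := fun s hs => (hV s hs).2.continuousWithinAt
  refine ⟨{
    toFun := f
    invFun := χ
    source := U ∩ f ⁻¹' V
    target := V ∩ χ ⁻¹' U
    map_source' := fun x hx => ⟨hx.2, by rw [Set.mem_preimage, hU x hx.1]; exact hx.1⟩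
    map_target' := fun s hs => ⟨hs.2, by rw [Set.mem_preimage, (hV s hs.1).1]; exact hs.1⟩
    left_inv' := fun x hx => hU x hx.1
    right_inv' := fun s hs => (hV s hs.1).1
    open_source := hUo.inter (hVo.preimage hf)
    open_target := hχ.isOpen_inter_preimage hVo hUo
    continuousOn_toFun := hf.continuousOn
    continuousOn_invFun := hχ.mono Set.inter_subset_left }, ⟨hpU, hpV⟩, fun _ _ => rfl⟩

end Chart

section Curve

variable {P Q : ℂ[X][X]} {c c₀ : ℂ}

theorem at₂_eq_sum (b : ℂ[X][X]) (p : ℂ × ℂ) :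
    at₂ b p = ∑ i ∈ Finset.range (b.natDegree + 1), (b.coeff i).eval p.1 * p.2 ^ i := by
  conv_lhs => rw [b.as_sum_range_C_mul_X_pow]
  rw [at₂_def, map_sum]
  refine Finset.sum_congr rfl fun i _ => ?_
  rw [← at₂_def, at₂_mul, at₂_pow, at₂_X, at₂_C]

theorem at₂_eq_eval (b : ℂ[X][X]) (x y : ℂ) :
    at₂ b (x, y) = (b.map (Polynomial.evalRingHom x)).eval y := by
  rw [at₂, Polynomial.map_evalRingHom_eval]

theorem norm_le_of_level (hP : P.Monic) (hm : 0 < P.natDegree) {p : ℂ × ℂ} (hp : at₂ P p = c) :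
    ‖p.2‖ ≤ 1 + ‖c‖ + ∑ i ∈ Finset.range P.natDegree, ‖(P.coeff i).eval p.1‖ := by
  rcases le_or_gt ‖p.2‖ 1 with h | h
  · have h1 : 0 ≤ ∑ i ∈ Finset.range P.natDegree, ‖(P.coeff i).eval p.1‖ :=
      Finset.sum_nonneg fun _ _ => norm_nonneg _
    have := norm_nonneg c
    linarith
  · obtain ⟨k, hk⟩ : ∃ k, P.natDegree = k + 1 := ⟨P.natDegree - 1, by omega⟩
    rw [at₂_eq_sum, Finset.sum_range_succ, hP.coeff_natDegree, Polynomial.eval_one, one_mul] at hp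
    have h1 : p.2 ^ P.natDegree =
        c - ∑ i ∈ Finset.range P.natDegree, (P.coeff i).eval p.1 * p.2 ^ i := by
      linear_combination hp
    have h2 : ‖p.2‖ ^ P.natDegree ≤
        (‖c‖ + ∑ i ∈ Finset.range P.natDegree, ‖(P.coeff i).eval p.1‖) * ‖p.2‖ ^ k := by
      rw [← norm_pow, h1, add_mul, Finset.sum_mul]
      refine (norm_sub_le _ _).trans (add_le_add ?_ ((norm_sum_le _ _).trans ?_))
      · exact le_mul_of_one_le_right (norm_nonneg _) (one_le_pow₀ h.le)
      · refine Finset.sum_le_sum fun i hi => ?_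
        rw [norm_mul, norm_pow]
        rw [Finset.mem_range] at hi
        exact mul_le_mul_of_nonneg_left (pow_le_pow_right₀ h.le (by omega)) (norm_nonneg _)
    nth_rewrite 1 [hk] at h2
    rw [pow_succ, mul_comm] at h2
    have h3 := le_of_mul_le_mul_right h2 (by positivity)
    linarith

theorem isClosed_level (P : ℂ[X][X]) (c : ℂ) : IsClosed {p : ℂ × ℂ | at₂ P p = c} :=
  isClosed_eq (at₂_continuous P) continuous_const

theorem isProperMap_level (hP : P.Monic) (hm : 0 < P.natDegree) :
    IsProperMap fun p : Level P c => p.1.1 := by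
  have hc : Continuous fun p : Level P c => p.1.1 := by fun_prop
  rw [isProperMap_iff_isCompact_preimage]
  refine ⟨hc, fun {K} hK => ?_⟩
  obtain ⟨B, hB⟩ := hK.exists_bound_of_continuousOn
    (f := fun x => 1 + ‖c‖ + ∑ i ∈ Finset.range P.natDegree, ‖(P.coeff i).eval x‖)
    (by fun_prop)
  have hce : IsClosedEmbedding (Subtype.val : Level P c → ℂ × ℂ) :=
    (isClosed_level P c).isClosedEmbedding_subtypeVal
  refine (hce.isCompact_preimage (hK.prod (isCompact_closedBall (0 : ℂ) B))).of_isClosed_subset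
    (hK.isClosed.preimage hc) fun p hp => ⟨hp, ?_⟩
  rw [mem_closedBall_zero_iff]
  exact (norm_le_of_level hP hm p.2).trans ((le_abs_self _).trans (hB _ hp))

theorem finite_fiber (hP : P.Monic) (hm : 0 < P.natDegree) (x : ℂ) :
    ((fun p : Level P c => p.1.1) ⁻¹' {x}).Finite := by
  classical
  have hmon : (P.map (Polynomial.evalRingHom x)).Monic := hP.map _
  have h0 : P.map (Polynomial.evalRingHom x) - Polynomial.C c ≠ 0 := by
    intro h
    have h1 := congrArg Polynomial.natDegree (sub_eq_zero.1 h)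
    rw [hP.natDegree_map, Polynomial.natDegree_C] at h1
    omega
  refine Set.Finite.of_finite_image (f := fun p : Level P c => p.1.2)
    ((P.map (Polynomial.evalRingHom x) - Polynomial.C c).roots.toFinset.finite_toSet.subset ?_) ?_
  · rintro _ ⟨p, hp, rfl⟩
    rw [Finset.mem_coe, Multiset.mem_toFinset, Polynomial.mem_roots h0, Polynomial.IsRoot,
      Polynomial.eval_sub, Polynomial.eval_C, sub_eq_zero, ← at₂_eq_eval]
    rw [← show p.1.1 = x from hp]
    exact p.2
  · intro p hp p' hp' h
    refine Subtype.ext (Prod.ext ?_ h)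
    exact Eq.trans (b := x) hp (Eq.symm hp')

theorem jac_C_X (P : ℂ[X][X]) : jac P (Polynomial.C Polynomial.X) = - dY ℂ P := by
  simp [jac]

theorem exists_chart_x (w : ℂ[X][X]) (k : ℂ) {p : Level P c} (h : at₂ (dY ℂ P) p ≠ 0) :
    ∃ χ : ℂ → Level P c, Chart (fun p : Level P c => p.1.1)
      (fun p => k * at₂ w p / at₂ (dY ℂ P) p) p χ ∧
      ∀ᶠ s in 𝓝 p.1.1, DifferentiableAt ℂ (fun s => (χ s : ℂ × ℂ)) s := by
  obtain ⟨χ, h1, h2, h3, h4, h5⟩ := exists_chart (Polynomial.C Polynomial.X) p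
    (by rw [jac_C_X, at₂_def, map_neg, neg_ne_zero, ← at₂_def]; exact h)
  simp only [at₂_C, Polynomial.eval_X] at h1 h2 h3 h4 h5
  refine ⟨χ, ⟨h1, h2, h3, h4, ?_⟩, h5⟩
  have h6 : ∀ᶠ s in 𝓝 p.1.1, at₂ (dY ℂ P) (χ s) ≠ 0 := by
    have h7 : ContinuousAt (fun s => at₂ (dY ℂ P) (χ s)) p.1.1 :=
      (at₂_continuous _).continuousAt.comp h5.self_of_nhds.continuousAt
    exact h7.eventually_ne (by rw [h1]; exact h)
  filter_upwards [h5, h6] with s h7 h8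
  have hd (b : ℂ[X][X]) : DifferentiableAt ℂ (fun s => at₂ b (χ s)) s :=
    DifferentiableAt.comp (g := at₂ b) s ((at₂_contDiff b).differentiable one_ne_zero _) h7
  exact ((hd w).const_mul k).div (hd _) h8

theorem prim_x (hJ : jac P Q = Polynomial.C (Polynomial.C c₀)) {p : Level P c}
    (h : at₂ (dY ℂ P) p ≠ 0) :
    Prim (fun p : Level P c => p.1.1) (fun p => -c₀ / at₂ (dY ℂ P) p) (fun p => at₂ Q p) p := by
  obtain ⟨χ, hχ, hd⟩ := exists_chart_x (P := P) 0 0 h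
  have hd := hd.self_of_nhds.hasDerivAt
  set v := deriv (fun s => (χ s : ℂ × ℂ)) p.1.1
  have hb (b : ℂ[X][X]) : HasDerivAt (fun s => at₂ b (χ s))
      (at₂ (dX ℂ b) p * v.1 + at₂ (dY ℂ b) p * v.2) p.1.1 := by
    have h1 := at₂_hasFDerivAt b (χ p.1.1)
    have h2 := h1.comp_hasDerivAt p.1.1 hd
    rw [show χ p.1.1 = p from hχ.base] at h2
    simpa [Function.comp_def] using h2
  have hv : v.1 = 1 := by
    have h1 := hb (Polynomial.C Polynomial.X)
    simp only [dX_C, Polynomial.derivative_X, map_one, dY_C, at₂_C, Polynomial.eval_X] at h1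
    have h2 : HasDerivAt (fun s => (χ s).1.1) 1 p.1.1 :=
      (hasDerivAt_id _).congr_of_eventuallyEq hχ.right
    have h3 := h1.unique h2
    simpa [at₂_def] using h3
  have hP0 : at₂ (dX ℂ P) p + at₂ (dY ℂ P) p * v.2 = 0 := by
    have h1 := hb P
    have h2 : HasDerivAt (fun s => at₂ P (χ s)) 0 p.1.1 := by
      rw [show (fun s => at₂ P (χ s)) = fun _ => c from funext fun s => (χ s).2]
      exact hasDerivAt_const _ _
    have h3 := h1.unique h2
    rwa [hv, mul_one] at h3
  have hQ := hb Q
  have hj : at₂ (jac P Q) p = c₀ := by rw [hJ]; simp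
  rw [at₂_jac_eq] at hj
  have he : at₂ (dX ℂ Q) p * v.1 + at₂ (dY ℂ Q) p * v.2 = -c₀ / at₂ (dY ℂ P) p := by
    rw [eq_div_iff h, hv]
    linear_combination at₂ (dY ℂ Q) p * hP0 - hj
  rw [he] at hQ
  have hx : Continuous fun p : Level P c => p.1.1 := by fun_prop
  refine ((hasDerivAt_iff_isLittleO.1 hQ).comp_tendsto hx.continuousAt).congr' ?_ EventuallyEq.rfl
  filter_upwards [hχ.left] with p' hp'
  simp only [Function.comp_apply, smul_eq_mul]
  rw [show χ p'.1.1 = p' from hp', show χ p.1.1 = p from hχ.base]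

theorem exists_chart_Q (hJ : jac P Q = Polynomial.C (Polynomial.C c₀)) (hc₀ : c₀ ≠ 0)
    (w : ℂ[X][X]) (p : Level P c) :
    ∃ χ : ℂ → Level P c, Chart (fun p : Level P c => at₂ Q p) (fun p => at₂ w p) p χ := by
  obtain ⟨χ, h1, h2, h3, h4, h5⟩ := exists_chart Q p (by rw [hJ]; simpa using hc₀)
  refine ⟨χ, h1, h2, h3, h4, ?_⟩
  filter_upwards [h5] with s h7
  exact DifferentiableAt.comp (g := at₂ w) s ((at₂_contDiff w).differentiable one_ne_zero _) h7

theorem isCoveringMapOn_level (hP : P.Monic) (hm : 0 < P.natDegree) {R : ℝ}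
    (hR : ∀ p : Level P c, R < ‖p.1.1‖ → at₂ (dY ℂ P) p ≠ 0) :
    IsCoveringMapOn (fun p : Level P c => p.1.1) {z | R < ‖z‖} := by
  refine (isProperMap_level hP hm).isClosedMap.isCoveringMapOn_of_isLocalHomeomorphOn
    (fun x _ => finite_fiber hP hm x) (IsLocalHomeomorphOn.mk _ _ fun p hp => ?_)
  obtain ⟨χ, h, -⟩ := exists_chart_x 0 0 (hR p hp)
  exact exists_openPartialHomeomorph (by fun_prop) h.right h.left h.cont

/-- A polynomial defining a form with no poles at the ends of a planar level curve vanishes. -/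
theorem Keller.eq_zero_on_level (hK : Keller P Q c₀) {T : Finset ℂ}
    (φ : Level P c ≃ₜ {z : ℂ // z ∉ T}) {w : ℂ[X][X]} {R C : ℝ} {n : ℕ} (hR : 0 < R) (hn : n ≠ 0)
    (hPy : ∀ p : Level P c, R < ‖p.1.1‖ → at₂ (dY ℂ P) p ≠ 0)
    (hb : ∀ p : Level P c, R < ‖p.1.1‖ → ‖at₂ w p‖ ^ n * ‖p.1.1‖ ^ (n + 1) ≤
      C * ‖at₂ (dY ℂ P) p‖ ^ n)
    (p : Level P c) : at₂ w p = 0 := by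
  have hm := hK.natDegree_pos
  have hea : Real.exp (Real.log R) = R := Real.exp_log hR
  have hx : Continuous fun p : Level P c => p.1.1 := by fun_prop
  have hn0 : (0 : ℝ) < n := Nat.cast_pos.2 (Nat.pos_of_ne_zero hn)
  have hε : (0 : ℝ) < (n : ℝ)⁻¹ := inv_pos.2 hn0
  obtain ⟨ge, C', hge⟩ := exists_end_prim (f := fun p : Level P c => p.1.1)
    (ψ := fun p => -c₀ * at₂ w p / at₂ (dY ℂ P) p) (a := Real.log R)
    (C := ‖c₀‖ * max C 0 ^ (n : ℝ)⁻¹) hε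
    (by rw [hea]; exact isCoveringMapOn_level hK.monic hm hPy) hx
    (fun p hp => by
      rw [hea] at hp
      obtain ⟨χ, h, -⟩ := exists_chart_x w (-c₀) (hPy p hp)
      exact ⟨χ, h⟩)
    (fun p hp => by
      rw [hea] at hp
      have h1 := norm_pos_iff.2 (hPy p hp)
      have h2 : 0 < ‖p.1.1‖ := hR.trans hp
      have h3 : ‖at₂ w p‖ ≤ max C 0 ^ (n : ℝ)⁻¹ * ‖at₂ (dY ℂ P) p‖ *
          ‖p.1.1‖ ^ (-(1 + (n : ℝ)⁻¹)) := by
        refine le_of_pow_le_pow_left₀ hn (by positivity) ?_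
        rw [mul_pow, mul_pow, ← Real.rpow_natCast (max C 0 ^ (n : ℝ)⁻¹),
          ← Real.rpow_mul (le_max_right _ _), inv_mul_cancel₀ hn0.ne', Real.rpow_one,
          ← Real.rpow_natCast (‖p.1.1‖ ^ (-(1 + (n : ℝ)⁻¹))), ← Real.rpow_mul h2.le,
          show -(1 + (n : ℝ)⁻¹) * n = -((n + 1 : ℕ) : ℝ) by
            push_cast; field_simp, Real.rpow_neg h2.le, Real.rpow_natCast,
          ← div_eq_mul_inv, le_div_iff₀ (by positivity)]
        exact (hb p hp).trans (by gcongr; exact le_max_left _ _)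
      rw [norm_div, norm_mul, norm_neg, div_le_iff₀ h1]
      calc _ ≤ ‖c₀‖ * (max C 0 ^ (n : ℝ)⁻¹ * ‖at₂ (dY ℂ P) p‖ *
          ‖p.1.1‖ ^ (-(1 + (n : ℝ)⁻¹))) := by gcongr
        _ = _ := by ring)
  rw [hea] at hge
  have ht : Tendsto (fun p : Level P c => ‖p.1.1‖) (cocompact _) atTop :=
    tendsto_norm_cocompact_atTop.comp (isProperMap_iff_tendsto_cocompact.1 (isProperMap_level hK.monic hm)).2
  refine eq_zero_of_planar φ (Q := fun p => at₂ Q p) (w := fun p => at₂ w p) (ge := ge)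
    ((at₂_continuous Q).comp continuous_subtype_val) (exists_chart_Q hK.jac_eq hK.ne_zero w)
    ?_ ?_ p
  · filter_upwards [ht.eventually (eventually_gt_atTop R)] with p hp
    refine (hge p hp).1.change (prim_x hK.jac_eq (hPy p hp)) ?_ ?_
    · exact div_ne_zero (neg_ne_zero.2 hK.ne_zero) (hPy p hp)
    · ring
  · have h0 := ((tendsto_rpow_neg_atTop hε).comp ht).const_mul C'
    rw [mul_zero] at h0
    refine squeeze_zero_norm' ?_ h0
    filter_upwards [ht.eventually (eventually_gt_atTop R)] with p hp
    exact (hge p hp).2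

end Curve

section Dual

variable {k K : Type*} [CommRing k] [IsDomain k] [Field K] [Algebra k K] [FaithfulSMul k K] {f : k[X][X]} {s : Finset (Hahn K)}

/-- The dual basis of the powers of `Y` for the trace form of `f`, up to the different. -/
noncomputable def dualPoly (f : k[X][X]) (l : ℕ) : k[X][X] :=
  ∑ i ∈ Finset.Icc (l + 1) f.natDegree, Polynomial.X ^ (i - (l + 1)) * Polynomial.C (f.coeff i)

theorem xmap_injective' : Function.Injective (xmap k K) := 
  xmap_injective (FaithfulSMul.algebraMap_injective k K)

theorem natDegree_eq_card (hf : f.map (xmap k K) = Lagrange.nodal s id) :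
    f.natDegree = s.card := by
  rw [← Polynomial.natDegree_map_eq_of_injective (xmap_injective' (k := k) (K := K)), hf, Lagrange.natDegree_nodal]

theorem monic_of_map_eq_nodal (hf : f.map (xmap k K) = Lagrange.nodal s id) : f.Monic :=
  Polynomial.monic_of_injective (xmap_injective' (K := K)) (hf ▸ Lagrange.nodal_monic)

theorem ev_eq_zero (hf : f.map (xmap k K) = Lagrange.nodal s id) {η : Hahn K} (hη : η ∈ s) :
    ev η f = 0 := by
  rw [ev_eq_eval, hf]; exact Lagrange.eval_nodal_at_node (v := id) hη

theorem ev_derivative_eq_nodalWeight (hf : f.map (xmap k K) = Lagrange.nodal s id) [DecidableEq (Hahn K)]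
    {η : Hahn K} (hη : η ∈ s) :
    ev η (Polynomial.derivative f) = (Lagrange.nodalWeight s id η)⁻¹ := by
  rw [Lagrange.nodalWeight_eq_eval_derivative_nodal hη, inv_inv, ev_eq_eval,
    ← Polynomial.derivative_map, hf]
  rfl

theorem ev_derivative_ne_zero (hf : f.map (xmap k K) = Lagrange.nodal s id)
    {η : Hahn K} (hη : η ∈ s) : ev η (Polynomial.derivative f) ≠ 0 := by
  classical
  rw [ev_derivative_eq_nodalWeight hf hη]
  exact inv_ne_zero (Lagrange.nodalWeight_ne_zero Function.injective_id.injOn hη)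

theorem ev_dualPoly (hf : f.map (xmap k K) = Lagrange.nodal s id) (η : Hahn K) (l : ℕ) :
    ev η (dualPoly f l) = (Lagrange.nodal s id /ₘ (Polynomial.X - Polynomial.C η)).coeff l := by
  rw [Polynomial.coeff_divByMonic_X_sub_C, dualPoly, map_sum, Lagrange.natDegree_nodal,
    natDegree_eq_card hf]
  refine Finset.sum_congr rfl fun i _ => ?_
  rw [map_mul, map_pow, ev_X, ev_C, ← hf, Polynomial.coeff_map]

theorem natDegree_dualPoly (hf : f.map (xmap k K) = Lagrange.nodal s id) (hs : s.Nonempty) (l : ℕ) :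
    (dualPoly f l).natDegree < s.card := by
  rw [← natDegree_eq_card hf]
  have h0 : 0 < f.natDegree := by rw [natDegree_eq_card hf]; exact hs.card_pos
  refine (Polynomial.natDegree_sum_le _ _).trans_lt ?_
  rw [Finset.fold_max_lt]
  refine ⟨h0, fun i hi => ?_⟩
  rw [Finset.mem_Icc] at hi
  refine Polynomial.natDegree_mul_le.trans_lt ?_
  rw [Polynomial.natDegree_X_pow, Polynomial.natDegree_C]
  omega

/-- The trace form: the coefficients of a polynomial in terms of its values. -/
theorem sum_dualPoly (hf : f.map (xmap k K) = Lagrange.nodal s id) {b : k[X][X]}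
    (hb : b.natDegree < s.card) (l : ℕ) :
    ∑ η ∈ s, ev η b * (ev η (dualPoly f l) / ev η (Polynomial.derivative f)) =
      xmap k K (b.coeff l) := by
  classical
  have h1 : (b.map (xmap k K)).degree < s.card :=
    Polynomial.degree_map_le.trans_lt (Polynomial.degree_le_natDegree.trans_lt (by exact_mod_cast hb))
  have h2 := Lagrange.eq_interpolate (v := id) Function.injective_id.injOn h1
  rw [Lagrange.interpolate_eq_nodalWeight_mul_nodal_div_X_sub_C] at h2
  rw [← Polynomial.coeff_map, h2, Polynomial.finsetSum_coeff]
  refine Finset.sum_congr rfl fun η hη => ?_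
  rw [Polynomial.coeff_mul_C, Polynomial.coeff_C_mul, ev_dualPoly hf,
    ev_derivative_eq_nodalWeight hf hη, div_inv_eq_mul, ev_eq_eval,
    ← Polynomial.divByMonic_eq_div _ (Polynomial.monic_X_sub_C _)]
  simp only [id_eq]
  ring

/-- A Bezout relation between `f` and its derivative. -/
theorem exists_bezout (hf : f.map (xmap k K) = Lagrange.nodal s id) (hs : s.Nonempty) :
    ∃ (A B : k[X][X]) (D : k[X]), D ≠ 0 ∧ D.natDegree ≠ 0 ∧
      A * Polynomial.derivative f + B * f = Polynomial.C D := by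
  classical
  have h0 : f.natDegree ≠ 0 := by rw [natDegree_eq_card hf]; exact hs.card_pos.ne'
  obtain ⟨p, q, -, -, h⟩ := Polynomial.exists_mul_add_mul_eq_C_resultant (m := f.natDegree)
    (n := f.natDegree) f (Polynomial.derivative f) le_rfl
    ((Polynomial.natDegree_derivative_le f).trans (Nat.sub_le _ _)) (Or.inl h0)
  set D := f.resultant (Polynomial.derivative f) f.natDegree f.natDegree with hD
  have hD0 : D ≠ 0 := by
    intro h0
    have h1 := Polynomial.resultant_map_map f (Polynomial.derivative f) f.natDegree f.natDegree
      (xmap k K)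
    have h2 : (f.map (xmap k K)).natDegree = f.natDegree :=
      (monic_of_map_eq_nodal hf).natDegree_map _
    have h3 : (f.map (xmap k K)).roots = s.val := by
      rw [hf, Lagrange.nodal]
      simp only [id_eq]
      rw [Polynomial.roots_prod_X_sub_C]
    rw [← hD, h0, map_zero, ← h2, Polynomial.resultant_eq_prod_eval _ _ _ (by
      rw [← Polynomial.derivative_map]
      exact (Polynomial.natDegree_derivative_le _).trans (Nat.sub_le _ _)) (by
      rw [hf, Lagrange.nodal]
      exact Polynomial.Splits.prod fun i _ => Polynomial.Splits.X_sub_C _),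
      ((monic_of_map_eq_nodal hf).map _).leadingCoeff, one_pow, one_mul, h3] at h1
    obtain ⟨η, hη, h4⟩ := Multiset.mem_map.1 (Multiset.prod_eq_zero_iff.1 h1)
    rw [← ev_eq_eval] at h4
    exact ev_derivative_ne_zero hf hη h4
  refine ⟨q * Polynomial.C Polynomial.X, p * Polynomial.C Polynomial.X, D * Polynomial.X,
    mul_ne_zero hD0 Polynomial.X_ne_zero, by rw [Polynomial.natDegree_mul_X hD0]; omega, ?_⟩
  rw [map_mul, ← h]
  ring

theorem ev_bezout (hf : f.map (xmap k K) = Lagrange.nodal s id) {A B : k[X][X]} {D : k[X]}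
    (h : A * Polynomial.derivative f + B * f = Polynomial.C D) {η : Hahn K} (hη : η ∈ s) :
    ev η A * ev η (Polynomial.derivative f) = xmap k K D := by
  have h1 := congrArg (ev η) h
  rwa [map_add, map_mul, map_mul, ev_eq_zero hf hη, mul_zero, add_zero, ev_C] at h1

end Dual

theorem eq_zero_of_sum_pow {ι K : Type*} [Field K] [CharZero K] {s : Finset ι} {d : ι → K}
    (h : ∀ j : ℕ, ∑ i ∈ s, d i ^ (j + 1) = 0) {i : ι} (hi : i ∈ s) : d i = 0 := by
  classical
  have h1 (p : K[X]) : ∑ i ∈ s, d i * p.eval (d i) = 0 := by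
    simp only [Polynomial.eval_eq_sum_range, Finset.mul_sum]
    rw [Finset.sum_comm]
    refine Finset.sum_eq_zero fun j _ => ?_
    rw [← mul_zero (p.coeff j), ← h j, Finset.mul_sum]
    exact Finset.sum_congr rfl fun i _ => by ring
  by_contra h0
  let p : K[X] := ∏ v ∈ (s.image d).erase (d i), (Polynomial.X - Polynomial.C v)
  have hp : p.eval (d i) ≠ 0 := by
    rw [Polynomial.eval_prod, Finset.prod_ne_zero_iff]
    intro v hv
    rw [Polynomial.eval_sub, Polynomial.eval_X, Polynomial.eval_C]
    exact sub_ne_zero.2 (Finset.ne_of_mem_erase hv).symm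
  have h2 := h1 p
  rw [← Finset.sum_filter_add_sum_filter_not s (fun j => d j = d i),
    Finset.sum_eq_zero (s := s.filter fun j => ¬ d j = d i) (fun j hj => by
      rw [Finset.mem_filter] at hj
      rw [Polynomial.eval_prod, Finset.prod_eq_zero (Finset.mem_erase.2
        ⟨hj.2, Finset.mem_image_of_mem d hj.1⟩) (by simp), mul_zero]), add_zero,
    Finset.sum_congr rfl (g := fun _ => d i * p.eval (d i)) (fun j hj => by
      rw [(Finset.mem_filter.1 hj).2]), Finset.sum_const, nsmul_eq_mul] at h2
  refine mul_ne_zero ?_ (mul_ne_zero h0 hp) h2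
  rw [Nat.cast_ne_zero]
  exact (Finset.card_pos.2 ⟨i, (Finset.mem_filter (p := fun j => d j = d i)).2 ⟨hi, rfl⟩⟩).ne'

section Duality

variable {k K : Type*} [Field k] [Field K] [Algebra k K] {f : k[X][X]} {s : Finset (Hahn K)}

/-- The principal part at a branch `η` with coefficients `e`. -/
noncomputable def principal (m N : ℕ) (η : Hahn K) (e : Fin m → Fin N → k) : Hahn K :=
  ∑ l : Fin m, ∑ j : Fin N, HahnSeries.single (((j : ℕ) + 1 : ℕ) : ℚ) (algebraMap k K (e l j)) * η ^ (l : ℕ)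

theorem principal_add (m N : ℕ) (η : Hahn K) (e e' : Fin m → Fin N → k) :
    principal m N η (e + e') = principal m N η e + principal m N η e' := by
  simp only [principal, ← Finset.sum_add_distrib, ← add_mul, Pi.add_apply, map_add,
    ← HahnSeries.single_add]

theorem principal_smul (m N : ℕ) (η : Hahn K) (c : k) (e : Fin m → Fin N → k) :
    principal m N η (c • e) = HahnSeries.C (algebraMap k K c) * principal m N η e := by
  simp only [principal, Finset.mul_sum, ← mul_assoc]
  refine Finset.sum_congr rfl fun l _ => Finset.sum_congr rfl fun j _ => ?_
  rw [HahnSeries.C_apply, HahnSeries.single_mul_single, zero_add]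
  simp

theorem shift_xmap (p : k[X]) (i : ℕ) : ∃ h : k[X],
    HahnSeries.single ((i + 1 : ℕ) : ℚ) 1 * xmap k K p = xmap k K h +
      ∑ j ∈ Finset.range (i + 1),
        HahnSeries.single ((j + 1 : ℕ) : ℚ) (algebraMap k K (p.coeff (i - j))) := by
  obtain ⟨h, hh⟩ : Polynomial.X ^ (i + 1) ∣
      p - ∑ j ∈ Finset.range (i + 1), Polynomial.C (p.coeff (i - j)) * Polynomial.X ^ (i - j) := by
    rw [Polynomial.X_pow_dvd_iff]
    intro d hd
    rw [Polynomial.coeff_sub, Polynomial.finsetSum_coeff, Finset.sum_eq_single (i - d)]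
    · rw [Polynomial.coeff_C_mul_X_pow, if_pos (by omega), show i - (i - d) = d by omega, sub_self]
    · intro j hj hne
      rw [Finset.mem_range] at hj
      rw [Polynomial.coeff_C_mul_X_pow, if_neg (by omega)]
    · intro h; exact (h (Finset.mem_range.2 (by omega))).elim
  have hX (n : ℕ) : xmap k K (Polynomial.X ^ n) = HahnSeries.single (-(n : ℚ)) 1 := by
    rw [map_pow, xmap_X, hx_pow]
  refine ⟨h, ?_⟩
  conv_lhs => rw [sub_eq_iff_eq_add.1 hh]
  rw [map_add, map_mul, hX, mul_add, ← mul_assoc,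
    HahnSeries.single_mul_single, add_neg_cancel, one_mul, ← HahnSeries.C_apply, HahnSeries.C_one,
    one_mul, map_sum, Finset.mul_sum]
  congr 1
  refine Finset.sum_congr rfl fun j hj => ?_
  rw [Finset.mem_range] at hj
  rw [map_mul, hX, xmap_C, HahnSeries.C_apply, HahnSeries.single_mul_single,
    HahnSeries.single_mul_single, Nat.cast_sub (by omega)]
  congr 1
  · push_cast; ring_nf
  · rw [one_mul, mul_one]

theorem exists_functional (N : ℕ) (hN : ∀ η ∈ s, ∀ l < s.card, Lge (-(N : ℚ)) (η ^ l))
    (hS : ¬ ∀ e : Fin s.card → Fin N → k, ∃ h : k[X][X], ∀ η ∈ s,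
      Lge 0 (principal s.card N η e - ev η h)) :
    ∃ Φ : ℕ → k[X], (∃ l < s.card, Φ l ≠ 0) ∧ ∀ b : k[X][X], b.natDegree < s.card → ∀ n : ℕ,
      (∀ η ∈ s, Lge (-(n : ℚ)) (ev η b)) → ∀ i, n ≤ i + 1 →
        (∑ l ∈ Finset.range s.card, b.coeff l * Φ l).coeff i = 0 := by
  classical
  let W : Submodule k (Fin s.card → Fin N → k) :=
    { carrier := {e | ∃ h : k[X][X], ∀ η ∈ s, Lge 0 (principal s.card N η e - ev η h)}
      zero_mem' := ⟨0, fun η _ => by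
        have := principal_smul (K := K) s.card N η (0 : k) 0
        rw [zero_smul, map_zero, map_zero, zero_mul] at this
        rw [this, map_zero, sub_zero]; exact lge_zero _⟩
      add_mem' := by
        rintro e e' ⟨h, hh⟩ ⟨h', hh'⟩
        refine ⟨h + h', fun η hη => ?_⟩
        rw [principal_add, map_add, add_sub_add_comm]
        exact (hh η hη).add (hh' η hη)
      smul_mem' := by
        rintro c e ⟨h, hh⟩
        refine ⟨Polynomial.C (Polynomial.C c) * h, fun η hη => ?_⟩
        rw [principal_smul, map_mul, ev_C_C, ← mul_sub]
        exact (lge_C _).mul₀ (hh η hη) }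
  have hW : W < ⊤ := by
    rw [lt_top_iff_ne_top]
    intro h
    apply hS
    intro e
    have : e ∈ W := h ▸ Submodule.mem_top
    exact this
  obtain ⟨φ, hφ0, hφ⟩ := W.exists_le_ker_of_lt_top hW
  let u (l j : ℕ) : Fin s.card → Fin N → k := fun l' j' => if (l' : ℕ) = l ∧ (j' : ℕ) = j then 1 else 0
  let Φ (l : ℕ) : k[X] := ∑ j ∈ Finset.range N, Polynomial.C (φ (u l j)) * Polynomial.X ^ j
  have hexp (e : ℕ → ℕ → k) : φ (fun l j => e l j) =
      ∑ l ∈ Finset.range s.card, ∑ j ∈ Finset.range N, e l j * φ (u l j) := by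
    have : (fun (l : Fin s.card) (j : Fin N) => e l j) =
        ∑ l ∈ Finset.range s.card, ∑ j ∈ Finset.range N, e l j • u l j := by
      ext l j
      simp only [Finset.sum_apply, Pi.smul_apply, u, smul_eq_mul]
      rw [Finset.sum_eq_single (l : ℕ), Finset.sum_eq_single (j : ℕ)]
      · simp
      · intro b _ hb; rw [if_neg (fun h => hb h.2.symm), mul_zero]
      · intro h; exact (h (Finset.mem_range.2 j.2)).elim
      · intro b _ hb
        exact Finset.sum_eq_zero fun _ _ => by rw [if_neg (fun h => hb h.1.symm), mul_zero]
      · intro h; exact (h (Finset.mem_range.2 l.2)).elim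
    rw [this, map_sum]
    simp only [map_sum, map_smul, smul_eq_mul]
  have hΦc (l j : ℕ) (hj : j < N) : (Φ l).coeff j = φ (u l j) := by
    simp only [Φ, Polynomial.finsetSum_coeff, Polynomial.coeff_C_mul_X_pow]
    rw [Finset.sum_eq_single j (fun i _ hi => if_neg hi.symm)
      (fun h => (h (Finset.mem_range.2 hj)).elim), if_pos rfl]
  have hΦc' (l j : ℕ) (hj : ¬ j < N) : (Φ l).coeff j = 0 := by
    simp only [Φ, Polynomial.finsetSum_coeff, Polynomial.coeff_C_mul_X_pow]
    refine Finset.sum_eq_zero fun i hi => if_neg ?_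
    rw [Finset.mem_range] at hi
    omega
  refine ⟨Φ, ?_, ?_⟩
  · by_contra! h0
    apply hφ0
    refine LinearMap.ext fun e => ?_
    let e' (l j : ℕ) : k := if h : l < s.card ∧ j < N then e ⟨l, h.1⟩ ⟨j, h.2⟩ else 0
    have he : e = fun (l : Fin s.card) (j : Fin N) => e' l j := by
      ext l j; simp [e']
    rw [he, hexp, LinearMap.zero_apply]
    refine Finset.sum_eq_zero fun l hl => Finset.sum_eq_zero fun j hj => ?_
    rw [Finset.mem_range] at hl hj
    rw [← hΦc l j hj, h0 l hl, Polynomial.coeff_zero, mul_zero]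
  · intro b hb n hbn i hi
    let e (l j : ℕ) : k := if j ≤ i then (b.coeff l).coeff (i - j) else 0
    have he : (fun (l : Fin s.card) (j : Fin N) => e l j) ∈ W := by
      choose q hq using fun l => shift_xmap (K := K) (b.coeff l) i
      refine ⟨-∑ l ∈ Finset.range s.card, Polynomial.C (q l) * Polynomial.X ^ l, fun η hη => ?_⟩
      have h1 : HahnSeries.single ((i + 1 : ℕ) : ℚ) 1 * ev η b =
          ev η (∑ l ∈ Finset.range s.card, Polynomial.C (q l) * Polynomial.X ^ l) +
          ∑ l ∈ Finset.range s.card, ∑ j ∈ Finset.range (i + 1),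
            HahnSeries.single ((j + 1 : ℕ) : ℚ) (algebraMap k K (e l j)) * η ^ l := by
        conv_lhs => rw [b.as_sum_range_C_mul_X_pow' hb]
        rw [map_sum, map_sum, Finset.mul_sum, ← Finset.sum_add_distrib]
        refine Finset.sum_congr rfl fun l _ => ?_
        rw [map_mul, map_mul, map_pow, ev_X, ev_C, ev_C, ← mul_assoc, hq, add_mul, Finset.sum_mul]
        congr 1
        refine Finset.sum_congr rfl fun j hj => ?_
        simp only [e]
        rw [if_pos (by rw [Finset.mem_range] at hj; omega)]
      have h2 : principal s.card N η (fun l j => e l j) = ∑ l ∈ Finset.range s.card,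
          ∑ j ∈ Finset.range N,
            HahnSeries.single ((j + 1 : ℕ) : ℚ) (algebraMap k K (e l j)) * η ^ l := by
        rw [principal, Finset.sum_range]
        refine Finset.sum_congr rfl fun l _ => ?_
        rw [Finset.sum_range]
      have h3 (l : ℕ) (hl : l < s.card) : Lge 0 (∑ j ∈ Finset.range N,
            HahnSeries.single ((j + 1 : ℕ) : ℚ) (algebraMap k K (e l j)) * η ^ l -
          ∑ j ∈ Finset.range (i + 1),
            HahnSeries.single ((j + 1 : ℕ) : ℚ) (algebraMap k K (e l j)) * η ^ l) := by
        rcases le_total N (i + 1) with h | h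
        · rw [← Finset.sum_range_add_sum_Ico _ h, sub_add_cancel_left]
          refine (Lge.sum fun j hj => ?_).neg
          rw [Finset.mem_Ico] at hj
          refine ((lge_single le_rfl _).mul (hN η hη l hl)).mono ?_
          have : (N : ℚ) ≤ j := by exact_mod_cast hj.1
          push_cast
          linarith
        · rw [← Finset.sum_range_add_sum_Ico _ h, add_sub_cancel_left,
            Finset.sum_eq_zero fun j hj => ?_]
          · exact lge_zero _
          rw [Finset.mem_Ico] at hj
          simp only [e]
          rw [if_neg (by omega), map_zero, HahnSeries.single_eq_zero, zero_mul]
      rw [map_neg, sub_neg_eq_add, h2, ← sub_add_cancel (∑ l ∈ Finset.range s.card,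
          ∑ j ∈ Finset.range N, _) (∑ l ∈ Finset.range s.card, ∑ j ∈ Finset.range (i + 1),
            HahnSeries.single ((j + 1 : ℕ) : ℚ) (algebraMap k K (e l j)) * η ^ l), add_assoc,
        add_comm (∑ l ∈ Finset.range s.card, ∑ j ∈ Finset.range (i + 1), _) (ev η _), ← h1,
        ← Finset.sum_sub_distrib]
      refine (Lge.sum fun l hl => h3 l (Finset.mem_range.1 hl)).add
        (((lge_single le_rfl _).mul (hbn η hη)).mono ?_)
      have : (n : ℚ) ≤ ((i + 1 : ℕ) : ℚ) := by exact_mod_cast hi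
      linarith
    have h1 := hφ he
    rw [LinearMap.mem_ker, hexp] at h1
    rw [← h1, Polynomial.finsetSum_coeff]
    refine Finset.sum_congr rfl fun l _ => ?_
    rw [mul_comm, Polynomial.coeff_mul, Finset.Nat.sum_antidiagonal_eq_sum_range_succ_mk]
    simp only
    have h4 : ∀ j, (if j < N then (Φ l).coeff j * e l j else 0) = (Φ l).coeff j * e l j := fun j => by
      split_ifs with h
      · rfl
      · rw [hΦc' l j h, zero_mul]
    have h5 : ∑ j ∈ Finset.range N, e l j * φ (u l j) = ∑ j ∈ Finset.range N, (Φ l).coeff j * e l j :=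
      Finset.sum_congr rfl fun j hj => by rw [hΦc l j (Finset.mem_range.1 hj), mul_comm]
    rw [h5]
    have h6 : ∑ j ∈ Finset.range (i + 1), (Φ l).coeff j * (b.coeff l).coeff (i - j) =
        ∑ j ∈ Finset.range (i + 1), (Φ l).coeff j * e l j :=
      Finset.sum_congr rfl fun j hj => by
        simp only [e]; rw [if_pos (by rw [Finset.mem_range] at hj; omega)]
    rw [Nat.succ_eq_add_one, h6]
    rcases le_total N (i + 1) with h | h
    · rw [← Finset.sum_range_add_sum_Ico _ h, add_eq_left]
      refine Finset.sum_eq_zero fun j hj => ?_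
      rw [Finset.mem_Ico] at hj
      rw [hΦc' l j (by omega), zero_mul]
    · rw [← Finset.sum_range_add_sum_Ico _ h, eq_comm, add_eq_left]
      refine Finset.sum_eq_zero fun j hj => ?_
      rw [Finset.mem_Ico] at hj
      simp only [e]
      rw [if_neg (by omega), mul_zero]

end Duality

variable {k K : Type*} [Field k] [Field K] [Algebra k K] {f : k[X][X]} {s : Finset (Hahn K)}

/-- If traces against `l` decay, then `l` itself decays. -/
theorem one_lt_of_ord [CharZero K] {l : Hahn K → Hahn K} {v : k[X][X]} {D : k[X]} (hD : D.natDegree ≠ 0)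
    (hv : ∀ η ∈ s, ev η v = l η * xmap k K D)
    (hl : ∀ (b : k[X][X]) (n : ℕ), (∀ η ∈ s, Lge (-(n : ℚ)) (ev η b)) → ∃ τ : k[X],
      ∑ η ∈ s, ev η b * l η = xmap k K τ ∧ ∀ i, n ≤ i + 1 → τ.coeff i = 0)
    {η₀ : Hahn K} (hη₀ : η₀ ∈ s) {p₀ : ℚ} (hp₀ : Ord p₀ (l η₀)) : 1 < p₀ := by
  classical
  by_contra! hp1
  obtain ⟨η₁, hη₁, p, hp, hpmin⟩ : ∃ η₁ ∈ s, ∃ p, Ord p (l η₁) ∧ ∀ η ∈ s, ∀ q, Ord q (l η) → p ≤ q := by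
    have hord (η : Hahn K) : ∃ p, l η ≠ 0 → Ord p (l η) := by
      by_cases h : l η = 0
      · exact ⟨0, fun h' => (h' h).elim⟩
      · obtain ⟨p, hp⟩ := exists_ord h
        exact ⟨p, fun _ => hp⟩
    choose o ho using hord
    obtain ⟨η₁, h1, h2⟩ := (s.filter fun η => l η ≠ 0).exists_min_image o
      ⟨η₀, Finset.mem_filter.2 ⟨hη₀, hp₀.ne_zero⟩⟩
    rw [Finset.mem_filter] at h1
    refine ⟨η₁, h1.1, o η₁, ho _ h1.2, fun η hη q hq => ?_⟩
    rw [hq.unique (ho _ hq.ne_zero)]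
    exact h2 η (Finset.mem_filter.2 ⟨hη, hq.ne_zero⟩)
  have hpl : p ≤ 1 := (hpmin _ hη₀ _ hp₀).trans hp1
  have hlp (η) (hη : η ∈ s) : Lge p (l η) := lge_of_forall_ord (hpmin η hη)
  obtain ⟨a, b, hb, hab⟩ : ∃ a b : ℕ, b ≠ 0 ∧ (b : ℚ) * (1 - p) = a := by
    refine ⟨(1 - p).num.toNat, (1 - p).den, (1 - p).den_ne_zero, ?_⟩
    have h1 : (((1 - p).num.toNat : ℤ) : ℚ) = (1 - p).num := by
      rw [Int.toNat_of_nonneg (Rat.num_nonneg.2 (sub_nonneg.2 hpl))]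
    rw [Int.cast_natCast] at h1
    rw [h1, Rat.den_mul_eq_num]
  have hvl (η) (hη : η ∈ s) : Lge (p - D.natDegree) (ev η v) := by
    rw [hv η hη, sub_eq_add_neg]
    exact (hlp η hη).mul (xmap_lge D)
  have hvc (η) (hη : η ∈ s) : (ev η v).coeff (p - D.natDegree) =
      (l η).coeff p * algebraMap k K D.leadingCoeff := by
    rw [hv η hη, sub_eq_add_neg, (hlp η hη).coeff_mul (xmap_lge D), xmap_coeff]
    rfl
  have key (j : ℕ) : ∑ η ∈ s, ((ev η v).coeff (p - D.natDegree) ^ b) ^ (j + 1) = 0 := by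
    obtain ⟨n, hn⟩ : ∃ n, n + 1 = b * (j + 1) :=
      ⟨b * (j + 1) - 1, Nat.sub_add_cancel (Nat.mul_pos (Nat.pos_of_ne_zero hb) (Nat.succ_pos j))⟩
    obtain ⟨e, he⟩ := Nat.exists_eq_succ_of_ne_zero hD
    have hnq : ((n : ℚ) + 1) * (1 - p) = (j + 1) * a := by
      have : ((n : ℚ) + 1) = b * (j + 1) := by exact_mod_cast hn
      rw [this, ← hab]; ring
    obtain ⟨τ, h1, h2⟩ := hl (v ^ n) (n * e + (j + 1) * a) (fun η hη => by
      rw [map_pow]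
      refine ((hvl η hη).pow n).mono ?_
      rw [he]; push_cast
      nlinarith)
    have h3 : ∑ η ∈ s, ev η v ^ (n + 1) = xmap k K (τ * D) := by
      rw [map_mul, ← h1, Finset.sum_mul]
      refine Finset.sum_congr rfl fun η hη => ?_
      rw [map_pow, pow_succ, mul_assoc, ← hv η hη]
    have h4 := congrArg (fun z => z.coeff (-((n * e + (j + 1) * a + e : ℕ) : ℚ))) h3
    simp only [xmap_coeff, HahnSeries.coeff_sum] at h4
    rw [Polynomial.coeff_mul, Finset.sum_eq_zero (s := Finset.HasAntidiagonal.antidiagonal _) (fun uv huv => by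
      rw [Finset.HasAntidiagonal.mem_antidiagonal] at huv
      rcases le_or_gt (n * e + (j + 1) * a) (uv.1 + 1) with h | h
      · rw [h2 _ h, zero_mul]
      · rw [Polynomial.coeff_eq_zero_of_natDegree_lt (p := D) (by omega), mul_zero]), map_zero] at h4
    rw [← h4]
    refine Finset.sum_congr rfl fun η hη => ?_
    rw [← pow_mul, ← hn, ← (hvl η hη).coeff_pow]
    congr 1
    rw [he]; push_cast
    linear_combination -hnq
  have h1 := eq_zero_of_sum_pow key hη₁
  rw [pow_eq_zero_iff hb, hvc _ hη₁, mul_eq_zero, map_eq_zero, Polynomial.leadingCoeff_eq_zero] at h1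
  rcases h1 with h1 | h1
  · exact hp.2 h1
  · rw [h1, Polynomial.natDegree_zero] at hD
    exact hD rfl

theorem exists_dual [CharZero K] (hf : f.map (xmap k K) = Lagrange.nodal s id) (hs : s.Nonempty)
    (N : ℕ) (hN : ∀ η ∈ s, ∀ l < s.card, Lge (-(N : ℚ)) (η ^ l))
    (hS : ¬ ∀ e : Fin s.card → Fin N → k, ∃ h : k[X][X], ∀ η ∈ s,
      Lge 0 (principal s.card N η e - ev η h)) :
    ∃ w : k[X][X], w ≠ 0 ∧ w.natDegree < s.card ∧ ∃ δ : ℚ, 0 < δ ∧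
      ∀ η ∈ s, Lge (1 + δ) (ev η w / ev η (Polynomial.derivative f)) := by
  classical
  obtain ⟨Φ, ⟨l₀, hl₀, hΦ⟩, hφ⟩ := exists_functional N hN hS
  obtain ⟨A, B, D, -, hD', hA⟩ := exists_bezout hf hs
  let w : k[X][X] := ∑ l ∈ Finset.range s.card, Polynomial.C (Φ l) * dualPoly f l
  have hw (b : k[X][X]) (hb : b.natDegree < s.card) :
      ∑ η ∈ s, ev η b * (ev η w / ev η (Polynomial.derivative f)) =
        xmap k K (∑ l ∈ Finset.range s.card, b.coeff l * Φ l) := by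
    simp only [w, map_sum, map_mul, Finset.sum_div, Finset.mul_sum]
    rw [Finset.sum_comm]
    refine Finset.sum_congr rfl fun l _ => ?_
    rw [← sum_dualPoly hf hb l, Finset.sum_mul]
    refine Finset.sum_congr rfl fun η _ => ?_
    rw [ev_C]; ring
  have hl (b : k[X][X]) (n : ℕ) (hb : ∀ η ∈ s, Lge (-(n : ℚ)) (ev η b)) : ∃ τ : k[X],
      ∑ η ∈ s, ev η b * (ev η w / ev η (Polynomial.derivative f)) = xmap k K τ ∧
        ∀ i, n ≤ i + 1 → τ.coeff i = 0 := by
    have h1 (η) (hη : η ∈ s) : ev η b = ev η (b %ₘ f) := by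
      have := congrArg (ev η) (Polynomial.modByMonic_add_div b f)
      rw [map_add, map_mul, ev_eq_zero hf hη, zero_mul, add_zero] at this
      exact this.symm
    have h2 : (b %ₘ f).natDegree < s.card := by
      rw [← natDegree_eq_card hf]
      refine Polynomial.natDegree_modByMonic_lt _ (monic_of_map_eq_nodal hf) fun h => ?_
      have := natDegree_eq_card hf
      rw [h, Polynomial.natDegree_one] at this
      exact hs.card_pos.ne this
    refine ⟨_, ?_, hφ (b %ₘ f) h2 n fun η hη => h1 η hη ▸ hb η hη⟩
    rw [← hw _ h2]
    exact Finset.sum_congr rfl fun η hη => by rw [h1 η hη]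
  have hord (η) (hη : η ∈ s) (p) (hp : Ord p (ev η w / ev η (Polynomial.derivative f))) : 1 < p :=
    one_lt_of_ord (l := fun η => ev η w / ev η (Polynomial.derivative f)) (v := w * A) hD'
      (fun η hη => by
        rw [map_mul, ← ev_bezout hf hA hη]
        field_simp [ev_derivative_ne_zero hf hη]) hl hη hp
  refine ⟨w, fun h => ?_, ?_, ?_⟩
  · have h1 := hw (Polynomial.X ^ l₀) (by rwa [Polynomial.natDegree_X_pow])
    rw [Finset.sum_eq_zero (fun η _ => by rw [h, map_zero, zero_div, mul_zero]), eq_comm,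
      map_eq_zero_iff _ (xmap_injective' (k := k) (K := K)), Finset.sum_eq_single l₀] at h1
    · rw [Polynomial.coeff_X_pow, if_pos rfl, one_mul] at h1
      exact hΦ h1
    · intro l _ hne
      rw [Polynomial.coeff_X_pow, if_neg hne, zero_mul]
    · intro h; exact (h (Finset.mem_range.2 hl₀)).elim
  · refine (Polynomial.natDegree_sum_le _ _).trans_lt ?_
    rw [Finset.fold_max_lt]
    exact ⟨hs.card_pos, fun l _ => (Polynomial.natDegree_C_mul_le _ _).trans_lt
      (natDegree_dualPoly hf hs l)⟩
  · have (η : Hahn K) : ∃ δ : ℚ, 0 < δ ∧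
        (η ∈ s → Lge (1 + δ) (ev η w / ev η (Polynomial.derivative f))) := by
      by_cases hη : η ∈ s
      · by_cases h0 : ev η w / ev η (Polynomial.derivative f) = 0
        · exact ⟨1, one_pos, fun _ => h0 ▸ lge_zero _⟩
        · obtain ⟨p, hp⟩ := exists_ord h0
          refine ⟨p - 1, sub_pos.2 (hord η hη p hp), fun _ => ?_⟩
          rw [add_sub_cancel]; exact hp.lge
      · exact ⟨1, one_pos, fun h => (hη h).elim⟩
    choose δ hδ hδ' using this
    refine ⟨s.inf' hs δ, (Finset.lt_inf'_iff _).2 fun η _ => hδ η, fun η hη => (hδ' η hη).mono ?_⟩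
    have := Finset.inf'_le δ hη
    linarith

section Growth

theorem exists_norm_eval_le (q : ℂ[X]) (a : ℕ) (ha : q.natDegree ≤ a) :
    ∃ C : ℝ, 0 ≤ C ∧ ∀ x : ℂ, 1 ≤ ‖x‖ → ‖q.eval x‖ ≤ C * ‖x‖ ^ a := by
  refine ⟨∑ i ∈ Finset.range (a + 1), ‖q.coeff i‖, Finset.sum_nonneg fun _ _ => norm_nonneg _,
    fun x hx => ?_⟩
  rw [Polynomial.eval_eq_sum_range' (Nat.lt_succ_of_le ha), Finset.sum_mul]
  refine (norm_sum_le _ _).trans (Finset.sum_le_sum fun i hi => ?_)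
  rw [norm_mul, norm_pow]
  exact mul_le_mul_of_nonneg_left
    (pow_le_pow_right₀ hx (Nat.lt_succ_iff.1 (Finset.mem_range.1 hi))) (norm_nonneg _)

theorem exists_le_norm_eval {q : ℂ[X]} (hq : q.natDegree ≠ 0) :
    ∃ R κ : ℝ, 1 ≤ R ∧ 0 < κ ∧ ∀ x : ℂ, R < ‖x‖ → κ * ‖x‖ ^ q.natDegree ≤ ‖q.eval x‖ := by
  obtain ⟨e, he⟩ := Nat.exists_eq_succ_of_ne_zero hq
  have h1 : q.eraseLead.natDegree ≤ e := by
    have := q.eraseLead_natDegree_le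
    omega
  obtain ⟨C, hC, h⟩ := exists_norm_eval_le _ e h1
  have hl : 0 < ‖q.leadingCoeff‖ := norm_pos_iff.2 fun h0 => by
    rw [Polynomial.leadingCoeff_eq_zero] at h0
    rw [h0, Polynomial.natDegree_zero] at hq
    exact hq rfl
  refine ⟨max 1 (2 * C / ‖q.leadingCoeff‖), ‖q.leadingCoeff‖ / 2, le_max_left _ _, by positivity,
    fun x hx => ?_⟩
  have hx1 : 1 ≤ ‖x‖ := (le_max_left _ _).trans hx.le
  have hx2 : 2 * C ≤ ‖q.leadingCoeff‖ * ‖x‖ := by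
    have := (le_max_right _ _).trans hx.le
    rwa [div_le_iff₀ hl, mul_comm ‖x‖] at this
  have h2 : q.eval x = q.eraseLead.eval x + q.leadingCoeff * x ^ q.natDegree := by
    conv_lhs => rw [← q.eraseLead_add_monomial_natDegree_leadingCoeff]
    rw [Polynomial.eval_add, Polynomial.eval_monomial]
  have h3 : ‖q.leadingCoeff * x ^ q.natDegree‖ ≤ ‖q.eval x‖ + ‖q.eraseLead.eval x‖ := by
    have : q.leadingCoeff * x ^ q.natDegree = q.eval x - q.eraseLead.eval x := by rw [h2]; ring
    rw [this]; exact norm_sub_le _ _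
  rw [norm_mul, norm_pow] at h3
  have h4 := h x hx1
  have h5 : 2 * C * ‖x‖ ^ e ≤ ‖q.leadingCoeff‖ * ‖x‖ * ‖x‖ ^ e :=
    mul_le_mul_of_nonneg_right hx2 (by positivity)
  rw [he, pow_succ] at h3 ⊢
  nlinarith

variable {P : ℂ[X][X]}

theorem exists_norm_at₂_le_of_level (hP : P.Monic) (hm : 0 < P.natDegree) :
    ∃ d : ℕ, ∀ c : ℂ, ∃ C : ℝ, 0 ≤ C ∧ ∀ p : Level P c, 1 ≤ ‖p.1.1‖ →
      ‖p.1.2‖ ≤ C * ‖p.1.1‖ ^ d := by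
  refine ⟨∑ i ∈ Finset.range P.natDegree, (P.coeff i).natDegree, fun c => ?_⟩
  have (i : ℕ) : ∃ C : ℝ, 0 ≤ C ∧ (i ∈ Finset.range P.natDegree → ∀ x : ℂ, 1 ≤ ‖x‖ →
      ‖(P.coeff i).eval x‖ ≤ C * ‖x‖ ^ ∑ i ∈ Finset.range P.natDegree, (P.coeff i).natDegree) := by
    by_cases hi : i ∈ Finset.range P.natDegree
    · obtain ⟨C, h1, h2⟩ := exists_norm_eval_le (P.coeff i) _
        (Finset.single_le_sum (f := fun i => (P.coeff i).natDegree) (fun _ _ => Nat.zero_le _) hi)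
      exact ⟨C, h1, fun _ => h2⟩
    · exact ⟨0, le_rfl, fun h => (hi h).elim⟩
  choose C hC hC' using this
  refine ⟨1 + ‖c‖ + ∑ i ∈ Finset.range P.natDegree, C i,
    add_nonneg (by positivity) (Finset.sum_nonneg fun i _ => hC i), fun p hp => ?_⟩
  refine (norm_le_of_level hP hm p.2).trans ?_
  rw [add_mul, Finset.sum_mul]
  exact add_le_add (le_mul_of_one_le_right (by positivity) (one_le_pow₀ hp))
    (Finset.sum_le_sum fun i hi => hC' i hi _ hp)

theorem exists_norm_at₂_le {c : ℂ} {d : ℕ} (hy : ∃ C : ℝ, 0 ≤ C ∧ ∀ p : Level P c, 1 ≤ ‖p.1.1‖ →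
    ‖p.1.2‖ ≤ C * ‖p.1.1‖ ^ d) (E : ℂ[X][X]) (a m : ℕ) (hE : ∀ i, (E.coeff i).natDegree ≤ a)
    (hm : E.natDegree ≤ m) :
    ∃ C : ℝ, 0 ≤ C ∧ ∀ p : Level P c, 1 ≤ ‖p.1.1‖ → ‖at₂ E p.1‖ ≤ C * ‖p.1.1‖ ^ (a + m * d) := by
  obtain ⟨C₁, hC₁, h1⟩ := hy
  choose C hC hC' using fun i => exists_norm_eval_le (E.coeff i) a (hE i)
  refine ⟨∑ i ∈ Finset.range (E.natDegree + 1), C i * C₁ ^ i,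
    Finset.sum_nonneg fun i _ => mul_nonneg (hC i) (pow_nonneg hC₁ _), fun p hp => ?_⟩
  rw [at₂_eq_sum, Finset.sum_mul]
  refine (norm_sum_le _ _).trans (Finset.sum_le_sum fun i hi => ?_)
  rw [norm_mul, norm_pow]
  have hi' : i ≤ m := (Nat.lt_succ_iff.1 (Finset.mem_range.1 hi)).trans hm
  calc _ ≤ (C i * ‖p.1.1‖ ^ a) * (C₁ * ‖p.1.1‖ ^ d) ^ i :=
        mul_le_mul (hC' i _ hp) (pow_le_pow_left₀ (norm_nonneg _) (h1 p hp) _) (by positivity)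
          (mul_nonneg (hC i) (by positivity))
    _ = C i * C₁ ^ i * ‖p.1.1‖ ^ (a + i * d) := by rw [mul_pow, ← pow_mul, pow_add, mul_comm d]; ring
    _ ≤ _ := mul_le_mul_of_nonneg_left
        (pow_le_pow_right₀ hp (Nat.add_le_add_left (Nat.mul_le_mul_right _ hi') _))
        (mul_nonneg (hC i) (pow_nonneg hC₁ _))

end Growth

section Lvl

variable {P Q : ℂ[X][X]} {c₀ : ℂ}

/-- The difference of `P` and a constant `t` of an extension of `ℂ`. -/
noncomputable def lvl {k : Type*} [CommRing k] [Algebra ℂ k] (P : ℂ[X][X]) (t : k) : k[X][X] :=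
  P.map (Polynomial.mapRingHom (algebraMap ℂ k)) - Polynomial.C (Polynomial.C t)

variable {k K : Type*} [CommRing k] [Algebra ℂ k] [Field K] [Algebra ℂ K] [Algebra k K]
  [IsScalarTower ℂ k K]

theorem lvl_map_xmap (t : k) : (lvl P t).map (xmap k K) = lev P (algebraMap k K t) := by
  rw [lvl, lev, Polynomial.map_sub, Polynomial.map_C, xmap_C, Polynomial.map_map]
  congr 2
  ext a
  · simp [-HahnSeries.C_apply, xmap_C, ← IsScalarTower.algebraMap_apply]
  · simp [xmap_X]

theorem Keller.lvl_map_eq_nodal [IsAlgClosed K] (hK : Keller P Q c₀) (t : k) :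
    (lvl P t).map (xmap k K) = Lagrange.nodal (rts P (algebraMap k K t)) id := by
  rw [lvl_map_xmap, hK.lev_eq_prod, Lagrange.nodal]
  rfl

theorem derivative_lvl (t : k) : Polynomial.derivative (lvl P t) =
    (dY ℂ P).map (Polynomial.mapRingHom (algebraMap ℂ k)) := by
  rw [lvl, Polynomial.derivative_sub, Polynomial.derivative_C, sub_zero, Polynomial.derivative_map,
    dY_apply]

theorem Keller.rts_nonempty [IsAlgClosed K] (hK : Keller P Q c₀) (c : K) : (rts P c).Nonempty := by
  rw [← Finset.card_pos, hK.card_rts]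
  exact hK.natDegree_pos

end Lvl

section Spc

variable {P Q : ℂ[X][X]} {c₀ : ℂ}

/-- Specialisation of the level parameter. -/
noncomputable def spc (c : ℂ) : ℂ[X][X][X] →+* ℂ[X][X] :=
  Polynomial.mapRingHom (Polynomial.mapRingHom (Polynomial.evalRingHom c))

theorem spc_coeff (c : ℂ) (w : ℂ[X][X][X]) (i j : ℕ) :
    ((spc c w).coeff i).coeff j = ((w.coeff i).coeff j).eval c := by
  simp [spc]

theorem spc_lvl (c : ℂ) : spc c (lvl P Polynomial.X) = P - Polynomial.C (Polynomial.C c) := by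
  ext i j
  rw [spc_coeff, lvl, Polynomial.coeff_sub, Polynomial.coeff_sub, Polynomial.coeff_sub,
    Polynomial.coeff_sub, Polynomial.coeff_map, Polynomial.coe_mapRingHom, Polynomial.coeff_map,
    Polynomial.eval_sub]
  congr 1
  · simp
  · simp only [Polynomial.coeff_C]
    split_ifs
    · rw [Polynomial.coeff_C, Polynomial.coeff_C]; split_ifs <;> simp
    · simp

theorem spc_C (c : ℂ) (D : ℂ[X][X]) :
    spc c (Polynomial.C D) = Polynomial.C (D.map (Polynomial.evalRingHom c)) := by
  simp [spc]

theorem spc_derivative_lvl (c : ℂ) : spc c (Polynomial.derivative (lvl P Polynomial.X)) = dY ℂ P := by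
  rw [spc, Polynomial.coe_mapRingHom, ← Polynomial.derivative_map]
  have := spc_lvl (P := P) c
  rw [spc, Polynomial.coe_mapRingHom] at this
  rw [this, Polynomial.derivative_sub, Polynomial.derivative_C, sub_zero, dY_apply]

theorem eq_zero_of_spc {w : ℂ[X][X][X]} {S : Set ℂ} (hS : S.Infinite) (h : ∀ c ∈ S, spc c w = 0) :
    w = 0 := by
  ext i j : 2
  rw [Polynomial.coeff_zero, Polynomial.coeff_zero]
  refine Polynomial.eq_zero_of_infinite_isRoot _ (hS.mono fun c hc => ?_)
  show Polynomial.eval _ _ = _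
  rw [← spc_coeff, h c hc, Polynomial.coeff_zero, Polynomial.coeff_zero]

/-- A polynomial of small degree vanishing on a level vanishes. -/
theorem eq_zero_of_level {c : ℂ} (hP : P.Monic) (hm : 0 < P.natDegree) {w A B : ℂ[X][X]} {D : ℂ[X]}
    (hD : D ≠ 0) (hA : A * dY ℂ P + B * (P - Polynomial.C (Polynomial.C c)) = Polynomial.C D)
    (hw : w.natDegree < P.natDegree) (h : ∀ p : Level P c, at₂ w p.1 = 0) : w = 0 := by
  have key (x : ℂ) (hx : D.eval x ≠ 0) : w.map (Polynomial.evalRingHom x) = 0 := by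
    set f : ℂ[X] := (P - Polynomial.C (Polynomial.C c)).map (Polynomial.evalRingHom x) with hf
    have hfd : Polynomial.derivative f = (dY ℂ P).map (Polynomial.evalRingHom x) := by
      rw [hf, Polynomial.derivative_map, Polynomial.derivative_sub, Polynomial.derivative_C,
        sub_zero, dY_apply]
    have hP' : (P - Polynomial.C (Polynomial.C c)).Monic := by
      refine hP.sub_of_left ?_
      rw [Polynomial.degree_eq_natDegree hP.ne_zero]
      exact Polynomial.degree_C_le.trans_lt (by exact_mod_cast hm)
    have hdeg : f.natDegree = P.natDegree := by
      rw [hf, hP'.natDegree_map, Polynomial.natDegree_sub_C]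
    have hf0 : f ≠ 0 := (hP'.map _).ne_zero
    have hsep : f.Separable := by
      refine ⟨B.map (Polynomial.evalRingHom x) * Polynomial.C (D.eval x)⁻¹,
        A.map (Polynomial.evalRingHom x) * Polynomial.C (D.eval x)⁻¹, ?_⟩
      have h1 := congrArg (Polynomial.map (Polynomial.evalRingHom x)) hA
      rw [Polynomial.map_add, Polynomial.map_mul, Polynomial.map_mul, ← hf, ← hfd,
        Polynomial.map_C] at h1
      have h2 : (Polynomial.C (D.eval x) : ℂ[X]) * Polynomial.C (D.eval x)⁻¹ = 1 := by
        rw [← Polynomial.C_mul, mul_inv_cancel₀ hx, Polynomial.C_1]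
      rw [← h2]
      change _ = Polynomial.C (D.eval x) at h1
      rw [← h1]; ring
    have hnd := Polynomial.nodup_roots hsep
    classical
    refine Polynomial.eq_zero_of_natDegree_lt_card_of_eval_eq_zero' _ f.roots.toFinset (fun y hy => ?_) ?_
    · rw [Multiset.mem_toFinset, Polynomial.mem_roots hf0] at hy
      have h1 : at₂ P (x, y) = c := by
        have h2 : f.eval y = at₂ P (x, y) - c := by
          rw [hf, at₂_eq_eval, Polynomial.map_sub, Polynomial.map_C, Polynomial.eval_sub,
            Polynomial.eval_C]
          simp
        rw [Polynomial.IsRoot, h2, sub_eq_zero] at hy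
        exact hy
      rw [← at₂_eq_eval]
      exact h ⟨(x, y), h1⟩
    · rw [Multiset.toFinset_card_of_nodup hnd, IsAlgClosed.card_roots_eq_natDegree, hdeg]
      exact Polynomial.natDegree_map_le.trans_lt hw
  ext i : 1
  rw [Polynomial.coeff_zero]
  refine Polynomial.eq_zero_of_infinite_isRoot _
    ((Polynomial.finite_setOfPred_isRoot hD).infinite_compl.mono fun x hx => ?_)
  have := congrArg (fun q => q.coeff i) (key x hx)
  rw [Polynomial.coeff_map] at this
  simpa using this

/-- All fibres of `P` outside a finite set are homeomorphic to punctured planes. -/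
def PlanarFibers (P : ℂ[X][X]) : Prop :=
  ∃ S : Finset ℂ, ∀ c ∉ S, ∃ T : Finset ℂ, Nonempty (Level P c ≃ₜ {z : ℂ // z ∉ T})

instance : FaithfulSMul ℂ[X] Kb := (faithfulSMul_iff_algebraMap_injective _ _).2 toKb_injective

theorem exists_exponent {s : Finset (Hahn Kb)} {v : ℂ[X][X][X]} {e : ℕ} {δ : ℚ} (hδ : 0 < δ) (he : e ≠ 0)
    {F : ℂ[X][X][X]} (hF : F.map (xmap ℂ[X] Kb) = Lagrange.nodal s id) (hs : s.Nonempty)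
    (hv : ∀ η ∈ s, Lge (δ - e) (ev η v)) (L : ℕ) :
    ∃ (n : ℕ) (E G : ℂ[X][X][X]) (a : ℕ), n ≠ 0 ∧ v ^ n = E + F * G ∧ E.natDegree < s.card ∧
      (∀ i, (E.coeff i).natDegree ≤ a) ∧ a + L + 1 ≤ n * e := by
  obtain ⟨D₀, hD₀⟩ := exists_lagrange_bound s
  obtain ⟨n₁, hn₁⟩ := exists_nat_gt ((D₀ + L + 2 : ℚ) / δ)
  rw [div_lt_iff₀ hδ] at hn₁
  obtain ⟨n, hn, hn0⟩ : ∃ n : ℕ, (D₀ + L + 2 : ℚ) < n * δ ∧ L + 1 ≤ n := by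
    refine ⟨n₁ + (L + 1), hn₁.trans_le ?_, by omega⟩
    push_cast
    nlinarith
  have hne : L + 1 ≤ n * e := hn0.trans (Nat.le_mul_of_pos_right _ (Nat.pos_of_ne_zero he))
  have hdeg : (v ^ n %ₘ F).natDegree < s.card := by
    rw [← natDegree_eq_card hF]
    refine Polynomial.natDegree_modByMonic_lt _ (monic_of_map_eq_nodal hF) fun h => ?_
    have := natDegree_eq_card hF
    rw [h, Polynomial.natDegree_one] at this
    exact hs.card_pos.ne this
  have hE (i : ℕ) : Lge (n * (δ - e) - D₀) (xmap ℂ[X] Kb ((v ^ n %ₘ F).coeff i)) := by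
    rw [← Polynomial.coeff_map]
    refine hD₀ _ _ ?_ (fun η hη => ?_) i
    · exact Polynomial.degree_map_le.trans_lt
        (Polynomial.degree_le_natDegree.trans_lt (by exact_mod_cast hdeg))
    · rw [← ev_eq_eval]
      have := congrArg (ev η) (Polynomial.modByMonic_add_div (v ^ n) F)
      rw [map_add, map_mul, ev_eq_zero hF hη, zero_mul, add_zero] at this
      rw [this, map_pow]
      exact (hv η hη).pow n
  refine ⟨n, v ^ n %ₘ F, v ^ n /ₘ F, n * e - (L + 1), by omega, (Polynomial.modByMonic_add_div _ _).symm,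
    hdeg, fun i => ?_, by omega⟩
  rw [Polynomial.natDegree_le_iff_coeff_eq_zero]
  intro j hj
  have h1 := hE i (-(j : ℚ)) (by
    have h2 : (n * e : ℚ) ≤ j + L := by exact_mod_cast (by omega : n * e ≤ j + L)
    linarith)
  rw [xmap_coeff] at h1
  exact (map_eq_zero_iff _ (FaithfulSMul.algebraMap_injective ℂ[X] Kb)).1 h1

/-- Over the field of rational functions, the different of a level does not decay on a
polynomial of small degree. -/
theorem Keller.no_dual (hK : Keller P Q c₀) (hP : PlanarFibers P) {w : ℂ[X][X][X]}
    (hw : w.natDegree < P.natDegree) {δ : ℚ} (hδ : 0 < δ)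
    (h : ∀ η ∈ rts P tt, Lge (1 + δ) (ev η w / ev η (Polynomial.derivative (lvl P (Polynomial.X : ℂ[X]))))) :
    w = 0 := by
  set F : ℂ[X][X][X] := lvl P Polynomial.X with hFdef
  have hF : F.map (xmap ℂ[X] Kb) = Lagrange.nodal (rts P tt) id := hK.lvl_map_eq_nodal Polynomial.X
  have hs : (rts P tt).Nonempty := hK.rts_nonempty tt
  obtain ⟨A, B, D, hD, hD', hAB⟩ := exists_bezout hF hs
  obtain ⟨d, hd⟩ := exists_norm_at₂_le_of_level hK.monic hK.natDegree_pos
  obtain ⟨n, E, G, a, hn, hE, hEdeg, hEa, ha⟩ := exists_exponent (e := D.natDegree)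
    (v := Polynomial.C Polynomial.X * w * A) hδ hD' hF hs (fun η hη => by
      have h0 := ev_derivative_ne_zero hF hη
      have h1 : ev η (Polynomial.C Polynomial.X * w * A) =
          hx Kb * (ev η w / ev η (Polynomial.derivative F)) * xmap ℂ[X] Kb D := by
        rw [map_mul, map_mul, ev_C_X, ← ev_bezout hF hAB hη]
        field_simp
      rw [h1]
      refine (((hx_ord (S := Kb)).lge.mul (h η hη)).mul (xmap_lge D)).mono (by linarith)) (P.natDegree * d)
  rw [hK.card_rts] at hEdeg
  obtain ⟨S, hS⟩ := hP
  refine eq_zero_of_spc (S := {c | c ∉ S ∧ D.leadingCoeff.eval c ≠ 0}) ?_ ?_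
  · have h1 : (↑S ∪ {c | D.leadingCoeff.IsRoot c} : Set ℂ).Finite :=
      S.finite_toSet.union (Polynomial.finite_setOfPred_isRoot (by simpa using hD))
    refine h1.infinite_compl.mono fun c hc => ?_
    simp only [Set.mem_compl_iff, Set.mem_union, not_or] at hc
    exact ⟨fun h => hc.1 h, hc.2⟩
  rintro c ⟨hcS, hcD⟩
  obtain ⟨T, ⟨φ⟩⟩ := hS c hcS
  set Dc : ℂ[X] := D.map (Polynomial.evalRingHom c) with hDc
  have hdeg : Dc.natDegree = D.natDegree := Polynomial.natDegree_map_of_leadingCoeff_ne_zero _ hcD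
  have hAc : spc c A * dY ℂ P + spc c B * (P - Polynomial.C (Polynomial.C c)) = Polynomial.C Dc := by
    have := congrArg (spc c) hAB
    rwa [map_add, map_mul, map_mul, hFdef, spc_derivative_lvl, spc_lvl, spc_C] at this
  have hEc : (Polynomial.C Polynomial.X * spc c w * spc c A) ^ n = spc c E +
      (P - Polynomial.C (Polynomial.C c)) * spc c G := by
    have := congrArg (spc c) hE
    rw [map_add, map_mul, map_pow, map_mul, map_mul, hFdef, spc_lvl, spc_C] at this
    rw [← this]; simp
  have hlev (p : Level P c) : at₂ (P - Polynomial.C (Polynomial.C c)) p.1 = 0 := by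
    simp [p.2]
  have hAp (p : Level P c) : at₂ (spc c A) p.1 * at₂ (dY ℂ P) p.1 = Dc.eval p.1.1 := by
    have := congrArg (fun b => at₂ b p.1) hAc
    simp only [at₂_add, at₂_mul, at₂_C, hlev, mul_zero, add_zero] at this
    exact this
  have hEp (p : Level P c) : (p.1.1 * at₂ (spc c w) p.1 * at₂ (spc c A) p.1) ^ n = at₂ (spc c E) p.1 := by
    have := congrArg (fun b => at₂ b p.1) hEc
    simp only [at₂_add, at₂_mul, at₂_C, at₂_pow, hlev, zero_mul, add_zero, Polynomial.eval_X] at this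
    exact this
  obtain ⟨R, κ, hR, hκ, hlow⟩ := exists_le_norm_eval (q := Dc) (by rwa [hdeg])
  obtain ⟨C, hC, hup⟩ := exists_norm_at₂_le (hd c) (spc c E) a P.natDegree
    (fun i => by
      rw [Polynomial.natDegree_le_iff_coeff_eq_zero]
      intro j hj
      rw [spc_coeff, Polynomial.coeff_eq_zero_of_natDegree_lt ((hEa i).trans_lt hj), Polynomial.eval_zero])
    (Polynomial.natDegree_map_le.trans hEdeg.le)
  refine eq_zero_of_level (c := c) hK.monic hK.natDegree_pos (D := Dc) (fun h0 => ?_) hAc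
    (Polynomial.natDegree_map_le.trans_lt hw)
    (hK.eq_zero_on_level φ (w := spc c w) (R := R) (C := C / κ ^ n) (n := n) (by linarith) hn
      (fun p hp h0 => ?_) fun p hp => ?_)
  · rw [← hdeg, h0, Polynomial.natDegree_zero] at hD'
    exact hD' rfl
  · have h1 := hAp p
    have h2 := hlow _ hp
    rw [← h1, h0, mul_zero, norm_zero] at h2
    have : 0 < κ * ‖p.1.1‖ ^ Dc.natDegree := mul_pos hκ (pow_pos (by linarith) _)
    linarith
  · have hx1 : 1 ≤ ‖p.1.1‖ := by linarith
    have hx0 : 0 < ‖p.1.1‖ := by linarith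
    have h1 := hup p hx1
    rw [← hEp, norm_pow, norm_mul, norm_mul] at h1
    have h2 : (κ * ‖p.1.1‖ ^ D.natDegree) ^ n ≤ (‖at₂ (spc c A) p.1‖ * ‖at₂ (dY ℂ P) p.1‖) ^ n := by
      rw [← norm_mul, hAp, ← hdeg]
      exact pow_le_pow_left₀ (by positivity) (hlow _ hp) _
    rw [div_mul_eq_mul_div, le_div_iff₀ (by positivity)]
    have h3 : 0 < ‖p.1.1‖ ^ (a + P.natDegree * d) := by positivity
    refine le_of_mul_le_mul_right ?_ h3
    have h4 : ‖p.1.1‖ ^ (a + P.natDegree * d) * ‖p.1.1‖ ≤ ‖p.1.1‖ ^ (n * D.natDegree) := by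
      rw [← pow_succ]; exact pow_le_pow_right₀ hx1 ha
    set X := ‖p.1.1‖
    set W := ‖at₂ (spc c w) p.1‖
    set Y := ‖at₂ (dY ℂ P) p.1‖
    set Z := ‖at₂ (spc c A) p.1‖
    calc W ^ n * X ^ (n + 1) * κ ^ n * X ^ (a + P.natDegree * d)
        = (W ^ n * X ^ n * κ ^ n) * (X ^ (a + P.natDegree * d) * X) := by rw [pow_succ]; ring
      _ ≤ (W ^ n * X ^ n * κ ^ n) * X ^ (n * D.natDegree) :=
          mul_le_mul_of_nonneg_left h4 (by positivity)
      _ = (X * W) ^ n * (κ * X ^ D.natDegree) ^ n := by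
          rw [mul_pow, mul_pow, mul_comm n, pow_mul]; ring
      _ ≤ (X * W) ^ n * (Z * Y) ^ n := mul_le_mul_of_nonneg_left h2 (by positivity)
      _ = (X * W * Z) ^ n * Y ^ n := by simp only [mul_pow]; ring
      _ ≤ (C * X ^ (a + P.natDegree * d)) * Y ^ n := mul_le_mul_of_nonneg_right h1 (by positivity)
      _ = _ := by ring

end Spc

theorem exists_clear_denominators (b : (FractionRing ℂ[X])[X][X]) :
    ∃ (q : ℂ[X]) (b' : ℂ[X][X][X]), q ≠ 0 ∧
      b'.map (Polynomial.mapRingHom (algebraMap ℂ[X] (FractionRing ℂ[X]))) =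
        Polynomial.C (Polynomial.C (algebraMap ℂ[X] (FractionRing ℂ[X]) q)) * b := by
  induction b using Polynomial.induction_on' with
  | add b₁ b₂ h₁ h₂ =>
    obtain ⟨q₁, b₁', hq₁, h₁⟩ := h₁
    obtain ⟨q₂, b₂', hq₂, h₂⟩ := h₂
    refine ⟨q₁ * q₂, Polynomial.C (Polynomial.C q₂) * b₁' + Polynomial.C (Polynomial.C q₁) * b₂',
      mul_ne_zero hq₁ hq₂, ?_⟩
    simp only [Polynomial.map_add, Polynomial.map_mul, h₁, h₂, Polynomial.map_C,
      Polynomial.coe_mapRingHom, map_mul]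
    ring
  | monomial n p =>
    obtain ⟨q, hq, hp⟩ := IsLocalization.integerNormalization_spec (nonZeroDivisors ℂ[X]) p
    refine ⟨q, Polynomial.monomial n (IsLocalization.integerNormalization (nonZeroDivisors ℂ[X]) p),
      nonZeroDivisors.ne_zero hq, ?_⟩
    rw [Polynomial.map_monomial, Polynomial.C_mul_monomial, Polynomial.coe_mapRingHom, hp,
      ← Polynomial.smul_eq_C_mul, algebraMap_smul]

theorem ev_map_algebraMap (η : Hahn Kb) (b : ℂ[X][X][X]) :
    ev η (b.map (Polynomial.mapRingHom (algebraMap ℂ[X] (FractionRing ℂ[X])))) = ev η b :=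
  ev_map _ (fun _ => (IsScalarTower.algebraMap_apply _ _ _ _).symm) η b

theorem hmap_xmap (p : ℂ[X][X]) :
    hmap (toKb : ℂ[X] →+* Kb) (xmap ℂ[X] ℂ[X] p) = xmap ℂ[X] Kb p := by
  ext i
  by_cases hi : ∃ n : ℕ, i = -n
  · obtain ⟨n, rfl⟩ := hi
    rw [hmap_coeff, xmap_coeff, xmap_coeff]; rfl
  · push Not at hi
    rw [hmap_coeff, xmap_coeff_of_ne _ _ hi, xmap_coeff_of_ne _ _ hi, map_zero]

theorem exists_lge_pow {S : Type*} [CommRing S] (η : Hahn S) (m : ℕ) :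
    ∃ N : ℕ, ∀ l < m, Lge (-(N : ℚ)) (η ^ l) := by
  obtain ⟨n, hn⟩ : ∃ n : ℕ, Lge (-(n : ℚ)) η := by
    by_cases h : η = 0
    · exact ⟨0, h ▸ lge_zero _⟩
    · obtain ⟨p, hp⟩ := exists_ord h
      obtain ⟨n, hn⟩ := exists_nat_gt (-p)
      exact ⟨n, hp.lge.mono (by linarith)⟩
  refine ⟨m * n, fun l hl => (hn.pow l).mono ?_⟩
  have : (l : ℚ) ≤ m := by exact_mod_cast hl.le
  push_cast
  nlinarith [(by positivity : (0 : ℚ) ≤ n)]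

section Realize

variable {P Q : ℂ[X][X]} {c₀ : ℂ}

theorem rts_tt : rts P (algebraMap (FractionRing ℂ[X]) Kb (algebraMap ℂ[X] (FractionRing ℂ[X]) Polynomial.X)) =
    rts P tt := by
  rw [← IsScalarTower.algebraMap_apply]; rfl

/-- Every system of principal parts on the generic level is realised by a regular function. -/
theorem Keller.exists_realize (hK : Keller P Q c₀) (hP : PlanarFibers P) (N : ℕ)
    (hN : ∀ η ∈ rts P tt, ∀ l < (rts P tt).card, Lge (-(N : ℚ)) (η ^ l))
    (e : Fin (rts P tt).card → Fin N → FractionRing ℂ[X]) :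
    ∃ h : (FractionRing ℂ[X])[X][X], ∀ η ∈ rts P tt,
      Lge 0 (principal (rts P tt).card N η e - ev η h) := by
  revert e
  by_contra hS
  have hF := hK.lvl_map_eq_nodal (K := Kb) (algebraMap ℂ[X] (FractionRing ℂ[X]) Polynomial.X)
  rw [rts_tt] at hF
  have : CharZero Kb := charZero_of_algebra Kb
  obtain ⟨w, hw, hdeg, δ, hδ, h⟩ := exists_dual hF (hK.rts_nonempty tt) N hN hS
  obtain ⟨q, w', hq, hw'⟩ := exists_clear_denominators w
  have hinj : Function.Injective (Polynomial.mapRingHom (algebraMap ℂ[X] (FractionRing ℂ[X]))) :=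
    Polynomial.map_injective _ (IsFractionRing.injective _ _)
  have hder (η : Hahn Kb) : ev η (Polynomial.derivative (lvl P
      (algebraMap ℂ[X] (FractionRing ℂ[X]) Polynomial.X))) =
      ev η (Polynomial.derivative (lvl P (Polynomial.X : ℂ[X]))) := by
    rw [derivative_lvl, derivative_lvl, ev_map _ (fun _ => (IsScalarTower.algebraMap_apply _ _ _ _).symm),
      ev_map _ (fun _ => (IsScalarTower.algebraMap_apply _ _ _ _).symm)]
  have hne : Polynomial.C (Polynomial.C (algebraMap ℂ[X] (FractionRing ℂ[X]) q)) ≠ 0 := by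
    simpa using hq
  have h0 : w' = 0 := by
    refine hK.no_dual hP ?_ hδ fun η hη => ?_
    · rw [← Polynomial.natDegree_map_eq_of_injective hinj, hw', Polynomial.natDegree_C_mul (by simpa using hq),
        ← hK.card_rts tt]
      exact hdeg
    · rw [← ev_map_algebraMap, hw', map_mul, ev_C_C, mul_div_assoc, ← hder]
      exact ((lge_C _).mul (h η hη)).mono (by rw [zero_add])
  rw [h0, Polynomial.map_zero, eq_comm, mul_eq_zero] at hw'
  exact hw'.elim hne hw

/-- A Hahn series with integral exponents is, up to decaying terms, a polynomial plus a
principal part. -/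
theorem exists_truncation {a : Hahn ℂ[X]} (ha : ∀ q, a.coeff q ≠ 0 → ∃ n : ℤ, q = n) :
    ∃ p : ℂ[X][X], ∀ N : ℕ, Lge (N : ℚ) (a - xmap ℂ[X] ℂ[X] p -
      ∑ j : Fin N, HahnSeries.single (((j : ℕ) + 1 : ℕ) : ℚ) (a.coeff (((j : ℕ) + 1 : ℕ) : ℚ))) := by
  obtain ⟨N₀, hN₀⟩ : ∃ N₀ : ℕ, Lge (-(N₀ : ℚ)) a := by
    by_cases h : a = 0
    · exact ⟨0, h ▸ lge_zero _⟩
    · obtain ⟨p, hp⟩ := exists_ord h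
      obtain ⟨n, hn⟩ := exists_nat_gt (-p)
      exact ⟨n, hp.lge.mono (by linarith)⟩
  obtain ⟨p, hp⟩ : ∃ p : ℂ[X][X], ∀ n : ℕ, p.coeff n = a.coeff (-(n : ℚ)) := by
    refine ⟨∑ i ∈ Finset.range (N₀ + 1), Polynomial.monomial i (a.coeff (-(i : ℚ))), fun n => ?_⟩
    rw [Polynomial.finsetSum_coeff]
    simp only [Polynomial.coeff_monomial]
    rw [Finset.sum_ite_eq' (Finset.range (N₀ + 1)) n fun i => a.coeff (-(i : ℚ))]
    split_ifs with h
    · rfl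
    · rw [Finset.mem_range, not_lt] at h
      refine (hN₀ _ ?_).symm
      have : ((N₀ + 1 : ℕ) : ℚ) ≤ n := by exact_mod_cast h
      push_cast at this
      linarith
  refine ⟨p, fun N q hq => ?_⟩
  rw [HahnSeries.coeff_sub, HahnSeries.coeff_sub, HahnSeries.coeff_sum]
  by_cases hi : ∃ n : ℤ, q = n
  · obtain ⟨n, rfl⟩ := hi
    have hn : n < N := by exact_mod_cast hq
    rcases le_or_gt n 0 with h | h
    · obtain ⟨i, rfl⟩ := Int.exists_eq_neg_ofNat h
      rw [Finset.sum_eq_zero, sub_zero]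
      · push_cast
        rw [xmap_coeff, hp]
        exact sub_self _
      · intro j _
        refine HahnSeries.coeff_single_of_ne ?_
        push_cast
        have : (0 : ℚ) ≤ i := by positivity
        have : (0 : ℚ) ≤ (j : ℕ) := by positivity
        intro h; linarith
    · obtain ⟨i, rfl⟩ := Int.eq_ofNat_of_zero_le h.le
      obtain ⟨i, rfl⟩ := Nat.exists_eq_succ_of_ne_zero (by omega : i ≠ 0)
      rw [Finset.sum_eq_single ⟨i, by omega⟩, xmap_coeff_of_ne]
      · simp
      · intro n hn
        simp at hn
        have : (0 : ℚ) ≤ n := by positivity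
        have : (0 : ℚ) ≤ i := by positivity
        linarith
      · intro j _ hj
        refine HahnSeries.coeff_single_of_ne fun h => hj ?_
        ext
        have : i + 1 = (j : ℕ) + 1 := by exact_mod_cast h
        simp at this ⊢; omega
      · simp
  · have h1 : a.coeff q = 0 := by
      by_contra h; exact hi (ha q h)
    rw [h1, xmap_coeff_of_ne, Finset.sum_eq_zero]
    · simp
    · intro j _
      exact HahnSeries.coeff_single_of_ne fun h => hi ⟨((j : ℕ) + 1 : ℕ), by rw [h]; simp⟩
    · intro n hn
      exact hi ⟨-n, by rw [hn]; push_cast; rfl⟩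

/-- Substitution of `P` for the level parameter. -/
noncomputable def subP (P : ℂ[X][X]) : ℂ[X][X][X] →+* ℂ[X][X] :=
  Polynomial.eval₂RingHom (Polynomial.eval₂RingHom
    (Polynomial.aeval P : ℂ[X] →ₐ[ℂ] ℂ[X][X]).toRingHom (Polynomial.C Polynomial.X)) Polynomial.X

theorem ev_subP {η : Hahn Kb} (h : ev η P = HahnSeries.C tt) (b : ℂ[X][X][X]) :
    ev η (subP P b) = ev η b := by
  have : (ev η).comp (subP P) = ev (A := ℂ[X]) η := by
    refine ringHom_ext₂ (fun a => ?_) ?_ ?_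
    · have h1 : subP P (Polynomial.C (Polynomial.C a)) = Polynomial.aeval P a := by simp [subP]
      rw [RingHom.comp_apply, h1, ev_aeval h, ev_C_C]
      congr 1
      have : (Polynomial.aeval tt : ℂ[X] →ₐ[ℂ] Kb) = toKb :=
        Polynomial.algHom_ext (by rw [Polynomial.aeval_X])
      rw [this]; rfl
    · simp [subP]
    · simp [subP]
  exact RingHom.congr_fun this b

/-- Polynomials in `Y` with integral exponents have principal parts realised by elements
of `ℂ[X][Y]`. -/
theorem Keller.exists_realize_poly (hK : Keller P Q c₀) (hP : PlanarFibers P) (V : (Hahn ℂ[X])[X])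
    (hV : V.natDegree < P.natDegree)
    (hinteger : ∀ l q, (V.coeff l).coeff q ≠ 0 → ∃ n : ℤ, q = n) :
    ∃ (b : ℂ[X][X]) (q : ℂ[X]), q ≠ 0 ∧ ∀ η ∈ rts P tt, Lge 0 (ev η b -
      HahnSeries.C (toKb q) * (V.map (hmap (toKb : ℂ[X] →+* Kb))).eval η) := by
  choose p hp using fun l => exists_truncation (hinteger l)
  choose N' hN' using fun η : Hahn Kb => exists_lge_pow η P.natDegree
  obtain ⟨N, hN⟩ : ∃ N : ℕ, ∀ η ∈ rts P tt, ∀ l < P.natDegree, Lge (-(N : ℚ)) (η ^ l) := by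
    refine ⟨(rts P tt).sup N', fun η hη l hl => (hN' η l hl).mono ?_⟩
    have : (N' η : ℚ) ≤ (rts P tt).sup N' := by exact_mod_cast Finset.le_sup hη
    linarith
  obtain ⟨h, hh⟩ := hK.exists_realize hP N (by rw [hK.card_rts]; exact hN)
    fun l j => algebraMap ℂ[X] _ ((V.coeff l).coeff (((j : ℕ) + 1 : ℕ) : ℚ))
  obtain ⟨q, h', hq, hh'⟩ := exists_clear_denominators h
  refine ⟨subP P (h' + Polynomial.C (Polynomial.C q) *
    ∑ l : Fin (rts P tt).card, Polynomial.C (p l) * Polynomial.X ^ (l : ℕ)), q, hq, fun η hη => ?_⟩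
  have h1 : ev η h' = HahnSeries.C (toKb q) * ev η h := by
    rw [← ev_map_algebraMap, hh', map_mul, ev_C_C]
    rfl
  have h2 : (V.map (hmap (toKb : ℂ[X] →+* Kb))).eval η =
      ∑ l : Fin (rts P tt).card, hmap (toKb : ℂ[X] →+* Kb) (V.coeff l) * η ^ (l : ℕ) := by
    rw [Polynomial.eval_eq_sum_range' (n := (rts P tt).card)
      (Polynomial.natDegree_map_le.trans_lt (by rwa [hK.card_rts])), Finset.sum_range]
    simp only [Polynomial.coeff_map]
  rw [ev_subP (hK.mem_rts.1 hη), map_add, map_mul, h1, ev_C_C, map_sum, h2]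
  have h3 := hh η hη
  have h4 : Lge 0 (∑ l : Fin (rts P tt).card, (hmap (toKb : ℂ[X] →+* Kb) (V.coeff l) -
      xmap ℂ[X] Kb (p l) - ∑ j : Fin N, HahnSeries.single (((j : ℕ) + 1 : ℕ) : ℚ)
        (toKb ((V.coeff l).coeff (((j : ℕ) + 1 : ℕ) : ℚ)))) * η ^ (l : ℕ)) := by
    refine Lge.sum fun l _ => ?_
    have h5 := (hp l N).hmap (toKb : ℂ[X] →+* Kb)
    rw [map_sub, map_sub, map_sum] at h5
    simp only [hmap_single] at h5
    rw [hmap_xmap] at h5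
    refine (h5.mul (hN η hη l (hK.card_rts (tt) ▸ l.2))).mono (by linarith)
  rw [principal] at h3
  simp only [← IsScalarTower.algebraMap_apply] at h3
  simp only [sub_mul, Finset.sum_sub_distrib, Finset.sum_mul] at h4
  have h7 := ((lge_C (toKb q)).mul₀ h3).add ((lge_C (toKb q)).mul₀ h4)
  convert h7.neg using 1
  simp only [map_mul, map_pow, ev_X, ev_C]
  change _ = -(HahnSeries.C (toKb q) * (∑ l : Fin (rts P tt).card, ∑ j : Fin N,
    HahnSeries.single (((j : ℕ) + 1 : ℕ) : ℚ) (toKb ((V.coeff l).coeff (((j : ℕ) + 1 : ℕ) : ℚ))) *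
      η ^ (l : ℕ) - ev η h) + HahnSeries.C (toKb q) * _)
  rw [show (algebraMap ℂ[X] Kb) q = toKb q from rfl]
  ring

end Realize

section Conj

variable {P Q : ℂ[X][X]} {c₀ : ℂ}

/-- The generic level polynomial over Hahn series with polynomial coefficients. -/
noncomputable def genLev (P : ℂ[X][X]) : (Hahn ℂ[X])[X] :=
  (lvl P (Polynomial.X : ℂ[X])).map (xmap ℂ[X] ℂ[X])

theorem genLev_eval (y : Hahn ℂ[X]) :
    (genLev P).eval y = ev y P - HahnSeries.C Polynomial.X := by
  rw [genLev, ← ev_eq_eval, lvl, map_sub, ev_C_C, ev_map _ (fun a => rfl)]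
  rfl

theorem genLev_derivative_eval (y : Hahn ℂ[X]) :
    (Polynomial.derivative (genLev P)).eval y = ev y (dY ℂ P) := by
  rw [genLev, Polynomial.derivative_map, ← ev_eq_eval, derivative_lvl, ev_map _ (fun a => rfl)]

theorem genLev_map : (genLev P).map (hmap (toKb : ℂ[X] →+* Kb)) = lev P tt := by
  have h := lvl_map_xmap (P := P) (K := Kb) (Polynomial.X : ℂ[X])
  change _ = lev P tt at h
  rw [← h, genLev, Polynomial.map_map]
  congr 1
  exact RingHom.ext hmap_xmap

theorem sigma_xmap (p : ℂ[X][X]) : sigma (xmap ℂ[X] ℂ[X] p) = xmap ℂ[X] ℂ[X] p := by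
  ext i : 2
  rw [sigma_coeff]
  by_cases hi : ∃ n : ℕ, i = -n
  · obtain ⟨n, rfl⟩ := hi
    rw [show chi (-(n : ℚ)) = 1 from chi_eq_one_iff.2 ⟨-n, by push_cast; rfl⟩, one_smul]
  · push Not at hi
    rw [xmap_coeff_of_ne _ _ hi, smul_zero]

theorem genLev_sigma : (genLev P).map sigma = genLev P := by
  rw [genLev, Polynomial.map_map]
  congr 1
  exact RingHom.ext sigma_xmap

/-- The generic level polynomial with one linear factor removed. -/
noncomputable def cofactor (P : ℂ[X][X]) (y : Hahn ℂ[X]) : (Hahn ℂ[X])[X] :=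
  genLev P /ₘ (Polynomial.X - Polynomial.C y)

variable {y : Hahn ℂ[X]} {β : ℚ} {g : ℂ}

theorem mul_cofactor (h : ev y P = HahnSeries.C Polynomial.X) :
    (Polynomial.X - Polynomial.C y) * cofactor P y = genLev P :=
  Polynomial.mul_divByMonic_eq_iff_isRoot.2 (by
    rw [Polynomial.IsRoot, genLev_eval, h, sub_self])

theorem cofactor_eval_self (h : ev y P = HahnSeries.C Polynomial.X) :
    (cofactor P y).eval y = ev y (dY ℂ P) := by
  rw [← genLev_derivative_eval, ← mul_cofactor h]
  simp

theorem cofactor_map_eval (hK : Keller P Q c₀) (h : ev y P = HahnSeries.C Polynomial.X) {η : Hahn Kb} (hη : η ∈ rts P tt)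
    (hne : η ≠ hmap (toKb : ℂ[X] →+* Kb) y) :
    ((cofactor P y).map (hmap (toKb : ℂ[X] →+* Kb))).eval η = 0 := by
  have h1 := congrArg (fun p => (p.map (hmap (toKb : ℂ[X] →+* Kb))).eval η) (mul_cofactor h)
  simp only [genLev_map, Polynomial.map_mul, Polynomial.eval_mul, Polynomial.map_sub,
    Polynomial.map_X, Polynomial.map_C, Polynomial.eval_sub, Polynomial.eval_X,
    Polynomial.eval_C] at h1
  rw [lev_eval, hK.mem_rts.1 hη, sub_self, mul_eq_zero, sub_eq_zero] at h1
  exact h1.resolve_left hne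

theorem cofactor_sigma (y : Hahn ℂ[X]) :
    (cofactor P y).map sigma = cofactor P (sigma y) := by
  rw [cofactor, Polynomial.map_divByMonic _ (Polynomial.monic_X_sub_C y), genLev_sigma,
    Polynomial.map_sub, Polynomial.map_X, Polynomial.map_C, cofactor]

theorem Keller.natDegree_cofactor (hK : Keller P Q c₀) (y : Hahn ℂ[X]) :
    (cofactor P y).natDegree < P.natDegree := by
  rw [cofactor, Polynomial.natDegree_divByMonic _ (Polynomial.monic_X_sub_C y),
    Polynomial.natDegree_X_sub_C]
  have h1 : (genLev P).natDegree ≤ P.natDegree := by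
    refine Polynomial.natDegree_map_le.trans ?_
    rw [lvl, Polynomial.natDegree_sub_C]
    exact Polynomial.natDegree_map_le
  have := hK.natDegree_pos
  omega

/-- The summands of the interpolating polynomial. -/
noncomputable def piece (P : ℂ[X][X]) (y : Hahn ℂ[X]) (r : ℚ) (j : ℕ) : (Hahn ℂ[X])[X] :=
  Polynomial.C (sigma^[j] (HahnSeries.single r 1 * dmap dT y)) * cofactor P (sigma^[j] y)

theorem piece_sigma (r : ℚ) (j : ℕ) : (piece P y r j).map sigma = piece P y r (j + 1) := by
  rw [piece, Polynomial.map_mul, Polynomial.map_C, cofactor_sigma, piece,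
    Function.iterate_succ_apply', Function.iterate_succ_apply']

theorem sigma_iter_dmap (j : ℕ) (y : Hahn ℂ[X]) :
    sigma^[j] (dmap dT y) = dmap dT (sigma^[j] y) := by
  ext q : 2
  rw [sigma_iter_coeff, dmap_coeff, dmap_coeff, sigma_iter_coeff, Derivation.map_smul]

theorem sigma_iter_single (j : ℕ) (r : ℚ) (s : ℂ[X]) :
    sigma^[j] (HahnSeries.single r s) = HahnSeries.single r (chi (j * r) • s) := by
  ext q : 2
  rw [sigma_iter_coeff]
  by_cases h : q = r
  · rw [h, HahnSeries.coeff_single_same, HahnSeries.coeff_single_same]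
  · rw [HahnSeries.coeff_single_of_ne h, HahnSeries.coeff_single_of_ne h, smul_zero]

theorem piece_period {M : ℕ} (hM : M ≠ 0) (hy : sigma^[M] y = y) :
    piece P y (-(1 / M : ℚ)) M = piece P y (-(1 / M : ℚ)) 0 := by
  have h1 : chi ((M : ℚ) * -(1 / M)) = 1 := chi_eq_one_iff.2 ⟨-1, by
    push_cast; field_simp⟩
  rw [piece, iterate_map_mul, sigma_iter_dmap, sigma_iter_single, hy, h1, one_smul]
  rfl

theorem exists_int_of_sigma {a : Hahn ℂ[X]} (h : sigma a = a) (q : ℚ) (hq : a.coeff q ≠ 0) :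
    ∃ n : ℤ, q = n := by
  rw [← chi_eq_one_iff]
  have := congrArg (fun z => z.coeff q) h
  simp only [sigma_coeff] at this
  by_contra hne
  have h2 : (chi q - 1) • a.coeff q = 0 := by rw [sub_smul, this, one_smul, sub_self]
  rw [smul_eq_zero, sub_eq_zero] at h2
  exact h2.elim hne hq

/-- For every branch `y` along which `Q` is unbounded there is a regular function of minimal
positive degree along `y` which is regular along all branches not conjugate to `y`. -/
theorem Keller.exists_meromorphic (hK : Keller P Q c₀) (hP : PlanarFibers P) (h : Lift P Q y β g) :
    ∃ (b : ℂ[X][X]) (q : ℂ[X]), q ≠ 0 ∧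
      Lge 0 (ev y b - HahnSeries.single (-(1 / Function.minimalPeriod sigma y : ℚ)) q) ∧
      ∀ η ∈ rts P tt, (∀ j, η ≠ hmap (toKb : ℂ[X] →+* Kb) (sigma^[j] y)) → Lge 0 (ev η b) := by
  set M := Function.minimalPeriod sigma y with hMdef
  have hM : 0 < M := h.exists_period hK
  have hper : sigma^[M] y = y := Function.isPeriodicPt_minimalPeriod sigma y
  set r : ℚ := -(1 / M : ℚ) with hr
  set V : (Hahn ℂ[X])[X] := ∑ j ∈ Finset.range M, piece P y r j with hVdef
  have hroot (j : ℕ) : ev (sigma^[j] y) P = HahnSeries.C Polynomial.X := (h.sigma_iter j).root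
  have hVs : V.map sigma = V := by
    have h1 : V.map sigma = ∑ j ∈ Finset.range M, piece P y r (j + 1) := by
      rw [hVdef, Polynomial.map_sum]
      exact Finset.sum_congr rfl fun j _ => piece_sigma r j
    have h2 := Finset.sum_range_succ (piece P y r) M
    rw [Finset.sum_range_succ', piece_period hM.ne' hper] at h2
    rw [h1]
    exact add_right_cancel h2
  have hVd : V.natDegree < P.natDegree := by
    refine (Polynomial.natDegree_sum_le _ _).trans_lt ?_
    rw [Finset.fold_max_lt]
    exact ⟨hK.natDegree_pos, fun j _ =>
      (Polynomial.natDegree_C_mul_le _ _).trans_lt (hK.natDegree_cofactor _)⟩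
  have hV0 (η) (hη : η ∈ rts P tt) (hne : ∀ j, η ≠ hmap (toKb : ℂ[X] →+* Kb) (sigma^[j] y)) :
      (V.map (hmap (toKb : ℂ[X] →+* Kb))).eval η = 0 := by
    rw [hVdef, Polynomial.map_sum, Polynomial.eval_finsetSum]
    refine Finset.sum_eq_zero fun j _ => ?_
    rw [piece, Polynomial.map_mul, Polynomial.eval_mul, cofactor_map_eval hK (hroot j) hη (hne j),
      mul_zero]
  have hyr : hmap (toKb : ℂ[X] →+* Kb) y ∈ rts P tt := hK.mem_rts.2 (by
    rw [← hmap_ev, h.root, hmap_C]; rfl)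
  have hVy : (V.map (hmap (toKb : ℂ[X] →+* Kb))).eval (hmap (toKb : ℂ[X] →+* Kb) y) =
      hmap (toKb : ℂ[X] →+* Kb) (HahnSeries.single r 1) := by
    rw [hVdef, Polynomial.map_sum, Polynomial.eval_finsetSum, Finset.sum_eq_single 0]
    · rw [Polynomial.eval_map_apply, piece, Polynomial.eval_mul, Polynomial.eval_C]
      rw [Function.iterate_zero_apply, Function.iterate_zero_apply, cofactor_eval_self h.root,
        mul_assoc, mul_comm (dmap dT y), Lift.dY_mul_dT h.root, mul_one]
    · intro j hj hj0
      rw [piece, Polynomial.map_mul, Polynomial.eval_mul, cofactor_map_eval hK (hroot j) hyr,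
        mul_zero]
      intro heq
      have h1 := hmap_injective (f := (toKb : ℂ[X] →+* Kb)) toKb_injective heq
      exact Function.not_isPeriodicPt_of_pos_of_lt_minimalPeriod hj0 (Finset.mem_range.1 hj) h1.symm
    · intro h0; exact (h0 (Finset.mem_range.2 hM)).elim
  obtain ⟨b, q, hq, hb⟩ := hK.exists_realize_poly hP V hVd fun l q hlq =>
    exists_int_of_sigma (a := V.coeff l) (by
      conv_rhs => rw [← hVs]
      rw [Polynomial.coeff_map]) q hlq
  refine ⟨b, q, hq, ?_, fun η hη hne => ?_⟩
  · have h1 := hb _ hyr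
    rw [hVy, ← hmap_ev, hmap_single, HahnSeries.C_apply, HahnSeries.single_mul_single, zero_add,
      map_one, mul_one] at h1
    rw [← lge_hmap_iff toKb_injective, map_sub, hmap_single]
    exact h1
  · have h1 := hb η hη
    rwa [hV0 η hη hne, mul_zero, sub_zero] at h1

end Conj

section Poles

variable {P Q : ℂ[X][X]} {c₀ : ℂ} {y y' y'' : Hahn ℂ[X]} {β β' : ℚ} {g' g : ℂ}

/-- The ramification index of a branch. -/
noncomputable def ram (y : Hahn ℂ[X]) : ℕ := Function.minimalPeriod sigma y

theorem sigma_iter_ram (y : Hahn ℂ[X]) : sigma^[ram y] y = y :=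
  Function.isPeriodicPt_minimalPeriod sigma y

theorem Lift.ram_pos (hK : Keller P Q c₀) (h : Lift P Q y β g) : 0 < (ram y : ℚ) := by
  exact_mod_cast h.exists_period hK

theorem ev_sigma_iter (j : ℕ) (y : Hahn ℂ[X]) (b : ℂ[X][X]) :
    ev (sigma^[j] y) b = sigma^[j] (ev y b) := by
  induction j with
  | zero => rfl
  | succ j ih => rw [Function.iterate_succ_apply', ev_sigma, ih, Function.iterate_succ_apply']

theorem lge_sigma_iter_iff {p : ℚ} {a : Hahn ℂ[X]} (j : ℕ) : Lge p (sigma^[j] a) ↔ Lge p a := by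
  induction j with
  | zero => rfl
  | succ j ih => rw [Function.iterate_succ_apply', lge_sigma_iff, ih]

theorem ord_iff_lge {S : Type*} [CommRing S] {p : ℚ} {a : Hahn S} :
    Ord p a ↔ a ≠ 0 ∧ ∀ q, Lge q a ↔ q ≤ p := by
  refine ⟨fun h => ⟨h.ne_zero, fun q => ⟨fun h' => h.le h', fun h' => h.lge.mono h'⟩⟩, fun h => ?_⟩
  obtain ⟨q, hq⟩ := exists_ord h.1
  have h1 := (h.2 q).1 hq.lge
  have h2 := hq.le ((h.2 p).2 le_rfl)
  rwa [le_antisymm h2 h1]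

theorem ord_sigma_iter_iff {p : ℚ} {a : Hahn ℂ[X]} (j : ℕ) : Ord p (sigma^[j] a) ↔ Ord p a := by
  rw [ord_iff_lge, ord_iff_lge]
  simp only [lge_sigma_iter_iff]
  refine and_congr_left fun _ => not_congr ?_
  conv_rhs => rw [← (sigma_injective.iterate j).eq_iff, iterate_map_zero]

/-- The degrees of regular functions along a branch are multiples of `1 / ram y`. -/
theorem exists_int_of_coeff_ne_zero (b : ℂ[X][X]) {q : ℚ} (hq : (ev y b).coeff q ≠ 0) :
    ∃ n : ℤ, ram y * q = n := by
  rw [← chi_eq_one_iff]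
  have h1 : (sigma^[ram y] (ev y b)).coeff q = (ev y b).coeff q := by
    rw [← ev_sigma_iter, sigma_iter_ram]
  rw [sigma_iter_coeff] at h1
  have h2 : (chi (ram y * q) - 1) • (ev y b).coeff q = 0 := by
    rw [sub_smul, h1, one_smul, sub_self]
  exact sub_eq_zero.1 ((smul_eq_zero.1 h2).resolve_right hq)

theorem lge_add_of_coeff_eq_zero (hr : 0 < (ram y : ℚ)) {b : ℂ[X][X]} {n : ℤ}
    (h : Lge (n / ram y) (ev y b)) (h0 : (ev y b).coeff (n / ram y) = 0) :
    Lge ((n + 1) / ram y) (ev y b) := by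
  intro q hq
  by_contra hne
  obtain ⟨k, hk⟩ := exists_int_of_coeff_ne_zero b hne
  obtain rfl : q = k / ram y := by rw [← hk]; field_simp
  rw [div_lt_div_iff_of_pos_right hr] at hq
  rcases lt_trichotomy k n with hkn | rfl | hkn
  · exact hne (h _ ((div_lt_div_iff_of_pos_right hr).2 (by exact_mod_cast hkn)))
  · exact hne h0
  · have : k < n + 1 := by exact_mod_cast hq
    omega

theorem lge_toKb_iff {p : ℚ} {a : Hahn ℂ[X]} : Lge p (hmap (toKb : ℂ[X] →+* Kb) a) ↔ Lge p a :=
  lge_hmap_iff (f := (toKb : ℂ[X] →+* Kb)) toKb_injective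

/-- The branch `η` of the generic level is not conjugate to `y`. -/
def Away (y : Hahn ℂ[X]) (η : Hahn Kb) : Prop :=
  ∀ j, η ≠ hmap (toKb : ℂ[X] →+* Kb) (sigma^[j] y)

/-- The branch `y'` is not conjugate to `y`. -/
def NConj (y y' : Hahn ℂ[X]) : Prop := ∀ j, y' ≠ sigma^[j] y

theorem NConj.away (h : NConj y y') : Away y (hmap (toKb : ℂ[X] →+* Kb) y') :=
  fun j hj => h j (hmap_injective (f := (toKb : ℂ[X] →+* Kb)) toKb_injective hj)

theorem NConj.symm (hy' : 0 < ram y') (h : NConj y y') : NConj y' y := by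
  rintro j rfl
  refine h (j * ram y' - j) ?_
  rw [← Function.iterate_add_apply, Nat.sub_add_cancel (Nat.le_mul_of_pos_right j hy')]
  exact ((Function.isPeriodicPt_minimalPeriod sigma y').const_mul j).symm

theorem Lift.mem_rts (hK : Keller P Q c₀) (h : Lift P Q y β g) :
    hmap (toKb : ℂ[X] →+* Kb) y ∈ rts P tt :=
  hK.mem_rts.2 (by rw [← hmap_ev, h.root, hmap_C]; rfl)

/-- Regularity along all branches not conjugate to `y`. -/
def RegAway (P : ℂ[X][X]) (y : Hahn ℂ[X]) (b : ℂ[X][X]) : Prop :=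
  ∀ η ∈ rts P tt, Away y η → Lge 0 (ev η b)

theorem RegAway.lge (hb : RegAway P y b) (hK : Keller P Q c₀) (h : Lift P Q y' β g)
    (hn : NConj y y') : Lge 0 (ev y' b) := by
  have := hb _ (h.mem_rts hK) hn.away
  rwa [← hmap_ev, lge_toKb_iff] at this

theorem RegAway.add {b b'} (h : RegAway P y b) (h' : RegAway P y b') : RegAway P y (b + b') :=
  fun η hη ha => by rw [map_add]; exact (h η hη ha).add (h' η hη ha)

theorem RegAway.sub {b b'} (h : RegAway P y b) (h' : RegAway P y b') : RegAway P y (b - b') :=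
  fun η hη ha => by rw [map_sub]; exact (h η hη ha).sub (h' η hη ha)

theorem RegAway.mul {b b'} (h : RegAway P y b) (h' : RegAway P y b') : RegAway P y (b * b') :=
  fun η hη ha => by rw [map_mul]; exact (h η hη ha).mul₀ (h' η hη ha)

theorem RegAway.pow {b} (h : RegAway P y b) (n : ℕ) : RegAway P y (b ^ n) :=
  fun η hη ha => by rw [map_pow]; exact (h η hη ha).pow₀ n

theorem Keller.regAway_aeval (hK : Keller P Q c₀) (y : Hahn ℂ[X]) (κ : ℂ[X]) :
    RegAway P y (Polynomial.aeval P κ) := fun η hη _ => by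
  rw [ev_aeval (hK.mem_rts.1 hη)]; exact lge_C _

/-- A function regular away from `y` and along `y` is a polynomial in `P`. -/
theorem RegAway.eq_aeval (hb : RegAway P y b) (hK : Keller P Q c₀) (h : Lge 0 (ev y b)) :
    ∃ κ : ℂ[X], b = Polynomial.aeval P κ := by
  refine hK.eq_aeval fun η hη => ?_
  by_cases ha : Away y η
  · exact hb η hη ha
  · simp only [Away, not_forall, not_not] at ha
    obtain ⟨j, rfl⟩ := ha
    rw [← hmap_ev, lge_toKb_iff, ev_sigma_iter, lge_sigma_iter_iff]
    exact h

/-- `h` is regular away from `y` and has minimal positive degree along `y`. -/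
structure Pole (P : ℂ[X][X]) (y : Hahn ℂ[X]) (h : ℂ[X][X]) (q : ℂ[X]) : Prop where
  ne_zero : q ≠ 0
  lge : Lge (-(1 / ram y : ℚ)) (ev y h)
  coeff : (ev y h).coeff (-(1 / ram y : ℚ)) = q
  reg : RegAway P y h

theorem Pole.ord {h q} (hp : Pole P y h q) : Ord (-(1 / ram y : ℚ)) (ev y h) :=
  ⟨hp.lge, by rw [hp.coeff]; exact hp.ne_zero⟩

theorem Keller.exists_pole (hK : Keller P Q c₀) (hP : PlanarFibers P) (h : Lift P Q y β g) :
    ∃ b q, Pole P y b q := by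
  obtain ⟨b, q, hq, h1, h2⟩ := hK.exists_meromorphic hP h
  have hr := h.ram_pos hK
  have hneg : -(1 / ram y : ℚ) < 0 := by
    have : 0 < (1 / ram y : ℚ) := by positivity
    linarith
  refine ⟨b, q, hq, ?_, ?_, h2⟩
  · have := (h1.mono hneg.le).add (lge_single (le_refl (-(1 / ram y : ℚ))) q)
    rwa [ram, sub_add_cancel] at this
  · have := h1 _ hneg
    rw [HahnSeries.coeff_sub, ram, HahnSeries.coeff_single_same, sub_eq_zero] at this
    exact this

/-- Evaluation of bivariate polynomials at `(P, h)`. -/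
noncomputable def pev (P h : ℂ[X][X]) : ℂ[X][X] →+* ℂ[X][X] :=
  Polynomial.eval₂RingHom (Polynomial.aeval P : ℂ[X] →ₐ[ℂ] ℂ[X][X]).toRingHom h

theorem pev_C (P h : ℂ[X][X]) (κ : ℂ[X]) : pev P h (Polynomial.C κ) = Polynomial.aeval P κ := by
  simp [pev]

theorem pev_X (P h : ℂ[X][X]) : pev P h Polynomial.X = h := by simp [pev]

theorem Pole.exists_pev {h q} (hp : Pole P y h q) (hK : Keller P Q c₀) (hy : Lift P Q y β g)
    {b : ℂ[X][X]} (hb : RegAway P y b) :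
    ∃ (n : ℕ) (G : ℂ[X][X]), Polynomial.aeval P (q ^ n) * b = pev P h G := by
  have hr := hy.ram_pos hK
  obtain ⟨n, hn⟩ : ∃ n : ℕ, Lge ((-n : ℤ) / ram y) (ev y b) := by
    by_cases h0 : ev y b = 0
    · exact ⟨0, h0 ▸ lge_zero _⟩
    · obtain ⟨p, hp⟩ := exists_ord h0
      obtain ⟨n, hn⟩ := exists_nat_ge (-(p * ram y))
      refine ⟨n, hp.lge.mono ?_⟩
      rw [div_le_iff₀ hr]
      push_cast
      linarith
  induction n generalizing b with
  | zero =>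
    obtain ⟨κ, rfl⟩ := hb.eq_aeval hK (by simpa using hn)
    exact ⟨0, Polynomial.C κ, by rw [pow_zero, map_one, one_mul, pev_C]⟩
  | succ n ih =>
    set s := (ev y b).coeff ((-(n + 1 : ℕ) : ℤ) / ram y) with hs
    set b' := Polynomial.aeval P (q ^ (n + 1)) * b - Polynomial.aeval P s * h ^ (n + 1) with hb'
    have e1 : ((-(n + 1 : ℕ) : ℤ) / ram y : ℚ) = 0 + (-(n + 1 : ℕ) : ℤ) / ram y := (zero_add _).symm
    have e2 : ((n + 1 : ℕ) : ℚ) * -(1 / ram y : ℚ) = (-(n + 1 : ℕ) : ℤ) / ram y := by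
      push_cast; ring
    have hph := hp.lge.pow (n + 1)
    have hpc := hp.lge.coeff_pow (n + 1)
    rw [e2] at hph hpc
    have h1 : Lge ((-(n + 1 : ℕ) : ℤ) / ram y) (ev y b') := by
      rw [hb', map_sub, map_mul, map_mul, map_pow (ev y) h, hy.ev_aeval_level, hy.ev_aeval_level, e1]
      exact ((lge_C _).mul hn).sub ((lge_C _).mul hph)
    have h2 : (ev y b').coeff ((-(n + 1 : ℕ) : ℤ) / ram y) = 0 := by
      rw [hb', map_sub, map_mul, map_mul, map_pow (ev y) h, hy.ev_aeval_level, hy.ev_aeval_level,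
        HahnSeries.coeff_sub, e1, (lge_C _).coeff_mul hn, (lge_C _).coeff_mul hph, hpc, hp.coeff,
        ← hs]
      simp only [HahnSeries.C_apply, HahnSeries.coeff_single_same]
      ring
    have h3 := lge_add_of_coeff_eq_zero hr h1 h2
    obtain ⟨k, G, hG⟩ := ih (b := b')
      (((hK.regAway_aeval y _).mul hb).sub ((hK.regAway_aeval y _).mul (hp.reg.pow _))) (by
        convert h3 using 2
        push_cast; ring)
    refine ⟨k + (n + 1), G + Polynomial.C (q ^ k * s) * Polynomial.X ^ (n + 1), ?_⟩
    rw [map_add, ← hG, map_mul, pev_C, map_pow (pev P h), pev_X, hb', pow_add, map_mul, map_mul]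
    ring

end Poles

section Separation

variable {P Q : ℂ[X][X]} {c₀ : ℂ} {y y' y'' : Hahn ℂ[X]} {β β' : ℚ} {g g' : ℂ}
  {h h' : ℂ[X][X]} {q q' : ℂ[X]}

theorem lge_of_conj {p : ℚ} {b : ℂ[X][X]} (h : Lge p (ev y b)) (j : ℕ) :
    Lge p (ev (hmap (toKb : ℂ[X] →+* Kb) (sigma^[j] y)) b) := by
  rw [← hmap_ev, lge_toKb_iff, ev_sigma_iter, lge_sigma_iter_iff]
  exact h

theorem Pole.sub_aeval (hp : Pole P y h q) (hK : Keller P Q c₀) (hy : Lift P Q y β g) (c : ℂ[X]) :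
    Pole P y (h - Polynomial.aeval P c) q where
  ne_zero := hp.ne_zero
  lge := by
    have hr := hy.ram_pos hK
    rw [map_sub, hy.ev_aeval_level]
    exact hp.lge.sub ((lge_C _).mono (neg_nonpos.2 (by positivity)))
  coeff := by
    have hr := hy.ram_pos hK
    rw [map_sub, hy.ev_aeval_level, HahnSeries.coeff_sub, hp.coeff,
      (lge_C c).coeff (neg_lt_zero.2 (by positivity)), sub_zero]
  reg := hp.reg.sub (hK.regAway_aeval y c)

/-- `b` divides a nonzero polynomial in `P`. -/
def Vertical (P b : ℂ[X][X]) : Prop := ∃ γ : ℂ[X], γ ≠ 0 ∧ b ∣ Polynomial.aeval P γ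

theorem Vertical.mul {b b' : ℂ[X][X]} (h : Vertical P b) (h' : Vertical P b') :
    Vertical P (b * b') := by
  obtain ⟨γ, h0, h1⟩ := h
  obtain ⟨γ', h0', h1'⟩ := h'
  exact ⟨γ * γ', mul_ne_zero h0 h0', by rw [map_mul]; exact mul_dvd_mul h1 h1'⟩

theorem Vertical.pow {b : ℂ[X][X]} (h : Vertical P b) (n : ℕ) : Vertical P (b ^ n) := by
  obtain ⟨γ, h0, h1⟩ := h
  exact ⟨γ ^ n, pow_ne_zero _ h0, by rw [map_pow]; exact pow_dvd_pow_of_dvd h1 n⟩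

theorem vertical_aeval {γ : ℂ[X]} (h : γ ≠ 0) : Vertical P (Polynomial.aeval P γ) :=
  ⟨γ, h, dvd_rfl⟩

theorem Vertical.of_dvd {b b' : ℂ[X][X]} (h : Vertical P b) (hb : b' ∣ b) : Vertical P b' := by
  obtain ⟨γ, h0, h1⟩ := h
  exact ⟨γ, h0, hb.trans h1⟩

theorem vertical_C_C {c : ℂ} (hc : c ≠ 0) : Vertical P (Polynomial.C (Polynomial.C c)) :=
  ⟨Polynomial.C c, Polynomial.C_ne_zero.2 hc, by rw [Polynomial.aeval_C]; rfl⟩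

theorem Pole.exists_sep (hp : Pole P y h q) (hp' : Pole P y' h' q') (hK : Keller P Q c₀)
    (hy : Lift P Q y β g) (hy' : Lift P Q y' β' g') (hn : NConj y y') :
    ∃ c : ℂ[X], Vertical P (h - Polynomial.aeval P c) ∧
      Ord (1 / ram y' : ℚ) (ev y' (h - Polynomial.aeval P c)) ∧
      ∀ y'' β'' g'', Lift P Q y'' β'' g'' → NConj y y'' → NConj y' y'' →
        Ord 0 (ev y'' (h - Polynomial.aeval P c)) := by
  have hr := hy.ram_pos hK
  have hr' := hy'.ram_pos hK
  have hn' : NConj y' y := hn.symm (by exact_mod_cast hr')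
  set c := (ev y' h).coeff 0 with hc
  set c' := (ev y h').coeff 0 with hc'
  refine ⟨c, ?_⟩
  set θ := h - Polynomial.aeval P c with hθ
  set θ' := h' - Polynomial.aeval P c' with hθ'
  have key {y y' : Hahn ℂ[X]} {β' g'} (hy' : Lift P Q y' β' g') {h : ℂ[X][X]}
      (hreg : RegAway P y h) (hn : NConj y y') :
      Lge (1 / ram y' : ℚ) (ev y' (h - Polynomial.aeval P ((ev y' h).coeff 0))) := by
    have h1 := lge_add_of_coeff_eq_zero (n := 0) (hy'.ram_pos hK)
      (b := h - Polynomial.aeval P ((ev y' h).coeff 0)) (by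
        rw [Int.cast_zero, zero_div]
        exact (hreg.sub (hK.regAway_aeval _ _)).lge hK hy' hn) (by
        rw [Int.cast_zero, zero_div, map_sub, hy'.ev_aeval_level, HahnSeries.coeff_sub,
          HahnSeries.C_apply, HahnSeries.coeff_single_same, sub_self])
    simpa using h1
  have hP1 := hp.sub_aeval hK hy c
  have hP2 := hp'.sub_aeval hK hy' c'
  have h1 : Lge (1 / ram y' : ℚ) (ev y' θ) := key hy' hp.reg hn
  have h2 : Lge (1 / ram y : ℚ) (ev y θ') := key hy hp'.reg hn'
  obtain ⟨γ, hγ⟩ := hK.eq_aeval (b := θ * θ') fun η hη => by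
    by_cases ha : Away y η
    · by_cases ha' : Away y' η
      · rw [map_mul]; exact (hP1.reg η hη ha).mul₀ (hP2.reg η hη ha')
      · simp only [Away, not_forall, not_not] at ha'
        obtain ⟨j, rfl⟩ := ha'
        refine lge_of_conj ?_ j
        rw [map_mul]
        exact (h1.mul hP2.lge).mono (by simp)
    · simp only [Away, not_forall, not_not] at ha
      obtain ⟨j, rfl⟩ := ha
      refine lge_of_conj ?_ j
      rw [map_mul]
      exact (hP1.lge.mul h2).mono (by simp)
  have hθ0 : θ ≠ 0 := fun h0 => hP1.ord.ne_zero (by rw [← hθ, h0, map_zero])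
  have hθ0' : θ' ≠ 0 := fun h0 => hP2.ord.ne_zero (by rw [← hθ', h0, map_zero])
  have hγ0 : γ ≠ 0 := by
    rintro rfl
    rw [map_zero] at hγ
    exact mul_ne_zero hθ0 hθ0' hγ
  have hord {z : Hahn ℂ[X]} {b g} (hz : Lift P Q z b g) :
      ∃ p p', Ord p (ev z θ) ∧ Ord p' (ev z θ') ∧ p + p' = 0 := by
    have hm : ev z θ * ev z θ' = HahnSeries.C γ := by rw [← map_mul, hγ, hz.ev_aeval_level]
    have hm0 : ev z θ * ev z θ' ≠ 0 := by rw [hm]; exact (ord_C hγ0).ne_zero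
    obtain ⟨p, hp⟩ := exists_ord (left_ne_zero_of_mul hm0)
    obtain ⟨p', hp'⟩ := exists_ord (right_ne_zero_of_mul hm0)
    refine ⟨p, p', hp, hp', (hp.mul hp').unique ?_⟩
    rw [hm]; exact ord_C hγ0
  refine ⟨⟨γ, hγ0, Dvd.intro _ hγ⟩, ?_, fun y'' β'' g'' hy'' hn1 hn2 => ?_⟩
  · obtain ⟨p, p', h3, h4, h5⟩ := hord hy'
    have h6 := h4.unique hP2.ord
    have : p = 1 / ram y' := by linarith
    rwa [← this]
  · obtain ⟨p, p', h3, h4, h5⟩ := hord hy''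
    have h6 := h3.le (hP1.reg.lge hK hy'' hn1)
    have h7 := h4.le (hP2.reg.lge hK hy'' hn2)
    have : p = 0 := by linarith
    rwa [← this]

theorem jac_pow (a b : ℂ[X][X]) (n : ℕ) : jac a (b ^ n) = n * b ^ (n - 1) * jac a b := by
  have := jac_aeval a b (Polynomial.X ^ n)
  rw [map_pow, Polynomial.aeval_X, Polynomial.derivative_X_pow, map_mul, map_pow,
    Polynomial.aeval_X] at this
  rw [this]
  simp

theorem jac_aeval_self (P : ℂ[X][X]) (κ : ℂ[X]) : jac P (Polynomial.aeval P κ) = 0 := by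
  have h1 := jac_mul P (Polynomial.aeval P κ) P
  induction κ using Polynomial.induction_on' with
  | add a b ha hb => rw [map_add, jac_add, ha (jac_mul _ _ _), hb (jac_mul _ _ _), add_zero]
  | monomial n a =>
    rw [Polynomial.aeval_monomial, jac_mul, jac_pow, jac_self, mul_zero, mul_zero, zero_add]
    exact mul_eq_zero_of_right _ (jac_C_C P a)

theorem jac_pev (P h G : ℂ[X][X]) :
    jac P (pev P h G) = pev P h (Polynomial.derivative G) * jac P h := by
  induction G using Polynomial.induction_on' with
  | add a b ha hb => rw [map_add, jac_add, ha, hb, Polynomial.derivative_add, map_add, add_mul]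
  | monomial n a =>
    rw [← Polynomial.C_mul_X_pow_eq_monomial, map_mul, pev_C, map_pow, pev_X, jac_mul, jac_pow,
      jac_aeval_self, Polynomial.derivative_C_mul_X_pow, map_mul, pev_C, map_pow, pev_X, map_mul,
      map_natCast]
    ring

theorem Pole.exists_multiplier (hp : Pole P y h q) (hK : Keller P Q c₀) (hP : PlanarFibers P)
    (hy : Lift P Q y β g) (s : Finset (Hahn ℂ[X])) (hs : ∀ y' ∈ s, NConj y y' ∧ y' ∈ lifts P Q) :
    ∃ u : ℂ[X][X], Vertical P (pev P h u) ∧ RegAway P y (pev P h u) ∧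
      ∀ y' ∈ s, Lge 0 (ev y' (Q * pev P h u)) := by
  classical
  induction s using Finset.induction_on with
  | empty =>
    refine ⟨1, ⟨1, one_ne_zero, by simp⟩, fun η hη _ => ?_, fun y' h => by simp at h⟩
    rw [map_one, map_one]; exact lge_one
  | insert y' s hy's ih =>
    obtain ⟨u, hu1, hu2, hu3⟩ := ih fun z hz => hs z (Finset.mem_insert_of_mem hz)
    obtain ⟨hn, β', g', hy'⟩ := hs y' (Finset.mem_insert_self _ _)
    obtain ⟨h', q', hp'⟩ := hK.exists_pole hP hy'
    obtain ⟨c, hc1, hc2, -⟩ := hp.exists_sep hp' hK hy hy' hn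
    have hr' := hy'.ram_pos hK
    obtain ⟨n, hn'⟩ := exists_nat_ge (β' * ram y')
    have hpev : pev P h (u * (Polynomial.X - Polynomial.C c) ^ n) =
        pev P h u * (h - Polynomial.aeval P c) ^ n := by
      rw [map_mul, map_pow, map_sub, pev_X, pev_C]
    have hreg := (hp.sub_aeval hK hy c).reg.pow n
    refine ⟨u * (Polynomial.X - Polynomial.C c) ^ n, ?_, ?_, fun z hz => ?_⟩
    · rw [hpev]; exact hu1.mul (hc1.pow n)
    · rw [hpev]; exact hu2.mul hreg
    · rw [hpev]
      rcases Finset.mem_insert.1 hz with rfl | hz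
      · rw [map_mul, map_mul, map_pow]
        refine (hy'.lge_Q.mul ((hu2.lge hK hy' hn).mul (hc2.lge.pow n))).mono ?_
        have : β' ≤ n * (1 / ram z) := by
          rw [mul_one_div, le_div_iff₀ hr']; exact hn'
        linarith
      · obtain ⟨hn2, β2, g2, hy2⟩ := hs z (Finset.mem_insert_of_mem hz)
        rw [← mul_assoc, map_mul]
        exact (hu3 z hz).mul₀ (hreg.lge hK hy2 hn2)

/-- The derivative of a pole function along the levels of `P` is vertical. -/
theorem Pole.vertical_jac (hp : Pole P y h q) (hK : Keller P Q c₀) (hP : PlanarFibers P)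
    (hy : Lift P Q y β g) : Vertical P (jac P h) := by
  classical
  obtain ⟨u, hu1, hu2, hu3⟩ := hp.exists_multiplier hK hP hy
    (hK.finite_lifts.toFinset.filter (NConj y)) fun y' h => by
      rw [Finset.mem_filter, Set.Finite.mem_toFinset] at h
      exact ⟨h.2, h.1⟩
  have hreg : RegAway P y (Q * pev P h u) := fun η hη ha => by
    by_cases hQ : Lge 0 (ev η Q)
    · rw [map_mul]; exact hQ.mul₀ (hu2 η hη ha)
    · obtain ⟨y', β', g', hy', rfl⟩ := hK.exists_lift (hK.mem_rts.1 hη) hQ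
      rw [spec_tt, ← hmap_ev, lge_toKb_iff]
      refine hu3 y' ?_
      rw [Finset.mem_filter, Set.Finite.mem_toFinset]
      refine ⟨⟨β', g', hy'⟩, fun j hj => ha j ?_⟩
      rw [spec_tt, hj]
  obtain ⟨n, G, hG⟩ := hp.exists_pev hK hy hreg
  have h1 := congrArg (jac P) hG
  rw [jac_pev, jac_mul, jac_aeval_self, mul_zero, add_zero, jac_mul, hK.jac_eq, jac_pev] at h1
  refine Vertical.of_dvd (b := Polynomial.aeval P (q ^ n) *
    (pev P h u * Polynomial.C (Polynomial.C c₀))) ?_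
    (Dvd.intro_left (pev P h (Polynomial.derivative G) -
      Polynomial.aeval P (q ^ n) * (Q * pev P h (Polynomial.derivative u))) ?_)
  · exact (vertical_aeval (pow_ne_zero _ hp.ne_zero)).mul (hu1.mul (vertical_C_C hK.ne_zero))
  · rw [sub_mul, ← h1]; ring

end Separation

section Components

variable {P Q : ℂ[X][X]} {c₀ : ℂ} {y y' : Hahn ℂ[X]} {β β' : ℚ} {g g' : ℂ} {Γ b : ℂ[X][X]}

theorem isUnit_iff_C_C {b : ℂ[X][X]} :
    IsUnit b ↔ ∃ a : ℂ, a ≠ 0 ∧ Polynomial.C (Polynomial.C a) = b := by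
  rw [Polynomial.isUnit_iff]
  constructor
  · rintro ⟨r, hr, rfl⟩
    obtain ⟨a, ha, rfl⟩ := Polynomial.isUnit_iff.1 hr
    exact ⟨a, ha.ne_zero, rfl⟩
  · rintro ⟨a, ha, rfl⟩
    exact ⟨_, Polynomial.isUnit_C.2 (isUnit_iff_ne_zero.2 ha), rfl⟩

theorem exists_dvd_level (hΓ : Prime Γ) (h : Vertical P Γ) :
    ∃ c : ℂ, Γ ∣ P - Polynomial.C (Polynomial.C c) := by
  obtain ⟨γ, h0, h1⟩ := h
  induction hn : γ.natDegree generalizing γ with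
  | zero =>
    rw [Polynomial.eq_C_of_natDegree_eq_zero hn, Polynomial.aeval_C] at h1
    rw [Polynomial.eq_C_of_natDegree_eq_zero hn, Polynomial.C_ne_zero] at h0
    exact (hΓ.not_isUnit (isUnit_of_dvd_unit h1 (isUnit_iff_C_C.2 ⟨_, h0, rfl⟩))).elim
  | succ n ih =>
    obtain ⟨c, hc⟩ := IsAlgClosed.exists_root γ fun h => by
      have := Polynomial.natDegree_eq_of_degree_eq_some (n := 0) h
      omega
    obtain ⟨γ', rfl⟩ := Polynomial.dvd_iff_isRoot.2 hc
    rw [map_mul] at h1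
    rcases hΓ.dvd_or_dvd h1 with h | h
    · refine ⟨c, ?_⟩
      rw [map_sub, Polynomial.aeval_X, Polynomial.aeval_C] at h
      exact h
    · refine ih γ' (right_ne_zero_of_mul h0) h ?_
      rw [Polynomial.natDegree_mul (Polynomial.X_sub_C_ne_zero c) (right_ne_zero_of_mul h0),
        Polynomial.natDegree_X_sub_C] at hn
      omega

theorem Keller.level_monic (hK : Keller P Q c₀) (c : ℂ) :
    (P - Polynomial.C (Polynomial.C c)).Monic := by
  refine hK.monic.sub_of_left ?_
  rw [Polynomial.degree_eq_natDegree hK.monic.ne_zero]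
  exact Polynomial.degree_C_le.trans_lt (by exact_mod_cast hK.natDegree_pos)

theorem natDegree_ne_zero_of_dvd_monic {p : ℂ[X][X]} (hp : p.Monic) (hΓ : ¬ IsUnit Γ)
    (h : Γ ∣ p) : Γ.natDegree ≠ 0 := by
  intro h0
  obtain ⟨A, rfl⟩ := h
  rw [Polynomial.Monic, Polynomial.leadingCoeff_mul] at hp
  rw [Polynomial.eq_C_of_natDegree_eq_zero h0] at hΓ
  refine hΓ (Polynomial.isUnit_C.2 ?_)
  rw [Polynomial.leadingCoeff, h0] at hp
  exact IsUnit.of_mul_eq_one _ hp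

/-- Every component of a level of `P` has a branch at infinity along which `Q` is unbounded. -/
theorem Keller.exists_lift_of_dvd (hK : Keller P Q c₀) (hΓ : ¬ IsUnit Γ) {c : ℂ}
    (h : Γ ∣ P - Polynomial.C (Polynomial.C c)) :
    ∃ y β g, Lift P Q y β g ∧ ev (spec c y) Γ = 0 := by
  have hd := natDegree_ne_zero_of_dvd_monic (hK.level_monic c) hΓ h
  obtain ⟨A, hA⟩ := h
  have hev (η : Hahn ℂ) : ev η P - HahnSeries.C c = ev η Γ * ev η A := by
    rw [← map_mul, ← hA, map_sub, ev_C_C]; rfl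
  obtain ⟨η, hη⟩ : ∃ η : Hahn ℂ, ev η Γ = 0 := by
    have : (Γ.map (xmap ℂ ℂ)).degree ≠ 0 := by
      rw [Polynomial.degree_map_eq_of_injective (xmap_injective (algebraMap ℂ ℂ).injective)]
      exact fun h => hd (Polynomial.natDegree_eq_of_degree_eq_some h)
    obtain ⟨η, hη⟩ := IsAlgClosed.exists_root _ this
    exact ⟨η, by rw [ev_eq_eval]; exact hη⟩
  have hηP : ev η P = HahnSeries.C c := by
    rw [← sub_eq_zero, hev, hη, zero_mul]
  have hAη : ev η A ≠ 0 := fun h0 => by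
    refine hK.dY_ne_zero hηP ?_
    have h1 := congrArg (fun b => ev η (dY ℂ b)) hA
    simp only [map_sub, Derivation.leibniz, map_add, smul_eq_mul, map_mul, hη, h0, zero_mul,
      add_zero] at h1
    rwa [dY_C, map_zero, sub_zero] at h1
  obtain ⟨η', h1, h2, h3⟩ := hK.exists_not_lge_of_ne (hK.mem_rts.2 hηP) hAη
  obtain ⟨y, β, g, hy, rfl⟩ := hK.exists_lift (hK.mem_rts.1 h1) h3
  refine ⟨y, β, g, hy, (mul_eq_zero.1 ?_).resolve_right h2⟩
  rw [← hev, hK.mem_rts.1 h1, sub_self]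

theorem dvd_jac_of_dvd_level {c : ℂ} (h : Γ ∣ P - Polynomial.C (Polynomial.C c)) :
    Γ ∣ jac P Γ := by
  obtain ⟨A, hA⟩ := h
  rw [sub_eq_iff_eq_add.1 hA, jac_swap, jac_add, jac_C_C, add_zero, jac_mul, jac_self, mul_zero,
    add_zero]
  exact ⟨-jac Γ A, by ring⟩

theorem Vertical.dvd_jac (h : Vertical P b) : b ∣ jac P b := by
  induction b using UniqueFactorizationMonoid.induction_on_prime with
  | h₁ => simp [jac]
  | h₂ b hb => exact hb.dvd
  | h₃ a p ha hp ih =>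
    obtain ⟨c, hc⟩ := exists_dvd_level hp (h.of_dvd (dvd_mul_right _ _))
    rw [jac_mul]
    refine dvd_add (mul_dvd_mul_left _ (ih (h.of_dvd (dvd_mul_left _ _)))) ?_
    rw [mul_comm p a]
    exact mul_dvd_mul_left _ (dvd_jac_of_dvd_level hc)

theorem Lift.theta_root (h : Lift P Q y β g) : theta (ev y P) = 0 := by rw [h.root, theta_C]

theorem Ord.theta {p : ℚ} {a : Hahn ℂ[X]} (h : Ord p a) (hp : p ≠ 0) :
    Ord p (KellerRational.theta a) ∧ (KellerRational.theta a).coeff p = -(p : ℂ) • a.coeff p := by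
  refine ⟨⟨h.lge.theta, ?_⟩, theta_coeff _ _⟩
  rw [theta_coeff]
  exact smul_ne_zero (neg_ne_zero.2 (by exact_mod_cast hp)) h.2

/-- The leading term of a logarithmic derivative along a branch. -/
theorem Lift.log_derivative (hy : Lift P Q y β g) (hK : Keller P Q c₀) {θ N : ℂ[X][X]} {p : ℚ}
    (hN : jac P θ = θ * N) (ho : Ord p (ev y θ)) (hp : p ≠ 0) :
    ∃ u : ℂ, u ≠ 0 ∧ Lge β (ev y N) ∧ (ev y N).coeff β = Polynomial.C u := by
  have h1 := level_jac hK.ne_zero hK.jac_eq hy.theta_root θ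
  rw [hN, map_mul] at h1
  obtain ⟨hθ1, hθ2⟩ := ho.theta hp
  have hβ := hy.pos
  obtain ⟨hQ1, hQ2⟩ := hy.ord_Q.theta (neg_ne_zero.2 hβ.ne')
  have hc : (algebraMap ℂ ℂ[X] c₀) ≠ 0 := Polynomial.C_ne_zero.2 hK.ne_zero
  have h2 : Ord (0 + p) (HahnSeries.C (algebraMap ℂ ℂ[X] c₀) * theta (ev y θ)) :=
    (ord_C hc).mul hθ1
  have hN0 : ev y N ≠ 0 := by
    intro h0
    rw [h0, mul_zero, zero_mul] at h1
    exact h2.ne_zero h1.symm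
  obtain ⟨o, hNo⟩ := exists_ord hN0
  have h3 := (ho.mul hNo).mul hQ1
  rw [h1] at h3
  obtain rfl : o = β := by have := h3.unique h2; linarith
  have h4 := congrArg (fun a => a.coeff (p + o + -o)) h1
  beta_reduce at h4
  rw [(ho.lge.mul hNo.lge).coeff_mul hQ1.lge, ho.lge.coeff_mul hNo.lge, hQ2, hy.coeff_Q,
    show p + o + -o = 0 + p by ring, (ord_C hc).lge.coeff_mul hθ1.lge, hθ2] at h4
  have h5 : (ev y θ).coeff p * ((ev y N).coeff o * (-((-o : ℚ) : ℂ) • Polynomial.C g)) =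
      (ev y θ).coeff p * (Polynomial.C c₀ * (Polynomial.C (-(p : ℂ)))) := by
    rw [← mul_assoc, h4, HahnSeries.C_apply, HahnSeries.coeff_single_same, Polynomial.smul_eq_C_mul,
      Polynomial.algebraMap_apply, Algebra.algebraMap_self, RingHom.id_apply]
    ring
  have h6 := mul_left_cancel₀ ho.2 h5
  have hβ' : (o : ℂ) ≠ 0 := by exact_mod_cast hβ.ne'
  have hp' : (p : ℂ) ≠ 0 := by exact_mod_cast hp
  have hg := hy.ne_zero
  refine ⟨-(c₀ * p) / (o * g), div_ne_zero (neg_ne_zero.2 (mul_ne_zero hK.ne_zero hp'))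
    (mul_ne_zero hβ' hg), hNo.lge, ?_⟩
  have h7 : (Polynomial.C ((o : ℂ) * g) : ℂ[X]) ≠ 0 := Polynomial.C_ne_zero.2 (mul_ne_zero hβ' hg)
  apply mul_right_cancel₀ h7
  rw [← Polynomial.C_mul, div_mul_cancel₀ _ (mul_ne_zero hβ' hg)]
  rw [Polynomial.smul_C, ← Polynomial.C_mul] at h6
  convert h6 using 3 <;> (try simp)

/-- The branches along which `Q` is unbounded cannot form exactly two conjugacy classes. -/
theorem Keller.exists_third (hK : Keller P Q c₀) (hP : PlanarFibers P) (hy : Lift P Q y β g)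
    (hy' : Lift P Q y' β' g') (hn : NConj y y') :
    ∃ z β'' g'', Lift P Q z β'' g'' ∧ NConj y z ∧ NConj y' z := by
  by_contra! hcon
  obtain ⟨h, q, hp⟩ := hK.exists_pole hP hy
  obtain ⟨h', q', hp'⟩ := hK.exists_pole hP hy'
  obtain ⟨c, hc1, hc2, -⟩ := hp.exists_sep hp' hK hy hy' hn
  have hpθ := hp.sub_aeval hK hy c
  set θ := h - Polynomial.aeval P c
  obtain ⟨N, hN⟩ := hc1.dvd_jac
  have hr := hy.ram_pos hK
  have hr' := hy'.ram_pos hK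
  obtain ⟨u, hu, hu1, hu2⟩ := hy.log_derivative hK hN hpθ.ord (neg_ne_zero.2 (by positivity))
  obtain ⟨u', hu', -, hu2'⟩ := hy'.log_derivative hK hN hc2 (by positivity)
  have hNv : Vertical P N := (hpθ.vertical_jac hK hP hy).of_dvd (hN ▸ dvd_mul_left _ _)
  have hβ := hy.pos
  have hN0 : N ≠ 0 := by
    rintro rfl
    rw [map_zero, HahnSeries.coeff_zero] at hu2
    exact hu (Polynomial.C_eq_zero.1 hu2.symm)
  have hconj {z : Hahn ℂ[X]} {b} {v : ℂ} (hv : v ≠ 0) (hz : (ev z N).coeff b = Polynomial.C v)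
      (j : ℕ) (c : ℂ) : ev (spec c (sigma^[j] z)) N ≠ 0 := by
    intro h0
    rw [ev_spec, ev_sigma_iter] at h0
    have h1 := congrArg (fun a => a.coeff b) h0
    simp only [spec_coeff, sigma_iter_coeff, hz, HahnSeries.coeff_zero, map_smul,
      Polynomial.aeval_C] at h1
    exact smul_ne_zero (chi_ne_zero _) hv h1
  by_cases hNu : IsUnit N
  · obtain ⟨a, -, rfl⟩ := isUnit_iff_C_C.1 hNu
    rw [ev_C_C] at hu2
    rw [HahnSeries.C_apply, HahnSeries.coeff_single_of_ne hβ.ne'] at hu2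
    exact hu (Polynomial.C_eq_zero.1 hu2.symm)
  · obtain ⟨Γ, hΓ, hΓN⟩ := WfDvdMonoid.exists_irreducible_factor hNu hN0
    obtain ⟨c, hc⟩ := exists_dvd_level hΓ.prime (hNv.of_dvd hΓN)
    obtain ⟨z, β'', g'', hz, hz0⟩ := hK.exists_lift_of_dvd hΓ.not_isUnit hc
    obtain ⟨A, rfl⟩ := hΓN
    by_cases h1 : NConj y z
    · have h2 := hcon z β'' g'' hz h1
      simp only [NConj, not_forall, not_not] at h2
      obtain ⟨j, rfl⟩ := h2
      exact hconj hu' hu2' j c (by rw [map_mul, hz0, zero_mul])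
    · simp only [NConj, not_forall, not_not] at h1
      obtain ⟨j, rfl⟩ := h1
      exact hconj hu hu2 j c (by rw [map_mul, hz0, zero_mul])

/-- If all branches along which `Q` is unbounded are conjugate, then vertical elements are
polynomials in `P`. -/
theorem Vertical.eq_aeval (h : Vertical P b) (hK : Keller P Q c₀)
    (hone : ∀ z ∈ lifts P Q, ¬ NConj y z) : ∃ κ : ℂ[X], b = Polynomial.aeval P κ := by
  induction b using UniqueFactorizationMonoid.induction_on_prime with
  | h₁ => exact ⟨0, (map_zero _).symm⟩
  | h₂ b hb =>
    obtain ⟨a, -, rfl⟩ := isUnit_iff_C_C.1 hb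
    exact ⟨Polynomial.C a, by rw [Polynomial.aeval_C]; rfl⟩
  | h₃ a p ha hp ih =>
    obtain ⟨κ, rfl⟩ := ih (h.of_dvd (dvd_mul_left _ _))
    obtain ⟨c, hc⟩ := exists_dvd_level hp (h.of_dvd (dvd_mul_right _ _))
    have hroot {Γ : ℂ[X][X]} (hΓ : ¬ IsUnit Γ) (hΓc : Γ ∣ P - Polynomial.C (Polynomial.C c)) :
        ev (spec c y) Γ = 0 := by
      obtain ⟨z, β, g, hz, hz0⟩ := hK.exists_lift_of_dvd hΓ hΓc
      have h2 := hone z ⟨β, g, hz⟩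
      simp only [NConj, not_forall, not_not] at h2
      obtain ⟨j, rfl⟩ := h2
      ext q : 2
      have h1 := congrArg (fun a => a.coeff q) hz0
      simp only [ev_spec, ev_sigma_iter, spec_coeff, sigma_iter_coeff, HahnSeries.coeff_zero,
        map_smul] at h1
      rw [ev_spec, spec_coeff]
      exact (smul_eq_zero.1 h1).resolve_left (chi_ne_zero _)
    obtain ⟨A, hA⟩ := hc
    have hp0 := hroot hp.not_isUnit (Dvd.intro _ hA.symm)
    have hAu : IsUnit A := by
      by_contra hAu
      have hA0 := hroot hAu (Dvd.intro_left _ hA.symm)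
      refine hK.dY_ne_zero (η := spec c y) (c := c) ?_ ?_
      · have h1 := congrArg (ev (spec c y)) hA
        rw [map_mul, hA0, mul_zero, map_sub, ev_C_C, sub_eq_zero] at h1
        exact h1
      · have h1 := congrArg (fun b => ev (spec c y) (dY ℂ b)) hA
        simp only [map_sub, Derivation.leibniz, map_add, smul_eq_mul, map_mul, hp0, hA0, zero_mul,
          add_zero] at h1
        rwa [dY_C, map_zero, sub_zero] at h1
    obtain ⟨a, ha0, rfl⟩ := isUnit_iff_C_C.1 hAu
    refine ⟨Polynomial.C a⁻¹ * (Polynomial.X - Polynomial.C c) * κ, ?_⟩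
    rw [map_mul, map_mul, map_sub, Polynomial.aeval_X, Polynomial.aeval_C, Polynomial.aeval_C]
    have h2 : p = Polynomial.C (Polynomial.C a⁻¹) * (P - Polynomial.C (Polynomial.C c)) := by
      rw [hA, mul_left_comm, ← Polynomial.C_mul, ← Polynomial.C_mul, inv_mul_cancel₀ ha0,
        Polynomial.C_1, Polynomial.C_1, mul_one]
    rw [h2]
    rfl

/-- If all branches along which `Q` is unbounded are conjugate, then functions regular along all
other branches are polynomials in `P` and `Q`. -/
theorem Keller.exists_pev_of_regAway (hK : Keller P Q c₀) (hP : PlanarFibers P)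
    (hy : Lift P Q y β g) (hone : ∀ z ∈ lifts P Q, ¬ NConj y z) (hb : RegAway P y b) :
    ∃ G, b = pev P Q G := by
  obtain ⟨h, q, hp⟩ := hK.exists_pole hP hy
  have hr := hy.ram_pos hK
  have hne : (-(1 / ram y) : ℚ) ≠ 0 := neg_ne_zero.2 (by positivity)
  obtain ⟨κ, hκ⟩ := (hp.vertical_jac hK hP hy).eq_aeval hK hone
  have h1 := level_jac hK.ne_zero hK.jac_eq hy.theta_root h
  rw [hκ, hy.ev_aeval_level] at h1
  have h2 : Ord (0 + -(1 / ram y : ℚ)) _ :=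
    (ord_C (S := ℂ[X]) (Polynomial.C_ne_zero.2 hK.ne_zero)).mul (hp.ord.theta hne).1
  have hκ0 : κ ≠ 0 := by
    rintro rfl
    rw [map_zero, zero_mul] at h1
    exact h2.ne_zero h1.symm
  have h3 := (ord_C hκ0).mul (hy.ord_Q.theta (neg_ne_zero.2 hy.pos.ne')).1
  rw [h1] at h3
  have h4 : -β = -(1 / ram y : ℚ) := by have := h3.unique h2; linarith
  have hpQ : Pole P y Q (Polynomial.C g) :=
    ⟨Polynomial.C_ne_zero.2 hy.ne_zero, h4 ▸ hy.lge_Q, h4 ▸ hy.coeff_Q, fun η hη ha => by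
      by_contra hQ
      obtain ⟨z, β', g', hz, rfl⟩ := hK.exists_lift (hK.mem_rts.1 hη) hQ
      refine hone z ⟨β', g', hz⟩ fun j hj => ha j ?_
      rw [spec_tt, hj]⟩
  obtain ⟨n, G, hG⟩ := hpQ.exists_pev hK hy hb
  refine ⟨Polynomial.C (Polynomial.C (g ^ n)⁻¹) * G, ?_⟩
  rw [map_mul, ← hG, pev_C, ← mul_assoc, ← map_mul, ← Polynomial.C_pow, ← Polynomial.C_mul,
    inv_mul_cancel₀ (pow_ne_zero _ hy.ne_zero), Polynomial.C_1, map_one, one_mul]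

end Components

section LeadingForms

variable {f g : ℂ[X]} {a b c : ℂ}

theorem eq_mul_order_of_ode (hf0 : f.coeff 0 = 0) (hf1 : f.coeff 1 ≠ 0) (hg : g ≠ 0)
    (h : Polynomial.C a * (Polynomial.derivative f * g) =
      Polynomial.C b * (f * Polynomial.derivative g)) :
    a = b * (g.rootMultiplicity 0 : ℂ) := by
  obtain ⟨f₁, rfl⟩ := Polynomial.X_dvd_iff.2 hf0
  obtain ⟨g₁, hg₁, hd⟩ := Polynomial.exists_eq_pow_rootMultiplicity_mul_and_not_dvd g hg 0
  set m := g.rootMultiplicity 0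
  rw [Polynomial.C_0, sub_zero] at hg₁ hd
  rw [Polynomial.X_dvd_iff] at hd
  rw [Polynomial.coeff_X_mul] at hf1
  have hX : Polynomial.X * Polynomial.derivative (Polynomial.X ^ m : ℂ[X]) =
      Polynomial.C (m : ℂ) * Polynomial.X ^ m := by
    rcases m with _ | m
    · simp
    · rw [Polynomial.derivative_X_pow, Nat.add_sub_cancel, pow_succ]; ring
  rw [hg₁, Polynomial.derivative_mul, Polynomial.derivative_mul, Polynomial.derivative_X] at h
  have h1 : Polynomial.C a * ((f₁ + Polynomial.X * Polynomial.derivative f₁) * g₁) =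
      Polynomial.C b * (f₁ * (Polynomial.C (m : ℂ) * g₁ +
        Polynomial.X * Polynomial.derivative g₁)) := by
    apply mul_left_cancel₀ (pow_ne_zero m (Polynomial.X_ne_zero (R := ℂ)))
    linear_combination h + Polynomial.C b * f₁ * g₁ * hX
  have h2 := congrArg (Polynomial.eval 0) h1
  simp only [Polynomial.eval_mul, Polynomial.eval_add, Polynomial.eval_C, Polynomial.eval_X,
    zero_mul, add_zero, ← Polynomial.coeff_zero_eq_eval_zero] at h2
  apply mul_right_cancel₀ (mul_ne_zero hf1 hd)
  linear_combination h2

theorem eq_pow_of_ode (hf0 : f.coeff 0 = 0) (hf1 : f.coeff 1 ≠ 0) (hg : g ≠ 0) (hb : b ≠ 0)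
    (h : Polynomial.C a * (Polynomial.derivative f * g) =
      Polynomial.C b * (f * Polynomial.derivative g)) :
    ∃ (m : ℕ) (l : ℂ), a = b * m ∧ g = Polynomial.C l * f ^ m := by
  have hm := eq_mul_order_of_ode hf0 hf1 hg h
  set m := g.rootMultiplicity 0 with hmdef
  obtain ⟨g₁, hg₁, hd⟩ := Polynomial.exists_eq_pow_rootMultiplicity_mul_and_not_dvd g hg 0
  rw [← hmdef, Polynomial.C_0, sub_zero] at hg₁
  obtain ⟨f₁, rfl⟩ := Polynomial.X_dvd_iff.2 hf0
  rw [Polynomial.coeff_X_mul] at hf1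
  refine ⟨m, g₁.coeff 0 / f₁.coeff 0 ^ m, hm, ?_⟩
  set l := g₁.coeff 0 / f₁.coeff 0 ^ m
  by_contra hne
  set f := Polynomial.X * f₁ with hf
  have hw : g - Polynomial.C l * f ^ m ≠ 0 := sub_ne_zero.2 hne
  have hpow : f * Polynomial.derivative (f ^ m) =
      Polynomial.C (m : ℂ) * (Polynomial.derivative f * f ^ m) := by
    rcases m with _ | m
    · simp
    · rw [Polynomial.derivative_pow, Nat.add_sub_cancel, pow_succ]; ring
  have h2 := eq_mul_order_of_ode hf0 (by rwa [hf, Polynomial.coeff_X_mul]) hw (a := a) (b := b) (by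
    rw [map_sub, Polynomial.derivative_C_mul]
    have := congrArg Polynomial.C hm
    rw [Polynomial.C_mul] at this
    linear_combination h + Polynomial.C b * Polynomial.C l * hpow -
      Polynomial.C l * f ^ m * Polynomial.derivative f * this)
  have h3 : m = (g - Polynomial.C l * f ^ m).rootMultiplicity 0 := by
    rw [hm] at h2; exact_mod_cast mul_left_cancel₀ hb h2
  have h4 : g - Polynomial.C l * f ^ m = Polynomial.X ^ m * (g₁ - Polynomial.C l * f₁ ^ m) := by
    rw [hf, mul_pow]; linear_combination hg₁
  have h5 : (Polynomial.X - Polynomial.C (0 : ℂ)) ^ (m + 1) ∣ g - Polynomial.C l * f ^ m := by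
    rw [Polynomial.C_0, sub_zero, h4, pow_succ]
    refine mul_dvd_mul_left _ (Polynomial.X_dvd_iff.2 ?_)
    rw [Polynomial.coeff_sub, Polynomial.coeff_C_mul, Polynomial.coeff_zero_eq_eval_zero (f₁ ^ m),
      Polynomial.eval_pow, ← Polynomial.coeff_zero_eq_eval_zero, div_mul_cancel₀, sub_self]
    exact pow_ne_zero _ hf1
  have := (Polynomial.le_rootMultiplicity_iff hw).2 h5
  omega

theorem degree_of_ode (hf : 2 ≤ f.natDegree) (hg : g ≠ 0)
    (h : Polynomial.C a * (Polynomial.derivative f * g) +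
      Polynomial.C b * (f * Polynomial.derivative g) = Polynomial.C c) :
    a * f.natDegree + b * g.natDegree = 0 := by
  have hd (p q : ℂ[X]) : Polynomial.coeff (Polynomial.X * (Polynomial.derivative p * q))
      (p.natDegree + q.natDegree) = p.natDegree * (p.leadingCoeff * q.leadingCoeff) := by
    have hX : (Polynomial.X * Polynomial.derivative p).natDegree ≤ p.natDegree := by
      rcases Nat.eq_zero_or_pos p.natDegree with h0 | h0
      · rw [Polynomial.eq_C_of_natDegree_eq_zero h0, Polynomial.derivative_C, mul_zero]; simp
      · have h1 := Polynomial.natDegree_derivative_lt h0.ne'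
        refine Polynomial.natDegree_mul_le.trans ?_
        rw [Polynomial.natDegree_X]
        omega
    rw [← mul_assoc, Polynomial.coeff_mul_add_eq_of_natDegree_le hX le_rfl,
      Polynomial.leadingCoeff, Polynomial.leadingCoeff, ← mul_assoc]
    congr 1
    rcases p.natDegree with _ | n
    · simp
    · rw [Polynomial.coeff_X_mul, Polynomial.coeff_derivative]; push_cast; ring
  have h1 := congrArg (fun p => Polynomial.coeff (Polynomial.X * p) (f.natDegree + g.natDegree)) h
  have h2 := hd f g
  have h3 := hd g f
  rw [add_comm g.natDegree] at h3
  simp only [mul_add, Polynomial.coeff_add] at h1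
  rw [show Polynomial.X * (Polynomial.C a * (Polynomial.derivative f * g)) =
      Polynomial.C a * (Polynomial.X * (Polynomial.derivative f * g)) by ring,
    show Polynomial.X * (Polynomial.C b * (f * Polynomial.derivative g)) =
      Polynomial.C b * (Polynomial.X * (Polynomial.derivative g * f)) by ring,
    Polynomial.coeff_C_mul, Polynomial.coeff_C_mul, h2, h3,
    mul_comm Polynomial.X (Polynomial.C c), Polynomial.coeff_C_mul,
    Polynomial.coeff_X_of_ne_one (by omega), mul_zero] at h1
  have hl : f.leadingCoeff * g.leadingCoeff ≠ 0 :=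
    mul_ne_zero (Polynomial.leadingCoeff_ne_zero.2 (by rintro rfl; simp at hf))
      (Polynomial.leadingCoeff_ne_zero.2 hg)
  apply mul_right_cancel₀ hl
  linear_combination h1

theorem ne_zero_of_ode (hf : 2 ≤ f.natDegree) (hc : c ≠ 0) (hb : b ≠ 0)
    (h : Polynomial.C a * (Polynomial.derivative f * g) +
      Polynomial.C b * (f * Polynomial.derivative g) = Polynomial.C c) {j : ℕ} (hj : 0 < j) :
    a + b * j ≠ 0 := by
  intro haj
  have hne {g : ℂ[X]} (h : Polynomial.C a * (Polynomial.derivative f * g) +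
      Polynomial.C b * (f * Polynomial.derivative g) = Polynomial.C c) : g ≠ 0 := by
    rintro rfl
    simp only [mul_zero, map_zero, add_zero] at h
    exact hc (Polynomial.C_eq_zero.1 h.symm)
  have hdeg {g : ℂ[X]} (h : Polynomial.C a * (Polynomial.derivative f * g) +
      Polynomial.C b * (f * Polynomial.derivative g) = Polynomial.C c) :
      g.natDegree = j * f.natDegree := by
    have := degree_of_ode hf (hne h) h
    have h1 : b * (g.natDegree : ℂ) = b * ((j * f.natDegree : ℕ) : ℂ) := by
      push_cast
      linear_combination this - f.natDegree * haj
    exact_mod_cast mul_left_cancel₀ hb h1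
  have hf0 : f ≠ 0 := by rintro rfl; simp at hf
  obtain ⟨l, hl⟩ : ∃ l, l = g.leadingCoeff / (f ^ j).leadingCoeff := ⟨_, rfl⟩
  have hpow : f * Polynomial.derivative (f ^ j) =
      Polynomial.C (j : ℂ) * (Polynomial.derivative f * f ^ j) := by
    obtain ⟨m, rfl⟩ := Nat.exists_eq_succ_of_ne_zero hj.ne'
    rw [Polynomial.derivative_pow, Nat.succ_sub_one, pow_succ]; ring
  have haj' : Polynomial.C a + Polynomial.C b * Polynomial.C (j : ℂ) = 0 := by
    rw [← Polynomial.C_mul, ← Polynomial.C_add, haj, Polynomial.C_0]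
  have h' : Polynomial.C a * (Polynomial.derivative f * (g - Polynomial.C l * f ^ j)) +
      Polynomial.C b * (f * Polynomial.derivative (g - Polynomial.C l * f ^ j)) =
        Polynomial.C c := by
    rw [map_sub, Polynomial.derivative_C_mul]
    linear_combination h - Polynomial.C b * Polynomial.C l * hpow -
      Polynomial.C l * f ^ j * Polynomial.derivative f * haj'
  have hfj := Polynomial.leadingCoeff_ne_zero.2 (pow_ne_zero j hf0)
  have hl0 : l ≠ 0 := by
    rw [hl]; exact div_ne_zero (Polynomial.leadingCoeff_ne_zero.2 (hne h)) hfj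
  have h1 : (g - Polynomial.C l * f ^ j).degree < g.degree := by
    refine Polynomial.degree_sub_lt_left ?_ (hne h) ?_
    · rw [Polynomial.degree_C_mul hl0, Polynomial.degree_eq_natDegree (hne h),
        Polynomial.degree_eq_natDegree (pow_ne_zero j hf0), hdeg h, Polynomial.natDegree_pow]
    · rw [Polynomial.leadingCoeff_mul, Polynomial.leadingCoeff_C, hl, div_mul_cancel₀ _ hfj]
  have h2 := Polynomial.natDegree_lt_natDegree (hne h') h1
  rw [hdeg h, hdeg h'] at h2
  exact lt_irrefl _ h2

end LeadingForms

section Discs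

variable {P Q : ℂ[X][X]} {c₀ : ℂ} {y y' : Hahn ℂ[X]} {β β' r s p q : ℚ} {g g' : ℂ} {b b' : ℂ[X][X]}

theorem disc_coeff_coeff {F : Type*} [Field F] [Algebra ℂ F] (η : Hahn F) (r r' q : ℚ)
    (b : ℂ[X][X]) (i : ℕ) :
    ((ev (disc η r) b).coeff q).coeff i =
      ((ev (disc η r') b).coeff (q + i * (r - r'))).coeff i := by
  rw [← polySwap_tay, ← polySwap_tay, polySwap_coeff, polySwap_coeff, tay_coeff,
    tay_coeff η r']
  have h (t : ℚ) (u : ℚ) (a : Hahn F) : (a * HahnSeries.single u 1).coeff t = a.coeff (t - u) := by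
    conv_lhs => rw [← sub_add_cancel t u]
    rw [HahnSeries.coeff_mul_single_add, mul_one]
  rw [h, h]
  congr 1
  ring

theorem lge_all_iff {S : Type*} [CommRing S] {a : Hahn S} : (∀ p, Lge p a) ↔ a = 0 := by
  refine ⟨fun h => ?_, fun h p => h ▸ lge_zero p⟩
  ext q
  exact h (q + 1) q (by linarith)

/-- The leading form along a branch is the leading form on the disc of conjugates up to scaling. -/
theorem Lift.ord_disc (hy : Lift P Q y β g) (hK : Keller P Q c₀) (hb : Ord p (ev y b)) :
    Ord p (ev (disc (spec (0 : ℂ) y) (β - 1)) b) ∧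
      ((ev (disc (spec (0 : ℂ) y) (β - 1)) b).coeff p).natDegree = ((ev y b).coeff p).natDegree := by
  obtain ⟨z, hz, hyz⟩ := hy.eq_shift hK 0
  obtain ⟨f, hf, ht⟩ := hy.spec_typeI hK (0 : ℂ)
  have ht' := ht.map (Polynomial.CAlgHom : ℂ →ₐ[ℂ] ℂ[X])
  have hz0 : z.coeff 0 = Polynomial.C f⁻¹ * Polynomial.X := by
    have h1 := ht'.P_at hz
    change (ev (hmap Polynomial.C _ + _) P).coeff 0 = Polynomial.C 0 + Polynomial.C f * _ at h1
    rw [← hyz, hy.root, HahnSeries.C_apply, HahnSeries.coeff_single_same, Polynomial.C_0,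
      zero_add] at h1
    rw [h1, ← mul_assoc, ← Polynomial.C_mul, inv_mul_cancel₀ hf, Polynomial.C_1, one_mul]
  have hdisc : disc (hmap (Polynomial.C : ℂ →+* ℂ[X]) (spec (0 : ℂ) y)) (β - 1) =
      hmap ((Polynomial.mapAlgHom Polynomial.CAlgHom : ℂ[X] →ₐ[ℂ] ℂ[X][X]) : ℂ[X] →+* ℂ[X][X])
        (disc (spec (0 : ℂ) y) (β - 1)) := (hmap_disc Polynomial.CAlgHom _ _).symm
  have key {p' : ℚ} (h : Lge p' (ev (disc (spec (0 : ℂ) y) (β - 1)) b)) :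
      Lge p' (ev y b) ∧ (ev y b).coeff p' =
        ((ev (disc (spec (0 : ℂ) y) (β - 1)) b).coeff p').comp
          (Polynomial.C f⁻¹ * Polynomial.X) := by
    have h2 : Lge p' (ev (disc (hmap Polynomial.C (spec (0 : ℂ) y)) (β - 1)) b) := by
      rw [hdisc, ← hmap_ev]; exact h.hmap _
    have h3 := disc_subst h2 hz
    rw [neg_sub, ← hyz] at h3
    refine ⟨h3.1, h3.2.trans ?_⟩
    rw [hdisc, ← hmap_ev, hmap_coeff, hz0]
    change Polynomial.eval _ (Polynomial.map _ _) = _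
    rw [Polynomial.eval_map]
    rfl
  have hne : ev (disc (spec (0 : ℂ) y) (β - 1)) b ≠ 0 := fun h0 =>
    hb.ne_zero (lge_all_iff.1 fun p' => (key (lge_all_iff.2 h0 p')).1)
  obtain ⟨p', hp'⟩ := exists_ord hne
  have h1 := key hp'.lge
  have hcomp : (ev y b).coeff p' ≠ 0 := by
    rw [h1.2]
    intro h0
    exact hp'.2 (by
      have := congrArg (fun a => a.comp (Polynomial.C f * Polynomial.X)) h0
      simp only [Polynomial.comp_assoc, Polynomial.mul_comp, Polynomial.C_comp,
        Polynomial.X_comp, Polynomial.zero_comp] at this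
      rwa [← mul_assoc, ← Polynomial.C_mul, inv_mul_cancel₀ hf, Polynomial.C_1, one_mul,
        Polynomial.comp_X] at this)
  obtain rfl : p' = p := Ord.unique ⟨h1.1, hcomp⟩ hb
  refine ⟨hp', ?_⟩
  rw [h1.2, Polynomial.natDegree_comp, Polynomial.natDegree_C_mul_X _ (inv_ne_zero hf), mul_one]

theorem ord_ev_aeval {S : Type*} [CommRing S] [IsDomain S] [Algebra ℂ S] {η : Hahn S}
    (hP : Ord s (ev η P)) (hs : s < 0) {κ : ℂ[X]} (hκ : κ ≠ 0) :
    Ord (κ.natDegree * s) (ev η (Polynomial.aeval P κ)) ∧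
      (ev η (Polynomial.aeval P κ)).coeff (κ.natDegree * s) =
        algebraMap ℂ S κ.leadingCoeff * (ev η P).coeff s ^ κ.natDegree := by
  induction hn : κ.natDegree generalizing κ with
  | zero =>
    rw [Polynomial.eq_C_of_natDegree_eq_zero hn, Polynomial.aeval_C, Nat.cast_zero, zero_mul]
    rw [Polynomial.eq_C_of_natDegree_eq_zero hn, Polynomial.C_ne_zero] at hκ
    change Ord 0 (ev η (Polynomial.C (Polynomial.C _))) ∧
      (ev η (Polynomial.C (Polynomial.C _))).coeff 0 = _
    rw [ev_C_C]
    refine ⟨ord_C ((map_ne_zero_iff _ (algebraMap ℂ S).injective).2 hκ), ?_⟩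
    rw [HahnSeries.C_apply, HahnSeries.coeff_single_same, Polynomial.leadingCoeff_C, pow_zero,
      mul_one]
  | succ n ih =>
    have hd : κ.divX.natDegree = n := by rw [Polynomial.natDegree_divX_eq_natDegree_tsub_one, hn]; rfl
    have hd0 : κ.divX ≠ 0 := by
      intro h0
      have := Polynomial.divX_mul_X_add κ
      rw [h0, zero_mul, zero_add] at this
      rw [← this, Polynomial.natDegree_C] at hn
      omega
    obtain ⟨h1, h2⟩ := ih hd0 hd
    have h3 := h1.mul hP
    have h4 := h1.lge.coeff_mul hP.lge
    have h5 : ev η (Polynomial.aeval P κ) = ev η (Polynomial.aeval P κ.divX) * ev η P +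
        HahnSeries.C (algebraMap ℂ S (κ.coeff 0)) := by
      conv_lhs => rw [← Polynomial.divX_mul_X_add κ, map_add, map_mul, Polynomial.aeval_X,
        Polynomial.aeval_C]
      rw [map_add, map_mul, ← ev_C_C]
      rfl
    have h6 : ((n + 1 : ℕ) : ℚ) * s = n * s + s := by push_cast; ring
    have h7 : n * s + s < 0 := by
      have : (n : ℚ) * s ≤ 0 := mul_nonpos_of_nonneg_of_nonpos (Nat.cast_nonneg n) hs.le
      linarith
    rw [h6, h5]
    refine ⟨h3.add_of_lt (lge_C _) h7, ?_⟩
    rw [HahnSeries.coeff_add, lge_C _ _ h7, add_zero, h4, h2, pow_succ, mul_assoc]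
    congr 2
    rw [Polynomial.leadingCoeff, Polynomial.leadingCoeff, hd, hn, Polynomial.coeff_divX]

theorem Lift.le_of_ord_disc (hy : Lift P Q y β g) (hK : Keller P Q c₀) (hb : Ord p (ev y b))
    (hq : Ord q (ev (disc (spec (0 : ℂ) y) r) b)) :
    q ≤ p + ((ev y b).coeff p).natDegree * (β - 1 - r) ∧
      (q = p + ((ev y b).coeff p).natDegree * (β - 1 - r) →
        ((ev (disc (spec (0 : ℂ) y) r) b).coeff q).coeff ((ev y b).coeff p).natDegree ≠ 0) := by
  obtain ⟨h1, h2⟩ := hy.ord_disc hK hb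
  set d := ((ev y b).coeff p).natDegree
  have h3 := disc_coeff_coeff (spec (0 : ℂ) y) r (β - 1) (p + d * (β - 1 - r)) b d
  rw [show p + d * (β - 1 - r) + d * (r - (β - 1)) = p by ring] at h3
  have h4 : ((ev (disc (spec (0 : ℂ) y) r) b).coeff (p + d * (β - 1 - r))).coeff d ≠ 0 := by
    rw [h3, ← h2]
    exact Polynomial.leadingCoeff_ne_zero.2 h1.2
  refine ⟨?_, fun h => h ▸ h4⟩
  by_contra! hlt
  rw [hq.lge _ hlt] at h4
  exact h4 rfl

/-- The leading forms of vertical elements along a branch and on a larger disc. -/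
theorem Lift.ord_vertical (hy : Lift P Q y β g) (hK : Keller P Q c₀)
    (hP : Ord (β - 1 - r) (ev (disc (spec (0 : ℂ) y) r) P)) (hs : β - 1 - r < 0)
    {κ : ℂ[X]} (hκ : κ ≠ 0) (hbb : b * b' = Polynomial.aeval P κ)
    (hb : Ord p (ev y b)) (hb' : Ord q (ev y b')) :
    Ord (p + ((ev y b).coeff p).natDegree * (β - 1 - r)) (ev (disc (spec (0 : ℂ) y) r) b) ∧
    ((ev (disc (spec (0 : ℂ) y) r) b).coeff
      (p + ((ev y b).coeff p).natDegree * (β - 1 - r))).coeff ((ev y b).coeff p).natDegree ≠ 0 ∧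
    ((ev y b).coeff p).natDegree + ((ev y b').coeff q).natDegree = κ.natDegree := by
  have h1 := hb.mul hb'
  have h2 := hb.lge.coeff_mul hb'.lge
  rw [← map_mul, hbb, hy.ev_aeval_level] at h1 h2
  have h3 : p + q = 0 := h1.unique (ord_C hκ)
  rw [h3, HahnSeries.C_apply, HahnSeries.coeff_single_same] at h2
  have h4 : ((ev y b).coeff p).natDegree + ((ev y b').coeff q).natDegree = κ.natDegree := by
    rw [h2, Polynomial.natDegree_mul hb.2 hb'.2]
  have h5 := (ord_ev_aeval hP hs hκ).1
  rw [← hbb, map_mul] at h5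
  obtain ⟨u, hu⟩ := exists_ord (left_ne_zero_of_mul h5.ne_zero)
  obtain ⟨v, hv⟩ := exists_ord (right_ne_zero_of_mul h5.ne_zero)
  obtain ⟨h6, h6'⟩ := hy.le_of_ord_disc hK hb hu
  obtain ⟨h7, -⟩ := hy.le_of_ord_disc hK hb' hv
  have h8 := (hu.mul hv).unique h5
  have h9 : (κ.natDegree : ℚ) = ((ev y b).coeff p).natDegree + ((ev y b').coeff q).natDegree := by
    exact_mod_cast h4.symm
  rw [h9, add_mul] at h8
  have h10 : u = p + ((ev y b).coeff p).natDegree * (β - 1 - r) := by linarith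
  exact ⟨h10 ▸ hu, h10 ▸ h6' h10, h4⟩

end Discs

section Discs

variable {P Q : ℂ[X][X]} {c₀ : ℂ} {y y' : Hahn ℂ[X]} {β β' r s p q : ℚ} {g g' : ℂ} {b b' : ℂ[X][X]}

theorem disc_coeff_eq_tay (η : Hahn ℂ) (r r' q : ℚ) (b : ℂ[X][X]) (i : ℕ) :
    ((ev (disc η r) b).coeff q).coeff i = ((tay η r' b).coeff i).coeff (q + i * (r - r')) := by
  rw [disc_coeff_coeff η r r', ← polySwap_tay, polySwap_coeff]

/-- The smallest disc around a branch of the zero level containing another branch of this level. -/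
theorem Lift.exists_disc (hy : Lift P Q y β g) (hK : Keller P Q c₀) (h2 : 2 ≤ P.natDegree) :
    ∃ r, β - 1 - r < 0 ∧ Ord (β - 1 - r) (ev (disc (spec (0 : ℂ) y) r) P) ∧
      2 ≤ ((ev (disc (spec (0 : ℂ) y) r) P).coeff (β - 1 - r)).natDegree ∧
      ((ev (disc (spec (0 : ℂ) y) r) P).coeff (β - 1 - r)).coeff 0 = 0 ∧
      ((ev (disc (spec (0 : ℂ) y) r) P).coeff (β - 1 - r)).coeff 1 ≠ 0 := by
  obtain ⟨f, hf, ht⟩ := hy.spec_typeI hK (0 : ℂ)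
  set η := spec (0 : ℂ) y with hη
  obtain ⟨t, htdef⟩ : ∃ t, t = tay η (β - 1) P := ⟨_, rfl⟩
  have hform (r q : ℚ) (i : ℕ) : ((ev (disc η r) P).coeff q).coeff i =
      (t.coeff i).coeff (q + i * (r - (β - 1))) := by rw [htdef, ← disc_coeff_eq_tay]
  have hc (i : ℕ) : (t.coeff i).coeff 0 = (Polynomial.C 0 + Polynomial.C f * Polynomial.X).coeff i := by
    rw [htdef, ← polySwap_coeff, polySwap_tay, ht.coeff_P]; rfl
  have h0 (i : ℕ) : Lge 0 (t.coeff i) := by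
    refine lge_polySwap_iff.1 ?_ i
    rw [htdef, polySwap_tay]; exact ht.lge_P
  have ht0 : t.coeff 0 = 0 := by
    rw [htdef, Polynomial.coeff_zero_eq_eval_zero, tay_eval, mul_zero, add_zero, hη,
      hy.spec_root, map_zero]
  have ht1 : (t.coeff 1).coeff 0 = f := by rw [hc]; simp
  have ht2 (i : ℕ) (hi : 2 ≤ i) : (t.coeff i).coeff 0 = 0 := by
    rw [hc, Polynomial.C_0, zero_add, Polynomial.coeff_C_mul,
      Polynomial.coeff_X_of_ne_one (by omega), mul_zero]
  have hex (i : ℕ) : ∃ p : ℚ, t.coeff i ≠ 0 → Ord p (t.coeff i) := by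
    by_cases h : t.coeff i = 0
    · exact ⟨0, fun h' => (h' h).elim⟩
    · obtain ⟨p, hp⟩ := exists_ord h
      exact ⟨p, fun _ => hp⟩
  choose o ho using hex
  obtain ⟨i₀, hi₀, hmin⟩ := Finset.exists_min_image
    (t.support.filter (2 ≤ ·)) (fun i => o i / (i - 1)) (by
      refine ⟨P.natDegree, Finset.mem_filter.2 ⟨?_, h2⟩⟩
      rw [Polynomial.mem_support_iff, htdef, natDegree_tay hK.monic]
      exact (ord_single one_ne_zero).ne_zero)
  simp only [Finset.mem_filter, Polynomial.mem_support_iff] at hi₀ hmin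
  obtain ⟨ρ, hρ⟩ : ∃ ρ, ρ = o i₀ / (i₀ - 1) := ⟨_, rfl⟩
  have hpos (i : ℕ) (hi : 2 ≤ i) : (0 : ℚ) < i - 1 := by
    have : (2 : ℚ) ≤ i := by exact_mod_cast hi
    linarith
  have hρ0 : 0 < ρ := by
    rw [hρ]
    refine div_pos (lt_of_le_of_ne ((ho i₀ hi₀.1).le (h0 i₀)) fun h => ?_) (hpos _ hi₀.2)
    have := (ho i₀ hi₀.1).2
    rw [← h] at this
    exact this (ht2 _ hi₀.2)
  have hs : β - 1 - (β - 1 + ρ) = -ρ := by ring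
  have hr : β - 1 + ρ - (β - 1) = ρ := by ring
  have hc0 : ((ev (disc η (β - 1 + ρ)) P).coeff (-ρ)).coeff 0 = 0 := by
    rw [hform, ht0]; rfl
  have hc1 : ((ev (disc η (β - 1 + ρ)) P).coeff (-ρ)).coeff 1 ≠ 0 := by
    rw [hform, hr, Nat.cast_one, one_mul, neg_add_cancel, ht1]
    exact hf
  refine ⟨β - 1 + ρ, ?_, ?_⟩
  · linarith
  rw [hs]
  refine ⟨⟨fun q hq => ?_, fun h => hc1 (by rw [h]; rfl)⟩, ?_, hc0, hc1⟩
  · ext i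
    rw [hform, hr, Polynomial.coeff_zero]
    rcases Nat.lt_or_ge i 2 with hi | hi
    · interval_cases i
      · rw [ht0]; rfl
      · exact h0 1 _ (by push_cast; linarith)
    · by_cases hz : t.coeff i = 0
      · rw [hz]; rfl
      · refine (ho i hz).lge _ ?_
        have h3 := hmin i ⟨hz, hi⟩
        rw [← hρ, le_div_iff₀ (hpos i hi)] at h3
        linarith
  · refine hi₀.2.trans (Polynomial.le_natDegree_of_ne_zero ?_)
    rw [hform, hr]
    have h3 : -ρ + i₀ * ρ = o i₀ := by
      have := (hpos _ hi₀.2).ne'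
      rw [hρ]; field_simp; ring
    rw [h3]
    exact (ho i₀ hi₀.1).2

/-- Simple roots of the leading form of `b` on a disc come from roots of `b`. -/
theorem exists_root_of_simple {η : Hahn ℂ} (hb : Lge p (ev (disc η r) b)) {c : ℂ}
    (hc : ((ev (disc η r) b).coeff p).eval c = 0)
    (hc' : (Polynomial.derivative ((ev (disc η r) b).coeff p)).eval c ≠ 0) :
    ∃ h : Hahn ℂ, Lge 0 h ∧ h.coeff 0 = c ∧ ev (η + HahnSeries.single (-r) 1 * h) b = 0 := by
  obtain ⟨hb1, hb2⟩ := ev_disc_shift hb (lge_C c)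
  rw [HahnSeries.C_apply, HahnSeries.coeff_single_same, ← HahnSeries.C_apply] at hb2
  set η' := η + HahnSeries.single (-r) 1 * HahnSeries.C c with hη'
  set a := (ev (disc η r) b).coeff p
  have hform (i : ℕ) : ((tay η' r b).coeff i).coeff p =
      (a.comp (Polynomial.X + Polynomial.C c)).coeff i := by
    rw [← hb2, disc_coeff_eq_tay η' r r, sub_self, mul_zero, add_zero]
  have hlge (i : ℕ) : Lge p ((tay η' r b).coeff i) := by
    refine lge_polySwap_iff.1 ?_ i
    rw [polySwap_tay]; exact hb1
  have hi0 : ((tay η' r b).coeff 0).coeff p = 0 := by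
    rw [hform, Polynomial.coeff_zero_eq_eval_zero, Polynomial.eval_comp]
    simpa using hc
  have hi1 : ((tay η' r b).coeff 1).coeff p ≠ 0 := by
    rw [hform]
    have h1 := Polynomial.coeff_derivative (a.comp (Polynomial.X + Polynomial.C c)) 0
    rw [Nat.cast_zero, zero_add, zero_add, mul_one] at h1
    rw [← h1, Polynomial.coeff_zero_eq_eval_zero, Polynomial.derivative_comp]
    simpa using hc'
  obtain ⟨ε, hε, h0⟩ : ∃ ε : ℚ, 0 < ε ∧ Lge (p + ε) ((tay η' r b).coeff 0) := by
    by_cases hz : (tay η' r b).coeff 0 = 0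
    · exact ⟨1, one_pos, by rw [hz]; exact lge_zero _⟩
    · obtain ⟨o, ho⟩ := exists_ord hz
      refine ⟨o - p, sub_pos.2 (lt_of_le_of_ne (ho.le (hlge 0)) ?_), ?_⟩
      · rintro rfl
        exact ho.2 hi0
      · rw [add_sub_cancel]; exact ho.lge
  have hcoef (i : ℕ) : (tay η' (r - ε) b * Polynomial.C (HahnSeries.single (-(p + ε)) 1)).coeff i =
      (tay η' r b).coeff i * HahnSeries.single (i * ε - p - ε) 1 := by
    rw [Polynomial.coeff_mul_C, tay_coeff, tay_coeff η' r, mul_assoc, mul_assoc,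
      HahnSeries.single_mul_single, HahnSeries.single_mul_single]
    congr 3; ring
  have hcc (i : ℕ) (q : ℚ) :
      ((tay η' (r - ε) b * Polynomial.C (HahnSeries.single (-(p + ε)) 1)).coeff i).coeff q =
        ((tay η' r b).coeff i).coeff (q - (i * ε - p - ε)) := by
    rw [hcoef]
    conv_lhs => rw [← sub_add_cancel q (i * ε - p - ε)]
    rw [HahnSeries.coeff_mul_single_add, mul_one]
  have hsmall (i : ℕ) (hi : 2 ≤ i) (q : ℚ) (hq : q ≤ 0) : q - (i * ε - p - ε) < p := by
    have : (2 : ℚ) ≤ i := by exact_mod_cast hi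
    nlinarith
  obtain ⟨h, hh, hroot, -⟩ := exists_simple_root
    (p := tay η' (r - ε) b * Polynomial.C (HahnSeries.single (-(p + ε)) 1))
    (fun i q hq => by
      rw [hcc]
      rcases Nat.lt_or_ge i 2 with hi | hi
      · interval_cases i
        · exact h0 _ (by push_cast; linarith)
        · exact hlge _ _ (by push_cast; linarith)
      · exact hlge _ _ (hsmall i hi q hq.le))
    (fun i hi => by rw [hcc]; exact hlge _ _ (hsmall i hi 0 le_rfl))
    (a := (((tay η' r b).coeff 1).coeff p)⁻¹) (by
      rw [hcc, show (0 : ℚ) - ((1 : ℕ) * ε - p - ε) = p by push_cast; ring]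
      exact inv_mul_cancel₀ hi1)
  rw [Polynomial.eval_mul, Polynomial.eval_C, tay_eval] at hroot
  have hroot' := (mul_eq_zero.1 hroot).resolve_right (ord_single one_ne_zero).ne_zero
  refine ⟨HahnSeries.C c + HahnSeries.single ε 1 * h, ?_, ?_, ?_⟩
  · exact (lge_C c).add (((lge_single le_rfl _).mul hh).mono (by linarith))
  · rw [HahnSeries.coeff_add, HahnSeries.C_apply, HahnSeries.coeff_single_same,
      ((lge_single (le_refl ε) 1).mul hh) 0 (by linarith), add_zero]
  · rw [mul_add, ← add_assoc, ← hη', ← mul_assoc, HahnSeries.single_mul_single, one_mul]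
    rwa [show -r + ε = -(r - ε) by ring]

theorem jac_sub_aeval (P b : ℂ[X][X]) (κ : ℂ[X]) :
    jac P (b - Polynomial.aeval P κ) = jac P b := by
  rw [jac_sub, jac_aeval_self, sub_zero]

/-- Subtracting a polynomial in `P` from `Q` minimizes the degree of `Q` on a disc. -/
theorem exists_reduced {η : Hahn ℂ} (hP : Ord (β - 1 - r) (ev (disc η r) P)) (hs : β - 1 - r < 0)
    (hf0 : ((ev (disc η r) P).coeff (β - 1 - r)).coeff 0 = 0)
    (hf1 : ((ev (disc η r) P).coeff (β - 1 - r)).coeff 1 ≠ 0)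
    (hc₀ : c₀ ≠ 0) (hJ : jac P Q = Polynomial.C (Polynomial.C c₀)) :
    ∃ κ : ℂ[X], Ord (-β) (ev (disc η r) (Q - Polynomial.aeval P κ)) := by
  set s := β - 1 - r with hsdef
  set f := (ev (disc η r) P).coeff s
  have hne {Q : ℂ[X][X]} (hJ : jac P Q = Polynomial.C (Polynomial.C c₀)) :
      ev (disc η r) Q ≠ 0 := fun h0 => by
    have h1 := disc_jac hP.lge (h0 ▸ lge_zero (-β) : Lge (-β) (ev (disc η r) Q))
    rw [hJ, h0, HahnSeries.coeff_zero, ev_C_C, show s + -β + 1 + r = 0 by rw [hsdef]; ring,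
      HahnSeries.C_apply, HahnSeries.coeff_single_same] at h1
    simp at h1
    exact hc₀ h1
  have step {Q : ℂ[X][X]} (hJ : jac P Q = Polynomial.C (Polynomial.C c₀)) {q : ℚ}
      (hq : Ord q (ev (disc η r) Q)) (hqβ : q ≠ -β) :
      ∃ (m : ℕ) (l : ℂ), q = m * s ∧ (ev (disc η r) Q).coeff q = Polynomial.C l * f ^ m := by
    have h1 := disc_jac hP.lge hq.lge
    rw [hJ, ev_C_C, HahnSeries.C_apply, HahnSeries.coeff_single_of_ne (fun h => hqβ (by linarith)),
      eq_comm, sub_eq_zero, Polynomial.smul_eq_C_mul, Polynomial.smul_eq_C_mul] at h1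
    obtain ⟨m, l, hm, hl⟩ := eq_pow_of_ode hf0 hf1 hq.2 (by exact_mod_cast hs.ne) h1
    refine ⟨m, l, ?_, hl⟩
    rw [mul_comm]
    exact_mod_cast hm
  obtain ⟨q, hq⟩ := exists_ord (hne hJ)
  by_cases hqβ : q = -β
  · exact ⟨0, by rw [map_zero, sub_zero, ← hqβ]; exact hq⟩
  obtain ⟨m, l, hm, hl⟩ := step hJ hq hqβ
  induction m using Nat.strong_induction_on generalizing Q q l with
  | _ m ih =>
    have hJ' := (jac_sub_aeval P Q (Polynomial.C l * Polynomial.X ^ m)).trans hJ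
    obtain ⟨q', hq'⟩ := exists_ord (hne hJ')
    by_cases hqβ' : q' = -β
    · exact ⟨_, hqβ' ▸ hq'⟩
    obtain ⟨m', l', hm', hl'⟩ := step hJ' hq' hqβ'
    have hlt : q < q' := by
      have hPm : Lge q (ev (disc η r) (Polynomial.aeval P (Polynomial.C l * Polynomial.X ^ m))) ∧
          (ev (disc η r) (Polynomial.aeval P (Polynomial.C l * Polynomial.X ^ m))).coeff q =
            Polynomial.C l * f ^ m := by
        rw [map_mul, Polynomial.aeval_C, map_pow, Polynomial.aeval_X, map_mul, map_pow, hm]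
        have h3 := hP.lge.pow m
        have h4 : ev (disc η r) (algebraMap ℂ ℂ[X][X] l) = HahnSeries.C (Polynomial.C l) :=
          ev_C_C _ _
        rw [h4]
        refine ⟨((lge_C _).mul h3).mono (by linarith), ?_⟩
        have h5 := (lge_C (Polynomial.C l)).coeff_mul h3
        rw [zero_add, hP.lge.coeff_pow, HahnSeries.C_apply, HahnSeries.coeff_single_same] at h5
        exact h5
      refine lt_of_le_of_ne (hq'.le ?_) ?_
      · rw [map_sub]; exact hq.lge.sub hPm.1
      · rintro rfl
        refine hq'.2 ?_
        rw [map_sub, HahnSeries.coeff_sub, hPm.2, hl, sub_self]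
    have hmm : m' < m := by
      by_contra! hle
      have : (m : ℚ) ≤ m' := by exact_mod_cast hle
      rw [hm, hm'] at hlt
      nlinarith
    obtain ⟨κ, hκ⟩ := ih m' hmm hJ' q' hq' hqβ' l' hm' hl'
    refine ⟨Polynomial.C l * Polynomial.X ^ m + κ, ?_⟩
    rwa [map_add, ← sub_sub]

end Discs

section Univariate

theorem rootMultiplicity_le_of_coeff_comp {h : ℂ[X]} {c : ℂ} {d : ℕ}
    (hd : (h.comp (Polynomial.X + Polynomial.C c)).coeff d ≠ 0) : h.rootMultiplicity c ≤ d := by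
  by_contra! hlt
  obtain ⟨u, hu⟩ := Polynomial.pow_rootMultiplicity_dvd h c
  rw [hu, Polynomial.mul_comp, Polynomial.pow_comp] at hd
  simp only [Polynomial.sub_comp, Polynomial.X_comp, Polynomial.C_comp, add_sub_cancel_right] at hd
  exact hd (Polynomial.X_pow_dvd_iff.1 (Dvd.intro _ rfl) d hlt)

theorem eq_C_mul_pow_of_rootMultiplicity_le {f h h' : ℂ[X]} {k : ℂ} {d d' : ℕ} (hk : k ≠ 0)
    (hf : ∀ c, f.eval c = 0 → (Polynomial.derivative f).eval c ≠ 0)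
    (hh : h * h' = Polynomial.C k * f ^ (d + d'))
    (hd : ∀ c, f.eval c = 0 → h.rootMultiplicity c ≤ d)
    (hd' : ∀ c, f.eval c = 0 → h'.rootMultiplicity c ≤ d') :
    ∃ l, h = Polynomial.C l * f ^ d := by
  classical
  have hf0 : f ≠ 0 := by rintro rfl; exact hf 0 (by simp) (by simp)
  have hne : h * h' ≠ 0 := by
    rw [hh]; exact mul_ne_zero (Polynomial.C_ne_zero.2 hk) (pow_ne_zero _ hf0)
  have hroots : h.roots = (f ^ d).roots := by
    refine Multiset.ext.2 fun c => ?_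
    have h1 := congrArg (Multiset.count c) (congrArg Polynomial.roots hh)
    rw [Polynomial.roots_mul hne, Polynomial.roots_C_mul _ hk, Polynomial.roots_pow,
      Multiset.count_add, Multiset.count_nsmul, Polynomial.count_roots, Polynomial.count_roots,
      Polynomial.count_roots] at h1
    rw [Polynomial.roots_pow, Multiset.count_nsmul, Polynomial.count_roots, Polynomial.count_roots]
    by_cases hc : f.eval c = 0
    · have h2 : f.rootMultiplicity c = 1 := by
        refine le_antisymm ?_ ((Polynomial.rootMultiplicity_pos hf0).2 hc)
        by_contra! h3
        exact hf c hc ((Polynomial.one_lt_rootMultiplicity_iff_isRoot hf0).1 h3).2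
      rw [h2] at h1 ⊢
      have := hd c hc
      have := hd' c hc
      omega
    · rw [Polynomial.rootMultiplicity_eq_zero hc] at h1 ⊢
      omega
  refine ⟨h.leadingCoeff * ((f ^ d).leadingCoeff)⁻¹, ?_⟩
  have h1 := (IsAlgClosed.splits h).eq_prod_roots
  have h2 := (IsAlgClosed.splits (f ^ d)).eq_prod_roots
  have h3 : (f ^ d).leadingCoeff ≠ 0 := Polynomial.leadingCoeff_ne_zero.2 (pow_ne_zero _ hf0)
  have h4 : Polynomial.C h.leadingCoeff = Polynomial.C (h.leadingCoeff * ((f ^ d).leadingCoeff)⁻¹) *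
      Polynomial.C (f ^ d).leadingCoeff := by
    rw [← Polynomial.C_mul, inv_mul_cancel_right₀ h3]
  rw [hroots, h4, mul_assoc, ← h2] at h1
  exact h1

end Univariate

section TwoPoints

variable {P Q : ℂ[X][X]} {c₀ : ℂ} {y z : Hahn ℂ[X]} {β β' r s : ℚ} {g g' : ℂ} {b b' θ : ℂ[X][X]}

/-- The branches through a disc: every simple root of the leading form gives a branch. -/
theorem Lift.exists_lift_of_root (hy : Lift P Q y β g) (hK : Keller P Q c₀)
    (hP : Ord s (ev (disc (spec (0 : ℂ) y) r) P)) {κ : ℂ[X]}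
    (hQ : Ord (-β) (ev (disc (spec (0 : ℂ) y) r) (Q - Polynomial.aeval P κ))) {c : ℂ}
    (hc : ((ev (disc (spec (0 : ℂ) y) r) P).coeff s).eval c = 0)
    (hc' : (Polynomial.derivative ((ev (disc (spec (0 : ℂ) y) r) P).coeff s)).eval c ≠ 0)
    (hg : ((ev (disc (spec (0 : ℂ) y) r) (Q - Polynomial.aeval P κ)).coeff (-β)).eval c ≠ 0) :
    ∃ (z : Hahn ℂ[X]) (g' : ℂ), Lift P Q z β g' ∧
      ∀ (b : ℂ[X][X]) (p : ℚ), Ord p (ev (disc (spec (0 : ℂ) y) r) b) →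
      Ord p (ev (disc (spec (0 : ℂ) z) r) b) ∧
      (ev (disc (spec (0 : ℂ) z) r) b).coeff p =
        ((ev (disc (spec (0 : ℂ) y) r) b).coeff p).comp (Polynomial.X + Polynomial.C c) := by
  obtain ⟨h, hh, rfl, hroot⟩ := exists_root_of_simple hP.lge hc hc'
  set η := spec (0 : ℂ) y + HahnSeries.single (-r) 1 * h with hη
  have hroot' : ev η P = HahnSeries.C 0 := by rw [hroot, map_zero]
  have h1 := disc_subst hQ.lge hh
  rw [← hη] at h1
  have h2 : Ord (-β) (ev η (Q - Polynomial.aeval P κ)) := ⟨h1.1, by rw [h1.2]; exact hg⟩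
  have hneg : -β < 0 := neg_lt_zero.2 hy.pos
  have h3 : Ord (-β) (ev η Q) := by
    have := h2.add_of_lt (lge_C (Polynomial.aeval (0 : ℂ) κ)) hneg
    rwa [map_sub, KellerRational.ev_aeval hroot', sub_add_cancel] at this
  obtain ⟨z, β', g', hz, hzη⟩ := hK.exists_lift hroot' fun h0 => absurd (h3.le h0) (not_le.2 hneg)
  have h4 := hz.ord_spec_Q (0 : ℂ)
  rw [hzη] at h4
  obtain rfl : β' = β := neg_injective (h4.unique h3)
  refine ⟨z, g', hz, fun b p hb => ?_⟩
  obtain ⟨h5, h6⟩ := ev_disc_shift hb.lge hh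
  rw [hzη]
  refine ⟨⟨h5, ?_⟩, h6⟩
  rw [h6]
  intro h7
  rw [Polynomial.comp_eq_zero_iff] at h7
  rcases h7 with h7 | ⟨-, h7⟩
  · exact hb.2 h7
  · have := congrArg (Polynomial.coeff · 1) h7
    simp at this

theorem lge_disc_jac {η : Hahn ℂ} {p q : ℚ} (hb : Lge p (ev (disc η r) b))
    (hb' : Lge q (ev (disc η r) b')) : Lge (p + q + 1 + r) (ev (disc η r) (jac b b')) := by
  intro t ht
  have h1 := disc_jac (hb.mono (by linarith : t - q - 1 - r ≤ p)) hb'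
  rw [hb _ (by linarith : t - q - 1 - r < p)] at h1
  simpa [show t - q - 1 - r + q + 1 + r = t by ring] using h1

theorem natDegree_lead_sigma_iter (j : ℕ) (p : ℚ) :
    ((ev (sigma^[j] y) b).coeff p).natDegree = ((ev y b).coeff p).natDegree := by
  rw [ev_sigma_iter, sigma_iter_coeff, Polynomial.smul_eq_C_mul,
    Polynomial.natDegree_C_mul (chi_ne_zero _)]

/-- A vertical separating function has a power of the leading form of `P` as its leading form, if
all the branches through the disc are conjugate. -/
theorem Lift.lead_vertical (hy : Lift P Q y β g) (hK : Keller P Q c₀) {p : ℚ}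
    (hP : Ord (β - 1 - r) (ev (disc (spec (0 : ℂ) y) r) P)) (hs : β - 1 - r < 0)
    (hv : Vertical P θ) (hp : Ord p (ev y θ))
    (hf : ∀ c, ((ev (disc (spec (0 : ℂ) y) r) P).coeff (β - 1 - r)).eval c = 0 →
      (Polynomial.derivative ((ev (disc (spec (0 : ℂ) y) r) P).coeff (β - 1 - r))).eval c ≠ 0)
    (hconj : ∀ c, ((ev (disc (spec (0 : ℂ) y) r) P).coeff (β - 1 - r)).eval c = 0 →
      ∃ (j : ℕ) (g' : ℂ), Lift P Q (KellerRational.sigma^[j] y) β g' ∧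
        ∀ (b : ℂ[X][X]) (p : ℚ), Ord p (ev (disc (spec (0 : ℂ) y) r) b) →
        Ord p (ev (disc (spec (0 : ℂ) (KellerRational.sigma^[j] y)) r) b) ∧
        (ev (disc (spec (0 : ℂ) (KellerRational.sigma^[j] y)) r) b).coeff p =
          ((ev (disc (spec (0 : ℂ) y) r) b).coeff p).comp (Polynomial.X + Polynomial.C c)) :
    ∃ (d : ℕ) (l : ℂ), Ord (p + d * (β - 1 - r)) (ev (disc (spec (0 : ℂ) y) r) θ) ∧
      (ev (disc (spec (0 : ℂ) y) r) θ).coeff (p + d * (β - 1 - r)) =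
        Polynomial.C l * ((ev (disc (spec (0 : ℂ) y) r) P).coeff (β - 1 - r)) ^ d := by
  obtain ⟨κ, hκ, b', hb'⟩ := hv
  have h0 : Ord 0 (ev y θ * ev y b') := by
    rw [← map_mul, ← hb', hy.ev_aeval_level]; exact ord_C hκ
  obtain ⟨q, hq⟩ := exists_ord (right_ne_zero_of_mul h0.ne_zero)
  obtain ⟨h1, -, h3⟩ := hy.ord_vertical hK hP hs hκ hb'.symm hp hq
  obtain ⟨h1', -, -⟩ := hy.ord_vertical hK hP hs hκ ((mul_comm _ _).trans hb'.symm) hq hp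
  have key {θ b' : ℂ[X][X]} {p q : ℚ} (hb' : θ * b' = Polynomial.aeval P κ)
      (hp : Ord p (ev y θ)) (hq : Ord q (ev y b')) (c : ℂ)
      (hc : ((ev (disc (spec (0 : ℂ) y) r) P).coeff (β - 1 - r)).eval c = 0) :
      ((ev (disc (spec (0 : ℂ) y) r) θ).coeff
        (p + ((ev y θ).coeff p).natDegree * (β - 1 - r))).rootMultiplicity c ≤
        ((ev y θ).coeff p).natDegree := by
    obtain ⟨h1, -, -⟩ := hy.ord_vertical hK hP hs hκ hb' hp hq
    obtain ⟨j, g', hz, hzb⟩ := hconj c hc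
    obtain ⟨-, h2, -⟩ := hz.ord_vertical hK (hzb P _ hP).1 hs hκ hb'
      (p := p) (q := q) (by rwa [ev_sigma_iter, ord_sigma_iter_iff])
      (by rwa [ev_sigma_iter, ord_sigma_iter_iff])
    rw [natDegree_lead_sigma_iter, (hzb θ _ h1).2] at h2
    exact rootMultiplicity_le_of_coeff_comp h2
  set d := ((ev y θ).coeff p).natDegree
  set d' := ((ev y b').coeff q).natDegree
  obtain ⟨h4, h5⟩ := ord_ev_aeval hP hs hκ
  have h6 := h1.lge.coeff_mul h1'.lge
  have h7 := h1.mul h1'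
  rw [← map_mul, ← hb'] at h6 h7
  rw [h7.unique h4, h5, ← h3] at h6
  obtain ⟨l, hl⟩ := eq_C_mul_pow_of_rootMultiplicity_le (Polynomial.leadingCoeff_ne_zero.2 hκ) hf
    h6.symm (key hb'.symm hp hq) (key ((mul_comm _ _).trans hb'.symm) hq hp)
  exact ⟨d, l, h1, hl⟩

theorem Keller.not_nconj (hK : Keller P Q c₀) (hPl : PlanarFibers P) (hy : Lift P Q y β g)
    (hz : Lift P Q z β' g') (hn : NConj y z) : False := by
  classical
  have h2 : 2 ≤ P.natDegree := by
    rw [← hK.card_rts (0 : ℂ), ← Nat.succ_le_iff.symm.trans Iff.rfl]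
    refine Finset.one_lt_card.2 ⟨_, hK.mem_rts.2 (hy.spec_root 0), _,
      hK.mem_rts.2 (hz.spec_root 0), fun h => hn 0 (hy.spec_injective hK hz h).symm⟩
  obtain ⟨r, hs, hP, hk, hf0, hf1⟩ := hy.exists_disc hK h2
  obtain ⟨κ, hQ⟩ := exists_reduced hP hs hf0 hf1 hK.ne_zero hK.jac_eq
  have hode := disc_jac hP.lge hQ.lge
  rw [jac_sub_aeval, hK.jac_eq, ev_C_C, show β - 1 - r + -β + 1 + r = 0 by ring,
    HahnSeries.C_apply, HahnSeries.coeff_single_same] at hode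
  obtain ⟨s, hsdef⟩ : ∃ s, s = β - 1 - r := ⟨_, rfl⟩
  rw [← hsdef] at hs hP hk hf0 hf1 hode
  obtain ⟨f, hf⟩ : ∃ f, f = (ev (disc (spec (0 : ℂ) y) r) P).coeff s := ⟨_, rfl⟩
  obtain ⟨w, hw⟩ : ∃ w, w = (ev (disc (spec (0 : ℂ) y) r) (Q - Polynomial.aeval P κ)).coeff (-β) :=
    ⟨_, rfl⟩
  have hlift := fun c => hy.exists_lift_of_root hK hP hQ (c := c)
  rw [← hf] at hk hf0 hf1 hode
  simp only [← hf, ← hw] at hlift hode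
  have hsimple (c : ℂ) (hc : f.eval c = 0) :
      (Polynomial.derivative f).eval c ≠ 0 ∧ w.eval c ≠ 0 := by
    have h3 := congrArg (Polynomial.eval c) hode
    rw [Polynomial.eval_sub, Polynomial.eval_smul, Polynomial.eval_smul, Polynomial.eval_mul,
      Polynomial.eval_mul, hc, zero_mul, smul_zero, sub_zero] at h3
    have h4 : c₀ ≠ 0 := hK.ne_zero
    constructor <;> intro h5 <;> rw [h5] at h3 <;> simp at h3 <;> exact h4 h3
  have hnum {j : ℕ} (hj : 0 < j) : β ≠ -s * j := by
    intro h3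
    refine ne_zero_of_ode (a := ((-β : ℚ) : ℂ)) (b := -(s : ℂ)) hk hK.ne_zero
      (neg_ne_zero.2 (by exact_mod_cast hs.ne)) (g := w) ?_ hj ?_
    · rw [Polynomial.smul_eq_C_mul, Polynomial.smul_eq_C_mul] at hode
      rw [Polynomial.C_neg, neg_mul, ← sub_eq_add_neg]
      exact hode.symm
    · rw [h3]; push_cast; ring
  have hM := hy.ram_pos hK
  by_cases hcase : ∃ (c : ℂ) (z : Hahn ℂ[X]) (g' : ℂ), f.eval c = 0 ∧ NConj y z ∧ Lift P Q z β g' ∧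
      ∀ (b : ℂ[X][X]) (p : ℚ), Ord p (ev (disc (spec (0 : ℂ) y) r) b) →
        Ord p (ev (disc (spec (0 : ℂ) z) r) b)
  · obtain ⟨c, z, g', hc, hyz, hz, hzb⟩ := hcase
    obtain ⟨x, β₂, g₂, hx, hyx, hzx⟩ := hK.exists_third hPl hy hz hyz
    obtain ⟨a, q, ha⟩ := hK.exists_pole hPl hy
    obtain ⟨a', q', ha'⟩ := hK.exists_pole hPl hx
    obtain ⟨κ', hv, -, h3⟩ := ha.exists_sep ha' hK hy hx hyx
    have h4 := (ha.sub_aeval hK hy κ').ord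
    have h5 := h3 z β g' hz hyz (hzx.symm (by exact_mod_cast hx.ram_pos hK))
    obtain ⟨γ, hγ, b', hb'⟩ := hv
    have hord {z : Hahn ℂ[X]} {g'} (hz : Lift P Q z β g') : ∃ q, Ord q (ev z b') := by
      refine exists_ord (right_ne_zero_of_mul (a := ev z (a - Polynomial.aeval P κ')) ?_)
      rw [← map_mul, ← hb', hz.ev_aeval_level]; exact (ord_C hγ).ne_zero
    obtain ⟨q₁, hq₁⟩ := hord hy
    obtain ⟨q₂, hq₂⟩ := hord hz
    rw [hsdef] at hP hs
    have h6 := (hy.ord_vertical hK hP hs hγ hb'.symm h4 hq₁).1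
    have h7 := (hz.ord_vertical hK (hzb _ _ hP) hs hγ hb'.symm h5 hq₂).1
    have h8 := (hzb _ _ h6).unique h7
    rw [← hsdef, zero_add] at h8
    rw [← hsdef] at hs
    set d₁ := ((ev y (a - Polynomial.aeval P κ')).coeff (-(1 / (ram y : ℚ)))).natDegree
    set d₂ := ((ev z (a - Polynomial.aeval P κ')).coeff 0).natDegree
    have hn : (ev y Q).coeff (-β) ≠ 0 := by
      rw [hy.coeff_Q]; exact Polynomial.C_ne_zero.2 hy.ne_zero
    obtain ⟨n, hn⟩ := exists_int_of_coeff_ne_zero Q hn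
    have h9 : 1 / (ram y : ℚ) = ((d₁ : ℤ) - d₂ : ℤ) * s := by push_cast; linarith
    have h10 : β = -s * ((n * ((d₁ : ℤ) - d₂) : ℤ) : ℚ) := by
      rw [Int.cast_mul, ← hn]
      have : (ram y : ℚ) * (1 / ram y) = 1 := mul_one_div_cancel hM.ne'
      rw [h9] at this
      linear_combination -β * this
    obtain ⟨j, hj⟩ : ∃ j : ℕ, (j : ℤ) = n * ((d₁ : ℤ) - d₂) := by
      refine Int.eq_ofNat_of_zero_le ?_ |>.imp fun _ h => h.symm
      by_contra! hlt
      have : ((n * ((d₁ : ℤ) - d₂) : ℤ) : ℚ) < 0 := by exact_mod_cast hlt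
      have := hy.pos
      nlinarith
    rw [← hj] at h10
    refine hnum (j := j) (Nat.pos_of_ne_zero ?_) (by exact_mod_cast h10)
    rintro rfl
    have := hy.pos
    simp at h10
    linarith
  · push Not at hcase
    obtain ⟨a, q, ha⟩ := hK.exists_pole hPl hy
    obtain ⟨a', q', ha'⟩ := hK.exists_pole hPl hz
    obtain ⟨κ', hv, -, -⟩ := ha.exists_sep ha' hK hy hz hn
    have hpole := ha.sub_aeval hK hy κ'
    set θ := a - Polynomial.aeval P κ'
    obtain ⟨γ, hγ, b', hb'⟩ := hpole.vertical_jac hK hPl hy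
    have hlead := hy.lead_vertical (r := r) hK (hsdef ▸ hP) (hsdef ▸ hs) hv hpole.ord
      (by rw [← hsdef, ← hf]; exact fun c hc => (hsimple c hc).1) (by
        rw [← hsdef, ← hf]
        intro c hc
        obtain ⟨z, g', hz, hzb⟩ := hlift c hc (hsimple c hc).1 (hsimple c hc).2
        by_contra! hcon
        obtain ⟨b, p, h3, h4⟩ := hcase c z g' hc (fun j hj => by
          obtain ⟨b, p, h3, h4⟩ := hcon j g' (hj ▸ hz)
          rw [← hj] at h4
          exact h4 (hzb b p h3).1 (hzb b p h3).2) hz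
        exact h4 (hzb b p h3).1)
    rw [← hsdef, ← hf] at hlead
    obtain ⟨d, l, h3, h4⟩ := hlead
    have h5 := disc_jac hP.lge h3.lge
    have hl : l ≠ 0 := by
      rintro rfl
      refine h3.2 ?_
      rw [h4, map_zero, zero_mul]
    rw [← hf, h4] at h5
    have h6 : ((-(1 / ram y) + d * s : ℚ) : ℂ) •
        (Polynomial.derivative f * (Polynomial.C l * f ^ d)) -
        (s : ℂ) • (f * Polynomial.derivative (Polynomial.C l * f ^ d)) =
        Polynomial.C (-(1 / (ram y : ℂ)) * l) * (Polynomial.derivative f * f ^ d) := by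
      rw [Polynomial.derivative_C_mul, Polynomial.derivative_pow, Polynomial.smul_eq_C_mul,
        Polynomial.smul_eq_C_mul]
      rcases d with _ | d
      · simp; ring
      · push_cast [Polynomial.C_add, Polynomial.C_mul, Polynomial.C_neg]
        ring
    rw [h6] at h5
    have hM' : (ram y : ℂ) ≠ 0 := by exact_mod_cast hM.ne'
    have hf' : Polynomial.derivative f ≠ 0 := fun h => by
      have := congrArg (Polynomial.coeff · 0) h
      simp [Polynomial.coeff_derivative] at this
      exact hf1 this
    have hfne : f ≠ 0 := fun h => hf' (by rw [h, Polynomial.derivative_zero])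
    have h7 : Ord (s + (-(1 / ram y) + d * s) + 1 + r)
        (ev (disc (spec (0 : ℂ) y) r) (jac P θ)) := by
      have h7' : Polynomial.C (-(1 / (ram y : ℂ)) * l) * (Polynomial.derivative f * f ^ d) ≠ 0 :=
        mul_ne_zero (Polynomial.C_ne_zero.2 (mul_ne_zero (neg_ne_zero.2 (one_div_ne_zero hM')) hl))
          (mul_ne_zero hf' (pow_ne_zero _ hfne))
      exact ⟨lge_disc_jac hP.lge h3.lge, by rw [h5]; exact h7'⟩
    obtain ⟨h8, h9⟩ := ord_ev_aeval hP hs hγ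
    rw [hb', map_mul] at h8 h9
    obtain ⟨o, ho⟩ := exists_ord (right_ne_zero_of_mul h8.ne_zero)
    have h10 := h7.lge.coeff_mul ho.lge
    rw [(h7.mul ho).unique h8, h9, h5, ← hf] at h10
    obtain ⟨e, he⟩ := (IsAlgClosed.splits (Polynomial.derivative f)).exists_eval_eq_zero (by
      rw [Polynomial.degree_derivative (by omega)]
      exact_mod_cast (by omega : f.natDegree - 1 ≠ 0))
    have h11 := congrArg (Polynomial.eval e) h10
    simp only [Polynomial.eval_mul, he, zero_mul, mul_zero, Polynomial.eval_pow] at h11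
    rcases mul_eq_zero.1 h11 with h12 | h12
    · rw [show (algebraMap ℂ ℂ[X]) γ.leadingCoeff = Polynomial.C γ.leadingCoeff from rfl,
        Polynomial.eval_C] at h12
      exact hγ (Polynomial.leadingCoeff_eq_zero.1 h12)
    · exact (hsimple e (eq_zero_of_pow_eq_zero h12)).1 he

end TwoPoints

theorem lge_zero_of_monic {K : Type*} [Field K] {p : (Hahn K)[X]} (hp : p.Monic)
    (h : ∀ i, Lge 0 (p.coeff i)) {z : Hahn K} (hz : p.eval z = 0) : Lge 0 z := by
  refine lge_of_forall_ord fun q hq => ?_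
  by_contra! hneg
  rw [Polynomial.eval_eq_sum_range, Finset.sum_range_succ, hp.coeff_natDegree, one_mul,
    add_comm] at hz
  refine ((hq.pow p.natDegree).add_of_lt (q := (p.natDegree - 1) * q)
    (Lge.sum fun i hi => ?_) (by linarith)).ne_zero hz
  refine ((h i).mul (hq.lge.pow i)).mono ?_
  have : (i : ℚ) ≤ p.natDegree - 1 := by
    have := Finset.mem_range.1 hi
    rw [le_sub_iff_add_le]; exact_mod_cast this
  nlinarith

section Elimination

/-- Eliminating the outer variable from two polynomials without common factor. -/
theorem exists_eliminant {π g : ℂ[X][X]} (hπ : Irreducible π) (hg : ¬ π ∣ g) :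
    ∃ e : ℂ[X], e ≠ 0 ∧ ∃ a b, Polynomial.C e = a * π + b * g := by
  by_cases hd : π.natDegree = 0
  · obtain ⟨e, rfl⟩ : ∃ e, π = Polynomial.C e := ⟨_, Polynomial.eq_C_of_natDegree_eq_zero hd⟩
    exact ⟨e, fun h => hπ.ne_zero (by rw [h, map_zero]), 1, 0, by ring⟩
  have hprim := hπ.isPrimitive hd
  have hcop : IsCoprime (π.map (algebraMap ℂ[X] (RatFunc ℂ))) (g.map (algebraMap ℂ[X] (RatFunc ℂ))) :=
    ((hprim.irreducible_iff_irreducible_map_fraction_map).1 hπ).coprime_iff_not_dvd.2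
      fun h => hg (hprim.dvd_of_fraction_map_dvd_fraction_map h)
  obtain ⟨a, b, -, -, h⟩ :=
    Polynomial.exists_mul_add_mul_eq_C_resultant π g le_rfl le_rfl (Or.inl hd)
  refine ⟨_, fun h0 => ?_, a, b, by rw [← h]; ring⟩
  have hinj := IsFractionRing.injective ℂ[X] (RatFunc ℂ)
  have h1 := congrArg (algebraMap ℂ[X] (RatFunc ℂ)) h0
  rw [← Polynomial.resultant_map_map, map_zero, ← Polynomial.natDegree_map_eq_of_injective hinj π,
    ← Polynomial.natDegree_map_eq_of_injective hinj g] at h1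
  exact (Polynomial.resultant_eq_zero_iff.1 h1).2 hcop

/-- Eliminating the inner variable from two polynomials without common factor. -/
theorem exists_eliminant_swap {π g : ℂ[X][X]} (hπ : Irreducible π) (hg : ¬ π ∣ g) :
    ∃ e : ℂ[X], e ≠ 0 ∧ ∃ a b, Polynomial.aeval (Polynomial.X : ℂ[X][X]) e = a * π + b * g := by
  let s := (Polynomial.Bivariate.swap (R := ℂ))
  obtain ⟨e, he, a, b, h⟩ := exists_eliminant (π := s π) (g := s g)
    ((MulEquiv.irreducible_iff s).2 hπ) fun h => hg ((map_dvd_iff s).1 h)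
  refine ⟨e, he, s a, s b, ?_⟩
  have h1 := congrArg s h
  rw [map_add, map_mul, map_mul, Polynomial.Bivariate.swap_swap_apply,
    Polynomial.Bivariate.swap_swap_apply] at h1
  rw [← h1, Polynomial.Bivariate.swap_C]
  rfl

end Elimination

section Endgame

variable {P Q : ℂ[X][X]} {c₀ : ℂ}

theorem Keller.pev_injective (hK : Keller P Q c₀) : Function.Injective (pev P Q) := by
  rw [injective_iff_map_eq_zero]
  intro G
  induction hn : G.natDegree generalizing G with
  | zero =>
    obtain ⟨κ, rfl⟩ : ∃ κ, G = Polynomial.C κ := ⟨_, Polynomial.eq_C_of_natDegree_eq_zero hn⟩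
    intro h
    rw [pev_C] at h
    obtain ⟨y, β, g, hy⟩ := hK.exists_mem_lifts
    have h1 := hy.ev_aeval_level κ
    rw [h, map_zero] at h1
    rw [HahnSeries.C_injective (h1.symm.trans (map_zero HahnSeries.C).symm), map_zero]
  | succ n ih =>
    intro h
    have h1 := jac_pev P Q G
    rw [h, hK.jac_eq, show jac P 0 = 0 by simp [jac], eq_comm, mul_eq_zero] at h1
    have h2 := h1.resolve_right
      (Polynomial.C_ne_zero.2 (Polynomial.C_ne_zero.2 hK.ne_zero))
    have h3 := ih _ (by rw [Polynomial.natDegree_derivative, hn]; rfl) h2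
    have := Polynomial.derivative_eq_zero.1 h3
    omega

/-- Evaluation at `(P, Q)`, as an algebra homomorphism. -/
noncomputable def pevAlg (P Q : ℂ[X][X]) : ℂ[X][X] →ₐ[ℂ] ℂ[X][X] :=
  { pev P Q with
    commutes' := fun c => by
      change pev P Q (Polynomial.C (Polynomial.C c)) = _
      rw [pev_C, Polynomial.aeval_C] }

theorem Keller.isAlgebraic (hK : Keller P Q c₀) :
    Algebra.IsAlgebraic (pevAlg P Q).range ℂ[X][X] := by
  rw [← trdeg_eq_zero_iff]
  have e := AlgEquiv.ofInjective (pevAlg P Q) hK.pev_injective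
  have h := trdeg_add_eq ℂ (pevAlg P Q).range (A := ℂ[X][X])
  rw [← e.trdeg_eq] at h
  have hfin : Algebra.trdeg ℂ ℂ[X][X] < Cardinal.aleph0 := trdeg_lt_aleph0_of_finiteType
  exact Cardinal.eq_of_add_eq_add_left (h.trans (add_zero _).symm) hfin

/-- Functions integral over `ℂ[P, Q]` are polynomials in `P` and `Q`. -/
theorem Keller.exists_pev_of_isIntegral (hK : Keller P Q c₀) (hP : PlanarFibers P) {b : ℂ[X][X]}
    (hb : IsIntegral (pevAlg P Q).range b) : ∃ G, b = pev P Q G := by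
  obtain ⟨y, β, g, hy⟩ := hK.exists_mem_lifts
  have hone : ∀ z ∈ lifts P Q, ¬ NConj y z := fun z ⟨β', g', hz⟩ hn => hK.not_nconj hP hy hz hn
  have hQ : RegAway P y Q := fun η hη ha => by
    by_contra hQ
    obtain ⟨z, β', g', hz, rfl⟩ := hK.exists_lift (hK.mem_rts.1 hη) hQ
    refine hone z ⟨β', g', hz⟩ fun j hj => ha j ?_
    rw [spec_tt, hj]
  have hpev (G : ℂ[X][X]) : RegAway P y (pev P Q G) := by
    induction G using Polynomial.induction_on' with
    | add a b ha hb => rw [map_add]; exact ha.add hb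
    | monomial n a =>
      rw [← Polynomial.C_mul_X_pow_eq_monomial, map_mul, pev_C, map_pow, pev_X]
      exact (hK.regAway_aeval y a).mul (hQ.pow n)
  refine hK.exists_pev_of_regAway hP hy hone fun η hη ha => ?_
  obtain ⟨p, hp, h0⟩ := hb
  refine lge_zero_of_monic (p := p.map ((ev η).comp (algebraMap (pevAlg P Q).range ℂ[X][X])))
    (hp.map _) (fun i => ?_) ?_
  · rw [Polynomial.coeff_map]
    obtain ⟨G, hG⟩ := (p.coeff i).2
    change Lge 0 (ev η (p.coeff i : ℂ[X][X]))
    rw [← hG]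
    exact hpev G η hη ha
  · rw [Polynomial.eval_map, ← Polynomial.hom_eval₂, h0, map_zero]

theorem Keller.exists_pev_mul (hK : Keller P Q c₀) (hP : PlanarFibers P) (b : ℂ[X][X]) :
    ∃ D ≠ 0, ∃ N, pev P Q D * b = pev P Q N := by
  have := hK.isAlgebraic
  obtain ⟨⟨_, D, rfl⟩, hD, h⟩ :=
    (Algebra.IsAlgebraic.isAlgebraic (R := (pevAlg P Q).range) b).exists_integral_multiple
  refine ⟨D, ?_, hK.exists_pev_of_isIntegral hP h⟩
  rintro rfl
  exact hD (Subtype.ext (map_zero (pevAlg P Q)))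

theorem Keller.dvd_of_pev_dvd (hK : Keller P Q c₀) {π g : ℂ[X][X]} (hπ : Irreducible π)
    (h : pev P Q π ∣ pev P Q g) : π ∣ g := by
  by_contra hg
  have hnu : ¬ IsUnit (pev P Q π) := by
    intro hu
    obtain ⟨a, ha, h1⟩ := isUnit_iff_C_C.1 hu
    have h2 : π = Polynomial.C (Polynomial.C a) := hK.pev_injective (by
      rw [← h1, pev_C, Polynomial.aeval_C]; rfl)
    exact hπ.not_isUnit (isUnit_iff_C_C.2 ⟨a, ha, h2.symm⟩)
  obtain ⟨Γ, hΓ, hd⟩ := WfDvdMonoid.exists_irreducible_factor hnu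
    (fun h0 => hπ.ne_zero (hK.pev_injective (h0.trans (map_zero _).symm)))
  have hdvd (a b : ℂ[X][X]) : Γ ∣ pev P Q (a * π + b * g) := by
    rw [map_add, map_mul, map_mul]
    exact dvd_add (hd.mul_left _) ((hd.trans h).mul_left _)
  obtain ⟨e, he, a, b, h1⟩ := exists_eliminant hπ hg
  obtain ⟨e', he', a', b', h2⟩ := exists_eliminant_swap hπ hg
  obtain ⟨c, A, hA⟩ := exists_dvd_level (P := P) hΓ.prime ⟨e, he, by
    rw [← pev_C P Q, h1]; exact hdvd a b⟩
  obtain ⟨c', B, hB⟩ := exists_dvd_level (P := Q) hΓ.prime ⟨e', he', by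
    have := hdvd a' b'
    rw [← h2] at this
    have h3 : pev P Q (Polynomial.aeval (Polynomial.X : ℂ[X][X]) e') = Polynomial.aeval Q e' := by
      change pevAlg P Q _ = _
      rw [← Polynomial.aeval_algHom_apply]
      exact congrArg (fun q => Polynomial.aeval q e') (pev_X P Q)
    rwa [h3] at this⟩
  have hJ : jac (P - Polynomial.C (Polynomial.C c)) (Q - Polynomial.C (Polynomial.C c')) =
      Polynomial.C (Polynomial.C c₀) := by
    rw [jac_sub, jac_C_C, sub_zero, jac_swap, jac_sub, jac_C_C, sub_zero, ← jac_swap, hK.jac_eq]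
  rw [hA, hB, jac_mul, jac_swap (Γ * A) Γ, jac_mul, jac_self] at hJ
  refine hΓ.not_isUnit (isUnit_of_dvd_unit (Dvd.intro (jac (Γ * A) B - B * jac Γ A) ?_)
    (isUnit_iff_C_C.2 ⟨c₀, hK.ne_zero, rfl⟩))
  rw [← hJ]; ring

theorem Keller.exists_pev_of_mul (hK : Keller P Q c₀) {D : ℂ[X][X]} (hD : D ≠ 0) {b N : ℂ[X][X]}
    (h : pev P Q D * b = pev P Q N) : ∃ G, b = pev P Q G := by
  have hinj := hK.pev_injective
  induction D using UniqueFactorizationMonoid.induction_on_prime generalizing N with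
  | h₁ => exact absurd rfl hD
  | h₂ D hu =>
    obtain ⟨D', hD'⟩ := hu.exists_left_inv
    refine ⟨D' * N, ?_⟩
    rw [map_mul, ← h, ← mul_assoc, ← map_mul, hD', map_one, one_mul]
  | h₃ D p hD0 hp ih =>
    obtain ⟨N', rfl⟩ := hK.dvd_of_pev_dvd hp.irreducible (g := N)
      ⟨pev P Q D * b, by rw [← h, map_mul, mul_assoc]⟩
    refine ih hD0 (N := N') (mul_left_cancel₀ (a := pev P Q p) ?_ ?_)
    · rw [Ne, map_eq_zero_iff _ hinj]; exact hp.ne_zero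
    · rw [← mul_assoc, ← map_mul, h, map_mul]

theorem pev_pev (P Q A B G : ℂ[X][X]) : pev P Q (pev A B G) = pev (pev P Q A) (pev P Q B) G := by
  have h (c : ℂ) (A B : ℂ[X][X]) : pev A B (Polynomial.C (Polynomial.C c)) =
      Polynomial.C (Polynomial.C c) := (pevAlg A B).commutes c
  have : (pev P Q).comp (pev A B) = pev (pev P Q A) (pev P Q B) :=
    ringHom_ext₂ (fun a => by simp only [RingHom.comp_apply, h])
      (by simp only [RingHom.comp_apply, pev_C, Polynomial.aeval_X])
      (by simp only [RingHom.comp_apply, pev_X])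
  exact RingHom.congr_fun this G

theorem pev_self (G : ℂ[X][X]) : pev (Polynomial.C Polynomial.X) Polynomial.X G = G := by
  have : pev (Polynomial.C Polynomial.X) Polynomial.X = RingHom.id ℂ[X][X] :=
    ringHom_ext₂ (fun a => (pevAlg _ _).commutes a)
      (by rw [pev_C, Polynomial.aeval_X]; rfl) (by rw [pev_X]; rfl)
  rw [this]; rfl

theorem Keller.exists_inverse (hK : Keller P Q c₀) (hP : PlanarFibers P) :
    ∃ A B, (pev P Q A = Polynomial.C Polynomial.X ∧ pev P Q B = Polynomial.X) ∧
      pev A B P = Polynomial.C Polynomial.X ∧ pev A B Q = Polynomial.X := by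
  have hsurj (b : ℂ[X][X]) : ∃ G, b = pev P Q G := by
    obtain ⟨D, hD, N, h⟩ := hK.exists_pev_mul hP b
    exact hK.exists_pev_of_mul hD h
  obtain ⟨A, hA⟩ := hsurj (Polynomial.C Polynomial.X)
  obtain ⟨B, hB⟩ := hsurj Polynomial.X
  refine ⟨A, B, ⟨hA.symm, hB.symm⟩, hK.pev_injective ?_, hK.pev_injective ?_⟩
  · rw [pev_pev, ← hA, ← hB, pev_self, pev_C, Polynomial.aeval_X]
  · rw [pev_pev, ← hA, ← hB, pev_self, pev_X]

end Endgame

section Substitution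

/-- Substitution of a pair of polynomials into a polynomial in two variables. -/
noncomputable def sub₂ (a b : ℂ[X][X]) : MvPolynomial (Fin 2) ℂ →ₐ[ℂ] ℂ[X][X] :=
  MvPolynomial.aeval ![a, b]

theorem derivation_sub₂ (D : Derivation ℂ ℂ[X][X] ℂ[X][X]) (a b : ℂ[X][X])
    (p : MvPolynomial (Fin 2) ℂ) :
    D (sub₂ a b p) = sub₂ a b (pderiv 0 p) * D a + sub₂ a b (pderiv 1 p) * D b := by
  induction p using MvPolynomial.induction_on with
  | C c =>
    rw [MvPolynomial.C_eq_algebraMap, AlgHom.commutes, Derivation.map_algebraMap]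
    simp
  | add p q hp hq => simp only [map_add, hp, hq]; ring
  | mul_X p i hp =>
    rw [map_mul, Derivation.leibniz, hp]
    simp only [Derivation.leibniz, map_add, smul_eq_mul, map_mul]
    fin_cases i <;> simp [sub₂, pderiv_X] <;> ring

theorem jac_sub₂ (a b : ℂ[X][X]) (p q : MvPolynomial (Fin 2) ℂ) :
    jac (sub₂ a b p) (sub₂ a b q) =
      sub₂ a b (pderiv 0 p * pderiv 1 q - pderiv 1 p * pderiv 0 q) * jac a b := by
  have hX := derivation_sub₂ (dX ℂ) a b
  have hY (p : MvPolynomial (Fin 2) ℂ) : dY ℂ (sub₂ a b p) =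
      sub₂ a b (pderiv 0 p) * dY ℂ a + sub₂ a b (pderiv 1 p) * dY ℂ b :=
    derivation_sub₂ ((dY ℂ).restrictScalars ℂ) a b p
  simp only [jac, hX, hY, map_sub, map_mul]
  ring

theorem at₂_sub₂ (a b : ℂ[X][X]) (p : MvPolynomial (Fin 2) ℂ) (z : ℂ × ℂ) :
    at₂ (sub₂ a b p) z = evalPoly p (at₂ a z, at₂ b z) := by
  induction p using MvPolynomial.induction_on with
  | C c => simp [sub₂, evalPoly, at₂_def]
  | add p q hp hq => rw [map_add, at₂_add, hp, hq]; simp [evalPoly]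
  | mul_X p i hp =>
    rw [map_mul, at₂_mul, hp]
    fin_cases i <;> simp [evalPoly, sub₂]

theorem pev_sub₂ (a b : ℂ[X][X]) (p : MvPolynomial (Fin 2) ℂ) :
    pev a b (sub₂ (Polynomial.C Polynomial.X) Polynomial.X p) = sub₂ a b p := by
  have : (pevAlg a b).comp (sub₂ (Polynomial.C Polynomial.X) Polynomial.X) = sub₂ a b := by
    refine MvPolynomial.algHom_ext fun i => ?_
    change pev a b _ = _
    fin_cases i
    · simp [sub₂, pev_C]
    · simp [sub₂, pev_X]
  exact DFunLike.congr_fun this p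

theorem at₂_pev (P Q G : ℂ[X][X]) (z : ℂ × ℂ) :
    at₂ (pev P Q G) z = at₂ G (at₂ P z, at₂ Q z) := by
  have : (Polynomial.evalEvalRingHom z.1 z.2).comp (pev P Q) =
      Polynomial.evalEvalRingHom (at₂ P z) (at₂ Q z) :=
    ringHom_ext₂ (fun a => by simp [pev_C]) (by simp [pev_C, at₂]) (by simp [pev_X, at₂])
  exact RingHom.congr_fun this G

theorem exists_evalPoly (u v : MvPolynomial (Fin 2) ℂ) (A : ℂ[X][X]) :
    ∃ A', ∀ z, evalPoly A' z = at₂ A (evalPoly u z, evalPoly v z) := by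
  refine ⟨Polynomial.eval₂RingHom (Polynomial.aeval u : ℂ[X] →ₐ[ℂ] _).toRingHom v A, fun z => ?_⟩
  have : (MvPolynomial.eval ![z.1, z.2]).comp
      (Polynomial.eval₂RingHom (Polynomial.aeval u : ℂ[X] →ₐ[ℂ] _).toRingHom v) =
      Polynomial.evalEvalRingHom (evalPoly u z) (evalPoly v z) :=
    ringHom_ext₂ (fun a => by simp) (by simp [evalPoly]) (by simp [evalPoly])
  exact RingHom.congr_fun this A

end Substitution

section Shear

theorem leadingCoeff_aeval_shear {N : ℕ} (hN : N ≠ 0) (p : ℂ[X]) :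
    (Polynomial.aeval (Polynomial.C Polynomial.X + Polynomial.X ^ N : ℂ[X][X]) p).leadingCoeff =
        Polynomial.C p.leadingCoeff ∧
      (Polynomial.aeval (Polynomial.C Polynomial.X + Polynomial.X ^ N : ℂ[X][X]) p).natDegree =
        p.natDegree * N := by
  have hq : (Polynomial.C Polynomial.X + Polynomial.X ^ N : ℂ[X][X]) =
      Polynomial.X ^ N + Polynomial.C Polynomial.X := add_comm _ _
  have hd := Polynomial.natDegree_X_pow_add_C (n := N) (r := (Polynomial.X : ℂ[X]))
  have hm := Polynomial.monic_X_pow_add_C (Polynomial.X : ℂ[X]) hN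
  have h : Polynomial.aeval (Polynomial.C Polynomial.X + Polynomial.X ^ N : ℂ[X][X]) p =
      (p.map Polynomial.C).comp (Polynomial.X ^ N + Polynomial.C Polynomial.X) := by
    rw [hq, Polynomial.comp, Polynomial.eval₂_map]; rfl
  rw [h, Polynomial.leadingCoeff_comp (by rwa [hd]), Polynomial.natDegree_comp, hd,
    hm.leadingCoeff, one_pow, mul_one,
    Polynomial.leadingCoeff_map_of_injective Polynomial.C_injective,
    Polynomial.natDegree_map_eq_of_injective Polynomial.C_injective]
  exact ⟨rfl, rfl⟩

/-- After a shear, every nonzero polynomial has constant leading coefficient. -/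
theorem exists_leadingCoeff_shear {N : ℕ} {b : ℂ[X][X]} (hb : b ≠ 0) (hN : b.natDegree < N) :
    ∃ c : ℂ, c ≠ 0 ∧
      (pev (Polynomial.C Polynomial.X + Polynomial.X ^ N) Polynomial.X b).leadingCoeff =
        Polynomial.C c ∧
      (pev (Polynomial.C Polynomial.X + Polynomial.X ^ N) Polynomial.X b).natDegree % N ≤
        b.natDegree := by
  have hN0 : N ≠ 0 := by omega
  induction hn : b.natDegree generalizing b with
  | zero =>
    obtain ⟨p, rfl⟩ : ∃ p, b = Polynomial.C p := ⟨_, Polynomial.eq_C_of_natDegree_eq_zero hn⟩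
    obtain ⟨h1, h2⟩ := leadingCoeff_aeval_shear hN0 p
    rw [pev_C]
    exact ⟨_, Polynomial.leadingCoeff_ne_zero.2 (Polynomial.C_ne_zero.1 hb), h1,
      by rw [h2, Nat.mul_mod_left]⟩
  | succ n ih =>
    have hd : b.divX.natDegree = n := by rw [Polynomial.natDegree_divX_eq_natDegree_tsub_one, hn]; rfl
    have hd0 : b.divX ≠ 0 := by
      intro h
      have h1 := Polynomial.divX_mul_X_add b
      rw [h, zero_mul, zero_add] at h1
      rw [← h1, Polynomial.natDegree_C] at hn
      omega
    obtain ⟨c, hc, h1, h2⟩ := ih hd0 (by omega) hd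
    set σ := pev (Polynomial.C Polynomial.X + Polynomial.X ^ N) Polynomial.X with hσ
    have hσ0 : σ b.divX ≠ 0 := fun h => hc (by
      rw [h, Polynomial.leadingCoeff_zero] at h1
      exact Polynomial.C_eq_zero.1 h1.symm)
    have hb' : σ b = σ b.divX * Polynomial.X + σ (Polynomial.C (b.coeff 0)) := by
      conv_lhs => rw [← Polynomial.divX_mul_X_add b]
      rw [map_add, map_mul, hσ, pev_X]
    have hlc := Polynomial.leadingCoeff_mul_X (p := σ b.divX)
    have hdeg := Polynomial.natDegree_mul_X hσ0
    have hmod : ((σ b.divX).natDegree + 1) % N = (σ b.divX).natDegree % N + 1 := by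
      rw [Nat.add_mod, Nat.mod_eq_of_lt (a := 1) (by omega), Nat.mod_eq_of_lt]
      omega
    by_cases hp : b.coeff 0 = 0
    · rw [hb', hp, map_zero, map_zero, add_zero, hlc, hdeg, hmod]
      exact ⟨c, hc, h1, by omega⟩
    · obtain ⟨h3, h4⟩ := leadingCoeff_aeval_shear hN0 (b.coeff 0)
      rw [← pev_C _ Polynomial.X, ← hσ] at h3 h4
      have hmod' : (σ (Polynomial.C (b.coeff 0))).natDegree % N = 0 := by
        rw [h4, Nat.mul_mod_left]
      rcases lt_trichotomy (σ b.divX * Polynomial.X).natDegree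
        (σ (Polynomial.C (b.coeff 0))).natDegree with hlt | heq | hlt
      · rw [hb', Polynomial.leadingCoeff_add_of_degree_lt (Polynomial.degree_lt_degree hlt),
          Polynomial.natDegree_add_eq_right_of_natDegree_lt hlt, hmod']
        exact ⟨_, Polynomial.leadingCoeff_ne_zero.2 hp, h3, by omega⟩
      · rw [← heq, hdeg, hmod] at hmod'
        omega
      · rw [hb', Polynomial.leadingCoeff_add_of_degree_lt' (Polynomial.degree_lt_degree hlt),
          Polynomial.natDegree_add_eq_left_of_natDegree_lt hlt, hdeg, hmod, hlc]
        exact ⟨c, hc, h1, by omega⟩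

/-- The shear `(x, y) ↦ (x + y ^ N, y)`. -/
def shear (N : ℕ) : (ℂ × ℂ) ≃ₜ (ℂ × ℂ) where
  toFun z := (z.1 + z.2 ^ N, z.2)
  invFun z := (z.1 - z.2 ^ N, z.2)
  left_inv z := by simp
  right_inv z := by simp
  continuous_toFun := by fun_prop
  continuous_invFun := by fun_prop

theorem exists_keller {P Q : MvPolynomial (Fin 2) ℂ} (hK : IsKeller P Q) :
    ∃ (N : ℕ) (c c₀ : ℂ) (P' Q' : ℂ[X][X]), c ≠ 0 ∧ Keller P' Q' c₀ ∧
      (∀ z, at₂ P' z = c⁻¹ * evalPoly P (shear N z)) ∧ ∀ z, at₂ Q' z = evalPoly Q (shear N z) := by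
  obtain ⟨c₀, hc₀, hJ⟩ := hK
  set b := sub₂ (Polynomial.C Polynomial.X) Polynomial.X P with hb
  set N := b.natDegree + 1 with hN
  set a : ℂ[X][X] := Polynomial.C Polynomial.X + Polynomial.X ^ N with ha
  have hja : jac a Polynomial.X = 1 := by
    simp [jac, ha, Derivation.leibniz_pow]
  have hj := jac_sub₂ a Polynomial.X P Q
  rw [hJ, hja, mul_one] at hj
  have hC : sub₂ a Polynomial.X (C c₀) = Polynomial.C (Polynomial.C c₀) := by simp [sub₂]
  rw [hC] at hj
  have hb0 : b ≠ 0 := by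
    intro h0
    rw [← pev_sub₂ a _ P, ← hb, h0, map_zero, show jac 0 _ = (0 : ℂ[X][X]) by simp [jac]] at hj
    exact Polynomial.C_ne_zero.2 (Polynomial.C_ne_zero.2 hc₀) hj.symm
  obtain ⟨c, hc, hlc, -⟩ := exists_leadingCoeff_shear hb0 (Nat.lt_succ_self _)
  rw [← Nat.succ_eq_add_one] at hN
  rw [← hN, ← ha, hb, pev_sub₂] at hlc
  have hat (z : ℂ × ℂ) : (at₂ a z, at₂ Polynomial.X z) = shear N z := by
    simp [ha, shear]
  refine ⟨N, c, c⁻¹ * c₀, Polynomial.C (Polynomial.C c⁻¹) * sub₂ a Polynomial.X P,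
    sub₂ a Polynomial.X Q, hc, ⟨?_, mul_ne_zero (inv_ne_zero hc) hc₀, ?_⟩, fun z => ?_, fun z => ?_⟩
  · rw [jac_swap, mul_comm, jac_mul, jac_C_C, mul_zero, zero_add, jac_swap, hj, map_mul, map_mul]
    ring
  · rw [Polynomial.Monic, Polynomial.leadingCoeff_mul, hlc, Polynomial.leadingCoeff_C,
      ← Polynomial.C_mul, inv_mul_cancel₀ hc, Polynomial.C_1]
  · rw [at₂_mul, at₂_sub₂, hat, at₂_C, Polynomial.eval_C]
  · rw [at₂_sub₂, hat]

theorem planarFibers_of_isRationalPoly {P : MvPolynomial (Fin 2) ℂ} (hP : IsRationalPoly P)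
    {N : ℕ} {c : ℂ} (hc : c ≠ 0) {P' : ℂ[X][X]}
    (h : ∀ z, at₂ P' z = c⁻¹ * evalPoly P (shear N z)) : PlanarFibers P' := by
  classical
  obtain ⟨S, hS⟩ := hP
  refine ⟨S.image (c⁻¹ * ·), fun t ht => ?_⟩
  obtain ⟨T, ⟨e⟩⟩ := hS (c * t) fun hmem =>
    ht (Finset.mem_image.2 ⟨c * t, hmem, inv_mul_cancel_left₀ hc t⟩)
  refine ⟨T, ⟨((shear N).subtype fun z => ?_).trans e⟩⟩
  rw [h, inv_mul_eq_iff_eq_mul₀ hc]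

end Shear

theorem isInvertible_of_isRationalPoly {P Q : MvPolynomial (Fin 2) ℂ} (hK : IsKeller P Q)
    (hP : IsRationalPoly P) : IsInvertible P Q := by
  obtain ⟨N, c, c₀, P', Q', hc, hK', hP', hQ'⟩ := exists_keller hK
  obtain ⟨A, B, ⟨h1, h2⟩, h3, h4⟩ :=
    hK'.exists_inverse (planarFibers_of_isRationalPoly hP hc hP')
  obtain ⟨A', hA'⟩ := exists_evalPoly (C c⁻¹ * X 0) (X 1) A
  obtain ⟨B', hB'⟩ := exists_evalPoly (C c⁻¹ * X 0) (X 1) B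
  have hw (z : ℂ × ℂ) : (evalPoly (C c⁻¹ * X 0) z, evalPoly (X 1) z) = (c⁻¹ * z.1, z.2) := by
    simp [evalPoly]
  have hG (z : ℂ × ℂ) : polyMap (A' + B' ^ N) B' z =
      shear N (at₂ A (c⁻¹ * z.1, z.2), at₂ B (c⁻¹ * z.1, z.2)) := by
    rw [← hw, ← hA', ← hB']
    simp [polyMap, evalPoly, shear]
  refine ⟨A' + B' ^ N, B', funext fun z => ?_, funext fun z => ?_⟩
  · obtain ⟨z, rfl⟩ := (shear N).surjective z
    have h1 := congrArg (at₂ · z) h1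
    have h2 := congrArg (at₂ · z) h2
    simp only [at₂_pev, hP', hQ', at₂_C, Polynomial.eval_X, at₂_X] at h1 h2
    rw [Function.comp_apply, hG]
    change shear N (at₂ A (c⁻¹ * evalPoly P (shear N z), evalPoly Q (shear N z)), _) = _
    rw [h1]
    change shear N (_, at₂ B (c⁻¹ * evalPoly P (shear N z), evalPoly Q (shear N z))) = _
    rw [h2]; rfl
  · have h3 := congrArg (at₂ · (c⁻¹ * z.1, z.2)) h3
    have h4 := congrArg (at₂ · (c⁻¹ * z.1, z.2)) h4
    simp only [at₂_pev, hP', hQ', at₂_C, Polynomial.eval_X, at₂_X] at h3 h4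
    rw [Function.comp_apply, hG, polyMap, h4, mul_left_cancel₀ (inv_ne_zero hc) h3]; rfl

end KellerRational

/-- Main Theorem: a Keller map with both components rational
polynomials is invertible. -/
theorem keller_rational_pair_invertible
    (P Q : MvPolynomial (Fin 2) ℂ) (hK : IsKeller P Q)
    (hP : IsRationalPoly P) (hQ : IsRationalPoly Q) :
    IsInvertible P Q :=
  KellerRational.isInvertible_of_isRationalPoly hK hP
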